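/- Let n ≥ 1, 2 ≤ p < ∞ and 0 ≤ δ ≤ ρ ≤ 1 with δ < 1, and set m_p = n(1−ρ)|1/p − 1/2|. Let σ : ℝⁿ × ℝⁿ → ℂ be a symbol for which there is C > 0 such that |∂_x^β ∂_ξ^α σ(x,ξ)| ≤ C ⟨ξ⟩^{−m_p − ρ|α| + δ|β|} for all (x,ξ) ∈ ℝⁿ × ℝⁿ and all multi-indices α, β with |α|, |β| ≤ [n/2]+1. Then T_σ : L^p(ℝⁿ) → L^p(ℝⁿ) is a bounded operator. -/

import Mathlib

open MeasureTheory Real ENNReal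

noncomputable section

/-- Partial derivative of a complex-valued function on `ℝⁿ` in the `j`-th coordinate
direction. -/
def pd {n : ℕ} (j : Fin n) (f : (Fin n → ℝ) → ℂ) : (Fin n → ℝ) → ℂ :=
  fun x => fderiv ℝ f x (Pi.single j 1)

/-- The canonical list of directions associated to a multi-index `β ∈ ℕⁿ`. -/
def mIdxList {n : ℕ} (β : Fin n → ℕ) : List (Fin n) :=
  (List.finRange n).flatMap fun j => List.replicate (β j) j

/-- Iterated partial derivative `∂^β` associated to a multi-index `β`. -/
def pdM {n : ℕ} (β : Fin n → ℕ) (f : (Fin n → ℝ) → ℂ) : (Fin n → ℝ) → ℂ :=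
  (mIdxList β).foldr pd f

/-- Forward difference operator in the `j`-th direction on functions of `ξ ∈ ℤⁿ`. -/
def dd {n : ℕ} (j : Fin n) (g : (Fin n → ℤ) → ℂ) : (Fin n → ℤ) → ℂ :=
  fun ξ => g (ξ + Pi.single j 1) - g ξ

/-- Iterated difference operator `Δ_ξ^α` associated to a multi-index `α`. -/
def ddM {n : ℕ} (α : Fin n → ℕ) (g : (Fin n → ℤ) → ℂ) : (Fin n → ℤ) → ℂ :=
  (mIdxList α).foldr dd g

/-- Japanese bracket `⟨ξ⟩ = (1+|ξ|²)^{1/2}` of a lattice point `ξ ∈ ℤⁿ`. -/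
def jb {n : ℕ} (ξ : Fin n → ℤ) : ℝ := Real.sqrt (1 + ∑ j, ((ξ j : ℝ)) ^ 2)

/-- Japanese bracket `⟨ξ⟩ = (1+|ξ|²)^{1/2}` of a vector `ξ ∈ ℝⁿ`. -/
def jbR {n : ℕ} (ξ : Fin n → ℝ) : ℝ := Real.sqrt (1 + ∑ j, (ξ j) ^ 2)

/-- The canonical embedding `ℤⁿ → ℝⁿ`. -/
def castZ {n : ℕ} (ξ : Fin n → ℤ) : Fin n → ℝ := fun j => (ξ j : ℝ)

/-- The fundamental domain `[0,1)ⁿ` of the torus `𝕋ⁿ = ℝⁿ/ℤⁿ`. -/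
def cube (n : ℕ) : Set (Fin n → ℝ) := Set.univ.pi fun _ => Set.Ico (0 : ℝ) 1

/-- The normalized Lebesgue measure of the torus `𝕋ⁿ`, realized as the Lebesgue measure
on `ℝⁿ` restricted to the fundamental domain `[0,1)ⁿ`. -/
def μT (n : ℕ) : Measure (Fin n → ℝ) := volume.restrict (cube n)

/-- `1`-periodicity of a function on `ℝⁿ` (i.e. the function descends to `𝕋ⁿ`). -/
def Per {n : ℕ} (f : (Fin n → ℝ) → ℂ) : Prop :=
  ∀ (x : Fin n → ℝ) (v : Fin n → ℤ), f (x + fun j => (v j : ℝ)) = f x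

/-- The character `e^{2πi⟨x,ξ⟩}`. -/
def eChar {n : ℕ} (x : Fin n → ℝ) (ξ : Fin n → ℤ) : ℂ :=
  Complex.exp (2 * (π : ℂ) * Complex.I * ∑ j, (x j : ℂ) * (ξ j : ℂ))

/-- Fourier coefficient `f̂(ξ) = ∫_{𝕋ⁿ} e^{-2πi⟨x,ξ⟩} f(x) dx` of a function on `𝕋ⁿ`. -/
def fc {n : ℕ} (f : (Fin n → ℝ) → ℂ) (ξ : Fin n → ℤ) : ℂ :=
  ∫ x, Complex.exp (-(2 * (π : ℂ) * Complex.I) * ∑ j, (x j : ℂ) * (ξ j : ℂ)) * f x ∂(μT n)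

/-- Periodic pseudo-differential operator
    `σ(x,D)f(x) = Σ_{ξ ∈ ℤⁿ} e^{2πi⟨x,ξ⟩} σ(x,ξ) f̂(ξ)`
with symbol `σ` on `𝕋ⁿ × ℤⁿ`. -/
def Op {n : ℕ} (σ : (Fin n → ℝ) → (Fin n → ℤ) → ℂ) (f : (Fin n → ℝ) → ℂ) :
    (Fin n → ℝ) → ℂ :=
  fun x => ∑' ξ : Fin n → ℤ, eChar x ξ * σ x ξ * fc f ξ

/-- The `L^p(𝕋ⁿ)` norm, for a real exponent `p`. -/
def lpT (n : ℕ) (p : ℝ) (g : (Fin n → ℝ) → ℂ) : ℝ :=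
  (∫ x, ‖g x‖ ^ p ∂(μT n)) ^ (1 / p)

/-- `∂_x^β Δ_ξ^α σ(x,ξ)` for a symbol `σ` on `𝕋ⁿ × ℤⁿ` (difference operator applied first,
then the derivatives in `x`). -/
def symbDxD {n : ℕ} (β α : Fin n → ℕ) (σ : (Fin n → ℝ) → (Fin n → ℤ) → ℂ)
    (x : Fin n → ℝ) (ξ : Fin n → ℤ) : ℂ :=
  pdM β (fun x' => ddM α (σ x') ξ) x

/-- `Δ_ξ^α ∂_x^β σ(x,ξ)` for a symbol `σ` on `𝕋ⁿ × ℤⁿ` (derivatives in `x` applied first,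
then the difference operator in `ξ`). -/
def symbDDx {n : ℕ} (α β : Fin n → ℕ) (σ : (Fin n → ℝ) → (Fin n → ℤ) → ℂ)
    (x : Fin n → ℝ) (ξ : Fin n → ℤ) : ℂ :=
  ddM α (fun ξ' => pdM β (fun x' => σ x' ξ') x) ξ

/-- `∂_ξ^α ∂_x^β σ(x,ξ)` for a symbol `σ` on `𝕋ⁿ × ℝⁿ` (derivatives in `x` applied first,
then the derivatives in `ξ`). -/
def symbDξDx {n : ℕ} (α β : Fin n → ℕ) (σ : (Fin n → ℝ) → (Fin n → ℝ) → ℂ)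
    (x ξ : Fin n → ℝ) : ℂ :=
  pdM α (fun ξ' => pdM β (fun x' => σ x' ξ') x) ξ

/-- `∂_x^β ∂_ξ^α σ(x,ξ)` for a symbol `σ` on `𝕋ⁿ × ℝⁿ` (derivatives in `ξ` applied first,
then the derivatives in `x`). -/
def symbDxDξ {n : ℕ} (β α : Fin n → ℕ) (σ : (Fin n → ℝ) → (Fin n → ℝ) → ℂ)
    (x ξ : Fin n → ℝ) : ℂ :=
  pdM β (fun x' => pdM α (σ x') ξ) x

/-- The Euclidean Fourier transform `û(ξ) = ∫_{ℝⁿ} e^{-2πi⟨x,ξ⟩} u(x) dx`. -/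
def FT {n : ℕ} (u : (Fin n → ℝ) → ℂ) (ξ : Fin n → ℝ) : ℂ :=
  ∫ x, Complex.exp (-(2 * (π : ℂ) * Complex.I) * ∑ j, (x j : ℂ) * (ξ j : ℂ)) * u x

/-- Pseudo-differential operator on `ℝⁿ`:
`T_σ u(x) = ∫_{ℝⁿ} e^{2πi⟨x,ξ⟩} σ(x,ξ) û(ξ) dξ`. -/
def OpR {n : ℕ} (σ : (Fin n → ℝ) → (Fin n → ℝ) → ℂ) (u : (Fin n → ℝ) → ℂ) :
    (Fin n → ℝ) → ℂ :=
  fun x => ∫ ξ, Complex.exp (2 * (π : ℂ) * Complex.I * ∑ j, (x j : ℂ) * (ξ j : ℂ)) * σ x ξ * FT u ξ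

/-- Periodic amplitude operator
`a(x,y,D)u(x) = ∫_{𝕋ⁿ} ∫_{ℝⁿ} e^{2πi⟨x-y,ξ⟩} a(x,y,ξ) u(y) dξ dy`. -/
def OpAmp {n : ℕ} (a : (Fin n → ℝ) → (Fin n → ℝ) → (Fin n → ℝ) → ℂ)
    (u : (Fin n → ℝ) → ℂ) : (Fin n → ℝ) → ℂ :=
  fun x => ∫ y,
    (∫ ξ, Complex.exp (2 * (π : ℂ) * Complex.I * ∑ j, ((x j : ℂ) - (y j : ℂ)) * (ξ j : ℂ)) *
        a x y ξ) * u y ∂(μT n)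

/-- The `L^p(ℝⁿ)` norm, for a real exponent `p`. -/
def lpR (n : ℕ) (p : ℝ) (g : (Fin n → ℝ) → ℂ) : ℝ :=
  (∫ x, ‖g x‖ ^ p) ^ (1 / p)

section PseudoDifferential

open FourierTransform SchwartzMap

section FourierBasics

variable {ι : Type*} [Fintype ι]

/-- The character `e^{-2πi⟨x,ξ⟩}`. -/
def ph (x ξ : ι → ℝ) : ℂ :=
  Complex.exp (-(2 * (π : ℂ) * Complex.I) * ∑ j, (x j : ℂ) * (ξ j : ℂ))

lemma ph_eq_ofReal (x ξ : ι → ℝ) :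
    ph x ξ = Complex.exp (((-2 * π * ∑ j, x j * ξ j : ℝ) : ℂ) * Complex.I) := by
  unfold ph; congr 1; push_cast; ring

@[simp] lemma norm_ph (x ξ : ι → ℝ) : ‖ph x ξ‖ = 1 := by
  rw [ph_eq_ofReal, Complex.norm_exp_ofReal_mul_I]

@[simp] lemma enorm_ph (x ξ : ι → ℝ) : ‖ph x ξ‖ₑ = 1 := by
  rw [← ofReal_norm, norm_ph, ENNReal.ofReal_one]

lemma ph_add_left (x y ξ : ι → ℝ) : ph (x + y) ξ = ph x ξ * ph y ξ := by
  unfold ph; rw [← Complex.exp_add, ← mul_add, ← Finset.sum_add_distrib]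
  simp [add_mul]

lemma ph_comm (x ξ : ι → ℝ) : ph x ξ = ph ξ x := by
  unfold ph; simp [mul_comm]

lemma ph_add_right (x ξ η : ι → ℝ) : ph x (ξ + η) = ph x ξ * ph x η := by
  rw [ph_comm, ph_add_left, ph_comm ξ, ph_comm η]

@[simp] lemma ph_zero_left (ξ : ι → ℝ) : ph 0 ξ = 1 := by simp [ph]
@[simp] lemma ph_zero_right (ξ : ι → ℝ) : ph ξ 0 = 1 := by simp [ph]

lemma ph_neg_right_mul (x ξ : ι → ℝ) : ph x (-ξ) * ph x ξ = 1 := by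
  rw [← ph_add_right]; simp

lemma ph_neg_left (x ξ : ι → ℝ) : ph (-x) ξ = ph x (-ξ) := by
  simp [ph]

lemma ph_smul_left (c : ℝ) (x ξ : ι → ℝ) : ph (c • x) ξ = ph x (c • ξ) := by
  unfold ph; congr 2; apply Finset.sum_congr rfl; intros; simp; ring

lemma continuous_ph : Continuous fun q : (ι → ℝ) × (ι → ℝ) => ph q.1 q.2 := by
  unfold ph; fun_prop

@[fun_prop] lemma continuous_ph_comp {X : Type*} [TopologicalSpace X] {f g : X → (ι → ℝ)}
    (hf : Continuous f) (hg : Continuous g) : Continuous fun x => ph (f x) (g x) :=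
  continuous_ph.comp (hf.prodMk hg)

attribute [irreducible] ph

/-- The Fourier transform on `ι → ℝ`. -/
def FTg (u : (ι → ℝ) → ℂ) (ξ : ι → ℝ) : ℂ := ∫ x, ph x ξ * u x

lemma FTg_eq_fourier (u : (ι → ℝ) → ℂ) (ξ : ι → ℝ) :
    FTg u ξ = 𝓕 (fun v : EuclideanSpace ℝ ι => u v.ofLp) (WithLp.toLp 2 ξ) := by
  rw [Real.fourier_eq', ← (PiLp.volume_preserving_toLp ι).integral_comp
    (MeasurableEquiv.toLp 2 _).measurableEmbedding, FTg]
  congr 1; ext x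
  simp only [smul_eq_mul]
  congr 1
  rw [ph_eq_ofReal]
  congr 3
  simp [PiLp.inner_apply, mul_comm]

lemma integrable_ph_mul {u : (ι → ℝ) → ℂ} (hu : Integrable u) (ξ : ι → ℝ) :
    Integrable fun x => ph x ξ * u x := by
  refine (hu.bdd_mul (c := 1) ?_ ?_)
  · exact (continuous_ph_comp continuous_id continuous_const).aestronglyMeasurable
  · exact Filter.Eventually.of_forall fun x => by simp

lemma norm_FTg_le (u : (ι → ℝ) → ℂ) (ξ : ι → ℝ) : ‖FTg u ξ‖ ≤ ∫ x, ‖u x‖ := by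
  refine (norm_integral_le_integral_norm _).trans_eq ?_
  simp

lemma enorm_FTg_le (u : (ι → ℝ) → ℂ) (ξ : ι → ℝ) : ‖FTg u ξ‖ₑ ≤ ∫⁻ x, ‖u x‖ₑ := by
  refine (enorm_integral_le_lintegral_enorm _).trans_eq ?_
  simp

lemma continuous_FTg {u : (ι → ℝ) → ℂ} (hu : Integrable u) : Continuous (FTg u) := by
  refine continuous_of_dominated (bound := fun x => ‖u x‖) ?_ ?_ hu.norm ?_
  · intro ξ; exact (integrable_ph_mul hu ξ).aestronglyMeasurable
  · intro ξ; exact Filter.Eventually.of_forall fun x => by simp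
  · exact Filter.Eventually.of_forall fun x => by fun_prop

lemma integrable_comp_ofLp {u : (ι → ℝ) → ℂ} (hu : Integrable u) :
    Integrable (fun v : EuclideanSpace ℝ ι => u v.ofLp) :=
  (PiLp.volume_preserving_ofLp ι).integrable_comp_of_integrable hu

theorem FTg_inversion {u : (ι → ℝ) → ℂ} (hc : Continuous u) (hu : Integrable u)
    (hf : Integrable (FTg u)) (x : ι → ℝ) : u x = ∫ ξ, ph x (-ξ) * FTg u ξ := by
  have h1 := Continuous.fourierInv_fourier_eq (f := fun v : EuclideanSpace ℝ ι => u v.ofLp)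
    (by fun_prop) (integrable_comp_ofLp hu) (by
      have := integrable_comp_ofLp hf
      refine this.congr (Filter.Eventually.of_forall fun v => ?_)
      simp [FTg_eq_fourier])
  have h2 := congrFun h1 (WithLp.toLp 2 x)
  rw [Real.fourierInv_eq'] at h2
  simp only at h2
  rw [← h2, ← (PiLp.volume_preserving_toLp ι).integral_comp
    (MeasurableEquiv.toLp 2 _).measurableEmbedding]
  congr 1; ext ξ
  rw [FTg_eq_fourier, smul_eq_mul]
  congr 1
  rw [ph_eq_ofReal]
  congr 3
  simp [PiLp.inner_apply, mul_comm]

/-- Plancherel for continuous integrable functions with integrable transform. -/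
theorem FTg_plancherel {u : (ι → ℝ) → ℂ} (hc : Continuous u) (hu : Integrable u)
    (hf : Integrable (FTg u)) : ∫⁻ x, ‖u x‖ₑ ^ 2 = ∫⁻ ξ, ‖FTg u ξ‖ₑ ^ 2 := by
  have hFc := continuous_FTg hu
  have hub : ∃ B, ∀ x, ‖u x‖ ≤ B := by
    refine ⟨∫ ξ, ‖FTg u ξ‖, fun x => ?_⟩
    rw [FTg_inversion hc hu hf x]
    refine (norm_integral_le_integral_norm _).trans_eq ?_
    simp
  have hFb : ∃ B, ∀ x, ‖FTg u x‖ ≤ B := ⟨_, norm_FTg_le u⟩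
  have sqi : ∀ {w : (ι → ℝ) → ℂ}, Continuous w → Integrable w → (∃ B, ∀ x, ‖w x‖ ≤ B) →
      Integrable fun x => w x * star (w x) := by
    rintro w hw hi ⟨B, hB⟩
    refine hi.mul_bdd (c := B) (by fun_prop) ?_
    exact Filter.Eventually.of_forall fun x => by simpa using hB x
  have conv : ∀ {w : (ι → ℝ) → ℂ}, Integrable (fun x => w x * star (w x)) →
      (∫⁻ x, ‖w x‖ₑ ^ 2) = ENNReal.ofReal (∫ x, w x * star (w x)).re := by
    intro w hi
    have : (∫ x, w x * star (w x)) = ((∫ x, ‖w x‖ ^ 2 : ℝ) : ℂ) := by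
      rw [← integral_complex_ofReal]
      congr 1; ext x
      have := Complex.mul_conj (w x)
      simp only [Complex.star_def, this, Complex.normSq_eq_norm_sq]
      
    rw [this, Complex.ofReal_re, ofReal_integral_eq_lintegral_ofReal]
    · congr 1; ext x
      rw [ENNReal.ofReal_pow (norm_nonneg _), ofReal_norm]
    · refine hi.norm.congr (Filter.Eventually.of_forall fun x => ?_)
      simp [sq]
    · exact Filter.Eventually.of_forall fun x => by positivity
  rw [conv (sqi hc hu hub), conv (sqi hFc hf hFb)]
  congr 2
  have key : Integrable (fun q : (ι → ℝ) × (ι → ℝ) => ph q.1 q.2 * (u q.1 * star (FTg u q.2)))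
      (volume.prod volume) := by
    refine ((hu.mul_prod (LinearIsometryEquiv.integrable_comp_iff Complex.conjLIE |>.2 hf)).bdd_mul (c := 1) ?_ ?_)
    · exact continuous_ph.aestronglyMeasurable
    · exact Filter.Eventually.of_forall fun x => by simp
  calc ∫ x, u x * star (u x) = ∫ x, ∫ ξ, ph x ξ * (u x * star (FTg u ξ)) := by
        congr 1; ext x
        conv_lhs => rw [FTg_inversion hc hu hf x]
        rw [← FTg_inversion hc hu hf x]
        conv_lhs => rw [FTg_inversion hc hu hf x, Complex.star_def, ← integral_conj, ← FTg_inversion hc hu hf x]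
        rw [← integral_const_mul]
        congr 1; ext ξ
        have : (starRingEnd ℂ) (ph x (-ξ)) = ph x ξ := by
          rw [ph_eq_ofReal, ph_eq_ofReal, ← Complex.exp_conj, map_mul, Complex.conj_ofReal, Complex.conj_I]
          simp
        rw [map_mul, this, Complex.star_def]; ring
    _ = ∫ ξ, ∫ x, ph x ξ * (u x * star (FTg u ξ)) := by
        rw [integral_integral_swap]; exact key
    _ = _ := by
        congr 1; ext ξ
        conv_rhs => rw [FTg]
        rw [← integral_mul_const]
        congr 1; ext x
        rw [mul_assoc]; rfl

end FourierBasics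

section SchwartzFT

variable {ι : Type*} [Fintype ι]

/-- Transfer of Schwartz functions from `ι → ℝ` to Euclidean space. -/
def toE (f : 𝓢(ι → ℝ, ℂ)) : 𝓢(EuclideanSpace ℝ ι, ℂ) :=
  compCLMOfContinuousLinearEquiv ℂ (EuclideanSpace.equiv ι ℝ) f

/-- Transfer of Schwartz functions from Euclidean space to `ι → ℝ`. -/
def ofE (f : 𝓢(EuclideanSpace ℝ ι, ℂ)) : 𝓢(ι → ℝ, ℂ) :=
  compCLMOfContinuousLinearEquiv ℂ (EuclideanSpace.equiv ι ℝ).symm f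

/-- Fourier transform of a Schwartz function as a Schwartz function. -/
def FTS (f : 𝓢(ι → ℝ, ℂ)) : 𝓢(ι → ℝ, ℂ) := ofE (𝓕 (toE f))

/-- Inverse Fourier transform of a Schwartz function as a Schwartz function. -/
def IFTS (f : 𝓢(ι → ℝ, ℂ)) : 𝓢(ι → ℝ, ℂ) := ofE (𝓕⁻ (toE f))

lemma toE_ofE (f : 𝓢(EuclideanSpace ℝ ι, ℂ)) : toE (ofE f) = f := by
  ext x; simp [toE, ofE]

lemma ofE_toE (f : 𝓢(ι → ℝ, ℂ)) : ofE (toE f) = f := by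
  ext x; rfl

lemma FTS_coe (f : 𝓢(ι → ℝ, ℂ)) : ⇑(FTS f) = FTg f := by
  ext ξ
  rw [FTg_eq_fourier]; rfl

lemma FTS_IFTS (f : 𝓢(ι → ℝ, ℂ)) : FTS (IFTS f) = f := by
  simp [FTS, IFTS, toE_ofE, ofE_toE]

lemma FTg_IFTS (f : 𝓢(ι → ℝ, ℂ)) : FTg (IFTS f) = f := by
  rw [← FTS_coe, FTS_IFTS]

lemma integrable_FTg_schwartz (f : 𝓢(ι → ℝ, ℂ)) : Integrable (FTg f) := by
  rw [← FTS_coe]; exact (FTS f).integrable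

lemma schwartz_inversion (f : 𝓢(ι → ℝ, ℂ)) (x : ι → ℝ) :
    f x = ∫ ξ, ph x (-ξ) * FTg f ξ :=
  FTg_inversion f.continuous f.integrable (integrable_FTg_schwartz f) x

lemma schwartz_plancherel (f : 𝓢(ι → ℝ, ℂ)) :
    ∫⁻ x, ‖f x‖ₑ ^ 2 = ∫⁻ ξ, ‖FTg f ξ‖ₑ ^ 2 :=
  FTg_plancherel f.continuous f.integrable (integrable_FTg_schwartz f)

/-- Derivative rule for the Fourier transform of smooth compactly supported functions. -/
lemma FTg_deriv {g : (ι → ℝ) → ℂ} (hg : ContDiff ℝ (⊤ : ℕ∞) g) (hs : HasCompactSupport g)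
    (v : ι → ℝ) (ξ : ι → ℝ) :
    FTg (fun x => fderiv ℝ g x v) ξ = (2 * π * Complex.I * ∑ j, (v j : ℂ) * ξ j) * FTg g ξ := by
  have hd : ∀ x, HasFDerivAt g (fderiv ℝ g x) x := fun x =>
    (hg.differentiable (by simp) x).hasFDerivAt
  set A : (ι → ℝ) →L[ℝ] ℂ := Complex.ofRealCLM.comp
    (∑ j, (-2 * π * ξ j) • ContinuousLinearMap.proj (R := ℝ) (φ := fun _ => ℝ) j) with hA
  have hAx : ∀ x, ph x ξ = Complex.exp (A x * Complex.I) := by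
    intro x; rw [ph_eq_ofReal, hA]; congr 2
    simp [Finset.mul_sum]
    apply Finset.sum_congr rfl; intros; ring
  have hp : ∀ x, HasFDerivAt (fun x => ph x ξ) ((ph x ξ * Complex.I) • A) x := by
    intro x
    have := ((A.hasFDerivAt (x := x)).mul_const Complex.I).cexp
    simp_rw [hAx]
    convert! this using 1
    ext v; simp; ring
  have hdc : Continuous fun x => fderiv ℝ g x v :=
    (hg.continuous_fderiv (by simp)).clm_apply continuous_const
  have hdsupp : HasCompactSupport fun x => fderiv ℝ g x v := hs.fderiv_apply (𝕜 := ℝ) v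
  have key := integral_mul_fderiv_eq_neg_fderiv_mul_of_integrable (μ := (volume : Measure (ι → ℝ)))
    (f := fun x => ph x ξ) (g := g) (v := v) ?_ ?_ ?_
    (fun x _ => (hp x).differentiableAt) (fun x _ => (hd x).differentiableAt)
  · unfold FTg
    rw [key, ← integral_const_mul, ← integral_neg]
    congr 1; ext x
    rw [(hp x).fderiv]
    have : A v = -2 * π * ∑ j, (v j : ℂ) * ξ j := by
      simp [hA, Finset.mul_sum]
      apply Finset.sum_congr rfl; intros; ring
    simp only [smul_apply, this, smul_eq_mul]
    ring
  · apply Continuous.integrable_of_hasCompactSupport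
    · have : (fun x => fderiv ℝ (fun x => ph x ξ) x v * g x) = fun x => (ph x ξ * Complex.I) * A v * g x := by
        ext x; rw [(hp x).fderiv]; simp
      rw [this]
      have := hg.continuous
      fun_prop
    · exact hs.mul_left
  · apply Continuous.integrable_of_hasCompactSupport
    · fun_prop
    · exact hdsupp.mul_left
  · apply Continuous.integrable_of_hasCompactSupport
    · have := hg.continuous
      fun_prop
    · exact hs.mul_left

end SchwartzFT

lemma FT_eq_FTg {n : ℕ} (u : (Fin n → ℝ) → ℂ) : FT u = FTg u := by
  ext ξ; unfold FT FTg ph; rfl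

lemma OpR_eq {n : ℕ} (s : (Fin n → ℝ) → (Fin n → ℝ) → ℂ) (u : (Fin n → ℝ) → ℂ) (x : Fin n → ℝ) :
    OpR s u x = ∫ ξ, ph x (-ξ) * s x ξ * FTg u ξ := by
  unfold OpR
  rw [FT_eq_FTg]
  congr 1; ext ξ
  congr 2
  simp [ph]

section DirDeriv

variable {E F : Type*} [NormedAddCommGroup E] [NormedSpace ℝ E]
  [NormedAddCommGroup F] [NormedSpace ℝ F]

/-- Directional derivative in a fixed direction. -/
def dv (v : E) (f : E → ℂ) : E → ℂ := fun x => fderiv ℝ f x v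

/-- Mixed iterated directional derivative. -/
def dvv (u v : E) (b a : ℕ) (f : E → ℂ) : E → ℂ := (dv u)^[b] ((dv v)^[a] f)

lemma ContDiff.dv {f : E → ℂ} (hf : ContDiff ℝ (⊤ : ℕ∞) f) (v : E) :
    ContDiff ℝ (⊤ : ℕ∞) (dv v f) :=
  (hf.fderiv_right (m := (⊤ : ℕ∞)) (by simp)).clm_apply contDiff_const

lemma ContDiff.dv_iter {f : E → ℂ} (hf : ContDiff ℝ (⊤ : ℕ∞) f) (v : E) (k : ℕ) :
    ContDiff ℝ (⊤ : ℕ∞) ((_root_.dv v)^[k] f) := by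
  induction k generalizing f with
  | zero => exact hf
  | succ k ih => exact ih (hf.dv v)

lemma ContDiff.dvv {f : E → ℂ} (hf : ContDiff ℝ (⊤ : ℕ∞) f) (u v : E) (b a : ℕ) :
    ContDiff ℝ (⊤ : ℕ∞) (_root_.dvv u v b a f) := (hf.dv_iter v a).dv_iter u b

lemma dv_add {f g : E → ℂ} (hf : ContDiff ℝ (⊤ : ℕ∞) f) (hg : ContDiff ℝ (⊤ : ℕ∞) g) (v : E) :
    dv v (fun x => f x + g x) = fun x => dv v f x + dv v g x := by
  ext x
  simp only [dv]
  rw [fderiv_fun_add (hf.differentiable (by simp) x) (hg.differentiable (by simp) x)]; rfl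

lemma dv_mul {f g : E → ℂ} (hf : ContDiff ℝ (⊤ : ℕ∞) f) (hg : ContDiff ℝ (⊤ : ℕ∞) g) (v : E) :
    dv v (fun x => f x * g x) = fun x => dv v f x * g x + f x * dv v g x := by
  ext x
  simp only [dv]
  rw [fderiv_fun_mul (hf.differentiable (by simp) x) (hg.differentiable (by simp) x)]
  simp; ring

lemma dv_iter_add {f g : E → ℂ} (hf : ContDiff ℝ (⊤ : ℕ∞) f) (hg : ContDiff ℝ (⊤ : ℕ∞) g)
    (v : E) (k : ℕ) :
    (dv v)^[k] (fun x => f x + g x) = fun x => (dv v)^[k] f x + (dv v)^[k] g x := by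
  induction k generalizing f g with
  | zero => rfl
  | succ k ih => rw [Function.iterate_succ_apply, dv_add hf hg, ih (hf.dv v) (hg.dv v)]; rfl

lemma dvv_add {f g : E → ℂ} (hf : ContDiff ℝ (⊤ : ℕ∞) f) (hg : ContDiff ℝ (⊤ : ℕ∞) g)
    (u v : E) (b a : ℕ) :
    dvv u v b a (fun x => f x + g x) = fun x => dvv u v b a f x + dvv u v b a g x := by
  unfold dvv
  rw [dv_iter_add hf hg, dv_iter_add (hf.dv_iter v a) (hg.dv_iter v a)]

lemma dvv_succ_right (u v : E) (b a : ℕ) (f : E → ℂ) :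
    dvv u v b (a + 1) f = dvv u v b a (dv v f) := rfl

lemma dvv_succ_left_zero (u v : E) (b : ℕ) (f : E → ℂ) :
    dvv u v (b + 1) 0 f = dvv u v b 0 (dv u f) := rfl

/-- Pointwise Leibniz bound for mixed directional derivatives. -/
lemma dvv_mul_le (u v : E) (b a : ℕ) {f g : E → ℂ} (hf : ContDiff ℝ (⊤ : ℕ∞) f)
    (hg : ContDiff ℝ (⊤ : ℕ∞) g) (z : E) {A B : ℝ}
    (hA : ∀ b' ≤ b, ∀ a' ≤ a, ‖dvv u v b' a' f z‖ ≤ A)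
    (hB : ∀ b' ≤ b, ∀ a' ≤ a, ‖dvv u v b' a' g z‖ ≤ B) :
    ‖dvv u v b a (fun x => f x * g x) z‖ ≤ 2 ^ (b + a) * (A * B) := by
  induction a generalizing f g with
  | succ a ih =>
    rw [dvv_succ_right, dv_mul hf hg,
      dvv_add ((hf.dv v).mul hg) (hf.mul (hg.dv v))]
    refine (norm_add_le _ _).trans ?_
    have h1 := ih (hf.dv v) hg (fun b' hb' a' ha' => hA b' hb' (a' + 1) (by omega))
      (fun b' hb' a' ha' => hB b' hb' a' (by omega))
    have h2 := ih hf (hg.dv v) (fun b' hb' a' ha' => hA b' hb' a' (by omega))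
      (fun b' hb' a' ha' => hB b' hb' (a' + 1) (by omega))
    rw [← add_assoc, pow_succ]; linarith
  | zero =>
    induction b generalizing f g with
    | zero =>
      simp only [dvv, Function.iterate_zero, id, norm_mul, add_zero, pow_zero, one_mul]
      have h1 := hA 0 le_rfl 0 le_rfl
      have h2 := hB 0 le_rfl 0 le_rfl
      simp only [dvv, Function.iterate_zero, id] at h1 h2
      exact mul_le_mul h1 h2 (norm_nonneg _) ((norm_nonneg _).trans h1)
    | succ b ih =>
      rw [dvv_succ_left_zero, dv_mul hf hg,
        dvv_add ((hf.dv u).mul hg) (hf.mul (hg.dv u))]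
      refine (norm_add_le _ _).trans ?_
      have e : ∀ (b' : ℕ) (f : E → ℂ), dvv u v (b' + 1) 0 f = dvv u v b' 0 (dv u f) :=
        fun _ _ => rfl
      have h1 := ih (hf.dv u) hg
        (fun b' hb' a' ha' => by
          obtain rfl : a' = 0 := by omega
          rw [← e]; exact hA (b' + 1) (by omega) 0 le_rfl)
        (fun b' hb' a' ha' => hB b' (by omega) a' ha')
      have h2 := ih hf (hg.dv u) (fun b' hb' a' ha' => hA b' (by omega) a' ha')
        (fun b' hb' a' ha' => by
          obtain rfl : a' = 0 := by omega
          rw [← e]; exact hB (b' + 1) (by omega) 0 le_rfl)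
      have : (2 : ℝ) ^ (b + 1 + 0) = 2 * 2 ^ (b + 0) := by rw [add_zero, add_zero, pow_succ]; ring
      rw [this]; linarith

lemma dv_comp_affine {f : F → ℂ} (hf : ContDiff ℝ (⊤ : ℕ∞) f) (T : E →L[ℝ] F) (c : F) (v : E) :
    dv v (fun x => f (c + T x)) = fun x => dv (T v) f (c + T x) := by
  ext x
  have h1 : HasFDerivAt (fun x => c + T x) T x := T.hasFDerivAt.const_add c
  have h2 := (hf.differentiable (by simp) (c + T x)).hasFDerivAt.comp x h1
  simp only [dv]
  rw [show (fun x => f (c + T x)) = f ∘ (fun x => c + T x) from rfl, h2.fderiv]; rfl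

lemma dv_iter_comp_affine {f : F → ℂ} (hf : ContDiff ℝ (⊤ : ℕ∞) f) (T : E →L[ℝ] F) (c : F)
    (v : E) (k : ℕ) :
    (dv v)^[k] (fun x => f (c + T x)) = fun x => (dv (T v))^[k] f (c + T x) := by
  induction k generalizing f with
  | zero => rfl
  | succ k ih => rw [Function.iterate_succ_apply, dv_comp_affine hf, ih (hf.dv _)]; rfl

lemma dvv_comp_affine {f : F → ℂ} (hf : ContDiff ℝ (⊤ : ℕ∞) f) (T : E →L[ℝ] F) (c : F)
    (u v : E) (b a : ℕ) :
    dvv u v b a (fun x => f (c + T x)) = fun x => dvv (T u) (T v) b a f (c + T x) := by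
  unfold dvv
  rw [dv_iter_comp_affine hf, dv_iter_comp_affine (hf.dv_iter _ _)]

lemma dv_const_smul {f : E → ℂ} (hf : ContDiff ℝ (⊤ : ℕ∞) f) (v : E) (c : ℂ) :
    dv v (fun x => c * f x) = fun x => c * dv v f x := by
  ext x
  simp only [dv]
  rw [fderiv_const_mul (hf.differentiable (by simp) x)]; rfl

lemma dv_iter_const_mul {f : E → ℂ} (hf : ContDiff ℝ (⊤ : ℕ∞) f) (v : E) (c : ℂ) (k : ℕ) :
    (dv v)^[k] (fun x => c * f x) = fun x => c * (dv v)^[k] f x := by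
  induction k generalizing f with
  | zero => rfl
  | succ k ih => rw [Function.iterate_succ_apply, dv_const_smul hf, ih (hf.dv v)]; rfl

lemma dv_iter_smul {f : E → ℂ} (hf : ContDiff ℝ (⊤ : ℕ∞) f) (v : E) (c : ℝ) (k : ℕ) :
    (dv (c • v))^[k] f = fun x => (c : ℂ) ^ k * (dv v)^[k] f x := by
  induction k generalizing f with
  | zero => simp
  | succ k ih =>
    rw [Function.iterate_succ_apply, ih (hf.dv _)]
    have : dv (c • v) f = fun x => (c : ℂ) * dv v f x := by
      ext x; simp [dv]
    rw [this, dv_iter_const_mul (hf.dv v)]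
    ext x; rw [pow_succ, Function.iterate_succ_apply]; ring

lemma dvv_smul {f : E → ℂ} (hf : ContDiff ℝ (⊤ : ℕ∞) f) (u v : E) (c d : ℝ) (b a : ℕ) :
    dvv (c • u) (d • v) b a f = fun x => (c : ℂ) ^ b * (d : ℂ) ^ a * dvv u v b a f x := by
  unfold dvv
  rw [dv_iter_smul hf, dv_iter_const_mul (hf.dv_iter v a), dv_iter_smul (hf.dv_iter v a)]
  ext x; ring

lemma dv_iter_zero_on {f : E → ℂ} {U : Set E} (hU : IsOpen U) (h : ∀ x ∈ U, f x = 0)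
    (v : E) (k : ℕ) : ∀ x ∈ U, (dv v)^[k] f x = 0 := by
  induction k generalizing f with
  | zero => exact h
  | succ k ih =>
    refine ih (f := dv v f) fun x hx => ?_
    have : f =ᶠ[nhds x] fun _ => (0 : ℂ) :=
      Filter.eventually_of_mem (hU.mem_nhds hx) h
    simp [dv, this.fderiv_eq]

lemma dvv_zero_on {f : E → ℂ} {U : Set E} (hU : IsOpen U) (h : ∀ x ∈ U, f x = 0)
    (u v : E) (b a : ℕ) : ∀ x ∈ U, dvv u v b a f x = 0 :=
  dv_iter_zero_on hU (dv_iter_zero_on hU h v a) u b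

lemma HasCompactSupport.dv_iter {f : E → ℂ} (hf : HasCompactSupport f) (v : E) (k : ℕ) :
    HasCompactSupport ((dv v)^[k] f) := by
  induction k generalizing f with
  | zero => exact hf
  | succ k ih => exact ih (hf.fderiv_apply (𝕜 := ℝ) v)

lemma HasCompactSupport.dvv {f : E → ℂ} (hf : HasCompactSupport f) (u v : E) (b a : ℕ) :
    HasCompactSupport (_root_.dvv u v b a f) :=
  (hf.dv_iter v a).dv_iter u b

end DirDeriv

section Sym

variable {n : ℕ}

/-- The order of smoothness `[n/2]+1`. -/
def NN (n : ℕ) : ℕ := n / 2 + 1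

/-- Standard basis vector of `ℝⁿ`. -/
def eb (j : Fin n) : Fin n → ℝ := Pi.single j 1

/-- Scale-`L` symbol bounds at a point: the pure derivatives
`(L⁻¹∂_{x_j})^b (L∂_{ξ_i})^a` are at most `M`. -/
def SymAt (L M : ℝ) (s : (Fin n → ℝ) × (Fin n → ℝ) → ℂ) (q : (Fin n → ℝ) × (Fin n → ℝ)) : Prop :=
  ∀ j i : Fin n, ∀ b ≤ NN n, ∀ a ≤ NN n, ‖dvv (L⁻¹ • eb j, 0) (0, L • eb i) b a s q‖ ≤ M

lemma SymAt.mul {L M M' : ℝ} {s t : (Fin n → ℝ) × (Fin n → ℝ) → ℂ}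
    {q : (Fin n → ℝ) × (Fin n → ℝ)} (hM : 0 ≤ M) (hM' : 0 ≤ M')
    (hs : ContDiff ℝ (⊤ : ℕ∞) s) (ht : ContDiff ℝ (⊤ : ℕ∞) t)
    (h : SymAt L M s q) (h' : SymAt L M' t q) :
    SymAt L (2 ^ (2 * NN n) * (M * M')) (fun q => s q * t q) q := by
  intro j i b hb a ha
  refine (dvv_mul_le _ _ b a hs ht q (fun b' hb' a' ha' => h j i b' (by omega) a' (by omega))
    (fun b' hb' a' ha' => h' j i b' (by omega) a' (by omega))).trans ?_
  gcongr
  · norm_num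
  · omega

/-- Rescaling to unit scale. -/
lemma SymAt.rescale {L M : ℝ} {s : (Fin n → ℝ) × (Fin n → ℝ) → ℂ}
    (hs : ContDiff ℝ (⊤ : ℕ∞) s) (c : Fin n → ℝ) (h : ∀ q, SymAt L M s q) (q) :
    SymAt 1 M (fun q => s (c + L⁻¹ • q.1, L • q.2)) q := by
  intro j i b hb a ha
  set T : (Fin n → ℝ) × (Fin n → ℝ) →L[ℝ] (Fin n → ℝ) × (Fin n → ℝ) :=
    (L⁻¹ • ContinuousLinearMap.fst ℝ _ _).prod (L • ContinuousLinearMap.snd ℝ _ _) with hT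
  have e : (fun q : (Fin n → ℝ) × (Fin n → ℝ) => s (c + L⁻¹ • q.1, L • q.2))
      = fun q => s ((c, 0) + T q) := by
    ext q; simp [hT]
  rw [e, dvv_comp_affine hs]
  have := h ((c, 0) + T q) j i b hb a ha
  have e1 : T (eb j, 0) = (L⁻¹ • eb j, 0) := by simp [hT]
  have e2 : T (0, eb i) = (0, L • eb i) := by simp [hT]
  simpa only [inv_one, one_smul, e1, e2] using this

/-- Frequency translation at unit scale. -/
lemma SymAt.translate {L M : ℝ} {s : (Fin n → ℝ) × (Fin n → ℝ) → ℂ}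
    (hs : ContDiff ℝ (⊤ : ℕ∞) s) (c : Fin n → ℝ) (h : ∀ q, SymAt L M s q) (q) :
    SymAt L M (fun q => s (q.1, c + q.2)) q := by
  intro j i b hb a ha
  have e : (fun q : (Fin n → ℝ) × (Fin n → ℝ) => s (q.1, c + q.2))
      = fun q => s ((0, c) + ContinuousLinearMap.id ℝ _ q) := by
    ext q; congr 1; ext <;> simp
  rw [e, dvv_comp_affine hs]
  have := h ((0, c) + q) j i b hb a ha
  simpa using this

end Sym

section Weights

variable {n : ℕ}

/-- The polynomial weight `(1+‖x‖)^{2N}`. -/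
def wR (x : Fin n → ℝ) : ℝ := (1 + ‖x‖) ^ (2 * NN n)

/-- The weight `(1+‖x‖)^{2N}` with values in `[0,∞]`. -/
def wi (x : Fin n → ℝ) : ℝ≥0∞ := ENNReal.ofReal (wR x)

/-- The decaying weight `(1+‖x‖)^{-2N}`. -/
def wt (x : Fin n → ℝ) : ℝ≥0∞ := ENNReal.ofReal (wR x)⁻¹

lemma wR_pos (x : Fin n → ℝ) : 0 < wR x := by unfold wR; positivity

lemma one_le_wR (x : Fin n → ℝ) : 1 ≤ wR x :=
  one_le_pow₀ (by linarith [norm_nonneg x])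

@[fun_prop] lemma continuous_wR : Continuous (wR (n := n)) := by unfold wR; fun_prop

@[fun_prop] lemma continuous_wi : Continuous (wi (n := n)) :=
  ENNReal.continuous_ofReal.comp continuous_wR

@[fun_prop] lemma continuous_wt : Continuous (wt (n := n)) :=
  ENNReal.continuous_ofReal.comp (continuous_wR.inv₀ fun x => (wR_pos x).ne')

@[fun_prop] lemma measurable_wi : Measurable (wi (n := n)) := continuous_wi.measurable
@[fun_prop] lemma measurable_wt : Measurable (wt (n := n)) := continuous_wt.measurable

lemma wt_mul_wi (x : Fin n → ℝ) : wt x * wi x = 1 := by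
  unfold wt wi
  rw [← ENNReal.ofReal_mul (inv_nonneg.2 (wR_pos x).le), inv_mul_cancel₀ (wR_pos x).ne',
    ENNReal.ofReal_one]

lemma wt_le_one (x : Fin n → ℝ) : wt x ≤ 1 := by
  unfold wt; rw [ENNReal.ofReal_le_one]; exact inv_le_one_of_one_le₀ (one_le_wR x)

lemma one_le_wi (x : Fin n → ℝ) : 1 ≤ wi x := by
  unfold wi; rw [ENNReal.one_le_ofReal]; exact one_le_wR x

lemma wi_ne_top (x : Fin n → ℝ) : wi x ≠ ∞ := ENNReal.ofReal_ne_top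
lemma wt_ne_top (x : Fin n → ℝ) : wt x ≠ ∞ := ENNReal.ofReal_ne_top

@[simp] lemma wR_neg (x : Fin n → ℝ) : wR (-x) = wR x := by simp [wR]
@[simp] lemma wt_neg (x : Fin n → ℝ) : wt (-x) = wt x := by simp [wt]
@[simp] lemma wi_neg (x : Fin n → ℝ) : wi (-x) = wi x := by simp [wi]

lemma wt_sub_comm (x y : Fin n → ℝ) : wt (x - y) = wt (y - x) := by
  rw [← wt_neg, neg_sub]

lemma wR_add_le (x y : Fin n → ℝ) : wR (x + y) ≤ wR x * wR y := by
  unfold wR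
  rw [← mul_pow]
  gcongr
  nlinarith [norm_add_le x y, norm_nonneg x, norm_nonneg y, mul_nonneg (norm_nonneg x) (norm_nonneg y)]

lemma wt_le_mul (x y : Fin n → ℝ) : wt x ≤ wt (x + y) * wi y := by
  unfold wt wi
  rw [← ENNReal.ofReal_mul (inv_nonneg.2 (wR_pos _).le)]
  apply ENNReal.ofReal_le_ofReal
  have := wR_add_le x y
  have h1 := wR_pos x
  have h2 := wR_pos (x + y)
  rw [inv_mul_eq_div, inv_eq_one_div, div_le_div_iff₀ h1 h2]; nlinarith

lemma lintegral_wt_lt_top : ∫⁻ x : Fin n → ℝ, wt x < ∞ := by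
  have h := (integrable_one_add_norm (E := Fin n → ℝ) (μ := volume) (r := 2 * NN n) (by
    have : n < 2 * NN n := by unfold NN; omega
    simpa using (by exact_mod_cast this : (n : ℝ) < 2 * NN n)))
  have := h.lintegral_lt_top
  convert! this using 3 with x
  unfold wt wR
  congr 1
  rw [Real.rpow_neg (by positivity), ← Real.rpow_natCast]; push_cast; rfl

/-- The total mass of the decaying weight. -/
def wtI (n : ℕ) : ℝ≥0∞ := ∫⁻ x : Fin n → ℝ, wt x

lemma lintegral_wt_sub (c : Fin n → ℝ) : ∫⁻ x : Fin n → ℝ, wt (x - c) = wtI n :=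
  lintegral_sub_right_eq_self wt c

lemma lintegral_wt_sub' (c : Fin n → ℝ) : ∫⁻ x : Fin n → ℝ, wt (c - x) = wtI n := by
  simp_rw [wt_sub_comm c]; exact lintegral_wt_sub c

lemma wR_le_sum [NeZero n] (x : Fin n → ℝ) :
    wR x ≤ 4 ^ NN n * ∑ j, (1 + |x j| ^ (2 * NN n)) := by
  obtain ⟨j, hj⟩ : ∃ j, ‖x‖ = |x j| := by
    obtain ⟨j, -, hj⟩ := Finset.exists_mem_eq_sup' (Finset.univ_nonempty (α := Fin n))
      (fun j => ‖x j‖₊)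
    refine ⟨j, ?_⟩
    rw [Pi.norm_def, ← Finset.sup'_eq_sup Finset.univ_nonempty, hj]; simp
  have h1 : (1 + |x j|) ^ (2 * NN n) ≤ 4 ^ NN n * (1 + |x j| ^ (2 * NN n)) := by
    have : (1 + |x j|) ^ (2 * NN n) ≤ (2 * max 1 |x j|) ^ (2 * NN n) := by
      gcongr
      linarith [le_max_left 1 |x j|, le_max_right 1 |x j|]
    refine this.trans ?_
    rw [mul_pow, pow_mul]
    norm_num
    rcases le_total 1 |x j| with h | h
    · rw [max_eq_right h]; linarith
    · rw [max_eq_left h]; simp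
  unfold wR
  rw [hj]
  refine h1.trans ?_
  gcongr
  exact Finset.single_le_sum (f := fun j => 1 + |x j| ^ (2 * NN n)) (fun i _ => by positivity)
    (Finset.mem_univ j)

end Weights

section WeightedPlancherel

variable {n : ℕ}

/-- The Fourier transform in `2n` variables. -/
def FT2 (K : (Fin n → ℝ) × (Fin n → ℝ) → ℂ) (ζ y : Fin n → ℝ) : ℂ :=
  ∫ q, ph q.1 ζ * ph q.2 y * K q

/-- Coordinates on the product. -/
def sumT : (Fin n ⊕ Fin n → ℝ) →L[ℝ] (Fin n → ℝ) × (Fin n → ℝ) :=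
  (ContinuousLinearMap.pi fun i => ContinuousLinearMap.proj (Sum.inl i)).prod
    (ContinuousLinearMap.pi fun i => ContinuousLinearMap.proj (Sum.inr i))

lemma sumT_apply (w : Fin n ⊕ Fin n → ℝ) : sumT w = (fun i => w (Sum.inl i), fun i => w (Sum.inr i)) :=
  rfl

lemma sumT_mp : MeasurePreserving (sumT (n := n)) volume volume :=
  volume_measurePreserving_sumPiEquivProdPi (fun _ : Fin n ⊕ Fin n => ℝ)

lemma sumT_me : MeasurableEmbedding (sumT (n := n)) :=
  (MeasurableEquiv.sumPiEquivProdPi (fun _ : Fin n ⊕ Fin n => ℝ)).measurableEmbedding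

lemma FT2_eq (K : (Fin n → ℝ) × (Fin n → ℝ) → ℂ) (w : Fin n ⊕ Fin n → ℝ) :
    FT2 K (sumT w).1 (sumT w).2 = FTg (fun v => K (sumT v)) w := by
  unfold FT2 FTg
  rw [← sumT_mp.integral_comp sumT_me]
  congr 1; ext v
  congr 1
  rw [ph_eq_ofReal, ph_eq_ofReal, ph_eq_ofReal, ← Complex.exp_add]
  congr 1
  simp [sumT_apply, Fintype.sum_sum_type]
  ring

lemma sumT_single_inl (j : Fin n) : sumT (Pi.single (Sum.inl j) 1) = (eb j, 0) := by
  ext i <;> simp [sumT_apply, eb, Pi.single_apply]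

lemma sumT_single_inr (j : Fin n) : sumT (Pi.single (Sum.inr j) 1) = (0, eb j) := by
  ext i <;> simp [sumT_apply, eb, Pi.single_apply]

lemma FTg_dv_iter {ι : Type*} [Fintype ι] [DecidableEq ι] {g : (ι → ℝ) → ℂ}
    (hg : ContDiff ℝ (⊤ : ℕ∞) g) (hs : HasCompactSupport g) (i : ι) (k : ℕ) (ξ : ι → ℝ) :
    FTg ((dv (Pi.single i 1))^[k] g) ξ = (2 * π * Complex.I * ξ i) ^ k * FTg g ξ := by
  induction k generalizing g with
  | zero => simp
  | succ k ih =>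
    rw [Function.iterate_succ_apply, ih (hg.dv _) (hs.dv_iter _ 1)]
    unfold dv
    rw [FTg_deriv hg hs]
    have : ∑ j, ((Pi.single i (1 : ℝ) : ι → ℝ) j : ℂ) * ξ j = ξ i := by
      rw [Finset.sum_eq_single i] <;> simp +contextual
    rw [this, pow_succ]; ring

lemma HasCompactSupport.comp_sumT {K : (Fin n → ℝ) × (Fin n → ℝ) → ℂ} (hK : HasCompactSupport K) :
    HasCompactSupport fun v => K (sumT v) := by
  have : Topology.IsClosedEmbedding (sumT (n := n)) :=
    (Homeomorph.sumPiEquivProdPi (Fin n) (Fin n) (fun _ => ℝ)).isClosedEmbedding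
  exact hK.comp_isClosedEmbedding this

lemma lintegral_FT2_deriv {K : (Fin n → ℝ) × (Fin n → ℝ) → ℂ} (hK : ContDiff ℝ (⊤ : ℕ∞) K)
    (hs : HasCompactSupport K) (j i : Fin n) (b a : ℕ) :
    ∫⁻ q : (Fin n → ℝ) × (Fin n → ℝ),
      ENNReal.ofReal (|q.1 j| ^ (2 * b) * |q.2 i| ^ (2 * a)) * ‖FT2 K q.1 q.2‖ₑ ^ 2 ≤
    ∫⁻ q, ‖dvv (eb j, 0) (0, eb i) b a K q‖ₑ ^ 2 := by
  have hKs : ContDiff ℝ (⊤ : ℕ∞) fun v => K (sumT v) := hK.comp sumT.contDiff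
  have hss := hs.comp_sumT
  rw [← sumT_mp.lintegral_comp_emb sumT_me, ← sumT_mp.lintegral_comp_emb sumT_me]
  set g := dvv (Pi.single (Sum.inl j) 1) (Pi.single (Sum.inr i) 1) b a (fun v => K (sumT v)) with hg
  have hgs : ContDiff ℝ (⊤ : ℕ∞) g := hKs.dvv _ _ _ _
  have hgc : HasCompactSupport g := hss.dvv _ _ _ _
  have hge : ∀ v, g v = dvv (eb j, 0) (0, eb i) b a K (sumT v) := by
    intro v
    have := dvv_comp_affine hK sumT 0 (Pi.single (Sum.inl j) 1) (Pi.single (Sum.inr i) 1) b a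
    simp only [zero_add, sumT_single_inl, sumT_single_inr] at this
    rw [hg, this]
  simp_rw [← hge]
  have hP := schwartz_plancherel (hgc.toSchwartzMap hgs)
  rw [show ⇑(hgc.toSchwartzMap hgs) = g from rfl] at hP
  rw [hP]
  refine lintegral_mono fun w => ?_
  have e : FTg g w = (2 * π * Complex.I * w (Sum.inl j)) ^ b *
      ((2 * π * Complex.I * w (Sum.inr i)) ^ a * FTg (fun v => K (sumT v)) w) := by
    rw [hg, dvv, FTg_dv_iter (hKs.dv_iter _ _) (hss.dv_iter _ _), FTg_dv_iter hKs hss]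
  rw [FT2_eq, e, ← mul_assoc, enorm_mul, mul_pow]
  gcongr
  rw [← ofReal_norm, ← ENNReal.ofReal_pow (norm_nonneg _)]
  apply ENNReal.ofReal_le_ofReal
  simp only [sumT_apply, norm_mul, norm_pow, Complex.norm_I, Complex.norm_real, Real.norm_eq_abs,
    Complex.norm_ofNat, mul_pow, abs_of_pos Real.pi_pos]
  have h1 : (1 : ℝ) ≤ (2 ^ b * π ^ b) ^ 2 := by
    rw [← mul_pow]
    exact one_le_pow₀ (one_le_pow₀ (by linarith [Real.pi_gt_three]))
  have h2 : (1 : ℝ) ≤ (2 ^ a * π ^ a) ^ 2 := by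
    rw [← mul_pow]
    exact one_le_pow₀ (one_le_pow₀ (by linarith [Real.pi_gt_three]))
  calc |w (Sum.inl j)| ^ (2 * b) * |w (Sum.inr i)| ^ (2 * a)
      = (1 * 1) * (|w (Sum.inl j)| ^ (2 * b) * |w (Sum.inr i)| ^ (2 * a)) := by ring
    _ ≤ ((2 ^ b * π ^ b) ^ 2 * (2 ^ a * π ^ a) ^ 2) *
        (|w (Sum.inl j)| ^ (2 * b) * |w (Sum.inr i)| ^ (2 * a)) := by gcongr
    _ = _ := by ring

lemma continuous_FT2 {K : (Fin n → ℝ) × (Fin n → ℝ) → ℂ} (hK : Integrable K) :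
    Continuous fun q : (Fin n → ℝ) × (Fin n → ℝ) => FT2 K q.1 q.2 := by
  refine continuous_of_dominated (bound := fun x => ‖K x‖) ?_ ?_ hK.norm ?_
  · intro ξ
    exact AEStronglyMeasurable.mul (Continuous.aestronglyMeasurable (by fun_prop)) hK.aestronglyMeasurable
  · intro ξ; exact Filter.Eventually.of_forall fun x => by simp
  · exact Filter.Eventually.of_forall fun x => by fun_prop

/-- Weighted Plancherel estimate in `2n` variables. -/
lemma lintegral_FT2_weighted [NeZero n] {K : (Fin n → ℝ) × (Fin n → ℝ) → ℂ}
    (hK : ContDiff ℝ (⊤ : ℕ∞) K) (hs : HasCompactSupport K) {A : ℝ≥0∞}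
    (hA : ∀ j i : Fin n, ∀ b ≤ NN n, ∀ a ≤ NN n,
      ∫⁻ q, ‖dvv (eb j, 0) (0, eb i) b a K q‖ₑ ^ 2 ≤ A) :
    ∫⁻ q : (Fin n → ℝ) × (Fin n → ℝ), wi q.1 * wi q.2 * ‖FT2 K q.1 q.2‖ₑ ^ 2 ≤
      (16 ^ NN n * n ^ 2 * 4 : ℕ) * A := by
  have hKi : Integrable K := hK.continuous.integrable_of_hasCompactSupport hs
  have hc := continuous_FT2 hKi
  set S : Finset (Fin n × Fin n × ℕ × ℕ) :=
    Finset.univ ×ˢ Finset.univ ×ˢ {0, NN n} ×ˢ {0, NN n} with hS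
  have hN : NN n ≠ 0 := by unfold NN; omega
  have hcard : S.card = n ^ 2 * 4 := by
    simp only [hS, Finset.card_product, Finset.card_univ, Fintype.card_fin,
      Finset.card_pair hN.symm]; ring
  have hpt : ∀ q : (Fin n → ℝ) × (Fin n → ℝ), wi q.1 * wi q.2 ≤
      (16 ^ NN n : ℕ) * ∑ t ∈ S, ENNReal.ofReal (|q.1 t.1| ^ (2 * t.2.2.1) * |q.2 t.2.1| ^ (2 * t.2.2.2)) := by
    intro q
    unfold wi
    rw [← ENNReal.ofReal_mul (wR_pos _).le, ← ENNReal.ofReal_sum_of_nonneg (fun _ _ => by positivity),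
      ← ENNReal.ofReal_natCast, ← ENNReal.ofReal_mul (by positivity)]
    apply ENNReal.ofReal_le_ofReal
    refine (mul_le_mul (wR_le_sum q.1) (wR_le_sum q.2) (wR_pos _).le (by positivity)).trans_eq ?_
    rw [hS, Finset.sum_product]
    simp_rw [Finset.sum_product]
    simp only [Finset.sum_pair hN.symm]
    push_cast
    rw [show (16 : ℝ) = 4 * 4 by norm_num, mul_pow]
    simp only [pow_zero, one_mul, mul_one]
    rw [mul_mul_mul_comm, Finset.sum_mul_sum]
    congr 1
    refine Finset.sum_congr rfl fun j _ => Finset.sum_congr rfl fun i _ => ?_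
    ring
  calc ∫⁻ q : (Fin n → ℝ) × (Fin n → ℝ), wi q.1 * wi q.2 * ‖FT2 K q.1 q.2‖ₑ ^ 2
      ≤ ∫⁻ q : (Fin n → ℝ) × (Fin n → ℝ), (16 ^ NN n : ℕ) * ∑ t ∈ S, ENNReal.ofReal
        (|q.1 t.1| ^ (2 * t.2.2.1) * |q.2 t.2.1| ^ (2 * t.2.2.2)) * ‖FT2 K q.1 q.2‖ₑ ^ 2 := by
        refine lintegral_mono fun q => ?_
        rw [← Finset.sum_mul, ← mul_assoc]
        exact mul_le_mul_left (hpt q) _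
    _ = (16 ^ NN n : ℕ) * ∑ t ∈ S, ∫⁻ q : (Fin n → ℝ) × (Fin n → ℝ), ENNReal.ofReal
        (|q.1 t.1| ^ (2 * t.2.2.1) * |q.2 t.2.1| ^ (2 * t.2.2.2)) * ‖FT2 K q.1 q.2‖ₑ ^ 2 := by
        rw [lintegral_const_mul', lintegral_finsetSum']
        · intro t _
          have := hc.measurable
          fun_prop
        · simp
    _ ≤ (16 ^ NN n : ℕ) * ∑ t ∈ S, A := by
        gcongr with t ht
        refine (lintegral_FT2_deriv hK hs _ _ _ _).trans (hA _ _ _ ?_ _ ?_) <;>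
        · simp only [hS, Finset.mem_product, Finset.mem_univ, true_and, Finset.mem_insert,
            Finset.mem_singleton] at ht
          omega
    _ = _ := by
        rw [Finset.sum_const, hcard, nsmul_eq_mul, ← mul_assoc]; push_cast; ring

end WeightedPlancherel

section CauchySchwarz

variable {α : Type*} [MeasurableSpace α] {μ : Measure α}

lemma lintegral_mul_sq_le {f g : α → ℝ≥0∞} (hf : AEMeasurable f μ) (hg : AEMeasurable g μ) :
    (∫⁻ a, f a * g a ∂μ) ^ 2 ≤ (∫⁻ a, f a ^ 2 ∂μ) * ∫⁻ a, g a ^ 2 ∂μ := by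
  have h := ENNReal.lintegral_mul_le_Lp_mul_Lq μ (p := 2) (q := 2)
    (Real.HolderConjugate.two_two) hf hg
  have := pow_le_pow_left₀ (zero_le) h 2
  simp only [Pi.mul_apply] at this
  refine this.trans_eq ?_
  rw [mul_pow, ← ENNReal.rpow_natCast, ← ENNReal.rpow_mul, ← ENNReal.rpow_natCast (_ ^ _),
    ← ENNReal.rpow_mul]
  norm_num

lemma lintegral_mul_sq_le_weighted {f g a b : α → ℝ≥0∞} (hf : AEMeasurable f μ)
    (hg : AEMeasurable g μ) (ha : AEMeasurable a μ) (hb : AEMeasurable b μ)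
    (hab : ∀ x, a x * b x = 1) :
    (∫⁻ x, f x * g x ∂μ) ^ 2 ≤ (∫⁻ x, a x * f x ^ 2 ∂μ) * ∫⁻ x, b x * g x ^ 2 ∂μ := by
  have h := lintegral_mul_sq_le (μ := μ) (f := fun x => a x ^ (1 / 2 : ℝ) * f x)
    (g := fun x => b x ^ (1 / 2 : ℝ) * g x) (by fun_prop) (by fun_prop)
  have e : ∀ c : ℝ≥0∞, (c ^ (1 / 2 : ℝ)) ^ 2 = c := fun c => by
    rw [← ENNReal.rpow_natCast, ← ENNReal.rpow_mul]; norm_num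
  have e2 : ∀ x, a x ^ (1 / 2 : ℝ) * f x * (b x ^ (1 / 2 : ℝ) * g x) = f x * g x := fun x => by
    rw [mul_mul_mul_comm, ← ENNReal.mul_rpow_of_nonneg _ _ (by norm_num), hab]; simp
  simp only [mul_pow, e, e2] at h
  exact h

lemma sq_rpow_half (c : ℝ≥0∞) : (c ^ (1 / 2 : ℝ)) ^ 2 = c := by
  rw [← ENNReal.rpow_natCast, ← ENNReal.rpow_mul]; norm_num

lemma le_rpow_half {a c : ℝ≥0∞} (h : a ^ 2 ≤ c) : a ≤ c ^ (1 / 2 : ℝ) := by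
  calc a = (a ^ 2) ^ (1 / 2 : ℝ) := by rw [← ENNReal.rpow_natCast, ← ENNReal.rpow_mul]; norm_num
    _ ≤ _ := ENNReal.rpow_le_rpow h (by norm_num)

end CauchySchwarz

section Cutoffs

variable {n : ℕ}

/-- Smooth cutoff equal to one on `‖x‖ ≤ 2`, supported in `‖x‖ ≤ 3`. -/
def chiB (n : ℕ) : ContDiffBump (0 : Fin n → ℝ) := ⟨2, 3, by norm_num, by norm_num⟩

/-- Smooth bump supported in `‖x‖ ≤ 1`. -/
def phB (n : ℕ) : ContDiffBump (0 : Fin n → ℝ) := ⟨1 / 2, 1, by norm_num, by norm_num⟩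

/-- Complex valued version of the cutoff. -/
def chi (x : Fin n → ℝ) : ℂ := ((chiB n x : ℝ) : ℂ)

lemma contDiff_chi : ContDiff ℝ (⊤ : ℕ∞) (chi (n := n)) :=
  Complex.ofRealCLM.contDiff.comp (chiB n).contDiff

lemma chi_eq_one {x : Fin n → ℝ} (h : ‖x‖ ≤ 2) : chi x = 1 := by
  unfold chi
  rw [(chiB n).one_of_mem_closedBall (by simpa [chiB] using h)]; simp

lemma chi_eq_zero {x : Fin n → ℝ} (h : 3 ≤ ‖x‖) : chi x = 0 := by
  unfold chi
  rw [(chiB n).zero_of_le_dist (by simpa [chiB] using h)]; simp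

lemma norm_chi_le (x : Fin n → ℝ) : ‖chi x‖ ≤ 1 := by
  unfold chi
  rw [Complex.norm_real, Real.norm_of_nonneg (chiB n).nonneg]; exact (chiB n).le_one

lemma hasCompactSupport_chi : HasCompactSupport (chi (n := n)) :=
  (chiB n).hasCompactSupport.comp_left (g := fun x : ℝ => (x : ℂ)) (by simp)

/-- Normalisation constant. -/
def phI (n : ℕ) : ℝ := ∫ x, (phB n x) ^ 2

lemma phI_pos : 0 < phI n := by
  unfold phI
  have hc : Continuous fun x => (phB n x) ^ 2 := (phB n).continuous.pow 2
  refine hc.integral_pos_of_hasCompactSupport_nonneg_nonzero (x := 0) ?_ (fun x => by positivity) ?_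
  · exact (phB n).hasCompactSupport.comp_left (g := fun x : ℝ => x ^ 2) (by simp)
  · have : phB n 0 = 1 := (phB n).one_of_mem_closedBall (by simp [phB])
    simp [this]

/-- A smooth bump in the unit ball with `∫ φ² = 1`. -/
def phiC (x : Fin n → ℝ) : ℂ := (((√(phI n))⁻¹ * phB n x : ℝ) : ℂ)

lemma contDiff_phiC : ContDiff ℝ (⊤ : ℕ∞) (phiC (n := n)) :=
  Complex.ofRealCLM.contDiff.comp (contDiff_const.mul (phB n).contDiff)

lemma hasCompactSupport_phiC : HasCompactSupport (phiC (n := n)) :=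
  (phB n).hasCompactSupport.comp_left (g := fun x : ℝ => (((√(phI n))⁻¹ * x : ℝ) : ℂ)) (by simp)

lemma phiC_eq_zero {x : Fin n → ℝ} (h : 1 ≤ ‖x‖) : phiC x = 0 := by
  unfold phiC
  rw [(phB n).zero_of_le_dist (by simpa [phB] using h)]; simp

lemma integral_phiC_sq : ∫ x : Fin n → ℝ, phiC x * phiC x = 1 := by
  have : ∀ x : Fin n → ℝ, phiC x * phiC x = (((phI n)⁻¹ * (phB n x) ^ 2 : ℝ) : ℂ) := by
    intro x
    unfold phiC
    rw [← Complex.ofReal_mul]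
    congr 1
    rw [mul_mul_mul_comm, ← mul_inv, Real.mul_self_sqrt phI_pos.le]; ring
  simp_rw [this]
  rw [integral_complex_ofReal, integral_const_mul]
  have h := phI_pos (n := n)
  change (((phI n)⁻¹ * phI n : ℝ) : ℂ) = 1
  rw [inv_mul_cancel₀ h.ne']; simp

/-- The bump as a Schwartz function. -/
def phiS (n : ℕ) : 𝓢(Fin n → ℝ, ℂ) := hasCompactSupport_phiC.toSchwartzMap contDiff_phiC

/-- Inverse Fourier transform of the bump. -/
def gS (n : ℕ) : 𝓢(Fin n → ℝ, ℂ) := IFTS (phiS n)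

lemma FTg_gS : FTg (gS n) = phiC := by
  unfold gS; rw [FTg_IFTS]; rfl

lemma schwartz_wR_bound (g : 𝓢(Fin n → ℝ, ℂ)) : ∃ B : ℝ, 0 ≤ B ∧ ∀ x, wR x * ‖g x‖ ≤ B := by
  refine ⟨|2 ^ (2 * NN n) * (Finset.Iic (2 * NN n, 0)).sup
    (fun m => SchwartzMap.seminorm ℝ m.1 m.2) g|, abs_nonneg _, fun x => ?_⟩
  have := one_add_le_sup_seminorm_apply (𝕜 := ℝ) (m := (2 * NN n, 0)) le_rfl le_rfl g x
  rw [norm_iteratedFDeriv_zero] at this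
  exact this.trans (le_abs_self _)

lemma schwartz_wi_sq_lt_top (g : 𝓢(Fin n → ℝ, ℂ)) : ∫⁻ x, wi x * ‖g x‖ₑ ^ 2 < ∞ := by
  obtain ⟨B, hB0, hB⟩ := schwartz_wR_bound g
  calc ∫⁻ x, wi x * ‖g x‖ₑ ^ 2 ≤ ∫⁻ x, ENNReal.ofReal (B ^ 2) * wt x := by
        refine lintegral_mono fun x => ?_
        rw [← ofReal_norm, ← ENNReal.ofReal_pow (norm_nonneg _), wi, wt,
          ← ENNReal.ofReal_mul (wR_pos x).le, ← ENNReal.ofReal_mul (by positivity)]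
        apply ENNReal.ofReal_le_ofReal
        rw [← div_eq_mul_inv, le_div_iff₀ (wR_pos x)]
        calc wR x * ‖g x‖ ^ 2 * wR x = (wR x * ‖g x‖) ^ 2 := by ring
          _ ≤ B ^ 2 := by
            have := wR_pos x
            gcongr
            exact hB x
    _ = ENNReal.ofReal (B ^ 2) * wtI n := by
        rw [lintegral_const_mul _ measurable_wt]; rfl
    _ < ∞ := ENNReal.mul_lt_top ENNReal.ofReal_lt_top lintegral_wt_lt_top

end Cutoffs

section ShortTime

variable {n : ℕ}

/-- Windowed Fourier transform of `f`. -/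
def Vv (f : (Fin n → ℝ) → ℂ) (ν y : Fin n → ℝ) : ℂ := FTg (fun z => f z * gS n (y - z)) ν

/-- The Schwartz function `z ↦ f z * g (y - z)`. -/
def winS (f : 𝓢(Fin n → ℝ, ℂ)) (y : Fin n → ℝ) : 𝓢(Fin n → ℝ, ℂ) :=
  smulLeftCLM ℂ (fun z => gS n (y - z)) f

lemma winS_apply (f : 𝓢(Fin n → ℝ, ℂ)) (y z : Fin n → ℝ) : winS f y z = f z * gS n (y - z) := by
  unfold winS
  rw [smulLeftCLM_apply]
  · simp [mul_comm]
  · exact (gS n).hasTemperateGrowth.comp (by fun_prop)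

lemma lintegral_Vv (f : 𝓢(Fin n → ℝ, ℂ)) (y : Fin n → ℝ) :
    ∫⁻ ν, ‖Vv f ν y‖ₑ ^ 2 = ∫⁻ z, ‖f z‖ₑ ^ 2 * ‖gS n (y - z)‖ₑ ^ 2 := by
  have := schwartz_plancherel (winS f y)
  unfold Vv
  simp only [← winS_apply]
  rw [← this]
  simp only [winS_apply, enorm_mul, mul_pow]

lemma integrable_conv (f : 𝓢(Fin n → ℝ, ℂ)) :
    Integrable (fun p : (Fin n → ℝ) × (Fin n → ℝ) => f p.2 * gS n (p.1 - p.2)) :=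
  Integrable.convolution_integrand (ContinuousLinearMap.mul ℝ ℂ) f.integrable (gS n).integrable

lemma continuous_Vv (f : 𝓢(Fin n → ℝ, ℂ)) :
    Continuous fun p : (Fin n → ℝ) × (Fin n → ℝ) => Vv f p.1 p.2 := by
  obtain ⟨B, hB0, hB⟩ := schwartz_wR_bound (gS n)
  unfold Vv FTg
  refine continuous_of_dominated (bound := fun z => ‖f z‖ * B) ?_ ?_ (f.integrable.norm.mul_const B) ?_
  · intro p
    have := f.continuous
    have := (gS n).continuous
    exact Continuous.aestronglyMeasurable (by fun_prop)
  · intro p; refine Filter.Eventually.of_forall fun z => ?_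
    simp only [norm_mul, norm_ph, one_mul]
    gcongr
    refine le_trans ?_ (hB (p.2 - z))
    exact le_mul_of_one_le_left (norm_nonneg _) (one_le_wR _)
  · refine Filter.Eventually.of_forall fun z => ?_
    have := (gS n).continuous
    fun_prop

lemma integrable_Vv (f : 𝓢(Fin n → ℝ, ℂ)) (ν : Fin n → ℝ) : Integrable (Vv f ν) := by
  have h : Integrable (fun p : (Fin n → ℝ) × (Fin n → ℝ) => ph p.2 ν * (f p.2 * gS n (p.1 - p.2)))
      (volume.prod volume) := by
    refine (integrable_conv f).bdd_mul (c := 1) ?_ ?_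
    · exact Continuous.aestronglyMeasurable (by fun_prop)
    · exact Filter.Eventually.of_forall fun x => by simp
  exact h.integral_prod_left

lemma integral_Vv (f : 𝓢(Fin n → ℝ, ℂ)) (ν η : Fin n → ℝ) :
    ∫ y, ph y η * Vv f ν y = phiC η * FTg f (ν + η) := by
  have h : Integrable (fun p : (Fin n → ℝ) × (Fin n → ℝ) =>
      ph p.1 η * (ph p.2 ν * (f p.2 * gS n (p.1 - p.2)))) (volume.prod volume) := by
    refine Integrable.bdd_mul (c := 1) (Integrable.bdd_mul (c := 1) (integrable_conv f) ?_ ?_) ?_ ?_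
    · exact Continuous.aestronglyMeasurable (by fun_prop)
    · exact Filter.Eventually.of_forall fun x => by simp
    · exact Continuous.aestronglyMeasurable (by fun_prop)
    · exact Filter.Eventually.of_forall fun x => by simp
  calc ∫ y, ph y η * Vv f ν y
      = ∫ y, ∫ z, ph y η * (ph z ν * (f z * gS n (y - z))) := by
        congr 1; ext y; rw [integral_const_mul]; rfl
    _ = ∫ z, ∫ y, ph y η * (ph z ν * (f z * gS n (y - z))) := integral_integral_swap h
    _ = ∫ z, phiC η * (ph z (ν + η) * f z) := by
        congr 1; ext z
        rw [← integral_add_right_eq_self _ z]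
        rw [← FTg_gS, FTg, ← integral_mul_const]
        congr 1; ext y
        rw [ph_add_left, ph_add_right, add_sub_cancel_right]; ring
    _ = _ := by rw [integral_const_mul]; rfl

/-- The weighted mass of the window. -/
def Cg (n : ℕ) : ℝ≥0∞ := ∫⁻ x, wi x * ‖gS n x‖ₑ ^ 2

lemma Cg_lt_top : Cg n < ∞ := schwartz_wi_sq_lt_top _

lemma lintegral_wt_Vv_le (f : 𝓢(Fin n → ℝ, ℂ)) :
    ∫⁻ ν, ∫⁻ y, wt y * ‖Vv f ν y‖ₑ ^ 2 ≤ Cg n * ∫⁻ z, ‖f z‖ₑ ^ 2 * wt z := by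
  have hV := (continuous_Vv f).measurable
  have hg := (gS n).continuous.measurable
  have hf := f.continuous.measurable
  calc ∫⁻ ν, ∫⁻ y, wt y * ‖Vv f ν y‖ₑ ^ 2 = ∫⁻ y, ∫⁻ ν, wt y * ‖Vv f ν y‖ₑ ^ 2 := by
        rw [lintegral_lintegral_swap]
        refine Measurable.aemeasurable ?_
        exact Measurable.mul (by fun_prop) (hV.enorm.pow_const 2)
    _ = ∫⁻ y, ∫⁻ z, wt y * (‖f z‖ₑ ^ 2 * ‖gS n (y - z)‖ₑ ^ 2) := by
        congr 1; ext y
        rw [lintegral_const_mul' _ _ (wt_ne_top y), lintegral_Vv,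
          lintegral_const_mul' _ _ (wt_ne_top y)]
    _ = ∫⁻ z, ∫⁻ y, wt y * (‖f z‖ₑ ^ 2 * ‖gS n (y - z)‖ₑ ^ 2) := by
        rw [lintegral_lintegral_swap]
        refine Measurable.aemeasurable ?_
        have : Measurable fun p : (Fin n → ℝ) × (Fin n → ℝ) =>
            wt p.1 * (‖f p.2‖ₑ ^ 2 * ‖gS n (p.1 - p.2)‖ₑ ^ 2) := by fun_prop
        exact this
    _ ≤ ∫⁻ z, ∫⁻ y, (‖f z‖ₑ ^ 2 * wt z) * (wi (y - z) * ‖gS n (y - z)‖ₑ ^ 2) := by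
        refine lintegral_mono fun z => lintegral_mono fun y => ?_
        have := wt_le_mul y (z - y)
        rw [add_sub_cancel, ← wi_neg, neg_sub] at this
        calc _ ≤ wt z * wi (y - z) * (‖f z‖ₑ ^ 2 * ‖gS n (y - z)‖ₑ ^ 2) := mul_le_mul_left this _
          _ = _ := by ring
    _ = ∫⁻ z, (‖f z‖ₑ ^ 2 * wt z) * Cg n := by
        congr 1; ext z
        rw [lintegral_const_mul _ (by fun_prop),
          lintegral_sub_right_eq_self (fun y => wi y * ‖gS n y‖ₑ ^ 2) z]; rfl
    _ = _ := by
        rw [lintegral_mul_const _ (by fun_prop), mul_comm]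

end ShortTime

section KeyLemma

lemma measurable_curry_left {α β γ : Type*} [MeasurableSpace α] [MeasurableSpace β] [MeasurableSpace γ]
    {g : α → β → γ} (h : Measurable fun p : α × β => g p.1 p.2) (a : α) : Measurable (g a) :=
  h.comp measurable_prodMk_left

lemma measurable_curry_comp {α β γ δ : Type*} [MeasurableSpace α] [MeasurableSpace β]
    [MeasurableSpace γ] [MeasurableSpace δ]
    {g : α → β → γ} (h : Measurable fun p : α × β => g p.1 p.2) {u : δ → α} {v : δ → β}
    (hu : Measurable u) (hv : Measurable v) : Measurable fun d => g (u d) (v d) :=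
  h.comp (hu.prodMk hv)

variable {n : ℕ}

/-- The pseudo-differential operator with symbol `s`, written with `FTg`. -/
def opS (s : (Fin n → ℝ) × (Fin n → ℝ) → ℂ) (f : (Fin n → ℝ) → ℂ) (x : Fin n → ℝ) : ℂ :=
  ∫ ξ, ph x (-ξ) * s (x, ξ) * FTg f ξ

lemma SymAt.norm_le [NeZero n] {L M : ℝ} {s : (Fin n → ℝ) × (Fin n → ℝ) → ℂ}
    {q : (Fin n → ℝ) × (Fin n → ℝ)} (h : SymAt L M s q) : ‖s q‖ ≤ M :=
  h 0 0 0 (Nat.zero_le _) 0 (Nat.zero_le _)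

/-- The localising factor of the kernel. -/
def Theta (q : (Fin n → ℝ) × (Fin n → ℝ)) : ℂ := chi q.1 * phiC q.2 * ph q.1 (-q.2)

lemma contDiff_ph_neg : ContDiff ℝ (⊤ : ℕ∞) fun q : (Fin n → ℝ) × (Fin n → ℝ) => ph q.1 (-q.2) := by
  unfold ph
  have : ∀ q : (Fin n → ℝ) × (Fin n → ℝ), -(2 * (π : ℂ) * Complex.I) *
      ∑ j, (q.1 j : ℂ) * ((-q.2) j : ℂ) = -(2 * (π : ℂ) * Complex.I) *
      ((∑ j, q.1 j * (-q.2) j : ℝ) : ℂ) := fun q => by push_cast; rfl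
  simp_rw [this]
  have h : ContDiff ℝ (⊤ : ℕ∞) fun q : (Fin n → ℝ) × (Fin n → ℝ) => ∑ j, q.1 j * (-q.2) j := by
    refine ContDiff.sum fun j _ => ?_
    simp only [Pi.neg_apply]
    fun_prop
  exact (contDiff_const.mul (Complex.ofRealCLM.contDiff.comp h)).cexp

lemma contDiff_Theta : ContDiff ℝ (⊤ : ℕ∞) (Theta (n := n)) :=
  ((contDiff_chi.comp contDiff_fst).mul (contDiff_phiC.comp contDiff_snd)).mul contDiff_ph_neg

lemma Theta_eq_zero {q : (Fin n → ℝ) × (Fin n → ℝ)} (h : 3 ≤ ‖q‖) : Theta q = 0 := by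
  rw [Prod.norm_def, le_max_iff] at h
  unfold Theta
  rcases h with h | h
  · rw [chi_eq_zero h]; ring
  · rw [phiC_eq_zero (by linarith)]; ring

lemma hasCompactSupport_Theta : HasCompactSupport (Theta (n := n)) := by
  refine HasCompactSupport.intro (isCompact_closedBall 0 3) fun q hq => ?_
  refine Theta_eq_zero ?_
  simp at hq; linarith

lemma exists_Theta_bound (n : ℕ) : ∃ B : ℝ, 0 ≤ B ∧ ∀ q, SymAt 1 B (Theta (n := n)) q := by
  have h : ∀ (j i : Fin n) (b a : ℕ), ∃ B : ℝ, 0 ≤ B ∧ ∀ q,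
      ‖dvv ((1 : ℝ)⁻¹ • eb j, 0) (0, (1 : ℝ) • eb i) b a (Theta (n := n)) q‖ ≤ B := by
    intro j i b a
    obtain ⟨B, hB⟩ := (hasCompactSupport_Theta.dvv ((1 : ℝ)⁻¹ • eb j, 0) (0, (1 : ℝ) • eb i) b a).exists_bound_of_continuous
      (contDiff_Theta.dvv ((1 : ℝ)⁻¹ • eb j, 0) (0, (1 : ℝ) • eb i) b a).continuous
    exact ⟨B, (norm_nonneg _).trans (hB 0), hB⟩
  choose B hB0 hB using h
  refine ⟨∑ j, ∑ i, ∑ b ∈ Finset.range (NN n + 1), ∑ a ∈ Finset.range (NN n + 1), B j i b a, ?_, ?_⟩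
  · exact Finset.sum_nonneg fun j _ => Finset.sum_nonneg fun i _ => Finset.sum_nonneg fun b _ =>
      Finset.sum_nonneg fun a _ => hB0 j i b a
  · intro q j i b hb a ha
    refine (hB j i b a q).trans ?_
    have h1 : B j i b a ≤ ∑ a ∈ Finset.range (NN n + 1), B j i b a :=
      Finset.single_le_sum (f := fun a => B j i b a) (fun a _ => hB0 j i b a)
        (Finset.mem_range.2 (by omega))
    have h2 := Finset.single_le_sum (f := fun b => ∑ a ∈ Finset.range (NN n + 1), B j i b a)
      (fun b _ => Finset.sum_nonneg fun a _ => hB0 j i b a) (Finset.mem_range.2 (Nat.lt_succ_of_le hb))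
    have h3 := Finset.single_le_sum (f := fun i => ∑ b ∈ Finset.range (NN n + 1), ∑ a ∈ Finset.range (NN n + 1), B j i b a)
      (fun i _ => Finset.sum_nonneg fun b _ => Finset.sum_nonneg fun a _ => hB0 j i b a) (Finset.mem_univ i)
    have h4 := Finset.single_le_sum (f := fun j => ∑ i, ∑ b ∈ Finset.range (NN n + 1), ∑ a ∈ Finset.range (NN n + 1), B j i b a)
      (fun j _ => Finset.sum_nonneg fun i _ => Finset.sum_nonneg fun b _ => Finset.sum_nonneg fun a _ => hB0 j i b a)
      (Finset.mem_univ j)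
    exact h1.trans (h2.trans (h3.trans h4))

/-- The localised symbol near the frequency `ν`. -/
def kK (s : (Fin n → ℝ) × (Fin n → ℝ) → ℂ) (ν : Fin n → ℝ) (q : (Fin n → ℝ) × (Fin n → ℝ)) : ℂ :=
  Theta q * s (q.1, ν + q.2)

variable {s : (Fin n → ℝ) × (Fin n → ℝ) → ℂ} {M : ℝ}

lemma contDiff_kK (hs : ContDiff ℝ (⊤ : ℕ∞) s) (ν : Fin n → ℝ) : ContDiff ℝ (⊤ : ℕ∞) (kK s ν) :=
  contDiff_Theta.mul (hs.comp (by fun_prop))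

lemma hasCompactSupport_kK (ν : Fin n → ℝ) : HasCompactSupport (kK s ν) :=
  hasCompactSupport_Theta.mul_right

lemma integrable_kK (hs : ContDiff ℝ (⊤ : ℕ∞) s) (ν : Fin n → ℝ) : Integrable (kK s ν) :=
  (contDiff_kK hs ν).continuous.integrable_of_hasCompactSupport (hasCompactSupport_kK ν)

lemma exists_kK_bound (n : ℕ) [NeZero n] : ∃ C : NNReal, ∀ (s : (Fin n → ℝ) × (Fin n → ℝ) → ℂ) (M : ℝ),
    ContDiff ℝ (⊤ : ℕ∞) s → 0 ≤ M → (∀ q, SymAt 1 M s q) → ∀ ν,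
    ∫⁻ q : (Fin n → ℝ) × (Fin n → ℝ), wi q.1 * wi q.2 * ‖FT2 (kK s ν) q.1 q.2‖ₑ ^ 2 ≤
      C * ENNReal.ofReal M ^ 2 := by
  obtain ⟨B, hB0, hB⟩ := exists_Theta_bound n
  set v : ℝ≥0∞ := volume (Metric.closedBall (0 : (Fin n → ℝ) × (Fin n → ℝ)) 4) with hv
  have hvt : v ≠ ∞ := (isCompact_closedBall _ _).measure_lt_top.ne
  refine ⟨(16 ^ NN n * n ^ 2 * 4 : ℕ) * ((2 ^ (2 * NN n) * B).toNNReal ^ 2 * v.toNNReal), ?_⟩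
  intro s M hs hM h ν
  refine (lintegral_FT2_weighted (contDiff_kK hs ν) (hasCompactSupport_kK ν)
    (A := ENNReal.ofReal (2 ^ (2 * NN n) * (B * M)) ^ 2 * v) ?_).trans_eq ?_
  · intro j i b hb a ha
    have hb1 : ∀ q, ‖dvv (eb j, 0) (0, eb i) b a (kK s ν) q‖ₑ ^ 2 ≤
        (Metric.closedBall (0 : (Fin n → ℝ) × (Fin n → ℝ)) 4).indicator
          (fun _ => ENNReal.ofReal (2 ^ (2 * NN n) * (B * M)) ^ 2) q := by
      intro q
      by_cases hq : q ∈ Metric.closedBall (0 : (Fin n → ℝ) × (Fin n → ℝ)) 4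
      · rw [Set.indicator_of_mem hq]
        have := SymAt.mul hB0 hM contDiff_Theta (t := fun q => s (q.1, ν + q.2)) (hs.comp (by fun_prop))
          (hB q) (SymAt.translate hs ν h q) j i b hb a ha
        simp only [inv_one, one_smul] at this
        rw [← ofReal_norm]
        gcongr
        exact this
      · rw [Set.indicator_of_notMem hq]
        have := dvv_zero_on (f := kK s ν) (U := (Metric.closedBall (0 : (Fin n → ℝ) × (Fin n → ℝ)) 3)ᶜ)
          (Metric.isClosed_closedBall.isOpen_compl) (fun x hx => by
            unfold kK; rw [Theta_eq_zero, zero_mul]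
            simp at hx; exact hx.le) (eb j, 0) (0, eb i) b a q (by
            simp at hq ⊢; linarith)
        rw [this]; simp
    refine (lintegral_mono hb1).trans_eq ?_
    rw [lintegral_indicator_const Metric.isClosed_closedBall.measurableSet]
  · have e : ENNReal.ofReal (2 ^ (2 * NN n) * (B * M)) =
        ((2 ^ (2 * NN n) * B).toNNReal : ℝ≥0∞) * ENNReal.ofReal M := by
      rw [← mul_assoc, ENNReal.ofReal_mul (by positivity)]; rfl
    rw [e]
    push_cast
    rw [ENNReal.coe_toNNReal hvt]
    ring

lemma continuous_FT2_kK (hs : ContDiff ℝ (⊤ : ℕ∞) s) (hM : ∀ q, ‖s q‖ ≤ M) :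
    Continuous fun p : (Fin n → ℝ) × (Fin n → ℝ) × (Fin n → ℝ) => FT2 (kK s p.1) p.2.1 p.2.2 := by
  have hT := (contDiff_Theta (n := n)).continuous
  have hsc := hs.continuous
  refine continuous_of_dominated (bound := fun q => ‖Theta q‖ * M) ?_ ?_ ?_ ?_
  · intro p
    unfold kK
    exact Continuous.aestronglyMeasurable (by fun_prop)
  · intro p; refine Filter.Eventually.of_forall fun q => ?_
    unfold kK
    simp only [norm_mul, norm_ph, one_mul]
    gcongr
    exact hM _
  · exact (hT.integrable_of_hasCompactSupport hasCompactSupport_Theta).norm.mul_const M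
  · refine Filter.Eventually.of_forall fun q => ?_
    unfold kK
    fun_prop

/-- The contribution of frequencies near `ν`. -/
def Jn (s : (Fin n → ℝ) × (Fin n → ℝ) → ℂ) (f : (Fin n → ℝ) → ℂ) (ν ζ : Fin n → ℝ) : ℂ :=
  ∫ q : (Fin n → ℝ) × (Fin n → ℝ), ph q.1 ζ * kK s ν q * (phiC q.2 * FTg f (ν + q.2))

lemma Jn_eq (hs : ContDiff ℝ (⊤ : ℕ∞) s) (f : 𝓢(Fin n → ℝ, ℂ)) (ν ζ : Fin n → ℝ) :
    Jn s f ν ζ = ∫ y, Vv f ν y * FT2 (kK s ν) ζ y := by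
  have hk := integrable_kK hs ν
  have h : Integrable (fun p : ((Fin n → ℝ) × (Fin n → ℝ)) × (Fin n → ℝ) =>
      ph p.1.1 ζ * (ph p.1.2 p.2 * (kK s ν p.1 * Vv f ν p.2))) (volume.prod volume) := by
    refine Integrable.bdd_mul (c := 1) (Integrable.bdd_mul (c := 1) (hk.mul_prod (integrable_Vv f ν)) ?_ ?_) ?_ ?_
    · exact Continuous.aestronglyMeasurable (by fun_prop)
    · exact Filter.Eventually.of_forall fun x => by simp
    · exact Continuous.aestronglyMeasurable (by fun_prop)
    · exact Filter.Eventually.of_forall fun x => by simp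
  calc Jn s f ν ζ = ∫ q : (Fin n → ℝ) × (Fin n → ℝ), ∫ y,
        ph q.1 ζ * (ph q.2 y * (kK s ν q * Vv f ν y)) := by
        unfold Jn
        congr 1; ext q
        rw [← integral_Vv, ← integral_const_mul]
        congr 1; ext y
        rw [ph_comm y]; ring
    _ = ∫ y, ∫ q : (Fin n → ℝ) × (Fin n → ℝ), ph q.1 ζ * (ph q.2 y * (kK s ν q * Vv f ν y)) :=
        integral_integral_swap h
    _ = _ := by
        congr 1; ext y
        unfold FT2
        rw [← integral_const_mul]
        congr 1; ext q; ring

lemma enorm_Jn_sq_le (hs : ContDiff ℝ (⊤ : ℕ∞) s) (f : 𝓢(Fin n → ℝ, ℂ)) (ν ζ : Fin n → ℝ) :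
    ‖Jn s f ν ζ‖ₑ ^ 2 ≤ (∫⁻ y, wt y * ‖Vv f ν y‖ₑ ^ 2) *
      ∫⁻ y, wi y * ‖FT2 (kK s ν) ζ y‖ₑ ^ 2 := by
  have hV := (continuous_Vv f).measurable
  have hF := (continuous_FT2 (integrable_kK hs ν)).measurable
  rw [Jn_eq hs]
  have h0 : ‖∫ y, Vv f ν y * FT2 (kK s ν) ζ y‖ₑ ≤ ∫⁻ y, ‖Vv f ν y‖ₑ * ‖FT2 (kK s ν) ζ y‖ₑ := by
    refine (enorm_integral_le_lintegral_enorm _).trans_eq ?_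
    simp only [enorm_mul]
  refine (pow_le_pow_left' h0 2).trans ?_
  refine lintegral_mul_sq_le_weighted (a := wt) (b := wi) ?_ ?_ measurable_wt.aemeasurable
    measurable_wi.aemeasurable wt_mul_wi
  · have : Measurable (Vv f ν) := measurable_curry_left (g := Vv f) hV ν
    exact this.enorm.aemeasurable
  · have : Measurable (FT2 (kK s ν) ζ) := measurable_curry_left (g := FT2 (kK s ν)) hF ζ
    exact this.enorm.aemeasurable

lemma FTg_chi_opS (hs : ContDiff ℝ (⊤ : ℕ∞) s) (hM : ∀ q, ‖s q‖ ≤ M) (f : 𝓢(Fin n → ℝ, ℂ))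
    (ζ : Fin n → ℝ) : FTg (fun x => chi x * opS s f x) ζ = ∫ ν, Jn s f ν (ζ - ν) := by
  have hF := integrable_FTg_schwartz f
  have hFc : Continuous (FTg f) := continuous_FTg f.integrable
  have hsc := hs.continuous
  have hchi : Continuous (chi (n := n)) := contDiff_chi.continuous
  have hphi : Continuous (phiC (n := n)) := contDiff_phiC.continuous
  have hchii : Integrable (chi (n := n)) := hchi.integrable_of_hasCompactSupport hasCompactSupport_chi
  have hphii : Integrable (fun η : Fin n → ℝ => phiC η * phiC η) :=
    (hphi.mul hphi).integrable_of_hasCompactSupport hasCompactSupport_phiC.mul_left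
  set G : (Fin n → ℝ) → (Fin n → ℝ) × (Fin n → ℝ) → ℂ := fun ν q =>
    (ph q.1 ζ * ph q.1 (-(ν + q.2)) * s (q.1, ν + q.2)) *
      (chi q.1 * (phiC q.2 * phiC q.2) * FTg f (ν + q.2)) with hG
  have hJ : ∀ ν, Jn s f ν (ζ - ν) = ∫ q, G ν q := by
    intro ν
    unfold Jn
    congr 1; ext q
    simp only [hG, kK, Theta]
    rw [sub_eq_add_neg, ph_add_right, neg_add, ph_add_right]; ring
  have hGi0 : Integrable (fun p : (Fin n → ℝ) × ((Fin n → ℝ) × (Fin n → ℝ)) =>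
      chi p.2.1 * (phiC p.2.2 * phiC p.2.2) * FTg f (p.1 + p.2.2)) (volume.prod volume) := by
    rw [integrable_prod_iff' (Continuous.aestronglyMeasurable (by fun_prop))]
    constructor
    · refine Filter.Eventually.of_forall fun q => ?_
      have := (hF.comp_add_right q.2).const_mul (chi q.1 * (phiC q.2 * phiC q.2))
      exact this
    · simp only [norm_mul, integral_const_mul]
      have : ∀ q : (Fin n → ℝ) × (Fin n → ℝ), ∫ x, ‖FTg f (x + q.2)‖ = ∫ x, ‖FTg f x‖ := fun q =>
        integral_add_right_eq_self (fun x => ‖FTg f x‖) q.2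
      simp only [this]
      refine Integrable.mul_const ?_ _
      have := (hchii.norm.mul_prod hphii.norm)
      simp only [norm_mul] at this
      exact this
  have hGi : Integrable (fun p : (Fin n → ℝ) × ((Fin n → ℝ) × (Fin n → ℝ)) => G p.1 p.2)
      (volume.prod volume) := by
    refine hGi0.bdd_mul (c := M) (Continuous.aestronglyMeasurable (by fun_prop)) ?_
    refine Filter.Eventually.of_forall fun p => ?_
    simpa only [norm_mul, norm_ph, one_mul] using hM _
  simp_rw [hJ]
  rw [integral_integral_swap hGi]
  have hin : ∀ q : (Fin n → ℝ) × (Fin n → ℝ), ∫ ν, G ν q =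
      (ph q.1 ζ * (chi q.1 * opS s f q.1)) * (phiC q.2 * phiC q.2) := by
    intro q
    simp only [hG]
    rw [integral_add_right_eq_self (fun ν => (ph q.1 ζ * ph q.1 (-ν) * s (q.1, ν)) *
      (chi q.1 * (phiC q.2 * phiC q.2) * FTg f ν)) q.2]
    unfold opS
    rw [← integral_const_mul, ← integral_const_mul, ← integral_mul_const]
    congr 1; ext ν; ring
  simp_rw [hin]
  rw [Measure.volume_eq_prod, integral_prod_mul (fun x => ph x ζ * (chi x * opS s f x)) (fun η => phiC η * phiC η), integral_phiC_sq, mul_one]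
  rfl

/-- The localised weighted estimate at unit scale. -/
theorem key_local (n : ℕ) [NeZero n] : ∃ C : NNReal, ∀ (s : (Fin n → ℝ) × (Fin n → ℝ) → ℂ) (M : ℝ),
    ContDiff ℝ (⊤ : ℕ∞) s → 0 ≤ M → (∀ q, SymAt 1 M s q) →
    ∀ (S : Set (Fin n → ℝ)) (w : (Fin n → ℝ) → ℝ≥0∞) (A : ℝ≥0∞), MeasurableSet S → Measurable w →
    (∀ x ν η, ν ∉ S → ‖η‖ ≤ 1 → s (x, ν + η) = 0) →
    (∀ ζ, w ζ * ∫⁻ ν in S, wt (ζ - ν) ≤ A) → ∀ f : 𝓢(Fin n → ℝ, ℂ),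
    ∫⁻ ζ, w ζ * ‖FTg (fun x => chi x * opS s f x) ζ‖ₑ ^ 2 ≤
      C * ENNReal.ofReal M ^ 2 * A * ∫⁻ x, ‖f x‖ₑ ^ 2 * wt x := by
  obtain ⟨C, hC⟩ := exists_kK_bound n
  refine ⟨C * (Cg n).toNNReal, ?_⟩
  intro s M hs hM h S w A hS hw hsS hwA f
  have hMs : ∀ q, ‖s q‖ ≤ M := fun q => (h q).norm_le
  have hcF := continuous_FT2_kK hs hMs
  obtain ⟨P, hP⟩ : ∃ P : (Fin n → ℝ) → ℝ≥0∞, P = fun ν => ∫⁻ y, wt y * ‖Vv f ν y‖ₑ ^ 2 := ⟨_, rfl⟩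
  obtain ⟨Q, hQ⟩ : ∃ Q : (Fin n → ℝ) → (Fin n → ℝ) → ℝ≥0∞, Q = fun ν ζ => ∫⁻ y, wi y * ‖FT2 (kK s ν) ζ y‖ₑ ^ 2 := ⟨_, rfl⟩
  have hJ2 : ∀ ν ζ, ‖Jn s f ν ζ‖ₑ ^ 2 ≤ P ν * Q ν ζ := by
    subst hP hQ; exact enorm_Jn_sq_le hs f
  have hPm : Measurable P := by
    rw [hP]
    have hV := (continuous_Vv f).measurable
    refine Measurable.lintegral_prod_right' (f := fun p : (Fin n → ℝ) × (Fin n → ℝ) => wt p.2 * ‖Vv f p.1 p.2‖ₑ ^ 2) ?_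
    exact (measurable_wt.comp measurable_snd).mul (hV.enorm.pow_const 2)
  have hQm : Measurable fun p : (Fin n → ℝ) × (Fin n → ℝ) => Q p.1 p.2 := by
    rw [hQ]
    refine Measurable.lintegral_prod_right' (f := fun p : ((Fin n → ℝ) × (Fin n → ℝ)) × (Fin n → ℝ) =>
      wi p.2 * ‖FT2 (kK s p.1.1) p.1.2 p.2‖ₑ ^ 2) ?_
    have : Measurable fun p : ((Fin n → ℝ) × (Fin n → ℝ)) × (Fin n → ℝ) => FT2 (kK s p.1.1) p.1.2 p.2 :=
      hcF.measurable.comp (by fun_prop : Measurable fun p : ((Fin n → ℝ) × (Fin n → ℝ)) × (Fin n → ℝ) => (p.1.1, p.1.2, p.2))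
    exact (measurable_wi.comp measurable_snd).mul (this.enorm.pow_const 2)
  have hJ0 : ∀ ν ∉ S, ∀ ζ, Jn s f ν ζ = 0 := by
    intro ν hν ζ
    unfold Jn
    refine integral_eq_zero_of_ae (Filter.Eventually.of_forall fun q => ?_)
    by_cases hq : ‖q.2‖ ≤ 1
    · simp [kK, hsS _ ν q.2 hν hq]
    · simp [phiC_eq_zero (not_le.1 hq).le]
  have hstep : ∀ ζ, w ζ * ‖FTg (fun x => chi x * opS s f x) ζ‖ₑ ^ 2 ≤
      A * ∫⁻ ν, wi (ζ - ν) * (P ν * Q ν (ζ - ν)) := by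
    intro ζ
    have hQmζ : Measurable fun ν => Q ν (ζ - ν) := 
      measurable_curry_comp (g := Q) hQm (u := fun ν => ν) (v := fun ν => ζ - ν) measurable_id
        (measurable_const.sub measurable_id)
    have h1 : ‖FTg (fun x => chi x * opS s f x) ζ‖ₑ ≤
        ∫⁻ ν in S, 1 * (P ν * Q ν (ζ - ν)) ^ (1 / 2 : ℝ) := by
      rw [FTg_chi_opS hs hMs]
      have h0 : ‖∫ ν, Jn s f ν (ζ - ν)‖ₑ ≤ ∫⁻ ν, ‖Jn s f ν (ζ - ν)‖ₑ :=
        enorm_integral_le_lintegral_enorm _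
      refine h0.trans ?_
      rw [← lintegral_indicator hS]
      refine lintegral_mono fun ν => ?_
      by_cases hν : ν ∈ S
      · rw [Set.indicator_of_mem hν, one_mul]
        exact le_rpow_half (hJ2 ν (ζ - ν))
      · rw [hJ0 ν hν]; simp
    have h2 := lintegral_mul_sq_le_weighted (μ := volume.restrict S) (f := fun _ => 1)
      (g := fun ν => (P ν * Q ν (ζ - ν)) ^ (1 / 2 : ℝ)) (a := fun ν => wt (ζ - ν))
      (b := fun ν => wi (ζ - ν)) aemeasurable_const ((hPm.mul hQmζ).pow_const _).aemeasurable
      (by fun_prop) (by fun_prop) (fun ν => wt_mul_wi _)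
    simp only [sq_rpow_half, one_pow, mul_one] at h2
    calc w ζ * ‖FTg (fun x => chi x * opS s f x) ζ‖ₑ ^ 2
        ≤ w ζ * ((∫⁻ ν in S, wt (ζ - ν)) * ∫⁻ ν in S, wi (ζ - ν) * (P ν * Q ν (ζ - ν))) := by
          gcongr
          exact (pow_le_pow_left' h1 2).trans h2
      _ = (w ζ * ∫⁻ ν in S, wt (ζ - ν)) * ∫⁻ ν in S, wi (ζ - ν) * (P ν * Q ν (ζ - ν)) := by ring
      _ ≤ _ := by
          gcongr
          · exact hwA ζ
          · exact Measure.restrict_le_self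
  have hmeas : Measurable fun p : (Fin n → ℝ) × (Fin n → ℝ) => wi (p.1 - p.2) * (P p.2 * Q p.2 (p.1 - p.2)) := by
    have h1 : Measurable fun p : (Fin n → ℝ) × (Fin n → ℝ) => Q p.2 (p.1 - p.2) :=
      measurable_curry_comp (g := Q) hQm (u := fun p : (Fin n → ℝ) × (Fin n → ℝ) => p.2)
        (v := fun p => p.1 - p.2) measurable_snd (measurable_fst.sub measurable_snd)
    have h2 : Measurable fun p : (Fin n → ℝ) × (Fin n → ℝ) => wi (p.1 - p.2) :=
      measurable_wi.comp (by fun_prop : Measurable fun p : (Fin n → ℝ) × (Fin n → ℝ) => p.1 - p.2)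
    exact h2.mul ((hPm.comp measurable_snd).mul h1)
  calc ∫⁻ ζ, w ζ * ‖FTg (fun x => chi x * opS s f x) ζ‖ₑ ^ 2
      ≤ ∫⁻ ζ, A * ∫⁻ ν, wi (ζ - ν) * (P ν * Q ν (ζ - ν)) := lintegral_mono hstep
    _ = A * ∫⁻ ζ, ∫⁻ ν, wi (ζ - ν) * (P ν * Q ν (ζ - ν)) :=
        lintegral_const_mul _ (Measurable.lintegral_prod_right' hmeas)
    _ = A * ∫⁻ ν, ∫⁻ ζ, wi (ζ - ν) * (P ν * Q ν (ζ - ν)) := by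
        rw [lintegral_lintegral_swap hmeas.aemeasurable]
    _ ≤ A * ∫⁻ ν, P ν * (C * ENNReal.ofReal M ^ 2) := by
        gcongr with ν
        have hQν : Measurable (Q ν) := measurable_curry_left (g := Q) hQm ν
        rw [lintegral_sub_right_eq_self (fun ζ => wi ζ * (P ν * Q ν ζ)) ν]
        have e : ∀ ζ, wi ζ * (P ν * Q ν ζ) = P ν * (wi ζ * Q ν ζ) := fun ζ => by ring
        simp_rw [e]
        have hwQ : Measurable fun ζ => wi ζ * Q ν ζ := measurable_wi.mul hQν
        rw [lintegral_const_mul _ hwQ]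
        gcongr
        refine le_trans (le_of_eq ?_) (hC s M hs hM h ν)
        have hF2 : Measurable fun q : (Fin n → ℝ) × (Fin n → ℝ) => FT2 (kK s ν) q.1 q.2 :=
          (continuous_FT2 (integrable_kK hs ν)).measurable
        have hF3 : Measurable fun q : (Fin n → ℝ) × (Fin n → ℝ) => wi q.1 * wi q.2 * ‖FT2 (kK s ν) q.1 q.2‖ₑ ^ 2 :=
          ((measurable_wi.comp measurable_fst).mul (measurable_wi.comp measurable_snd)).mul (hF2.enorm.pow_const 2)
        rw [Measure.volume_eq_prod, lintegral_prod _ hF3.aemeasurable]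
        congr 1; ext ζ
        simp only [hQ, mul_assoc]
        rw [lintegral_const_mul' _ _ (wi_ne_top ζ)]
    _ = A * ((∫⁻ ν, P ν) * (C * ENNReal.ofReal M ^ 2)) := by rw [lintegral_mul_const _ hPm]
    _ ≤ A * ((Cg n * ∫⁻ x, ‖f x‖ₑ ^ 2 * wt x) * (C * ENNReal.ofReal M ^ 2)) := by
        gcongr
        rw [hP]; exact lintegral_wt_Vv_le f
    _ = _ := by
        push_cast
        rw [ENNReal.coe_toNNReal Cg_lt_top.ne]; ring

end KeyLemma

section UnitScale

variable {n : ℕ}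

lemma lintegral_affine {L : ℝ} (hL : 0 < L) (g : (Fin n → ℝ) → ℝ≥0∞) (c : Fin n → ℝ) :
    ∫⁻ y, g (c + L⁻¹ • y) = ENNReal.ofReal (L ^ n) * ∫⁻ x, g x := by
  have hL' : L⁻¹ ≠ 0 := by positivity
  have h1 := (Homeomorph.smulOfNeZero L⁻¹ hL' (α := Fin n → ℝ)).measurableEmbedding.lintegral_map
    (μ := volume) (fun y => g (c + y))
  have h2 := Measure.map_addHaar_smul (volume : Measure (Fin n → ℝ)) hL'
  simp only [Homeomorph.smulOfNeZero_apply] at h1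
  change ∫⁻ a, g (c + a) ∂(Measure.map (fun x => L⁻¹ • x) volume) = _ at h1
  change Measure.map (fun x => L⁻¹ • x) volume = _ at h2
  rw [← h1, h2, lintegral_smul_measure, lintegral_add_left_eq_self g c]
  simp [abs_of_pos hL]

lemma lintegral_schwartz_wt_lt_top (f : 𝓢(Fin n → ℝ, ℂ)) : ∫⁻ x, ‖f x‖ₑ ^ 2 * wt x < ∞ := by
  refine lt_of_le_of_lt (lintegral_mono fun x => ?_) (schwartz_wi_sq_lt_top f)
  rw [mul_comm]
  gcongr
  exact (wt_le_one x).trans (one_le_wi x)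

lemma lintegral_schwartz_sq_lt_top (f : 𝓢(Fin n → ℝ, ℂ)) : ∫⁻ x, ‖f x‖ₑ ^ 2 < ∞ := by
  refine lt_of_le_of_lt (lintegral_mono fun x => ?_) (schwartz_wi_sq_lt_top f)
  exact le_mul_of_one_le_left zero_le (one_le_wi x)

/-- The constant in `wi_mul_lintegral_wt_le`. -/
def CA (n : ℕ) : ℝ≥0∞ := 8 ^ (2 * NN n) * (wtI n + 6 ^ n)

lemma CA_lt_top : CA n < ∞ := by
  refine ENNReal.mul_lt_top (by simp) (ENNReal.add_lt_top.2 ⟨lintegral_wt_lt_top, by simp⟩)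

lemma wi_mul_lintegral_wt_le {R : ℝ} (hR : 1 ≤ R) (ζ : Fin n → ℝ) :
    wi (R⁻¹ • ζ) * ∫⁻ ν in Metric.closedBall 0 (3 * R), wt (ζ - ν) ≤ CA n := by
  have hR0 : 0 < R := by linarith
  have key : ∀ ν : Fin n → ℝ, ‖ν‖ ≤ 3 * R →
      wi (R⁻¹ • ζ) * wt (ζ - ν) ≤ 8 ^ (2 * NN n) * (wt (ζ - ν) + ENNReal.ofReal ((R ^ n)⁻¹)) := by
    intro ν hν
    have e8 : (8 : ℝ≥0∞) ^ (2 * NN n) = ENNReal.ofReal (8 ^ (2 * NN n)) := by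
      rw [ENNReal.ofReal_pow (by norm_num)]; norm_num
    rw [e8, wi, wt, ← ENNReal.ofReal_mul (wR_pos _).le, ← ENNReal.ofReal_add (inv_nonneg.2 (wR_pos _).le)
      (by positivity), ← ENNReal.ofReal_mul (by positivity)]
    apply ENNReal.ofReal_le_ofReal
    set z := ζ - ν with hz
    have h1 : 1 + ‖R⁻¹ • ζ‖ ≤ 4 * (1 + ‖z‖ / R) := by
      have : ‖ζ‖ ≤ ‖z‖ + 3 * R := by
        calc ‖ζ‖ = ‖z + ν‖ := by rw [hz, sub_add_cancel]
          _ ≤ _ := (norm_add_le _ _).trans (by linarith)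
      rw [norm_smul, norm_inv, Real.norm_of_nonneg hR0.le]
      have h2 : R⁻¹ * ‖ζ‖ ≤ R⁻¹ * (‖z‖ + 3 * R) := by gcongr
      have h3 : R⁻¹ * (‖z‖ + 3 * R) = ‖z‖ / R + 3 := by field_simp
      have h4 : 0 ≤ ‖z‖ / R := by positivity
      linarith
    have h5 : (1 + ‖z‖ / R) * (1 + ‖z‖)⁻¹ ≤ (1 + ‖z‖)⁻¹ + R⁻¹ := by
      have : ‖z‖ * (1 + ‖z‖)⁻¹ ≤ 1 := by
        rw [← div_eq_mul_inv, div_le_one (by positivity)]; linarith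
      have h6 : R⁻¹ * (‖z‖ * (1 + ‖z‖)⁻¹) ≤ R⁻¹ * 1 := by gcongr
      calc _ = (1 + ‖z‖)⁻¹ + R⁻¹ * (‖z‖ * (1 + ‖z‖)⁻¹) := by ring
        _ ≤ _ := by linarith
    have hRN : (R⁻¹) ^ (2 * NN n) ≤ (R ^ n)⁻¹ := by
      rw [← inv_pow]
      exact pow_le_pow_of_le_one (by positivity) (inv_le_one_of_one_le₀ hR) (by unfold NN; omega)
    unfold wR
    rw [← inv_pow, ← mul_pow]
    calc ((1 + ‖R⁻¹ • ζ‖) * (1 + ‖z‖)⁻¹) ^ (2 * NN n)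
        ≤ (4 * (1 + ‖z‖ / R) * (1 + ‖z‖)⁻¹) ^ (2 * NN n) := by gcongr
      _ ≤ (4 * ((1 + ‖z‖)⁻¹ + R⁻¹)) ^ (2 * NN n) := by
          rw [mul_assoc]; gcongr
      _ = 4 ^ (2 * NN n) * ((1 + ‖z‖)⁻¹ + R⁻¹) ^ (2 * NN n) := by rw [mul_pow]
      _ ≤ 4 ^ (2 * NN n) * (2 ^ (2 * NN n - 1) * ((1 + ‖z‖)⁻¹ ^ (2 * NN n) + R⁻¹ ^ (2 * NN n))) := by
          gcongr
          exact add_pow_le (by positivity) (by positivity) _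
      _ ≤ 4 ^ (2 * NN n) * (2 ^ (2 * NN n) * ((1 + ‖z‖)⁻¹ ^ (2 * NN n) + (R ^ n)⁻¹)) := by
          gcongr
          · norm_num
          · omega
      _ = _ := by
          rw [show (8 : ℝ) = 4 * 2 by norm_num, mul_pow]; ring
  have hS : MeasurableSet (Metric.closedBall (0 : Fin n → ℝ) (3 * R)) := Metric.isClosed_closedBall.measurableSet
  rw [← lintegral_const_mul' _ _ (wi_ne_top _)]
  calc ∫⁻ ν in Metric.closedBall 0 (3 * R), wi (R⁻¹ • ζ) * wt (ζ - ν)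
      ≤ ∫⁻ ν in Metric.closedBall 0 (3 * R), 8 ^ (2 * NN n) * (wt (ζ - ν) + ENNReal.ofReal ((R ^ n)⁻¹)) := by
        refine setLIntegral_mono' hS fun ν hν => key ν (by simpa using hν)
    _ = 8 ^ (2 * NN n) * ((∫⁻ ν in Metric.closedBall 0 (3 * R), wt (ζ - ν)) +
          ENNReal.ofReal ((R ^ n)⁻¹) * volume (Metric.closedBall (0 : Fin n → ℝ) (3 * R))) := by
        rw [lintegral_const_mul' _ _ (by simp), lintegral_add_right _ measurable_const,
          setLIntegral_const]
    _ ≤ 8 ^ (2 * NN n) * (wtI n + 6 ^ n) := by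
        gcongr
        · rw [← lintegral_wt_sub' ζ]
          exact setLIntegral_le_lintegral _ _
        · rw [Real.volume_pi_closedBall _ (by positivity), ← ENNReal.ofReal_mul (by positivity), Fintype.card_fin,
            show (2 * (3 * R)) ^ n = 6 ^ n * R ^ n by rw [← mul_pow]; ring]
          rw [mul_comm, mul_assoc, mul_inv_cancel₀ (by positivity), mul_one,
            ENNReal.ofReal_pow (by norm_num)]
          norm_num

variable {s : (Fin n → ℝ) × (Fin n → ℝ) → ℂ} {M : ℝ}

lemma continuous_opS (hs : Continuous s) (hM : ∀ q, ‖s q‖ ≤ M) (f : 𝓢(Fin n → ℝ, ℂ)) :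
    Continuous (opS s f) := by
  have hFc : Continuous (FTg f) := continuous_FTg f.integrable
  unfold opS
  refine continuous_of_dominated (bound := fun ξ => M * ‖FTg f ξ‖) ?_ ?_
    ((integrable_FTg_schwartz f).norm.const_mul M) ?_
  · intro x
    exact Continuous.aestronglyMeasurable (by fun_prop)
  · intro x; refine Filter.Eventually.of_forall fun ξ => ?_
    simp only [norm_mul, norm_ph, one_mul]
    gcongr
    exact hM _
  · exact Filter.Eventually.of_forall fun ξ => by fun_prop

lemma norm_opS_le (hM : ∀ q, ‖s q‖ ≤ M) (f : 𝓢(Fin n → ℝ, ℂ)) (x : Fin n → ℝ) :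
    ‖opS s f x‖ ≤ M * ∫ ξ, ‖FTg f ξ‖ := by
  unfold opS
  rw [← integral_const_mul]
  refine norm_integral_le_of_norm_le ((integrable_FTg_schwartz f).norm.const_mul M)
    (Filter.Eventually.of_forall fun ξ => ?_)
  simp only [norm_mul, norm_ph, one_mul]
  gcongr
  exact hM _

lemma continuous_chi_opS (hs : Continuous s) (hM : ∀ q, ‖s q‖ ≤ M) (f : 𝓢(Fin n → ℝ, ℂ)) :
    Continuous fun x => chi x * opS s f x :=
  contDiff_chi.continuous.mul (continuous_opS hs hM f)

lemma integrable_chi_opS (hs : Continuous s) (hM : ∀ q, ‖s q‖ ≤ M) (f : 𝓢(Fin n → ℝ, ℂ)) :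
    Integrable fun x => chi x * opS s f x :=
  (continuous_chi_opS hs hM f).integrable_of_hasCompactSupport hasCompactSupport_chi.mul_right

lemma integrable_of_weighted {F : (Fin n → ℝ) → ℂ} (hF : Continuous F) {R : ℝ} (hR : 0 < R)
    (h : ∫⁻ ζ, wi (R⁻¹ • ζ) * ‖F ζ‖ₑ ^ 2 < ∞) : Integrable F := by
  refine ⟨hF.aestronglyMeasurable, ?_⟩
  have h2 := lintegral_mul_sq_le_weighted (μ := volume) (f := fun _ : Fin n → ℝ => (1 : ℝ≥0∞))
    (g := fun ζ => ‖F ζ‖ₑ) (a := fun ζ => wt (R⁻¹ • ζ)) (b := fun ζ => wi (R⁻¹ • ζ))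
    aemeasurable_const hF.measurable.enorm.aemeasurable (by fun_prop) (by fun_prop)
    (fun ζ => wt_mul_wi _)
  simp only [one_mul, one_pow, mul_one] at h2
  have h3 : ∫⁻ ζ : Fin n → ℝ, wt (R⁻¹ • ζ) < ∞ := by
    have := lintegral_affine hR (wt (n := n)) 0
    simp only [zero_add] at this
    rw [this]
    exact ENNReal.mul_lt_top ENNReal.ofReal_lt_top lintegral_wt_lt_top
  have h4 := h2.trans_lt (ENNReal.mul_lt_top h3 h)
  exact (ENNReal.pow_lt_top_iff).1 h4 |>.resolve_right (by norm_num)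

/-- Weighted bound for the transform of the localised operator, frequencies `≤ 2R`. -/
theorem unit_weighted (n : ℕ) [NeZero n] : ∃ C : NNReal,
    ∀ (s : (Fin n → ℝ) × (Fin n → ℝ) → ℂ) (M R : ℝ), ContDiff ℝ (⊤ : ℕ∞) s → 0 ≤ M → 1 ≤ R →
    (∀ q, SymAt 1 M s q) → (∀ x ξ, 2 * R < ‖ξ‖ → s (x, ξ) = 0) → ∀ f : 𝓢(Fin n → ℝ, ℂ),
    ∫⁻ ζ, wi (R⁻¹ • ζ) * ‖FTg (fun x => chi x * opS s f x) ζ‖ₑ ^ 2 ≤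
      C * ENNReal.ofReal M ^ 2 * ∫⁻ x, ‖f x‖ₑ ^ 2 * wt x := by
  obtain ⟨C, hC⟩ := key_local n
  refine ⟨C * (CA n).toNNReal, ?_⟩
  intro s M R hs hM hR h hsupp f
  refine (hC s M hs hM h (Metric.closedBall 0 (3 * R)) (fun ζ => wi (R⁻¹ • ζ)) (CA n)
    Metric.isClosed_closedBall.measurableSet (by fun_prop) ?_ (wi_mul_lintegral_wt_le hR) f).trans_eq ?_
  · intro x ν η hν hη
    apply hsupp
    have : ‖ν‖ ≤ ‖ν + η‖ + ‖η‖ := by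
      calc ‖ν‖ = ‖(ν + η) - η‖ := by rw [add_sub_cancel_right]
        _ ≤ _ := norm_sub_le _ _
    simp at hν
    linarith
  · push_cast
    rw [ENNReal.coe_toNNReal CA_lt_top.ne]; ring

lemma FTg_translate {H : (Fin n → ℝ) → ℂ} (h ζ : Fin n → ℝ) :
    FTg (fun x => H (x + h)) ζ = ph h (-ζ) * FTg H ζ := by
  unfold FTg
  rw [← integral_add_right_eq_self (fun x => ph x ζ * H x) h, ← integral_const_mul]
  congr 1; ext x
  rw [ph_add_left]
  have := ph_neg_right_mul h ζ
  linear_combination (-(ph x ζ * H (x + h))) * this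

lemma norm_ph_sub_one_sq_le (h ζ : Fin n → ℝ) :
    ‖ph h (-ζ) - 1‖ ^ 2 ≤ 4 * √(2 * π * n * (‖h‖ * ‖ζ‖)) := by
  set t : ℝ := 2 * π * ∑ j, h j * ζ j with ht
  have e : ph h (-ζ) = Complex.exp (Complex.I * t) := by
    rw [ph_eq_ofReal, mul_comm Complex.I]
    congr 2
    rw [ht]; push_cast
    simp [Finset.mul_sum]
  have h1 : ‖ph h (-ζ) - 1‖ ≤ |t| := by
    rw [e]; simpa using Real.norm_exp_I_mul_ofReal_sub_one_le (x := t)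
  have h2 : ‖ph h (-ζ) - 1‖ ≤ 2 := by
    refine (norm_sub_le _ _).trans ?_
    simp; norm_num
  have h3 : |t| ≤ 2 * π * n * (‖h‖ * ‖ζ‖) := by
    rw [ht, abs_mul, abs_of_pos (by positivity : (0 : ℝ) < 2 * π), mul_assoc (2 * π)]
    gcongr
    refine (Finset.abs_sum_le_sum_abs _ _).trans ?_
    refine (Finset.sum_le_card_nsmul _ _ (‖h‖ * ‖ζ‖) fun j _ => ?_).trans_eq (by simp)
    rw [abs_mul]
    exact mul_le_mul (norm_le_pi_norm h j) (norm_le_pi_norm ζ j) (abs_nonneg _) (norm_nonneg _)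
  set u := 2 * π * n * (‖h‖ * ‖ζ‖) with hu
  have hu0 : 0 ≤ u := by positivity
  rcases le_total u 1 with h4 | h4
  · have h5 : u ≤ √u := by
      apply Real.le_sqrt_of_sq_le; nlinarith
    have := norm_nonneg (ph h (-ζ) - 1)
    nlinarith
  · have h5 : 1 ≤ √u := by rwa [Real.one_le_sqrt]
    have := norm_nonneg (ph h (-ζ) - 1)
    nlinarith

end UnitScale

section UnitBounds

variable {n : ℕ}

/-- The constant `∫ ‖ζ‖^{1/2} wt ζ dζ`. -/
def CH (n : ℕ) : ℝ≥0∞ := ∫⁻ ζ : Fin n → ℝ, ENNReal.ofReal √‖ζ‖ * wt ζ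

lemma CH_lt_top : CH n < ∞ := by
  have h := (integrable_one_add_norm (E := Fin n → ℝ) (μ := volume) (r := 2 * NN n - 1 / 2) (by
    have : n + 1 ≤ 2 * NN n := by unfold NN; omega
    have h2 : (n : ℝ) + 1 ≤ 2 * NN n := by exact_mod_cast this
    simp only [Module.finrank_fintype_fun_eq_card, Fintype.card_fin]
    linarith)).lintegral_lt_top
  refine lt_of_le_of_lt (lintegral_mono fun ζ => ?_) h
  have h0 : 0 < 1 + ‖ζ‖ := by positivity
  unfold wt wR
  rw [← ENNReal.ofReal_mul (by positivity)]
  apply ENNReal.ofReal_le_ofReal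
  rw [neg_sub, Real.rpow_sub h0, ← Real.sqrt_eq_rpow, div_eq_mul_inv]
  have : (1 + ‖ζ‖) ^ (2 * (NN n : ℝ)) = (1 + ‖ζ‖) ^ (2 * NN n) := by
    rw [← Real.rpow_natCast]; push_cast; rfl
  rw [this]
  gcongr
  linarith

lemma wR_ge_sqrt (ζ : Fin n → ℝ) : √‖ζ‖ ≤ wR ζ := by
  have h0 := norm_nonneg ζ
  calc √‖ζ‖ ≤ 1 + ‖ζ‖ := by
        apply Real.sqrt_le_iff.2; constructor <;> nlinarith
    _ ≤ _ := by
        unfold wR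
        exact le_self_pow₀ (by linarith) (by unfold NN; omega)

variable {s : (Fin n → ℝ) × (Fin n → ℝ) → ℂ} {M : ℝ}

lemma enorm_ph_sub_one_sq_le {R : ℝ} (hR : 0 < R) (h ζ : Fin n → ℝ) :
    ‖ph h (-ζ) - 1‖ₑ ^ 2 ≤
      ENNReal.ofReal (4 * √(2 * π * n)) * ENNReal.ofReal √(R * ‖h‖) * ENNReal.ofReal √‖R⁻¹ • ζ‖ := by
  rw [← ofReal_norm, ← ENNReal.ofReal_pow (norm_nonneg _), ← ENNReal.ofReal_mul (by positivity),
    ← ENNReal.ofReal_mul (by positivity)]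
  apply ENNReal.ofReal_le_ofReal
  refine (norm_ph_sub_one_sq_le h ζ).trans_eq ?_
  rw [norm_smul, Real.norm_of_nonneg (by positivity), mul_assoc (4 * _), ← Real.sqrt_mul (by positivity),
    mul_assoc 4, ← Real.sqrt_mul (by positivity)]
  congr 2
  field_simp

lemma unit_L2 (n : ℕ) [NeZero n] : ∃ C : NNReal,
    ∀ (s : (Fin n → ℝ) × (Fin n → ℝ) → ℂ) (M R : ℝ), ContDiff ℝ (⊤ : ℕ∞) s → 0 ≤ M → 1 ≤ R →
    (∀ q, SymAt 1 M s q) → (∀ x ξ, 2 * R < ‖ξ‖ → s (x, ξ) = 0) → ∀ f : 𝓢(Fin n → ℝ, ℂ),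
    (∫⁻ x in Metric.closedBall 0 2, ‖opS s f x‖ₑ ^ 2 ≤
      C * ENNReal.ofReal M ^ 2 * ∫⁻ x, ‖f x‖ₑ ^ 2 * wt x) ∧
    ∀ h : Fin n → ℝ, ‖h‖ ≤ 1 →
      (∫⁻ x in Metric.closedBall 0 1, ‖opS s f (x + h) - opS s f x‖ₑ ^ 2 ≤
        C * ENNReal.ofReal M ^ 2 * ENNReal.ofReal √(R * ‖h‖) * ∫⁻ x, ‖f x‖ₑ ^ 2 * wt x) ∧
      ∀ x, ‖x‖ ≤ 1 → ‖opS s f (x + h) - opS s f x‖ₑ ^ 2 ≤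
        C * ENNReal.ofReal M ^ 2 * ENNReal.ofReal √(R * ‖h‖) * ENNReal.ofReal (R ^ n) *
          ∫⁻ x, ‖f x‖ₑ ^ 2 * wt x := by
  obtain ⟨C, hC⟩ := unit_weighted n
  obtain ⟨K, hK⟩ : ∃ K : NNReal, (K : ℝ≥0∞) = ENNReal.ofReal (4 * √(2 * π * n)) :=
    ⟨(4 * √(2 * π * n)).toNNReal, rfl⟩
  obtain ⟨I, hI⟩ : ∃ I : NNReal, (I : ℝ≥0∞) = CH n := ⟨(CH n).toNNReal, ENNReal.coe_toNNReal CH_lt_top.ne⟩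
  refine ⟨C + K * C + K * I * C, ?_⟩
  intro s M R hs hM hR hsym hsupp f
  have hR0 : 0 < R := by linarith
  have hW := hC s M R hs hM hR hsym hsupp f
  have hMs : ∀ q, ‖s q‖ ≤ M := fun q => (hsym q).norm_le
  have hHc := continuous_chi_opS hs.continuous hMs f
  have hHi := integrable_chi_opS hs.continuous hMs f
  obtain ⟨H, hH⟩ : ∃ H : (Fin n → ℝ) → ℂ, H = fun x => chi x * opS s f x := ⟨_, rfl⟩
  obtain ⟨V, hV⟩ : ∃ V : ℝ≥0∞, V = ∫⁻ x, ‖f x‖ₑ ^ 2 * wt x := ⟨_, rfl⟩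
  have hVt : V < ∞ := hV ▸ lintegral_schwartz_wt_lt_top f
  have hopH : ∀ x, ‖x‖ ≤ 2 → opS s f x = H x := by
    intro x hx; rw [hH]; simp [chi_eq_one hx]
  rw [← hH] at hW hHc hHi
  rw [← hV] at hW ⊢
  have hFc : Continuous (FTg H) := continuous_FTg hHi
  have hFi : Integrable (FTg H) := integrable_of_weighted hFc hR0 (hW.trans_lt
    (ENNReal.mul_lt_top (ENNReal.mul_lt_top ENNReal.coe_lt_top (by finiteness)) hVt))
  refine ⟨?_, ?_⟩
  · calc ∫⁻ x in Metric.closedBall 0 2, ‖opS s f x‖ₑ ^ 2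
        = ∫⁻ x in Metric.closedBall 0 2, ‖H x‖ₑ ^ 2 := by
          refine setLIntegral_congr_fun Metric.isClosed_closedBall.measurableSet fun x hx => ?_
          rw [hopH x (by simpa using hx)]
      _ ≤ ∫⁻ x, ‖H x‖ₑ ^ 2 := setLIntegral_le_lintegral _ _
      _ = ∫⁻ ζ, ‖FTg H ζ‖ₑ ^ 2 := FTg_plancherel hHc hHi hFi
      _ ≤ ∫⁻ ζ, wi (R⁻¹ • ζ) * ‖FTg H ζ‖ₑ ^ 2 :=
          lintegral_mono fun ζ => le_mul_of_one_le_left' (one_le_wi _)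
      _ ≤ _ := hW
      _ ≤ _ := by
        gcongr
        rw [add_assoc]; exact le_self_add
  intro h hh
  have hDc : Continuous fun x => H (x + h) - H x := by fun_prop
  have hHi' : Integrable fun x => H (x + h) := hHi.comp_add_right h
  have hDi : Integrable fun x => H (x + h) - H x := hHi'.sub hHi
  have hDF : ∀ ζ, FTg (fun x => H (x + h) - H x) ζ = (ph h (-ζ) - 1) * FTg H ζ := by
    intro ζ
    rw [sub_mul, one_mul, ← FTg_translate]
    unfold FTg
    rw [← integral_sub (integrable_ph_mul hHi' ζ) (integrable_ph_mul hHi ζ)]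
    congr 1; ext x; ring
  have hDFi : Integrable (FTg fun x => H (x + h) - H x) := by
    have : (FTg fun x => H (x + h) - H x) = fun ζ => (ph h (-ζ) - 1) * FTg H ζ := funext hDF
    rw [this]
    refine Integrable.bdd_mul (c := 2) hFi (Continuous.aestronglyMeasurable (by fun_prop))
      (Filter.Eventually.of_forall fun ζ => ?_)
    refine (norm_sub_le _ _).trans ?_
    simp; norm_num
  have hD : ∀ x, ‖x‖ ≤ 1 → opS s f (x + h) - opS s f x = H (x + h) - H x := by
    intro x hx
    rw [hopH x (by linarith), hopH (x + h) (by linarith [norm_add_le x h])]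
  have hph := enorm_ph_sub_one_sq_le (n := n) hR0 h
  rw [← hK] at hph
  obtain ⟨κ, hκ⟩ : ∃ κ : ℝ≥0∞, κ = ENNReal.ofReal √(R * ‖h‖) := ⟨_, rfl⟩
  rw [← hκ] at hph ⊢
  refine ⟨?_, ?_⟩
  · calc ∫⁻ x in Metric.closedBall 0 1, ‖opS s f (x + h) - opS s f x‖ₑ ^ 2
        = ∫⁻ x in Metric.closedBall 0 1, ‖H (x + h) - H x‖ₑ ^ 2 := by
          refine setLIntegral_congr_fun Metric.isClosed_closedBall.measurableSet fun x hx => ?_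
          simp only [hD x (by simpa using hx)]
      _ ≤ ∫⁻ x, ‖H (x + h) - H x‖ₑ ^ 2 := setLIntegral_le_lintegral _ _
      _ = ∫⁻ ζ, ‖FTg (fun x => H (x + h) - H x) ζ‖ₑ ^ 2 := FTg_plancherel hDc hDi hDFi
      _ ≤ ∫⁻ ζ, K * κ * (wi (R⁻¹ • ζ) * ‖FTg H ζ‖ₑ ^ 2) := by
          refine lintegral_mono fun ζ => ?_
          rw [hDF, enorm_mul, mul_pow, ← mul_assoc]
          gcongr
          refine (hph ζ).trans ?_
          gcongr
          exact ENNReal.ofReal_le_ofReal (wR_ge_sqrt _)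
      _ = K * κ * ∫⁻ ζ, (wi (R⁻¹ • ζ) * ‖FTg H ζ‖ₑ ^ 2) :=
          lintegral_const_mul _ (by fun_prop)
      _ ≤ K * κ * (C * ENNReal.ofReal M ^ 2 * V) := by gcongr
      _ = (K * C : NNReal) * ENNReal.ofReal M ^ 2 * κ * V := by push_cast; ring
      _ ≤ _ := by
        gcongr
        exact le_add_right (le_add_left le_rfl)
  intro x hx
  rw [hD x hx]
  have h0 : H (x + h) - H x = ∫ ζ, ph x (-ζ) * FTg (fun x => H (x + h) - H x) ζ :=
    FTg_inversion hDc hDi hDFi x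
  have h1 : ‖∫ ζ, ph x (-ζ) * FTg (fun x => H (x + h) - H x) ζ‖ₑ ≤
      ∫⁻ ζ, ‖ph x (-ζ) * FTg (fun x => H (x + h) - H x) ζ‖ₑ := enorm_integral_le_lintegral_enorm _
  have h2 := lintegral_mul_sq_le_weighted (μ := volume) (f := fun ζ : Fin n → ℝ => ‖ph h (-ζ) - 1‖ₑ)
    (g := fun ζ => ‖FTg H ζ‖ₑ) (a := fun ζ => wt (R⁻¹ • ζ)) (b := fun ζ => wi (R⁻¹ • ζ))
    (by fun_prop) hFc.measurable.enorm.aemeasurable (by fun_prop) (by fun_prop)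
    (fun ζ => wt_mul_wi _)
  have h3 : ∫⁻ ζ : Fin n → ℝ, ‖ph h (-ζ) - 1‖ₑ ^ 2 * wt (R⁻¹ • ζ) ≤
      K * κ * (ENNReal.ofReal (R ^ n) * I) := by
    calc _ ≤ ∫⁻ ζ : Fin n → ℝ, K * κ * (ENNReal.ofReal √‖R⁻¹ • ζ‖ * wt (R⁻¹ • ζ)) := by
          refine lintegral_mono fun ζ => ?_
          rw [← mul_assoc]
          gcongr
          exact hph ζ
      _ = K * κ * ∫⁻ ζ : Fin n → ℝ, (ENNReal.ofReal √‖R⁻¹ • ζ‖ * wt (R⁻¹ • ζ)) :=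
          lintegral_const_mul _ (by fun_prop)
      _ = _ := by
          have := lintegral_affine hR0 (fun ζ : Fin n → ℝ => ENNReal.ofReal √‖ζ‖ * wt ζ) 0
          simp only [zero_add] at this
          rw [this, hI]; rfl
  calc ‖H (x + h) - H x‖ₑ ^ 2 ≤ (∫⁻ ζ, ‖ph h (-ζ) - 1‖ₑ * ‖FTg H ζ‖ₑ) ^ 2 := by
        refine pow_le_pow_left' ?_ 2
        rw [h0]
        refine h1.trans_eq ?_
        congr 1; ext ζ
        rw [hDF, enorm_mul, enorm_mul, enorm_ph, one_mul]
    _ ≤ _ := h2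
    _ ≤ (K * κ * (ENNReal.ofReal (R ^ n) * I)) * (C * ENNReal.ofReal M ^ 2 * V) := by
        refine mul_le_mul' ?_ hW
        simpa only [mul_comm (wt _)] using h3
    _ = (K * I * C : NNReal) * ENNReal.ofReal M ^ 2 * κ * ENNReal.ofReal (R ^ n) * V := by
        push_cast; ring
    _ ≤ _ := by
        gcongr
        exact le_add_left le_rfl

end UnitBounds

section Scaling

variable {n : ℕ}

lemma integral_affine {L : ℝ} (hL : 0 < L) (g : (Fin n → ℝ) → ℂ) (c : Fin n → ℝ) :
    ∫ y, g (c + L⁻¹ • y) = (L : ℂ) ^ n * ∫ x, g x := by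
  rw [Measure.integral_comp_inv_smul_of_nonneg volume (fun y => g (c + y)) hL.le,
    integral_add_left_eq_self]
  simp

lemma FTg_affine {L : ℝ} (hL : 0 < L) (g : (Fin n → ℝ) → ℂ) (c η : Fin n → ℝ) :
    FTg (fun y => g (c + L⁻¹ • y)) η = (L : ℂ) ^ n * (ph (-c) (L • η) * FTg g (L • η)) := by
  unfold FTg
  rw [← integral_const_mul, ← integral_affine hL _ c]
  congr 1; ext y
  rw [← mul_assoc, ← ph_add_left, neg_add_cancel_left]
  congr 1
  rw [ph_smul_left, smul_smul, inv_mul_cancel₀ hL.ne', one_smul]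

lemma opS_affine {L : ℝ} (hL : 0 < L) (s : (Fin n → ℝ) × (Fin n → ℝ) → ℂ) (f : (Fin n → ℝ) → ℂ)
    (c y : Fin n → ℝ) :
    opS s f (c + L⁻¹ • y) =
      opS (fun q => s (c + L⁻¹ • q.1, L • q.2)) (fun y => f (c + L⁻¹ • y)) y := by
  have hLi : 0 < L⁻¹ := by positivity
  unfold opS
  have h := integral_affine hLi (fun ξ => ph (c + L⁻¹ • y) (-ξ) * s (c + L⁻¹ • y, ξ) * FTg f ξ) 0
  simp only [zero_add, inv_inv] at h
  have h2 : ∫ ξ, ph (c + L⁻¹ • y) (-ξ) * s (c + L⁻¹ • y, ξ) * FTg f ξ =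
      (L : ℂ) ^ n * ∫ η, ph (c + L⁻¹ • y) (-(L • η)) * s (c + L⁻¹ • y, L • η) * FTg f (L • η) := by
    rw [h, ← mul_assoc, ← mul_pow]
    have : (L : ℂ) ≠ 0 := by exact_mod_cast hL.ne'
    push_cast
    rw [mul_inv_cancel₀ this, one_pow, one_mul]
  rw [h2, ← integral_const_mul]
  congr 1; ext η
  rw [FTg_affine hL, ph_add_left, ph_neg_left]
  have : ph (L⁻¹ • y) (-(L • η)) = ph y (-η) := by
    rw [ph_smul_left, smul_neg, smul_smul, inv_mul_cancel₀ hL.ne', one_smul]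
  rw [this]; ring

lemma exists_schwartz_affine {L : ℝ} (hL : 0 < L) (f : 𝓢(Fin n → ℝ, ℂ)) (c : Fin n → ℝ) :
    ∃ g : 𝓢(Fin n → ℝ, ℂ), ∀ y, g y = f (c + L⁻¹ • y) := by
  have hL' : L⁻¹ ≠ 0 := by positivity
  let e : (Fin n → ℝ) ≃L[ℝ] (Fin n → ℝ) := ContinuousLinearEquiv.smulLeft (Units.mk0 L⁻¹ hL')
  refine ⟨SchwartzMap.compCLMOfContinuousLinearEquiv ℂ e (SchwartzMap.compSubConstCLM ℂ (-c) f), fun y => ?_⟩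
  simp only [SchwartzMap.compCLMOfContinuousLinearEquiv_apply, Function.comp_apply,
    SchwartzMap.compSubConstCLM_apply, sub_neg_eq_add]
  rw [add_comm]; rfl

/-- The local quantity `∫ |f(x)|² wt(L(x-c)) dx`. -/
def Vc (L : ℝ) (f : (Fin n → ℝ) → ℂ) (c : Fin n → ℝ) : ℝ≥0∞ :=
  ∫⁻ x, ‖f x‖ₑ ^ 2 * wt (L • (x - c))

lemma Vc_affine {L : ℝ} (hL : 0 < L) (f : (Fin n → ℝ) → ℂ) (c : Fin n → ℝ) :
    ∫⁻ y, ‖f (c + L⁻¹ • y)‖ₑ ^ 2 * wt y = ENNReal.ofReal (L ^ n) * Vc L f c := by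
  unfold Vc
  rw [← lintegral_affine hL _ c]
  congr 1; ext y
  rw [add_sub_cancel_left, smul_smul, mul_inv_cancel₀ hL.ne', one_smul]

lemma setLIntegral_affine {L : ℝ} (hL : 0 < L) (g : (Fin n → ℝ) → ℝ≥0∞) (c : Fin n → ℝ) (r : ℝ) :
    ∫⁻ y in Metric.closedBall 0 r, g (c + L⁻¹ • y) =
      ENNReal.ofReal (L ^ n) * ∫⁻ x in Metric.closedBall c (L⁻¹ * r), g x := by
  rw [← lintegral_indicator Metric.isClosed_closedBall.measurableSet,
    ← lintegral_indicator Metric.isClosed_closedBall.measurableSet, ← lintegral_affine hL _ c]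
  congr 1; ext y
  have : c + L⁻¹ • y ∈ Metric.closedBall c (L⁻¹ * r) ↔ y ∈ Metric.closedBall 0 r := by
    simp only [Metric.mem_closedBall, dist_self_add_left, dist_zero_right, norm_smul, norm_inv,
      Real.norm_of_nonneg hL.le]
    exact mul_le_mul_iff_right₀ (by positivity)
  by_cases h : y ∈ Metric.closedBall 0 r
  · rw [Set.indicator_of_mem h, Set.indicator_of_mem (this.2 h)]
  · rw [Set.indicator_of_notMem h, Set.indicator_of_notMem (fun h' => h (this.1 h'))]

lemma ofReal_pow_ne_zero {L : ℝ} (hL : 0 < L) : ENNReal.ofReal (L ^ n) ≠ 0 := by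
  have := pow_pos hL n
  simpa using this

/-- Local `L²` and sup bounds at frequency scale `B` for symbols smooth at scale `L`. -/
theorem local_bounds (n : ℕ) [NeZero n] : ∃ C : NNReal,
    ∀ (s : (Fin n → ℝ) × (Fin n → ℝ) → ℂ) (M L B : ℝ), ContDiff ℝ (⊤ : ℕ∞) s → 0 ≤ M → 0 < L → L ≤ B →
    (∀ q, SymAt L M s q) → (∀ x ξ, 2 * B < ‖ξ‖ → s (x, ξ) = 0) → ∀ (f : 𝓢(Fin n → ℝ, ℂ)) (c : Fin n → ℝ),
    (∫⁻ x in Metric.closedBall c (L⁻¹ * 2), ‖opS s f x‖ₑ ^ 2 ≤ C * ENNReal.ofReal M ^ 2 * Vc L f c) ∧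
    ∀ h : Fin n → ℝ, ‖h‖ ≤ L⁻¹ →
      (∫⁻ x in Metric.closedBall c L⁻¹, ‖opS s f (x + h) - opS s f x‖ₑ ^ 2 ≤
        C * ENNReal.ofReal M ^ 2 * ENNReal.ofReal √(B * ‖h‖) * Vc L f c) ∧
      ∀ x ∈ Metric.closedBall c L⁻¹, ‖opS s f (x + h) - opS s f x‖ₑ ^ 2 ≤
        C * ENNReal.ofReal M ^ 2 * ENNReal.ofReal √(B * ‖h‖) * ENNReal.ofReal (B ^ n) * Vc L f c := by
  obtain ⟨C, hC⟩ := unit_L2 n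
  refine ⟨C, ?_⟩
  intro s M L B hs hM hL hLB hsym hsupp f c
  have hB : 0 < B := hL.trans_le hLB
  obtain ⟨g, hg⟩ := exists_schwartz_affine hL f c
  have hgf : (g : (Fin n → ℝ) → ℂ) = fun y => f (c + L⁻¹ • y) := funext hg
  obtain ⟨t, ht⟩ : ∃ t, t = fun q : (Fin n → ℝ) × (Fin n → ℝ) => s (c + L⁻¹ • q.1, L • q.2) := ⟨_, rfl⟩
  have hts : ContDiff ℝ (⊤ : ℕ∞) t := by
    rw [ht]
    exact hs.comp (by fun_prop)
  have htsym : ∀ q, SymAt 1 M t q := fun q => ht ▸ SymAt.rescale hs c hsym q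
  have htsupp : ∀ x ξ, 2 * (B / L) < ‖ξ‖ → t (x, ξ) = 0 := by
    intro x ξ hξ
    rw [ht]
    apply hsupp
    rw [norm_smul, Real.norm_of_nonneg hL.le]
    calc 2 * B = L * (2 * (B / L)) := by field_simp
      _ < _ := by gcongr
  have h1R : 1 ≤ B / L := by rwa [one_le_div hL]
  obtain ⟨H1, H2⟩ := hC t M (B / L) hts hM h1R htsym htsupp g
  have hop : ∀ y, opS t g y = opS s f (c + L⁻¹ • y) := fun y => by
    rw [opS_affine hL, ht, hgf]
  simp only [hop, hg] at H1 H2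
  rw [Vc_affine hL] at H1 H2
  have hL0 := ofReal_pow_ne_zero (n := n) hL
  have hLt : ENNReal.ofReal (L ^ n) ≠ ∞ := ENNReal.ofReal_ne_top
  constructor
  · rw [setLIntegral_affine hL (fun x => ‖opS s f x‖ₑ ^ 2), mul_left_comm] at H1
    exact (ENNReal.mul_le_mul_iff_right hL0 hLt).1 H1
  · intro h hh
    have hLh : ‖L • h‖ ≤ 1 := by
      rw [norm_smul, Real.norm_of_nonneg hL.le]
      calc L * ‖h‖ ≤ L * L⁻¹ := by gcongr
        _ = 1 := mul_inv_cancel₀ hL.ne'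
    obtain ⟨H3, H4⟩ := H2 (L • h) hLh
    have e1 : B / L * ‖L • h‖ = B * ‖h‖ := by
      rw [norm_smul, Real.norm_of_nonneg hL.le]; field_simp
    have e2 : ∀ y, c + L⁻¹ • (y + L • h) = c + L⁻¹ • y + h := by
      intro y
      rw [smul_add, smul_smul, inv_mul_cancel₀ hL.ne', one_smul, add_assoc]
    rw [e1] at H3 H4
    simp only [e2] at H3 H4
    constructor
    · rw [setLIntegral_affine hL (fun x => ‖opS s f (x + h) - opS s f x‖ₑ ^ 2), mul_left_comm, mul_one] at H3
      exact (ENNReal.mul_le_mul_iff_right hL0 hLt).1 H3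
    · intro x hx
      have := H4 (L • (x - c)) (by
        rw [norm_smul, Real.norm_of_nonneg hL.le]
        rw [Metric.mem_closedBall, dist_eq_norm] at hx
        calc L * ‖x - c‖ ≤ L * L⁻¹ := by gcongr
          _ = 1 := mul_inv_cancel₀ hL.ne')
      rw [smul_smul, inv_mul_cancel₀ hL.ne', one_smul, add_sub_cancel] at this
      refine this.trans_eq ?_
      rw [← mul_assoc, mul_assoc _ (ENNReal.ofReal ((B / L) ^ n)), ← ENNReal.ofReal_mul (by positivity), div_pow,
        div_mul_cancel₀ _ (by positivity)]

end Scaling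

section Averaging

variable {n : ℕ}

lemma wtI_ne_top : wtI n ≠ ∞ := (lintegral_wt_lt_top (n := n)).ne

lemma continuous_FTg_chi : Continuous (FTg (chi (n := n))) :=
  continuous_FTg (contDiff_chi.continuous.integrable_of_hasCompactSupport hasCompactSupport_chi)

lemma integrable_FTg_chi : Integrable (FTg (chi (n := n))) :=
  integrable_FTg_schwartz (hasCompactSupport_chi.toSchwartzMap contDiff_chi)

lemma FTg_chi_zero_ne : FTg (chi (n := n)) 0 ≠ 0 := by
  unfold FTg
  simp only [ph_zero_right, one_mul]
  unfold chi
  rw [integral_complex_ofReal]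
  exact_mod_cast (ContDiffBump.integral_pos (f := chiB n)).ne.symm

/-- The mass of the transform of `chi` near the origin. -/
def cChi (n : ℕ) : ℝ≥0∞ := ∫⁻ θ in Metric.closedBall (0 : Fin n → ℝ) 1, ‖FTg chi (-θ)‖ₑ ^ 2

lemma cChi_pos (n : ℕ) : cChi n ≠ 0 := by
  have hc : Continuous fun θ : Fin n → ℝ => ‖FTg chi (-θ)‖ₑ ^ 2 := by
    have := continuous_FTg_chi (n := n); fun_prop
  have h0 : ‖FTg (chi (n := n)) (-0)‖ₑ ^ 2 ≠ 0 := by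
    simpa using FTg_chi_zero_ne
  intro h
  have hpos : 0 < ∫⁻ θ in Metric.ball (0 : Fin n → ℝ) 1, ‖FTg chi (-θ)‖ₑ ^ 2 := by
    rw [setLIntegral_pos_iff hc.measurable]
    refine IsOpen.measure_pos _ (hc.isOpen_support.inter Metric.isOpen_ball) ⟨0, ?_, by simp⟩
    exact h0
  have : ∫⁻ θ in Metric.ball (0 : Fin n → ℝ) 1, ‖FTg chi (-θ)‖ₑ ^ 2 ≤ cChi n :=
    lintegral_mono_set Metric.ball_subset_closedBall
  rw [h] at this
  exact absurd hpos (not_lt.2 this)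

variable {G : (Fin n → ℝ) → ℂ}

lemma continuous_FTg_window (hG : Continuous G) (hGc : HasCompactSupport G) :
    Continuous fun q : (Fin n → ℝ) × (Fin n → ℝ) => FTg (fun x => chi (x - q.1) * G x) q.2 := by
  have hchi := contDiff_chi (n := n).continuous
  unfold FTg
  refine continuous_of_dominated (bound := fun x => ‖G x‖) ?_ ?_
    (hG.integrable_of_hasCompactSupport hGc).norm ?_
  · intro q
    exact Continuous.aestronglyMeasurable (by fun_prop)
  · intro q; refine Filter.Eventually.of_forall fun x => ?_
    simp only [norm_mul, norm_ph, one_mul]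
    exact mul_le_of_le_one_left (norm_nonneg _) (norm_chi_le _)
  · exact Filter.Eventually.of_forall fun x => by fun_prop

lemma integrable_window_prod (hG : Continuous G) (hGc : HasCompactSupport G) :
    Integrable fun q : (Fin n → ℝ) × (Fin n → ℝ) => chi (q.2 - q.1) * G q.2 := by
  have h1 : Integrable (chi (n := n)) :=
    contDiff_chi.continuous.integrable_of_hasCompactSupport hasCompactSupport_chi
  have h2 := hG.integrable_of_hasCompactSupport hGc (μ := volume)
  have hchi := contDiff_chi (n := n).continuous
  rw [Measure.volume_eq_prod, integrable_prod_iff' (Continuous.aestronglyMeasurable (by fun_prop))]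
  constructor
  · refine Filter.Eventually.of_forall fun x => ?_
    have := (h1.comp_sub_left x).mul_const (G x)
    exact this
  · have : ∀ x : Fin n → ℝ, ∫ c : Fin n → ℝ, ‖chi (x - c) * G x‖ = (∫ c : Fin n → ℝ, ‖chi c‖) * ‖G x‖ := by
      intro x
      simp only [norm_mul]
      rw [integral_mul_const, integral_sub_left_eq_self (fun c : Fin n → ℝ => ‖chi c‖)]
    simp only [this]
    exact h2.norm.const_mul _

lemma FTg_window (hG : Continuous G) (hGc : HasCompactSupport G) (ζ θ : Fin n → ℝ) :
    FTg (fun c => FTg (fun x => chi (x - c) * G x) ζ) θ = FTg G (ζ + θ) * FTg chi (-θ) := by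
  have hI := integrable_window_prod hG hGc
  have hI2 : Integrable (Function.uncurry fun c x : Fin n → ℝ => ph c θ * (ph x ζ * (chi (x - c) * G x))) := by
    have e : (Function.uncurry fun c x : Fin n → ℝ => ph c θ * (ph x ζ * (chi (x - c) * G x))) =
      fun q : (Fin n → ℝ) × (Fin n → ℝ) => (ph q.1 θ * ph q.2 ζ) * (chi (q.2 - q.1) * G q.2) := by
      ext q; simp only [Function.uncurry]; ring
    rw [e]
    refine Integrable.bdd_mul (c := 1) hI (Continuous.aestronglyMeasurable (by fun_prop))
      (Filter.Eventually.of_forall fun ζ => by simp)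
  have e1 : FTg (fun c => FTg (fun x => chi (x - c) * G x) ζ) θ =
      ∫ c, ∫ x, ph c θ * (ph x ζ * (chi (x - c) * G x)) := by
    unfold FTg
    congr 1; ext c
    rw [integral_const_mul]
  rw [e1, integral_integral_swap hI2]
  have e2 : ∀ x, ∫ c, ph c θ * (ph x ζ * (chi (x - c) * G x)) = ph x (ζ + θ) * G x * FTg chi (-θ) := by
    intro x
    rw [← integral_sub_left_eq_self _ volume x]
    unfold FTg
    rw [← integral_const_mul]
    congr 1; ext c
    rw [show x - (x - c) = c from sub_sub_cancel x c, sub_eq_add_neg, ph_add_left, ph_neg_left, ph_add_right]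
    ring
  simp only [e2]
  rw [integral_mul_const]
  rfl

lemma window_plancherel (hG : Continuous G) (hGc : HasCompactSupport G) (ζ : Fin n → ℝ) :
    ∫⁻ c, ‖FTg (fun x => chi (x - c) * G x) ζ‖ₑ ^ 2 =
      ∫⁻ θ, ‖FTg G (ζ + θ)‖ₑ ^ 2 * ‖FTg chi (-θ)‖ₑ ^ 2 := by
  have hGi := hG.integrable_of_hasCompactSupport hGc (μ := volume)
  have hc : Continuous fun c => FTg (fun x => chi (x - c) * G x) ζ :=
    (continuous_FTg_window hG hGc).comp (by fun_prop : Continuous fun c : Fin n → ℝ => (c, ζ))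
  have hi : Integrable fun c => FTg (fun x => chi (x - c) * G x) ζ := by
    have hI := integrable_window_prod hG hGc
    have e : Integrable fun q : (Fin n → ℝ) × (Fin n → ℝ) => ph q.2 ζ * (chi (q.2 - q.1) * G q.2) :=
      Integrable.bdd_mul (c := 1) hI (Continuous.aestronglyMeasurable (by fun_prop))
        (Filter.Eventually.of_forall fun ζ => by simp)
    exact e.integral_prod_left
  have hF : FTg (fun c => FTg (fun x => chi (x - c) * G x) ζ) =
    fun θ => FTg G (ζ + θ) * FTg chi (-θ) := funext (FTg_window hG hGc ζ)
  have hFi : Integrable fun θ => FTg G (ζ + θ) * FTg chi (-θ) := by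
    have hGF := continuous_FTg hGi
    exact Integrable.bdd_mul (c := ∫ x, ‖G x‖) integrable_FTg_chi.comp_neg
      (Continuous.aestronglyMeasurable (by fun_prop))
      (Filter.Eventually.of_forall fun θ => norm_FTg_le G _)
  rw [FTg_plancherel hc hi (hF ▸ hFi), hF]
  simp only [enorm_mul, mul_pow]

/-- Averaging the localised bounds over all windows. -/
lemma window_average (hG : Continuous G) (hGc : HasCompactSupport G) {w w' : (Fin n → ℝ) → ℝ≥0∞}
    (hw : Measurable w) (hww : ∀ ξ θ, ‖θ‖ ≤ 1 → w' ξ ≤ w (ξ - θ)) :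
    cChi n * ∫⁻ ξ, w' ξ * ‖FTg G ξ‖ₑ ^ 2 ≤
      ∫⁻ c, ∫⁻ ζ, w ζ * ‖FTg (fun x => chi (x - c) * G x) ζ‖ₑ ^ 2 := by
  have hGi := hG.integrable_of_hasCompactSupport hGc (μ := volume)
  have hGF := continuous_FTg hGi
  have hcw := continuous_FTg_window hG hGc
  have hchi := continuous_FTg_chi (n := n)
  have hchin : Continuous fun θ : Fin n → ℝ => FTg chi (-θ) := hchi.comp continuous_neg
  have hGadd : Continuous fun q : (Fin n → ℝ) × (Fin n → ℝ) => FTg G (q.1 + q.2) :=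
    hGF.comp (by fun_prop)
  rw [lintegral_lintegral_swap (by
    refine Measurable.aemeasurable ?_
    exact (hw.comp measurable_snd).mul (hcw.measurable.enorm.pow_const 2))]
  have e : ∀ ζ, ∫⁻ c, w ζ * ‖FTg (fun x => chi (x - c) * G x) ζ‖ₑ ^ 2 =
      ∫⁻ θ, w ζ * (‖FTg G (ζ + θ)‖ₑ ^ 2 * ‖FTg chi (-θ)‖ₑ ^ 2) := by
    intro ζ
    have hm : Measurable fun c => ‖FTg (fun x => chi (x - c) * G x) ζ‖ₑ ^ 2 :=
      ((hcw.comp (by fun_prop : Continuous fun c : Fin n → ℝ => (c, ζ))).measurable).enorm.pow_const 2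
    rw [lintegral_const_mul _ hm, window_plancherel hG hGc, lintegral_const_mul _ (by
      have : Continuous fun θ => FTg G (ζ + θ) := hGF.comp (by fun_prop)
      exact (this.measurable.enorm.pow_const 2).mul (hchin.measurable.enorm.pow_const 2))]
  simp only [e]
  rw [lintegral_lintegral_swap (by
    refine Measurable.aemeasurable ?_
    exact (hw.comp measurable_fst).mul ((hGadd.measurable.enorm.pow_const 2).mul
      ((hchin.comp continuous_snd).measurable.enorm.pow_const 2)))]
  have e2 : ∀ θ, ∫⁻ ζ, w ζ * (‖FTg G (ζ + θ)‖ₑ ^ 2 * ‖FTg chi (-θ)‖ₑ ^ 2) =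
      (∫⁻ ξ, w (ξ - θ) * ‖FTg G ξ‖ₑ ^ 2) * ‖FTg chi (-θ)‖ₑ ^ 2 := by
    intro θ
    have := lintegral_add_right_eq_self (μ := volume) (fun ξ => w (ξ - θ) * ‖FTg G ξ‖ₑ ^ 2) θ
    rw [← this, ← lintegral_mul_const _ (by
      exact (hw.comp (by fun_prop)).mul (Continuous.measurable (by fun_prop)))]
    simp only [add_sub_cancel_right, mul_assoc]
  simp only [e2]
  unfold cChi
  rw [mul_comm, ← lintegral_const_mul _ (hchin.measurable.enorm.pow_const 2)]
  refine le_trans ?_ (setLIntegral_le_lintegral (Metric.closedBall 0 1) _)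
  refine setLIntegral_mono' Metric.isClosed_closedBall.measurableSet fun θ hθ => ?_
  gcongr with ξ
  exact hww ξ θ (by simpa using hθ)

lemma hasCompactSupport_opS {s : (Fin n → ℝ) × (Fin n → ℝ) → ℂ} {K : ℝ}
    (hK : ∀ x ξ, K < ‖x‖ → s (x, ξ) = 0) (f : (Fin n → ℝ) → ℂ) : HasCompactSupport (opS s f) := by
  refine HasCompactSupport.intro (isCompact_closedBall (0 : Fin n → ℝ) K) fun x hx => ?_
  unfold opS
  simp [hK x _ (by simpa using hx)]

/-- Weighted bounds for the transform of an operator with `x`-compactly supported symbol. -/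
theorem unit_average (n : ℕ) [NeZero n] : ∃ C : NNReal, ∀ (s : (Fin n → ℝ) × (Fin n → ℝ) → ℂ) (M K : ℝ),
    ContDiff ℝ (⊤ : ℕ∞) s → 0 ≤ M → (∀ q, SymAt 1 M s q) → (∀ x ξ, K < ‖x‖ → s (x, ξ) = 0) →
    ∀ (S : Set (Fin n → ℝ)) (w w' : (Fin n → ℝ) → ℝ≥0∞) (A : ℝ≥0∞), MeasurableSet S → Measurable w →
    (∀ x ν η, ν ∉ S → ‖η‖ ≤ 1 → s (x, ν + η) = 0) →
    (∀ ζ, w ζ * ∫⁻ ν in S, wt (ζ - ν) ≤ A) → (∀ ξ θ, ‖θ‖ ≤ 1 → w' ξ ≤ w (ξ - θ)) →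
    ∀ f : 𝓢(Fin n → ℝ, ℂ),
    ∫⁻ ζ, w' ζ * ‖FTg (opS s f) ζ‖ₑ ^ 2 ≤ C * ENNReal.ofReal M ^ 2 * A * ∫⁻ x, ‖f x‖ₑ ^ 2 := by
  obtain ⟨C, hC⟩ := key_local n
  refine ⟨(cChi n)⁻¹.toNNReal * C * (wtI n).toNNReal, ?_⟩
  intro s M K hs hM h hK S w w' A hS hw hsS hwA hww f
  have hMs : ∀ q, ‖s q‖ ≤ M := fun q => (h q).norm_le
  have hGc : Continuous (opS s f) := continuous_opS hs.continuous hMs f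
  have h1 := window_average hGc (hasCompactSupport_opS hK f) hw hww
  have h2 : ∀ c, ∫⁻ ζ, w ζ * ‖FTg (fun x => chi (x - c) * opS s f x) ζ‖ₑ ^ 2 ≤
      C * ENNReal.ofReal M ^ 2 * A * ∫⁻ x, ‖f x‖ₑ ^ 2 * wt (x - c) := by
    intro c
    obtain ⟨g, hg⟩ := exists_schwartz_affine one_pos f c
    have hgf : (g : (Fin n → ℝ) → ℂ) = fun y => f (c + (1 : ℝ)⁻¹ • y) := funext hg
    have h3 := hC (fun q => s (c + (1 : ℝ)⁻¹ • q.1, (1 : ℝ) • q.2)) M (hs.comp (by fun_prop)) hM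
      (fun q => SymAt.rescale hs c h q) S w A hS hw (by
        intro x ν η hν hη
        simp only [one_smul]
        exact hsS _ ν η hν hη) hwA g
    simp only [hgf, ← opS_affine one_pos] at h3
    rw [Vc_affine one_pos] at h3
    simp only [one_pow, ENNReal.ofReal_one, one_mul, inv_one, one_smul, Vc] at h3
    refine le_trans (le_of_eq ?_) h3
    congr 1; ext ζ
    congr 2
    have := FTg_translate (H := fun x => chi (x - c) * opS s f x) c ζ
    simp only [add_sub_cancel_right] at this
    simp only [add_comm c]
    rw [this, enorm_mul, enorm_ph, one_mul]
  have h3 := h1.trans (lintegral_mono h2)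
  have hcM : Measurable fun q : (Fin n → ℝ) × (Fin n → ℝ) => ‖f q.2‖ₑ ^ 2 * wt (q.2 - q.1) := by
    exact ((f.continuous.comp continuous_snd).measurable.enorm.pow_const 2).mul
      (measurable_wt.comp (measurable_snd.sub measurable_fst))
  rw [lintegral_const_mul _ (Measurable.lintegral_prod_right' hcM),
    lintegral_lintegral_swap hcM.aemeasurable] at h3
  have h4 : ∀ x : Fin n → ℝ, ∫⁻ c, ‖f x‖ₑ ^ 2 * wt (x - c) = ‖f x‖ₑ ^ 2 * wtI n := by
    intro x
    rw [lintegral_const_mul _ (by fun_prop), lintegral_wt_sub']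
  simp only [h4] at h3
  rw [lintegral_mul_const _ (by have := f.continuous; exact Continuous.measurable (by fun_prop))] at h3
  have hc0 := cChi_pos n
  have hct : (cChi n)⁻¹ ≠ ∞ := ENNReal.inv_ne_top.2 hc0
  have hct' : cChi n ≠ ∞ := by
    have hb : ∫⁻ x : Fin n → ℝ, ‖chi x‖ₑ ≠ ∞ :=
      (contDiff_chi.continuous.integrable_of_hasCompactSupport hasCompactSupport_chi).2.ne
    refine ((lintegral_mono fun θ => pow_le_pow_left' (enorm_FTg_le chi (-θ)) 2).trans_lt ?_).ne
    rw [lintegral_const]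
    refine ENNReal.mul_lt_top (by finiteness) ?_
    rw [Measure.restrict_apply_univ]
    exact measure_closedBall_lt_top
  push_cast
  rw [ENNReal.coe_toNNReal hct, ENNReal.coe_toNNReal wtI_ne_top]
  calc ∫⁻ ζ, w' ζ * ‖FTg (opS s f) ζ‖ₑ ^ 2
      = (cChi n)⁻¹ * (cChi n * ∫⁻ ζ, w' ζ * ‖FTg (opS s f) ζ‖ₑ ^ 2) := by
        rw [← mul_assoc, ENNReal.inv_mul_cancel hc0 hct', one_mul]
    _ ≤ _ := mul_le_mul_right h3 _
    _ = _ := by ring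

end Averaging

section ScaledAveraging

variable {n : ℕ}

lemma unit_integrable [NeZero n] {s : (Fin n → ℝ) × (Fin n → ℝ) → ℂ} {M K R : ℝ}
    (hs : ContDiff ℝ (⊤ : ℕ∞) s) (hM : 0 ≤ M) (hR : 1 ≤ R) (h : ∀ q, SymAt 1 M s q)
    (hK : ∀ x ξ, K < ‖x‖ → s (x, ξ) = 0) (hsupp : ∀ x ξ, 2 * R < ‖ξ‖ → s (x, ξ) = 0)
    (f : 𝓢(Fin n → ℝ, ℂ)) : Integrable (FTg (opS s f)) := by
  obtain ⟨C, hC⟩ := unit_average n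
  have hMs : ∀ q, ‖s q‖ ≤ M := fun q => (h q).norm_le
  have hGi := (continuous_opS hs.continuous hMs f).integrable_of_hasCompactSupport
    (hasCompactSupport_opS hK f) (μ := volume)
  have hR0 : 0 < R := by linarith
  have := hC s M K hs hM h hK (Metric.closedBall 0 (3 * R))
    (fun ζ => 2 ^ (2 * NN n) * wi (R⁻¹ • ζ)) (fun ζ => wi (R⁻¹ • ζ)) (2 ^ (2 * NN n) * CA n)
    Metric.isClosed_closedBall.measurableSet (by fun_prop) (by
      intro x ν η hν hη
      apply hsupp
      have : ‖ν‖ ≤ ‖ν + η‖ + ‖η‖ := by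
        calc ‖ν‖ = ‖(ν + η) - η‖ := by rw [add_sub_cancel_right]
          _ ≤ _ := norm_sub_le _ _
      simp at hν
      linarith) (by
      intro ζ
      rw [mul_assoc]
      gcongr
      exact wi_mul_lintegral_wt_le hR ζ) (by
      intro ξ θ hθ
      unfold wi
      rw [show (2 : ℝ≥0∞) = ENNReal.ofReal 2 by simp, ← ENNReal.ofReal_pow (by norm_num),
        ← ENNReal.ofReal_mul (by positivity)]
      apply ENNReal.ofReal_le_ofReal
      have h1 := wR_add_le (R⁻¹ • θ) (R⁻¹ • (ξ - θ))
      rw [← smul_add, add_sub_cancel] at h1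
      refine h1.trans ?_
      have := wR_pos (R⁻¹ • (ξ - θ))
      gcongr
      unfold wR
      gcongr
      rw [norm_smul, Real.norm_of_nonneg (by positivity)]
      have : R⁻¹ ≤ 1 := inv_le_one_of_one_le₀ hR
      nlinarith [norm_nonneg θ]) f
  refine integrable_of_weighted (continuous_FTg hGi) hR0 (this.trans_lt ?_)
  have h1 := lintegral_schwartz_sq_lt_top f
  have h2 := CA_lt_top (n := n)
  finiteness

lemma unit_gain (n : ℕ) [NeZero n] : ∃ C : NNReal,
    ∀ (s : (Fin n → ℝ) × (Fin n → ℝ) → ℂ) (M K R : ℝ), ContDiff ℝ (⊤ : ℕ∞) s → 0 ≤ M → 1 ≤ R →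
    (∀ q, SymAt 1 M s q) → (∀ x ξ, K < ‖x‖ → s (x, ξ) = 0) → (∀ x ξ, 2 * R < ‖ξ‖ → s (x, ξ) = 0) →
    (1 < R → ∀ x ξ, ‖ξ‖ < R / 2 → s (x, ξ) = 0) → ∀ (f : 𝓢(Fin n → ℝ, ℂ)) (w : (Fin n → ℝ) → ℝ≥0∞),
    (∀ ζ, w ζ ≤ ENNReal.ofReal √R) → (∀ ζ, R / 32 < ‖ζ‖ → ‖ζ‖ < 32 * R → w ζ ≤ 1) →
    ∫⁻ ζ, w ζ * ‖FTg (opS s f) ζ‖ₑ ^ 2 ≤ C * ENNReal.ofReal M ^ 2 * ∫⁻ x, ‖f x‖ₑ ^ 2 := by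
  obtain ⟨C, hC⟩ := unit_average n
  refine ⟨C * (6 * wtI n + 3 * CH n).toNNReal, ?_⟩
  have hCH := CH_lt_top (n := n)
  have hwtI := wtI_ne_top (n := n)
  intro s M K R hs hM hR h hK hsupp hlow f w hw1 hw2
  have hR0 : 0 < R := by linarith
  suffices H : ∫⁻ ζ, w ζ * ‖FTg (opS s f) ζ‖ₑ ^ 2 ≤
      C * ENNReal.ofReal M ^ 2 * (6 * wtI n + 3 * CH n) * ∫⁻ x, ‖f x‖ₑ ^ 2 by
    refine H.trans_eq ?_
    push_cast
    rw [ENNReal.coe_toNNReal (by finiteness)]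
    ring
  rcases lt_or_ge R 32 with h32 | h32
  · have h6 : √R ≤ 6 := by
      rw [Real.sqrt_le_left (by norm_num)]; linarith
    refine hC s M K hs hM h hK Set.univ (fun _ => 6) w _ MeasurableSet.univ measurable_const
      (by simp) ?_ ?_ f
    · intro ζ
      rw [Measure.restrict_univ, lintegral_wt_sub']
      exact le_self_add
    · intro ξ θ _
      refine (hw1 ξ).trans ?_
      rw [ENNReal.ofReal_le_iff_le_toReal (by norm_num)]
      simpa using h6
  · have hn1 : Measurable fun ζ : Fin n → ℝ => ‖ζ‖ := measurable_norm
    have hmw : Measurable fun ζ : Fin n → ℝ =>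
        if R / 16 < ‖ζ‖ ∧ ‖ζ‖ < 16 * R then 1 else ENNReal.ofReal √R :=
      Measurable.ite ((measurableSet_lt measurable_const hn1).inter
        (measurableSet_lt hn1 measurable_const)) measurable_const measurable_const
    refine hC s M K hs hM h hK {ν | R / 4 ≤ ‖ν‖ ∧ ‖ν‖ ≤ 3 * R} _ w _
      ((measurableSet_le measurable_const hn1).inter (measurableSet_le hn1 measurable_const)) hmw
      ?_ ?_ ?_ f
    · intro x ν η hν hη
      have h1 : ‖ν‖ ≤ ‖ν + η‖ + ‖η‖ := by
        calc ‖ν‖ = ‖(ν + η) - η‖ := by rw [add_sub_cancel_right]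
          _ ≤ _ := norm_sub_le _ _
      have h2 := norm_add_le ν η
      rcases lt_or_ge ‖ν‖ (R / 4) with h3 | h3
      · exact hlow (by linarith) _ _ (by linarith)
      · apply hsupp
        have : 3 * R < ‖ν‖ := by
          by_contra! h4
          exact hν ⟨h3, h4⟩
        linarith
    · intro ζ
      by_cases hζ : R / 16 < ‖ζ‖ ∧ ‖ζ‖ < 16 * R
      · rw [if_pos hζ, one_mul]
        refine (setLIntegral_le_lintegral _ _).trans ?_
        rw [lintegral_wt_sub']
        refine le_trans ?_ le_self_add
        exact le_mul_of_one_le_left' (by norm_num)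
      · rw [if_neg hζ, ← lintegral_const_mul _ (by fun_prop)]
        refine le_trans ?_ le_add_self
        have e : 3 * CH n = ∫⁻ ν, 3 * (ENNReal.ofReal √‖ζ - ν‖ * wt (ζ - ν)) := by
          unfold CH
          rw [lintegral_const_mul _ (by fun_prop),
            lintegral_sub_left_eq_self (fun ν => ENNReal.ofReal √‖ν‖ * wt ν)]
        rw [e]
        refine le_trans ?_ (setLIntegral_le_lintegral {ν | R / 4 ≤ ‖ν‖ ∧ ‖ν‖ ≤ 3 * R} _)
        refine setLIntegral_mono (by fun_prop) fun ν hν => ?_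
        rw [← mul_assoc]
        gcongr
        rw [show (3 : ℝ≥0∞) = ENNReal.ofReal 3 by simp, ← ENNReal.ofReal_mul (by norm_num)]
        apply ENNReal.ofReal_le_ofReal
        rw [show (3 : ℝ) = √9 by rw [show (9 : ℝ) = 3 ^ 2 by norm_num]; simp,
          ← Real.sqrt_mul (by norm_num)]
        apply Real.sqrt_le_sqrt
        have h1 := norm_sub_norm_le ζ ν
        have h2 := norm_sub_norm_le ν ζ
        rw [norm_sub_rev] at h2
        have hν1 := hν.1
        have hν2 := hν.2
        rcases le_or_gt ‖ζ‖ (R / 16) with h3 | h3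
        · linarith
        · have : 16 * R ≤ ‖ζ‖ := by
            by_contra! h4; exact hζ ⟨h3, h4⟩
          linarith
    · intro ξ θ hθ
      split_ifs with hc
      · have h1 := norm_sub_le ξ θ
        have h2 := norm_sub_norm_le ξ θ
        exact hw2 ξ (by linarith [hc.1]) (by linarith [hc.2])
      · exact hw1 ξ

theorem scaled_average (n : ℕ) [NeZero n] : ∃ C : NNReal,
    ∀ (s : (Fin n → ℝ) × (Fin n → ℝ) → ℂ) (M K L B : ℝ), ContDiff ℝ (⊤ : ℕ∞) s → 0 ≤ M → 0 < L → L ≤ B →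
    (∀ q, SymAt L M s q) → (∀ x ξ, K < ‖x‖ → s (x, ξ) = 0) → (∀ x ξ, 2 * B < ‖ξ‖ → s (x, ξ) = 0) →
    (L < B → ∀ x ξ, ‖ξ‖ < B / 2 → s (x, ξ) = 0) → ∀ f : 𝓢(Fin n → ℝ, ℂ),
    Integrable (FTg (opS s f)) ∧ ∀ w : (Fin n → ℝ) → ℝ≥0∞, Measurable w →
    (∀ ζ, w ζ ≤ ENNReal.ofReal √(B / L)) → (∀ ζ, B / 32 < ‖ζ‖ → ‖ζ‖ < 32 * B → w ζ ≤ 1) →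
    ∫⁻ ζ, w ζ * ‖FTg (opS s f) ζ‖ₑ ^ 2 ≤ C * ENNReal.ofReal M ^ 2 * ∫⁻ x, ‖f x‖ₑ ^ 2 := by
  obtain ⟨C, hC⟩ := unit_gain n
  refine ⟨C, ?_⟩
  intro s M K L B hs hM hL hLB hsym hK hsupp hlow f
  have hB : 0 < B := hL.trans_le hLB
  obtain ⟨g, hg⟩ := exists_schwartz_affine hL f 0
  have hgf : (g : (Fin n → ℝ) → ℂ) = fun y => f (0 + L⁻¹ • y) := funext hg
  obtain ⟨t, ht⟩ : ∃ t, t = fun q : (Fin n → ℝ) × (Fin n → ℝ) => s (0 + L⁻¹ • q.1, L • q.2) := ⟨_, rfl⟩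
  have hts : ContDiff ℝ (⊤ : ℕ∞) t := by
    rw [ht]
    exact hs.comp (by fun_prop)
  have htsym : ∀ q, SymAt 1 M t q := fun q => ht ▸ SymAt.rescale hs 0 hsym q
  have hnorm : ∀ ξ : Fin n → ℝ, ‖L • ξ‖ = L * ‖ξ‖ := fun ξ => by
    rw [norm_smul, Real.norm_of_nonneg hL.le]
  have hnorm' : ∀ ξ : Fin n → ℝ, ‖L⁻¹ • ξ‖ = L⁻¹ * ‖ξ‖ := fun ξ => by
    rw [norm_smul, Real.norm_of_nonneg (inv_nonneg.2 hL.le)]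
  have htsupp : ∀ x ξ, 2 * (B / L) < ‖ξ‖ → t (x, ξ) = 0 := by
    intro x ξ hξ
    rw [ht]
    apply hsupp
    rw [hnorm]
    calc 2 * B = L * (2 * (B / L)) := by field_simp
      _ < _ := by gcongr
  have htlow : 1 < B / L → ∀ x ξ, ‖ξ‖ < B / L / 2 → t (x, ξ) = 0 := by
    intro h1 x ξ hξ
    rw [ht]
    apply hlow (by rwa [one_lt_div hL] at h1)
    rw [hnorm]
    calc L * ‖ξ‖ < L * (B / L / 2) := by gcongr
      _ = _ := by field_simp
  have htK : ∀ x ξ, L * K < ‖x‖ → t (x, ξ) = 0 := by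
    intro x ξ hx
    rw [ht]
    apply hK
    rw [zero_add, hnorm']
    calc K = L⁻¹ * (L * K) := by field_simp
      _ < _ := by gcongr
  have h1R : 1 ≤ B / L := by rwa [one_le_div hL]
  have hopf : opS t g = fun y => opS s f (0 + L⁻¹ • y) := funext fun y => by
    rw [opS_affine hL, ht, hgf]
  have hFT : ∀ η, FTg (opS t g) η = (L : ℂ) ^ n * FTg (opS s f) (L • η) := by
    intro η
    rw [hopf, FTg_affine hL]; simp
  have hLc : (L : ℂ) ^ n ≠ 0 := pow_ne_zero _ (by exact_mod_cast hL.ne')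
  constructor
  · have h1 := unit_integrable hts hM h1R htsym htK htsupp g
    have h2 : FTg (opS t g) = fun η => (L : ℂ) ^ n * FTg (opS s f) (L • η) := funext hFT
    rw [h2, integrable_const_mul_iff (IsUnit.mk0 _ hLc)] at h1
    exact (integrable_comp_smul_iff volume _ hL.ne').1 h1
  · intro w hw hw1 hw2
    have h1 := hC t M (L * K) (B / L) hts hM h1R htsym htK htsupp htlow g (fun η => w (L • η))
      (fun ζ => hw1 _) (by
        intro ζ h3 h4
        apply hw2
        · rw [hnorm]
          calc B / 32 = L * (B / L / 32) := by field_simp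
            _ < _ := by gcongr
        · rw [hnorm]
          calc L * ‖ζ‖ < L * (32 * (B / L)) := by gcongr
            _ = _ := by field_simp)
    have hGi := (continuous_opS hs.continuous (fun q => (hsym q).norm_le) f).integrable_of_hasCompactSupport
      (hasCompactSupport_opS hK f) (μ := volume)
    have hGF := continuous_FTg hGi
    have hL0 := ofReal_pow_ne_zero (n := n) hL
    have hLt : ENNReal.ofReal (L ^ n) ≠ ∞ := ENNReal.ofReal_ne_top
    have hLe : ‖(L : ℂ) ^ n‖ₑ = ENNReal.ofReal (L ^ n) := by
      rw [← ofReal_norm]; congr 1; simp [abs_of_pos hL]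
    have h5 : ∫⁻ x, ‖g x‖ₑ ^ 2 = ENNReal.ofReal (L ^ n) * ∫⁻ x, ‖f x‖ₑ ^ 2 := by
      rw [hgf]; exact lintegral_affine hL (fun x => ‖f x‖ₑ ^ 2) 0
    have h6 := lintegral_affine (n := n) (inv_pos.2 hL) (fun ζ => w ζ * ‖FTg (opS s f) ζ‖ₑ ^ 2) 0
    simp only [zero_add, inv_inv] at h6
    have h7 : ENNReal.ofReal (L ^ n) * ENNReal.ofReal (L⁻¹ ^ n) = 1 := by
      rw [← ENNReal.ofReal_mul (by positivity), ← mul_pow, mul_inv_cancel₀ hL.ne']; simp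
    have h8 : ∫⁻ η, w (L • η) * ‖FTg (opS t g) η‖ₑ ^ 2 =
        ENNReal.ofReal (L ^ n) * ∫⁻ ζ, w ζ * ‖FTg (opS s f) ζ‖ₑ ^ 2 := by
      calc _ = ∫⁻ η, ENNReal.ofReal (L ^ n) ^ 2 * (w (L • η) * ‖FTg (opS s f) (L • η)‖ₑ ^ 2) := by
            congr 1; ext η
            rw [hFT, enorm_mul, hLe]; ring
        _ = ENNReal.ofReal (L ^ n) ^ 2 * ∫⁻ η, (w (L • η) * ‖FTg (opS s f) (L • η)‖ₑ ^ 2) := by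
            rw [lintegral_const_mul]
            have : Continuous fun η => FTg (opS s f) (L • η) := hGF.comp (by fun_prop)
            exact (hw.comp (by fun_prop)).mul (this.measurable.enorm.pow_const 2)
        _ = _ := by
            rw [h6, sq, mul_assoc, ← mul_assoc _ (ENNReal.ofReal (L⁻¹ ^ n)), h7, one_mul]
    rw [h8, h5, mul_left_comm] at h1
    exact (ENNReal.mul_le_mul_iff_right hL0 hLt).1 h1

end ScaledAveraging

section SymbolPieces

variable {n : ℕ}

lemma flatMap_replicate_single (j : Fin n) (b : ℕ) (l : List (Fin n)) (hl : l.Nodup) :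
    l.flatMap (fun i => List.replicate ((Pi.single j b : Fin n → ℕ) i) i)
      = if j ∈ l then List.replicate b j else [] := by
  induction l with
  | nil => simp
  | cons i l ih =>
    rw [List.flatMap_cons, ih hl.of_cons]
    have hil : i ∉ l := (List.nodup_cons.1 hl).1
    by_cases h : j = i
    · subst h; simp [hil]
    · simp [h]

lemma pdM_single (j : Fin n) (b : ℕ) (f : (Fin n → ℝ) → ℂ) :
    pdM (Pi.single j b) f = (dv (eb j))^[b] f := by
  unfold pdM mIdxList
  rw [flatMap_replicate_single j b _ (List.nodup_finRange n), if_pos (List.mem_finRange j)]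
  induction b with
  | zero => rfl
  | succ b ih => rw [List.replicate_succ, List.foldr_cons, ih, Function.iterate_succ_apply']; rfl

lemma symbDxDξ_single {σ : (Fin n → ℝ) → (Fin n → ℝ) → ℂ}
    (hσ : ContDiff ℝ (⊤ : ℕ∞) fun q : (Fin n → ℝ) × (Fin n → ℝ) => σ q.1 q.2)
    (j i : Fin n) (b a : ℕ) (x ξ : Fin n → ℝ) :
    symbDxDξ (Pi.single j b) (Pi.single i a) σ x ξ
      = dvv (eb j, 0) (0, eb i) b a (fun q : (Fin n → ℝ) × (Fin n → ℝ) => σ q.1 q.2) (x, ξ) := by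
  unfold symbDxDξ
  simp only [pdM_single]
  have e1 : (fun x' => (dv (eb i))^[a] (σ x') ξ) = fun x' =>
      ((dv ((0, eb i) : (Fin n → ℝ) × (Fin n → ℝ)))^[a]
        (fun q : (Fin n → ℝ) × (Fin n → ℝ) => σ q.1 q.2))
        ((0, ξ) + ContinuousLinearMap.inl ℝ (Fin n → ℝ) (Fin n → ℝ) x') := by
    ext x'
    have := congrFun (dv_iter_comp_affine hσ (ContinuousLinearMap.inr ℝ (Fin n → ℝ) (Fin n → ℝ))
      (x', 0) (eb i) a) ξ
    simpa using this
  rw [e1, dv_iter_comp_affine (hσ.dv_iter _ _)]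
  simp [dvv]

/-- Symbol estimates of order `-m` and type `(ρ, δ)`, for pure derivatives of order `≤ NN n`. -/
def SClass (m ρ δ C : ℝ) (S : (Fin n → ℝ) × (Fin n → ℝ) → ℂ) : Prop :=
  ∀ j i : Fin n, ∀ b ≤ NN n, ∀ a ≤ NN n, ∀ x ξ,
    ‖dvv (eb j, 0) (0, eb i) b a S (x, ξ)‖ ≤ C * jbR ξ ^ (-m - ρ * a + δ * b)

lemma one_le_jbR (ξ : Fin n → ℝ) : 1 ≤ jbR ξ := by
  unfold jbR
  rw [Real.one_le_sqrt]
  have : 0 ≤ ∑ j, (ξ j) ^ 2 := Finset.sum_nonneg fun _ _ => sq_nonneg _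
  linarith

lemma norm_le_jbR (ξ : Fin n → ℝ) : ‖ξ‖ ≤ jbR ξ := by
  refine (pi_norm_le_iff_of_nonneg (zero_le_one.trans (one_le_jbR ξ))).2 fun i => ?_
  unfold jbR
  refine Real.le_sqrt_of_sq_le ?_
  rw [Real.norm_eq_abs, sq_abs]
  have := Finset.single_le_sum (f := fun j => (ξ j) ^ 2) (fun _ _ => sq_nonneg _)
    (Finset.mem_univ i)
  linarith

lemma jbR_le (ξ : Fin n → ℝ) {t : ℝ} (ht : 1 ≤ t) (h : ‖ξ‖ ≤ 2 * t) : jbR ξ ≤ 2 * (n + 1) * t := by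
  unfold jbR
  rw [Real.sqrt_le_left (by positivity)]
  have h1 : ∑ j, (ξ j) ^ 2 ≤ ∑ _j : Fin n, (2 * t) ^ 2 := by
    refine Finset.sum_le_sum fun j _ => ?_
    rw [← sq_abs]
    have := (norm_le_pi_norm ξ j).trans h
    rw [Real.norm_eq_abs] at this
    gcongr
  simp only [Finset.sum_const, Finset.card_univ, Fintype.card_fin, nsmul_eq_mul] at h1
  have hn : (0 : ℝ) ≤ n := Nat.cast_nonneg n
  nlinarith [mul_nonneg hn hn, sq_nonneg t, mul_nonneg hn (sq_nonneg t),
    mul_nonneg (mul_nonneg hn hn) (sq_nonneg t)]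

lemma SClass.of_symbDxDξ {m ρ δ C : ℝ} {σ : (Fin n → ℝ) → (Fin n → ℝ) → ℂ}
    (hσ : ContDiff ℝ (⊤ : ℕ∞) fun q : (Fin n → ℝ) × (Fin n → ℝ) => σ q.1 q.2)
    (h : ∀ α β : Fin n → ℕ, ∑ j, α j ≤ n / 2 + 1 → ∑ j, β j ≤ n / 2 + 1 → ∀ x ξ,
      ‖symbDxDξ β α σ x ξ‖ ≤ C * jbR ξ ^ (-m - ρ * (∑ j, (α j : ℝ)) + δ * ∑ j, (β j : ℝ))) :
    SClass m ρ δ C fun q : (Fin n → ℝ) × (Fin n → ℝ) => σ q.1 q.2 := by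
  intro j i b hb a ha x ξ
  have hs : ∀ (j : Fin n) (b : ℕ), ∑ k, (Pi.single j b : Fin n → ℕ) k = b := fun j b => by simp
  have := h (Pi.single i a) (Pi.single j b) ((hs i a).le.trans ha) ((hs j b).le.trans hb) x ξ
  rw [symbDxDξ_single hσ] at this
  rw [← Nat.cast_sum, ← Nat.cast_sum, hs, hs] at this
  exact this

lemma SClass.mono {m ρ δ C : ℝ} {S : (Fin n → ℝ) × (Fin n → ℝ) → ℂ} (hC : 0 ≤ C) (hm : 0 ≤ m)
    (hδ : δ ≤ ρ) (h : SClass m ρ δ C S) : SClass 0 δ δ C S := by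
  intro j i b hb a ha x ξ
  refine (h j i b hb a ha x ξ).trans ?_
  refine mul_le_mul_of_nonneg_left (Real.rpow_le_rpow_of_exponent_le (one_le_jbR ξ) ?_) hC
  have : δ * a ≤ ρ * a := by gcongr
  linarith

/-- The bump used for the frequency decomposition. -/
def betB (n : ℕ) : ContDiffBump (0 : Fin n → ℝ) := ⟨1, 2, by norm_num, by norm_num⟩

/-- Complex-valued frequency bump, `1` for `‖ξ‖ ≤ 1` and `0` for `2 ≤ ‖ξ‖`. -/
def bet (ξ : Fin n → ℝ) : ℂ := ((betB n ξ : ℝ) : ℂ)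

lemma contDiff_bet : ContDiff ℝ (⊤ : ℕ∞) (bet (n := n)) :=
  Complex.ofRealCLM.contDiff.comp (betB n).contDiff

lemma bet_eq_one {ξ : Fin n → ℝ} (h : ‖ξ‖ ≤ 1) : bet ξ = 1 := by
  unfold bet
  rw [(betB n).one_of_mem_closedBall (by simpa [betB] using h)]; simp

lemma bet_eq_zero {ξ : Fin n → ℝ} (h : 2 ≤ ‖ξ‖) : bet ξ = 0 := by
  unfold bet
  rw [(betB n).zero_of_le_dist (by simpa [betB] using h)]; simp

lemma norm_bet_le (ξ : Fin n → ℝ) : ‖bet ξ‖ ≤ 1 := by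
  unfold bet
  rw [Complex.norm_real, Real.norm_of_nonneg (betB n).nonneg]
  exact (betB n).le_one

lemma hasCompactSupport_bet : HasCompactSupport (bet (n := n)) :=
  HasCompactSupport.intro (isCompact_closedBall 0 2) fun x hx =>
    bet_eq_zero (by simpa using (not_le.1 (by simpa using hx)).le)

/-- The dyadic frequency pieces. -/
def psi : ℕ → (Fin n → ℝ) → ℂ
  | 0 => bet
  | j + 1 => fun ξ => bet (((2 : ℝ) ^ (j + 1))⁻¹ • ξ) - bet (((2 : ℝ) ^ j)⁻¹ • ξ)

lemma sum_psi (J : ℕ) (ξ : Fin n → ℝ) :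
    ∑ j ∈ Finset.range (J + 1), psi j ξ = bet (((2 : ℝ) ^ J)⁻¹ • ξ) := by
  induction J with
  | zero => simp [psi]
  | succ J ih => rw [Finset.sum_range_succ, ih]; simp [psi]

lemma contDiff_psi (j : ℕ) : ContDiff ℝ (⊤ : ℕ∞) (psi (n := n) j) := by
  cases j with
  | zero => exact contDiff_bet
  | succ j =>
    exact (contDiff_bet.comp (contDiff_const_smul _)).sub
      (contDiff_bet.comp (contDiff_const_smul _))

lemma norm_inv_pow_smul (j : ℕ) (ξ : Fin n → ℝ) :
    ‖((2 : ℝ) ^ j)⁻¹ • ξ‖ = ‖ξ‖ / 2 ^ j := by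
  rw [norm_smul, norm_inv, norm_pow, Real.norm_two]; ring

lemma psi_eq_zero_of_ge {j : ℕ} {ξ : Fin n → ℝ} (h : 2 * 2 ^ j ≤ ‖ξ‖) : psi j ξ = 0 := by
  cases j with
  | zero => exact bet_eq_zero (by simpa using h)
  | succ j =>
    have h1 : (0 : ℝ) < 2 ^ j := by positivity
    simp only [psi]
    rw [bet_eq_zero, bet_eq_zero, sub_zero]
    · rw [norm_inv_pow_smul, le_div_iff₀ (by positivity)]
      rw [pow_succ] at h; linarith
    · rw [norm_inv_pow_smul, le_div_iff₀ (by positivity)]; exact h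

lemma psi_eq_zero_of_le {j : ℕ} (hj : j ≠ 0) {ξ : Fin n → ℝ} (h : ‖ξ‖ ≤ 2 ^ j / 2) :
    psi j ξ = 0 := by
  cases j with
  | zero => exact absurd rfl hj
  | succ j =>
    have h1 : (0 : ℝ) < 2 ^ j := by positivity
    rw [pow_succ] at h
    simp only [psi]
    rw [bet_eq_one, bet_eq_one, sub_self]
    · rw [norm_inv_pow_smul, div_le_one (by positivity)]; linarith
    · rw [norm_inv_pow_smul, div_le_one (by positivity), pow_succ]; linarith

lemma exists_dvv_bound {G : (Fin n → ℝ) → ℂ} (hG : ContDiff ℝ (⊤ : ℕ∞) G)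
    (hc : HasCompactSupport G) :
    ∃ M : ℝ, 0 ≤ M ∧ ∀ j i : Fin n, ∀ b ≤ NN n, ∀ a ≤ NN n, ∀ x,
      ‖dvv (eb j) (eb i) b a G x‖ ≤ M := by
  have h1 : ∀ t : (Fin n × Fin n) × (ℕ × ℕ), ∃ M, ∀ x,
      ‖dvv (eb t.1.1) (eb t.1.2) t.2.1 t.2.2 G x‖ ≤ M := fun t =>
    (hc.dvv _ _ _ _).exists_bound_of_continuous (hG.dvv _ _ _ _).continuous
  choose M hM using h1
  have hM0 : ∀ t, 0 ≤ M t := fun t => (norm_nonneg _).trans (hM t 0)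
  refine ⟨∑ t ∈ (Finset.univ : Finset (Fin n × Fin n)) ×ˢ
    (Finset.range (NN n + 1) ×ˢ Finset.range (NN n + 1)), M t,
    Finset.sum_nonneg fun t _ => hM0 t, fun j i b hb a ha x => (hM ((j, i), (b, a)) x).trans ?_⟩
  refine Finset.single_le_sum (f := M) (fun t _ => hM0 t) ?_
  simp only [Finset.mem_product, Finset.mem_univ, Finset.mem_range, true_and]
  omega

lemma symAt_comp {G : (Fin n → ℝ) → ℂ} (hG : ContDiff ℝ (⊤ : ℕ∞) G) {M : ℝ}
    (h : ∀ j i : Fin n, ∀ b ≤ NN n, ∀ a ≤ NN n, ∀ x, ‖dvv (eb j) (eb i) b a G x‖ ≤ M)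
    (L c d : ℝ) (hc : |c| ≤ 2) (hd : |d| ≤ 2)
    (T : (Fin n → ℝ) × (Fin n → ℝ) →L[ℝ] (Fin n → ℝ))
    (h1 : ∀ j, T (L⁻¹ • eb j, 0) = c • eb j) (h2 : ∀ i, T (0, L • eb i) = d • eb i) (q) :
    SymAt L (2 ^ (2 * NN n) * M) (fun q => G (T q)) q := by
  intro j i b hb a ha
  have e : (fun q => G (T q)) = fun q => G (0 + T q) := by simp
  rw [e, dvv_comp_affine hG, h1, h2, dvv_smul hG, norm_mul, norm_mul, norm_pow, norm_pow,
    Complex.norm_real, Complex.norm_real, Real.norm_eq_abs, Real.norm_eq_abs]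
  refine mul_le_mul ?_ (h j i b hb a ha _) (norm_nonneg _) (by positivity)
  calc |c| ^ b * |d| ^ a ≤ 2 ^ b * 2 ^ a := by gcongr
    _ ≤ 2 ^ (NN n) * 2 ^ (NN n) := by gcongr <;> norm_num
    _ = 2 ^ (2 * NN n) := by ring

lemma exists_symAt_psi (n : ℕ) : ∃ M : ℝ, 0 ≤ M ∧ ∀ j r : ℕ, r ≤ j →
    ∀ q, SymAt ((2 : ℝ) ^ r) M (fun q : (Fin n → ℝ) × (Fin n → ℝ) => psi j q.2) q := by
  obtain ⟨M, hM0, hM⟩ := exists_dvv_bound (contDiff_bet (n := n)) hasCompactSupport_bet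
  have key : ∀ j r : ℕ, r ≤ j + 1 → ∀ q, SymAt ((2 : ℝ) ^ r) (2 ^ (2 * NN n) * M)
      (fun q : (Fin n → ℝ) × (Fin n → ℝ) => bet (((2 : ℝ) ^ j)⁻¹ • q.2)) q := by
    intro j r hr q
    have e : (fun q : (Fin n → ℝ) × (Fin n → ℝ) => bet (((2 : ℝ) ^ j)⁻¹ • q.2))
        = fun q => bet ((((2 : ℝ) ^ j)⁻¹ • ContinuousLinearMap.snd ℝ (Fin n → ℝ) (Fin n → ℝ)) q) := by
      ext q; rfl
    rw [e]
    refine symAt_comp contDiff_bet hM (2 ^ r) 0 (((2 : ℝ) ^ j)⁻¹ * 2 ^ r) (by norm_num) ?_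
      _ (fun j => by simp) (fun i => by simp [smul_smul]) q
    rw [abs_of_nonneg (by positivity), inv_mul_le_iff₀ (by positivity), ← pow_succ]
    exact pow_le_pow_right₀ (by norm_num) hr
  refine ⟨2 * (2 ^ (2 * NN n) * M), by positivity, fun j r hr q => ?_⟩
  cases j with
  | zero =>
    intro j i b hb a ha
    have := key 0 r (by omega) q j i b hb a ha
    simp only [pow_zero, inv_one, one_smul] at this
    refine this.trans ?_
    have : 0 ≤ 2 ^ (2 * NN n) * M := by positivity
    linarith
  | succ k =>
    intro j i b hb a ha
    have h1 := key (k + 1) r (by omega) q j i b hb a ha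
    have h2 := key k r (by omega) q j i b hb a ha
    have s1 : ContDiff ℝ (⊤ : ℕ∞) (fun q : (Fin n → ℝ) × (Fin n → ℝ) =>
        bet (((2 : ℝ) ^ (k + 1))⁻¹ • q.2)) :=
      contDiff_bet.comp (contDiff_snd.const_smul _)
    have s2 : ContDiff ℝ (⊤ : ℕ∞) (fun q : (Fin n → ℝ) × (Fin n → ℝ) =>
        bet (((2 : ℝ) ^ k)⁻¹ • q.2)) :=
      contDiff_bet.comp (contDiff_snd.const_smul _)
    have s3 : ContDiff ℝ (⊤ : ℕ∞) (fun q : (Fin n → ℝ) × (Fin n → ℝ) => psi (k + 1) q.2) :=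
      (contDiff_psi (k + 1)).comp contDiff_snd
    have e : (fun q : (Fin n → ℝ) × (Fin n → ℝ) => bet (((2 : ℝ) ^ (k + 1))⁻¹ • q.2))
        = fun q => psi (k + 1) q.2 + bet (((2 : ℝ) ^ k)⁻¹ • q.2) := by
      ext q; simp [psi]
    rw [e, dvv_add s3 s2] at h1
    have h3 := norm_sub_le (dvv ((2 ^ r : ℝ)⁻¹ • eb j, 0) (0, (2 ^ r : ℝ) • eb i) b a
      (fun q : (Fin n → ℝ) × (Fin n → ℝ) => psi (k + 1) q.2) q
      + dvv ((2 ^ r : ℝ)⁻¹ • eb j, 0) (0, (2 ^ r : ℝ) • eb i) b a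
      (fun q : (Fin n → ℝ) × (Fin n → ℝ) => bet (((2 : ℝ) ^ k)⁻¹ • q.2)) q)
      (dvv ((2 ^ r : ℝ)⁻¹ • eb j, 0) (0, (2 ^ r : ℝ) • eb i) b a
      (fun q : (Fin n → ℝ) × (Fin n → ℝ) => bet (((2 : ℝ) ^ k)⁻¹ • q.2)) q)
    rw [add_sub_cancel_right] at h3
    linarith

lemma exists_symAt_chi (n : ℕ) : ∃ M : ℝ, 0 ≤ M ∧ ∀ (L ε : ℝ), 1 ≤ L → 0 < ε → ε ≤ 1 →
    ∀ q, SymAt L M (fun q : (Fin n → ℝ) × (Fin n → ℝ) => bet (ε • q.1)) q := by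
  obtain ⟨M, hM0, hM⟩ := exists_dvv_bound (contDiff_bet (n := n)) hasCompactSupport_bet
  refine ⟨2 ^ (2 * NN n) * M, by positivity, fun L ε hL hε hε1 q => ?_⟩
  have e : (fun q : (Fin n → ℝ) × (Fin n → ℝ) => bet (ε • q.1))
      = fun q => bet ((ε • ContinuousLinearMap.fst ℝ (Fin n → ℝ) (Fin n → ℝ)) q) := by
    ext q; rfl
  rw [e]
  refine symAt_comp contDiff_bet hM L (ε * L⁻¹) 0 ?_ (by norm_num)
    _ (fun j => by simp [smul_smul]) (fun i => by simp) q
  rw [abs_of_nonneg (by positivity)]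
  have : L⁻¹ ≤ 1 := inv_le_one_of_one_le₀ hL
  have h0 : 0 ≤ L⁻¹ := by positivity
  nlinarith

/-- Symbol estimates for the dyadic pieces, at the scale `2^r` with `δ j - 1 ≤ r ≤ ρ j`. -/
theorem exists_symAt_piece {m ρ δ C : ℝ} (hC : 0 ≤ C) (hm : 0 ≤ m) (hδ0 : 0 ≤ δ) (hδ1 : δ ≤ 1)
    (hρ0 : 0 ≤ ρ) (hρ1 : ρ ≤ 1)
    {S : (Fin n → ℝ) × (Fin n → ℝ) → ℂ} (hS : ContDiff ℝ (⊤ : ℕ∞) S) (h : SClass m ρ δ C S) :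
    ∃ A : ℝ, 0 ≤ A ∧ ∀ j r : ℕ, (r : ℝ) ≤ ρ * j → δ * j ≤ r + 1 →
      ∀ q, SymAt ((2 : ℝ) ^ r) (A * 2 ^ (-(j * m))) (fun q => S q * psi j q.2) q := by
  obtain ⟨P, hP0, hP⟩ := exists_symAt_psi n
  set K : ℝ := 2 * (n + 1) with hK
  have hK1 : 1 ≤ K := by have : (0 : ℝ) ≤ n := Nat.cast_nonneg n; rw [hK]; linarith
  set Q : ℝ := C * K ^ (m + 2 * NN n) * 2 ^ (NN n) with hQ
  have hQ0 : 0 ≤ Q := by positivity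
  refine ⟨2 ^ (2 * NN n) * (Q * P), by positivity, fun j r hr hr1 q => ?_⟩
  have hrj : r ≤ j := by
    have : (r : ℝ) ≤ j := hr.trans (mul_le_of_le_one_left (Nat.cast_nonneg _) hρ1)
    exact_mod_cast this
  have hψ : ContDiff ℝ (⊤ : ℕ∞) (fun q : (Fin n → ℝ) × (Fin n → ℝ) => psi j q.2) :=
    (contDiff_psi j).comp contDiff_snd
  have hc2 : Continuous fun q : (Fin n → ℝ) × (Fin n → ℝ) => ‖q.2‖ := by fun_prop
  by_cases h1 : 2 * 2 ^ j < ‖q.2‖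
  · intro j' i' b hb a ha
    rw [dvv_zero_on (isOpen_lt continuous_const hc2 :
      IsOpen {q : (Fin n → ℝ) × (Fin n → ℝ) | 2 * 2 ^ j < ‖q.2‖})
      (fun q hq => by rw [psi_eq_zero_of_ge (le_of_lt hq), mul_zero]) _ _ b a q h1, norm_zero]
    positivity
  by_cases h2 : j ≠ 0 ∧ ‖q.2‖ < 2 ^ j / 2
  · intro j' i' b hb a ha
    rw [dvv_zero_on (isOpen_lt hc2 continuous_const :
      IsOpen {q : (Fin n → ℝ) × (Fin n → ℝ) | ‖q.2‖ < 2 ^ j / 2})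
      (fun q hq => by rw [psi_eq_zero_of_le h2.1 (le_of_lt hq), mul_zero]) _ _ b a q h2.2,
      norm_zero]
    positivity
  have hJ1 : (1 : ℝ) ≤ 2 ^ j := one_le_pow₀ (by norm_num)
  have hup : jbR q.2 ≤ K * 2 ^ j := jbR_le q.2 hJ1 (not_lt.1 h1)
  have hlow : 2 ^ j ≤ K * jbR q.2 := by
    have hj := one_le_jbR q.2
    have hn := norm_le_jbR q.2
    have h2K : 2 ≤ K := by have : (0 : ℝ) ≤ n := Nat.cast_nonneg n; rw [hK]; linarith
    have : (2 : ℝ) ^ j ≤ 2 * jbR q.2 := by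
      by_cases h0 : j = 0
      · subst h0; norm_num; linarith
      · have : 2 ^ j / 2 ≤ ‖q.2‖ := by
          by_contra hh; exact h2 ⟨h0, not_le.1 hh⟩
        linarith
    nlinarith
  have hmain : SymAt ((2 : ℝ) ^ r) (Q * 2 ^ (-(j * m))) S q := by
    intro j' i' b hb a ha
    have e1 : dvv (((2 : ℝ) ^ r)⁻¹ • eb j', 0) (0, (2 : ℝ) ^ r • eb i') b a S q
        = ((((2 : ℝ) ^ r)⁻¹ : ℝ) : ℂ) ^ b * (((2 : ℝ) ^ r : ℝ) : ℂ) ^ a *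
          dvv (eb j', 0) (0, eb i') b a S q := by
      rw [← congrFun (dvv_smul hS (eb j', 0) (0, eb i') (((2 : ℝ) ^ r)⁻¹) ((2 : ℝ) ^ r) b a) q]
      simp
    rw [e1, norm_mul, norm_mul, norm_pow, norm_pow, Complex.norm_real, Complex.norm_real,
      Real.norm_of_nonneg (by positivity), Real.norm_of_nonneg (by positivity)]
    have h3 := h j' i' b hb a ha q.1 q.2
    set e : ℝ := -m - ρ * a + δ * b with he
    have ha' : (a : ℝ) ≤ NN n := by exact_mod_cast ha
    have hb' : (b : ℝ) ≤ NN n := by exact_mod_cast hb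
    have ha0 : (0 : ℝ) ≤ a := Nat.cast_nonneg a
    have hb0 : (0 : ℝ) ≤ b := Nat.cast_nonneg b
    have hE : |e| ≤ m + 2 * NN n := by
      rw [abs_le, he]; constructor <;> nlinarith
    have hpos : 0 < jbR q.2 := zero_lt_one.trans_le (one_le_jbR _)
    have h4 : jbR q.2 ^ e ≤ K ^ |e| * ((2 : ℝ) ^ j) ^ e := by
      rcases le_total 0 e with he0 | he0
      · rw [abs_of_nonneg he0, ← Real.mul_rpow (by positivity) (by positivity)]
        exact Real.rpow_le_rpow hpos.le hup he0
      · rw [abs_of_nonpos he0, Real.rpow_neg (by positivity)]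
        have := Real.rpow_le_rpow_of_nonpos (by positivity) hlow he0
        rw [Real.mul_rpow (by positivity) hpos.le] at this
        rw [← div_eq_inv_mul, le_div_iff₀ (by positivity), mul_comm]
        exact this
    have h5 : K ^ |e| ≤ K ^ (m + 2 * NN n) := Real.rpow_le_rpow_of_exponent_le hK1 hE
    have h6 : (((2 : ℝ) ^ r)⁻¹) ^ b * ((2 : ℝ) ^ r) ^ a * ((2 : ℝ) ^ j) ^ e
        ≤ 2 ^ (NN n) * 2 ^ (-(j * m)) := by
      have t1 : (((2 : ℝ) ^ r)⁻¹) ^ b = (2 : ℝ) ^ (-((r : ℝ) * b)) := by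
        rw [Real.rpow_neg (by norm_num), Real.rpow_mul (by norm_num), Real.rpow_natCast,
          Real.rpow_natCast, inv_pow]
      have t2 : ((2 : ℝ) ^ r) ^ a = (2 : ℝ) ^ ((r : ℝ) * a) := by
        rw [Real.rpow_mul (by norm_num), Real.rpow_natCast, Real.rpow_natCast]
      have t3 : ((2 : ℝ) ^ j) ^ e = (2 : ℝ) ^ ((j : ℝ) * e) := by
        rw [Real.rpow_mul (by norm_num), Real.rpow_natCast]
      have t4 : (2 : ℝ) ^ (NN n) = (2 : ℝ) ^ ((NN n : ℕ) : ℝ) := by rw [Real.rpow_natCast]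
      rw [t1, t2, t3, t4, ← Real.rpow_add (by norm_num), ← Real.rpow_add (by norm_num),
        ← Real.rpow_add (by norm_num)]
      refine Real.rpow_le_rpow_of_exponent_le (by norm_num) ?_
      rw [he]
      nlinarith [mul_le_mul_of_nonneg_right hr ha0, mul_le_mul_of_nonneg_right hr1 hb0]
    calc _ ≤ (((2 : ℝ) ^ r)⁻¹) ^ b * ((2 : ℝ) ^ r) ^ a *
        (C * (K ^ (m + 2 * NN n) * ((2 : ℝ) ^ j) ^ e)) := by
          refine mul_le_mul_of_nonneg_left (h3.trans ?_) (by positivity)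
          refine mul_le_mul_of_nonneg_left (h4.trans ?_) hC
          gcongr
      _ = C * K ^ (m + 2 * NN n) *
          ((((2 : ℝ) ^ r)⁻¹) ^ b * ((2 : ℝ) ^ r) ^ a * ((2 : ℝ) ^ j) ^ e) := by ring
      _ ≤ C * K ^ (m + 2 * NN n) * (2 ^ (NN n) * 2 ^ (-(j * m))) := by
          gcongr
      _ = _ := by rw [hQ]; ring
  have := SymAt.mul (by positivity) hP0 hS hψ hmain (hP j r hrj q)
  convert this using 1
  ring

end SymbolPieces

section FrequencyPieces

variable {n : ℕ}

lemma sum_ite_le_of_close (I : Finset ℕ) (p : ℕ → Prop) [DecidablePred p] (m : ℕ)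
    (hp : ∀ i j, p i → p j → j ≤ i + m) (c : ℝ≥0∞) :
    ∑ j ∈ I, (if p j then c else 0) ≤ ((m + 1 : ℕ) : ℝ≥0∞) * c := by
  rw [← Finset.sum_filter, Finset.sum_const, nsmul_eq_mul]
  refine mul_le_mul_left ?_ c
  norm_cast
  rcases (I.filter p).eq_empty_or_nonempty with h | h
  · simp [h]
  · have hm := (Finset.mem_filter.1 ((I.filter p).min'_mem h)).2
    refine (Finset.card_le_card (t := Finset.Icc ((I.filter p).min' h)
      ((I.filter p).min' h + m)) fun j hj => ?_).trans (by simp; omega)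
    rw [Finset.mem_Icc]
    exact ⟨Finset.min'_le _ _ hj, hp _ _ hm (Finset.mem_filter.1 hj).2⟩

lemma exists_fmult {g : (Fin n → ℝ) → ℂ} (hg : ContDiff ℝ (⊤ : ℕ∞) g) (hc : HasCompactSupport g)
    (f : 𝓢(Fin n → ℝ, ℂ)) : ∃ F : 𝓢(Fin n → ℝ, ℂ), FTg F = fun ξ => g ξ * FTg f ξ := by
  have h1 : ContDiff ℝ (⊤ : ℕ∞) fun ξ => g ξ * FTS f ξ := hg.mul (FTS f).smooth'
  have h2 : HasCompactSupport fun ξ => g ξ * FTS f ξ := hc.mul_right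
  refine ⟨IFTS (h2.toSchwartzMap h1), ?_⟩
  rw [FTg_IFTS, ← FTS_coe]
  rfl

lemma contDiff_bet_smul (c : ℝ) : ContDiff ℝ (⊤ : ℕ∞) fun ξ : Fin n → ℝ => bet (c • ξ) :=
  contDiff_bet.comp (contDiff_const_smul _)

lemma hasCompactSupport_bet_smul {c : ℝ} (hc : c ≠ 0) :
    HasCompactSupport fun ξ : Fin n → ℝ => bet (c • ξ) :=
  hasCompactSupport_bet.comp_smul hc

/-- Frequency localisation of a Schwartz function to `‖ξ‖ ≲ 2^a`. -/
def Pa (a : ℕ) (f : 𝓢(Fin n → ℝ, ℂ)) : 𝓢(Fin n → ℝ, ℂ) :=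
  (exists_fmult (contDiff_bet_smul ((2 : ℝ) ^ a)⁻¹)
    (hasCompactSupport_bet_smul (inv_ne_zero (pow_ne_zero a two_ne_zero))) f).choose

lemma FTg_Pa (a : ℕ) (f : 𝓢(Fin n → ℝ, ℂ)) :
    FTg (Pa a f) = fun ξ => bet (((2 : ℝ) ^ a)⁻¹ • ξ) * FTg f ξ :=
  (exists_fmult (contDiff_bet_smul ((2 : ℝ) ^ a)⁻¹)
    (hasCompactSupport_bet_smul (inv_ne_zero (pow_ne_zero a two_ne_zero))) f).choose_spec

/-- Frequency localisation of a Schwartz function to a neighbourhood of the support of `psi j`. -/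
def Pj (j : ℕ) (f : 𝓢(Fin n → ℝ, ℂ)) : 𝓢(Fin n → ℝ, ℂ) :=
  Pa (j + 1) f - if j < 2 then 0 else Pa (j - 2) f

/-- The multiplier of `Pj`. -/
def psit (j : ℕ) (ξ : Fin n → ℝ) : ℂ :=
  bet (((2 : ℝ) ^ (j + 1))⁻¹ • ξ) - if j < 2 then 0 else bet (((2 : ℝ) ^ (j - 2))⁻¹ • ξ)

lemma FTg_sub {f g : (Fin n → ℝ) → ℂ} (hf : Integrable f) (hg : Integrable g) (ξ) :
    FTg (fun x => f x - g x) ξ = FTg f ξ - FTg g ξ := by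
  unfold FTg
  rw [← integral_sub (integrable_ph_mul hf ξ) (integrable_ph_mul hg ξ)]
  simp only [mul_sub]

lemma FTg_Pj (j : ℕ) (f : 𝓢(Fin n → ℝ, ℂ)) : FTg (Pj j f) = fun ξ => psit j ξ * FTg f ξ := by
  ext ξ
  unfold Pj psit
  split_ifs with h
  · simp [FTg_Pa]
  · have := FTg_sub (Pa (j + 1) f).integrable (Pa (j - 2) f).integrable ξ
    rw [FTg_Pa, FTg_Pa] at this
    rw [sub_mul, ← this]
    rfl

lemma norm_psit_le (j : ℕ) (ξ : Fin n → ℝ) : ‖psit j ξ‖ ≤ 2 := by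
  unfold psit
  refine (norm_sub_le _ _).trans ?_
  have h1 := norm_bet_le (((2 : ℝ) ^ (j + 1))⁻¹ • ξ)
  have h2 := norm_bet_le (((2 : ℝ) ^ (j - 2))⁻¹ • ξ)
  split_ifs
  · rw [norm_zero]; linarith
  · linarith

lemma psit_eq_zero_of_ge {j : ℕ} {ξ : Fin n → ℝ} (h : 2 ^ (j + 2) ≤ ‖ξ‖) : psit j ξ = 0 := by
  have e1 : bet (((2 : ℝ) ^ (j + 1))⁻¹ • ξ) = 0 := by
    refine bet_eq_zero ?_
    rw [norm_inv_pow_smul, le_div_iff₀ (by positivity), ← pow_succ']; exact h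
  have e2 : bet (((2 : ℝ) ^ (j - 2))⁻¹ • ξ) = 0 := by
    refine bet_eq_zero ?_
    rw [norm_inv_pow_smul, le_div_iff₀ (by positivity), ← pow_succ']
    exact (pow_le_pow_right₀ (by norm_num) (by omega)).trans h
  unfold psit
  rw [e1, e2]; simp

lemma psit_eq_zero_of_le {j : ℕ} (hj : 2 ≤ j) {ξ : Fin n → ℝ} (h : ‖ξ‖ ≤ 2 ^ (j - 2)) :
    psit j ξ = 0 := by
  have e1 : bet (((2 : ℝ) ^ (j + 1))⁻¹ • ξ) = 1 := by
    refine bet_eq_one ?_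
    rw [norm_inv_pow_smul, div_le_one (by positivity)]
    exact h.trans (pow_le_pow_right₀ (by norm_num) (by omega))
  have e2 : bet (((2 : ℝ) ^ (j - 2))⁻¹ • ξ) = 1 := by
    refine bet_eq_one ?_
    rw [norm_inv_pow_smul, div_le_one (by positivity)]
    exact h
  unfold psit
  rw [e1, e2, if_neg (by omega), sub_self]

lemma psi_mul_psit (j : ℕ) (ξ : Fin n → ℝ) : psi j ξ * psit j ξ = psi j ξ := by
  by_cases h1 : 2 * 2 ^ j ≤ ‖ξ‖
  · rw [psi_eq_zero_of_ge h1, zero_mul]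
  push Not at h1
  have e1 : bet (((2 : ℝ) ^ (j + 1))⁻¹ • ξ) = 1 := by
    refine bet_eq_one ?_
    rw [norm_inv_pow_smul, div_le_one (by positivity), pow_succ']
    exact h1.le
  unfold psit
  rw [e1]
  split_ifs with h
  · simp
  · by_cases h2 : ‖ξ‖ ≤ 2 ^ j / 2
    · rw [psi_eq_zero_of_le (by omega) h2, zero_mul]
    · rw [bet_eq_zero]
      · simp
      · rw [norm_inv_pow_smul, le_div_iff₀ (by positivity)]
        obtain ⟨i, rfl⟩ : ∃ i, j = i + 2 := ⟨j - 2, by omega⟩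
        have h3 : (0 : ℝ) < 2 ^ i := by positivity
        rw [pow_add] at h2
        simp only [Nat.add_sub_cancel]
        linarith [not_le.1 h2]

lemma opS_congr_FTg {s : (Fin n → ℝ) × (Fin n → ℝ) → ℂ} {f g : (Fin n → ℝ) → ℂ}
    (x : Fin n → ℝ) (h : ∀ ξ, s (x, ξ) * FTg f ξ = s (x, ξ) * FTg g ξ) :
    opS s f x = opS s g x := by
  unfold opS
  congr 1; ext ξ
  rw [mul_assoc, h, ← mul_assoc]

lemma opS_Pj (s : (Fin n → ℝ) × (Fin n → ℝ) → ℂ) (j : ℕ) (f : 𝓢(Fin n → ℝ, ℂ)) :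
    opS (fun q => s q * psi j q.2) (Pj j f) = opS (fun q => s q * psi j q.2) f := by
  ext x
  refine opS_congr_FTg x fun ξ => ?_
  rw [FTg_Pj]
  simp only
  rw [← mul_assoc, mul_assoc (s (x, ξ)), psi_mul_psit]

lemma psit_close {i j : ℕ} {ξ : Fin n → ℝ} (hi : psit i ξ ≠ 0) (hj : psit j ξ ≠ 0) :
    j ≤ i + 4 := by
  by_contra hlt
  push Not at hlt
  by_cases h1 : 2 ^ (i + 2) ≤ ‖ξ‖
  · exact hi (psit_eq_zero_of_ge h1)
  push Not at h1
  exact hj (psit_eq_zero_of_le (by omega)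
    (h1.le.trans (pow_le_pow_right₀ (by norm_num) (by omega))))

lemma sum_lintegral_Pj_sq_le (I : Finset ℕ) (f : 𝓢(Fin n → ℝ, ℂ)) :
    ∑ j ∈ I, ∫⁻ x, ‖Pj j f x‖ₑ ^ 2 ≤ 20 * ∫⁻ x, ‖f x‖ₑ ^ 2 := by
  classical
  simp only [schwartz_plancherel, FTg_Pj]
  have hFm : Measurable fun ξ => ‖FTg f ξ‖ₑ := (continuous_FTg f.integrable).measurable.enorm
  have hps : ∀ j, Continuous (psit (n := n) j) := by
    intro j
    unfold psit
    have h1 := (contDiff_bet_smul (n := n) ((2 : ℝ) ^ (j + 1))⁻¹).continuous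
    have h2 := (contDiff_bet_smul (n := n) ((2 : ℝ) ^ (j - 2))⁻¹).continuous
    split_ifs
    · simpa using h1
    · exact h1.sub h2
  rw [← lintegral_finsetSum, ← lintegral_const_mul _ (hFm.pow_const 2)]
  · refine lintegral_mono fun ξ => ?_
    have h1 : ∀ j ∈ I, ‖psit j ξ * FTg f ξ‖ₑ ^ 2 ≤
        if psit j ξ ≠ 0 then 4 * ‖FTg f ξ‖ₑ ^ 2 else 0 := by
      intro j _
      split_ifs with h
      · rw [enorm_mul, mul_pow]
        refine mul_le_mul_left ?_ _
        have : ‖psit j ξ‖ₑ ≤ 2 := by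
          rw [← ofReal_norm]
          exact (ENNReal.ofReal_le_ofReal (norm_psit_le j ξ)).trans (by norm_num)
        calc ‖psit j ξ‖ₑ ^ 2 ≤ 2 ^ 2 := pow_le_pow_left' this 2
          _ = 4 := by norm_num
      · rw [not_not.1 h]; simp
    refine (Finset.sum_le_sum h1).trans ?_
    refine (sum_ite_le_of_close I (fun j => psit j ξ ≠ 0) 4 (fun i j => psit_close) _).trans ?_
    rw [← mul_assoc]
    refine mul_le_mul_left ?_ _
    norm_num
  · intro j _
    have : Measurable fun ξ => ‖psit j ξ * FTg f ξ‖ₑ ^ 2 := by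
      simp only [enorm_mul]
      exact ((hps j).measurable.enorm.mul hFm).pow_const 2
    exact this

end FrequencyPieces

section LTwo

variable {n : ℕ}

lemma lintegral_le_of_tendsto {α : Type*} [MeasurableSpace α] {μ : Measure α}
    {F : ℕ → α → ℝ≥0∞} {G : α → ℝ≥0∞} {K : ℝ≥0∞} (hF : ∀ k, Measurable (F k))
    (hlim : ∀ x, Filter.Tendsto (fun k => F k x) Filter.atTop (nhds (G x)))
    (hK : ∀ k, ∫⁻ x, F k x ∂μ ≤ K) : ∫⁻ x, G x ∂μ ≤ K := by
  calc ∫⁻ x, G x ∂μ = ∫⁻ x, Filter.liminf (fun k => F k x) Filter.atTop ∂μ := by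
        congr 1; ext x; exact (hlim x).liminf_eq.symm
    _ ≤ Filter.liminf (fun k => ∫⁻ x, F k x ∂μ) Filter.atTop := lintegral_liminf_le hF
    _ ≤ Filter.liminf (fun _ : ℕ => K) Filter.atTop :=
        Filter.liminf_le_liminf (Filter.Eventually.of_forall hK)
    _ = K := Filter.liminf_const K

lemma sum_sq_le_weighted (I : Finset ℕ) (a w : ℕ → ℝ≥0∞) (hw0 : ∀ j ∈ I, w j ≠ 0)
    (hwt : ∀ j ∈ I, w j ≠ ∞) :
    (∑ j ∈ I, a j) ^ 2 ≤ (∑ j ∈ I, (w j)⁻¹) * ∑ j ∈ I, w j * a j ^ 2 := by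
  have h := ENNReal.inner_le_Lp_mul_Lq I (fun j => (w j)⁻¹ ^ (1 / 2 : ℝ))
    (fun j => (w j) ^ (1 / 2 : ℝ) * a j) (p := 2) (q := 2)
    (Real.holderConjugate_iff.2 ⟨by norm_num, by norm_num⟩)
  have e1 : ∑ j ∈ I, (w j)⁻¹ ^ (1 / 2 : ℝ) * ((w j) ^ (1 / 2 : ℝ) * a j) = ∑ j ∈ I, a j := by
    refine Finset.sum_congr rfl fun j hj => ?_
    rw [← mul_assoc, ← ENNReal.mul_rpow_of_nonneg _ _ (by norm_num),
      ENNReal.inv_mul_cancel (hw0 j hj) (hwt j hj), ENNReal.one_rpow, one_mul]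
  have e2 : ∀ j, ((w j)⁻¹ ^ (1 / 2 : ℝ)) ^ (2 : ℝ) = (w j)⁻¹ := fun j => by
    rw [← ENNReal.rpow_mul]; norm_num
  have e3 : ∀ j, ((w j) ^ (1 / 2 : ℝ) * a j) ^ (2 : ℝ) = w j * a j ^ 2 := fun j => by
    rw [ENNReal.mul_rpow_of_nonneg _ _ (by norm_num), ← ENNReal.rpow_mul]; norm_num
  rw [e1] at h
  simp only [e2, e3] at h
  calc _ ≤ _ := pow_le_pow_left' h 2
    _ = _ := by
      rw [mul_pow, ← ENNReal.rpow_natCast, ← ENNReal.rpow_mul, ← ENNReal.rpow_natCast,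
        ← ENNReal.rpow_mul]
      norm_num

lemma opS_mul_left (g : (Fin n → ℝ) → ℂ) (s : (Fin n → ℝ) × (Fin n → ℝ) → ℂ)
    (f : (Fin n → ℝ) → ℂ) (x : Fin n → ℝ) :
    opS (fun q => s q * g q.1) f x = g x * opS s f x := by
  unfold opS
  rw [← integral_const_mul]
  congr 1; ext ξ
  ring

lemma FTg_finset_sum (I : Finset ℕ) {G : ℕ → (Fin n → ℝ) → ℂ} (hG : ∀ j ∈ I, Integrable (G j))
    (ξ : Fin n → ℝ) : FTg (fun x => ∑ j ∈ I, G j x) ξ = ∑ j ∈ I, FTg (G j) ξ := by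
  unfold FTg
  simp only [Finset.mul_sum]
  exact integral_finsetSum I fun j hj => integrable_ph_mul (hG j hj) ξ

lemma exists_sum_inv_gain {δ : ℝ} (hδ0 : 0 ≤ δ) (hδ1 : δ < 1) : ∃ K : NNReal, ∀ I : Finset ℕ,
    ∑ j ∈ I, (ENNReal.ofReal √((2 : ℝ) ^ j / 2 ^ ⌊δ * j⌋₊))⁻¹ ≤ K := by
  set x : ℝ := 2 ^ (-((1 - δ) / 2)) with hx
  have hx0 : 0 < x := by positivity
  have hx1 : x < 1 := Real.rpow_lt_one_of_one_lt_of_neg (by norm_num) (by linarith)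
  have hs : Summable fun j : ℕ => x ^ j := summable_geometric_of_lt_one hx0.le hx1
  refine ⟨(∑' j : ℕ, x ^ j).toNNReal, fun I => ?_⟩
  have h1 : ∀ j ∈ I, (ENNReal.ofReal √((2 : ℝ) ^ j / 2 ^ ⌊δ * j⌋₊))⁻¹ ≤ ENNReal.ofReal (x ^ j) := by
    intro j _
    have hf : (0 : ℝ) < √((2 : ℝ) ^ j / 2 ^ ⌊δ * j⌋₊) := Real.sqrt_pos.2 (by positivity)
    rw [← ENNReal.ofReal_inv_of_pos hf]
    refine ENNReal.ofReal_le_ofReal ?_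
    rw [Real.sqrt_eq_rpow, ← Real.rpow_natCast, ← Real.rpow_natCast, ← Real.rpow_natCast x,
      ← Real.rpow_sub (by norm_num), ← Real.rpow_mul (by norm_num), ← Real.rpow_neg (by norm_num),
      hx, ← Real.rpow_mul (by norm_num)]
    refine Real.rpow_le_rpow_of_exponent_le (by norm_num) ?_
    have := Nat.floor_le (mul_nonneg hδ0 (Nat.cast_nonneg j))
    linarith
  refine (Finset.sum_le_sum h1).trans ?_
  rw [← ENNReal.ofReal_sum_of_nonneg fun j _ => by positivity]
  exact ENNReal.ofReal_le_ofReal (hs.sum_le_tsum I fun j _ => by positivity)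

lemma sum_indicator_annulus_le (I : Finset ℕ) (t : ℝ) :
    ∑ j ∈ I, (if (2 : ℝ) ^ j / 32 < t ∧ t < 32 * 2 ^ j then (1 : ℝ≥0∞) else 0) ≤ 11 := by
  refine (sum_ite_le_of_close I (fun j => (2 : ℝ) ^ j / 32 < t ∧ t < 32 * 2 ^ j) 10
    (fun i j hi hj => ?_) 1).trans (by norm_num)
  have h1 : (2 : ℝ) ^ j < 2 ^ (i + 10) := by
    rw [pow_add]
    have := hj.1.trans hi.2
    rw [div_lt_iff₀ (by norm_num)] at this
    norm_num; linarith
  exact ((pow_lt_pow_iff_right₀ (by norm_num)).1 h1).le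

/-- The `L²` bound for finite sums of dyadic pieces. -/
theorem L2_finite_sums {δ C : ℝ} [NeZero n] (hC : 0 ≤ C) (hδ0 : 0 ≤ δ) (hδ1 : δ < 1)
    {S : (Fin n → ℝ) × (Fin n → ℝ) → ℂ} (hS : ContDiff ℝ (⊤ : ℕ∞) S) (h : SClass 0 δ δ C S) :
    ∃ A : NNReal, ∀ (I : Finset ℕ) (f : 𝓢(Fin n → ℝ, ℂ)),
      ∫⁻ x, ‖∑ j ∈ I, opS (fun q => S q * psi j q.2) f x‖ₑ ^ 2 ≤ A * ∫⁻ x, ‖f x‖ₑ ^ 2 := by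
  obtain ⟨A, hA0, hA⟩ := exists_symAt_piece hC le_rfl hδ0 hδ1.le hδ0 hδ1.le hS h
  obtain ⟨P, hP0, hP⟩ := exists_symAt_chi n
  obtain ⟨D, hD⟩ := scaled_average n
  obtain ⟨K, hK⟩ := exists_sum_inv_gain hδ0 hδ1
  set M : ℝ := 2 ^ (2 * NN n) * (A * P) with hM
  have hM0 : 0 ≤ M := by positivity
  refine ⟨(11 + K) * (D * M.toNNReal ^ 2 * 20), fun I f => ?_⟩
  set r : ℕ → ℕ := fun j => ⌊δ * j⌋₊ with hr
  have hδj : ∀ j : ℕ, 0 ≤ δ * j := fun j => mul_nonneg hδ0 (Nat.cast_nonneg j)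
  have hrj : ∀ j, r j ≤ j := fun j => Nat.floor_le_of_le
    (mul_le_of_le_one_left (Nat.cast_nonneg j) hδ1.le)
  have hp : ∀ j, ∀ q, SymAt ((2 : ℝ) ^ r j) A (fun q => S q * psi j q.2) q := by
    intro j q
    have := hA j (r j) (Nat.floor_le (hδj j)) (Nat.lt_floor_add_one _).le q
    simpa using this
  have hsm : ∀ j, ContDiff ℝ (⊤ : ℕ∞) (fun q : (Fin n → ℝ) × (Fin n → ℝ) => S q * psi j q.2) :=
    fun j => hS.mul ((contDiff_psi j).comp contDiff_snd)
  have hcT : ∀ j, Continuous (opS (fun q => S q * psi j q.2) f) := fun j =>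
    continuous_opS (hsm j).continuous (fun q => (hp j q).norm_le) f
  have key : ∀ ε : ℝ, 0 < ε → ε ≤ 1 →
      ∫⁻ x, ‖bet (ε • x) * ∑ j ∈ I, opS (fun q => S q * psi j q.2) f x‖ₑ ^ 2 ≤
        ((11 + K) * (D * M.toNNReal ^ 2 * 20) : NNReal) * ∫⁻ x, ‖f x‖ₑ ^ 2 := by
    intro ε hε hε1
    have hbs : ContDiff ℝ (⊤ : ℕ∞) (fun q : (Fin n → ℝ) × (Fin n → ℝ) => bet (ε • q.1)) :=
      (contDiff_bet_smul ε).comp contDiff_fst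
    obtain ⟨s, hs⟩ : ∃ s : ℕ → (Fin n → ℝ) × (Fin n → ℝ) → ℂ,
        s = fun j q => (S q * psi j q.2) * bet (ε • q.1) := ⟨_, rfl⟩
    have hsC : ∀ j, ContDiff ℝ (⊤ : ℕ∞) (s j) := fun j => by rw [hs]; exact (hsm j).mul hbs
    have hsS : ∀ j q, SymAt ((2 : ℝ) ^ r j) M (s j) q := fun j q => by
      rw [hs]
      exact SymAt.mul hA0 hP0 (hsm j) hbs (hp j q)
        (hP _ ε (one_le_pow₀ (by norm_num)) hε hε1 q)
    have hsK : ∀ j x ξ, 2 / ε < ‖x‖ → s j (x, ξ) = 0 := by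
      intro j x ξ hx
      simp only [hs]
      rw [bet_eq_zero, mul_zero]
      rw [norm_smul, Real.norm_of_nonneg hε.le]
      rw [div_lt_iff₀ hε] at hx
      linarith
    have hG : ∀ j x, opS (s j) f x = bet (ε • x) * opS (fun q => S q * psi j q.2) f x := by
      intro j x
      rw [hs]
      exact opS_mul_left (fun x => bet (ε • x)) _ _ x
    have hG2 : ∀ j, opS (s j) (Pj j f) = opS (s j) f := by
      intro j
      ext x
      rw [hG, ← congrFun (opS_Pj S j f) x, hs]
      exact opS_mul_left (fun x => bet (ε • x)) _ _ x
    have hav : ∀ j, Integrable (FTg (opS (s j) f)) ∧ ∀ w : (Fin n → ℝ) → ℝ≥0∞, Measurable w →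
        (∀ ζ, w ζ ≤ ENNReal.ofReal √((2 : ℝ) ^ j / 2 ^ r j)) →
        (∀ ζ, (2 : ℝ) ^ j / 32 < ‖ζ‖ → ‖ζ‖ < 32 * 2 ^ j → w ζ ≤ 1) →
        ∫⁻ ζ, w ζ * ‖FTg (opS (s j) f) ζ‖ₑ ^ 2 ≤
          D * ENNReal.ofReal M ^ 2 * ∫⁻ x, ‖Pj j f x‖ₑ ^ 2 := by
      intro j
      have := hD (s j) M (2 / ε) (2 ^ r j) (2 ^ j) (hsC j) hM0 (by positivity)
        (pow_le_pow_right₀ (by norm_num) (hrj j)) (hsS j) (hsK j)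
        (fun x ξ hξ => by simp only [hs]; rw [psi_eq_zero_of_ge hξ.le]; ring)
        (fun hlt x ξ hξ => by
          have hj0 : j ≠ 0 := by
            rintro rfl
            have := hrj 0
            rw [Nat.le_zero.1 this] at hlt
            exact lt_irrefl _ hlt
          simp only [hs]; rw [psi_eq_zero_of_le hj0 hξ.le]; ring) (Pj j f)
      rw [hG2] at this
      exact this
    have hGc : ∀ j, Continuous (opS (s j) f) := fun j =>
      continuous_opS (hsC j).continuous (fun q => (hsS j q).norm_le) f
    have hGi : ∀ j, Integrable (opS (s j) f) := fun j =>
      (hGc j).integrable_of_hasCompactSupport (hasCompactSupport_opS (hsK j) f)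
    obtain ⟨w, hw⟩ : ∃ w : ℕ → (Fin n → ℝ) → ℝ≥0∞, w = fun j ζ =>
        if (2 : ℝ) ^ j / 32 < ‖ζ‖ ∧ ‖ζ‖ < 32 * 2 ^ j then 1
        else ENNReal.ofReal √((2 : ℝ) ^ j / 2 ^ r j) := ⟨_, rfl⟩
    have hwm : ∀ j, Measurable (w j) := fun j => by
      rw [hw]
      refine Measurable.ite ?_ measurable_const measurable_const
      exact (measurableSet_lt measurable_const measurable_norm).inter
        (measurableSet_lt measurable_norm measurable_const)
    have hone : ∀ j, (1 : ℝ≥0∞) ≤ ENNReal.ofReal √((2 : ℝ) ^ j / 2 ^ r j) := fun j => by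
      rw [ENNReal.one_le_ofReal, Real.one_le_sqrt, one_le_div (by positivity)]
      exact pow_le_pow_right₀ (by norm_num) (hrj j)
    have hw1 : ∀ j ζ, 1 ≤ w j ζ := fun j ζ => by
      simp only [hw]; split_ifs
      · exact le_rfl
      · exact hone j
    have hwt : ∀ j ζ, w j ζ ≠ ∞ := fun j ζ => by
      simp only [hw]; split_ifs <;> finiteness
    have hwb : ∀ j, ∫⁻ ζ, w j ζ * ‖FTg (opS (s j) f) ζ‖ₑ ^ 2 ≤
          D * ENNReal.ofReal M ^ 2 * ∫⁻ x, ‖Pj j f x‖ₑ ^ 2 := fun j =>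
      (hav j).2 (w j) (hwm j) (fun ζ => by
        simp only [hw]; split_ifs
        · exact hone j
        · exact le_rfl) (fun ζ h1 h2 => by simp [hw, h1, h2])
    have hsumw : ∀ ζ, ∑ j ∈ I, (w j ζ)⁻¹ ≤ 11 + K := by
      intro ζ
      have hle : ∀ j ∈ I, (w j ζ)⁻¹ ≤
          (if (2 : ℝ) ^ j / 32 < ‖ζ‖ ∧ ‖ζ‖ < 32 * 2 ^ j then (1 : ℝ≥0∞) else 0)
            + (ENNReal.ofReal √((2 : ℝ) ^ j / 2 ^ r j))⁻¹ := by
        intro j _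
        simp only [hw]; split_ifs
        · simp
        · simp
      refine (Finset.sum_le_sum hle).trans ?_
      rw [Finset.sum_add_distrib]
      exact add_le_add (sum_indicator_annulus_le I _) (hK I)
    have hsum : (fun x => bet (ε • x) * ∑ j ∈ I, opS (fun q => S q * psi j q.2) f x)
        = fun x => ∑ j ∈ I, opS (s j) f x := by
      ext x; simp only [hG, Finset.mul_sum]
    have hFs : FTg (fun x => ∑ j ∈ I, opS (s j) f x) = fun ζ => ∑ j ∈ I, FTg (opS (s j) f) ζ :=
      funext fun ζ => FTg_finset_sum I (fun j _ => hGi j) ζ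
    have hpl := FTg_plancherel (u := fun x => ∑ j ∈ I, opS (s j) f x)
      (continuous_finsetSum I fun j _ => hGc j) (integrable_finsetSum I fun j _ => hGi j)
      (by rw [hFs]; exact integrable_finsetSum I fun j _ => (hav j).1)
    have e0 := congrFun hsum
    simp only [e0]
    rw [hpl, hFs]
    have hFm : ∀ j, Measurable fun ζ => w j ζ * ‖FTg (opS (s j) f) ζ‖ₑ ^ 2 := fun j =>
      (hwm j).mul ((continuous_FTg (hGi j)).measurable.enorm.pow_const 2)
    calc ∫⁻ ζ, ‖∑ j ∈ I, FTg (opS (s j) f) ζ‖ₑ ^ 2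
        ≤ ∫⁻ ζ, (11 + K) * ∑ j ∈ I, w j ζ * ‖FTg (opS (s j) f) ζ‖ₑ ^ 2 := by
          refine lintegral_mono fun ζ => ?_
          refine (pow_le_pow_left' (enorm_sum_le I _) 2).trans ?_
          refine (sum_sq_le_weighted I _ (fun j => w j ζ)
            (fun j _ => (zero_lt_one.trans_le (hw1 j ζ)).ne') (fun j _ => hwt j ζ)).trans ?_
          exact mul_le_mul_left (hsumw ζ) _
      _ = (11 + K) * ∑ j ∈ I, ∫⁻ ζ, w j ζ * ‖FTg (opS (s j) f) ζ‖ₑ ^ 2 := by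
          rw [lintegral_const_mul _ (Finset.measurable_sum I fun j _ => hFm j),
            lintegral_finsetSum I fun j _ => hFm j]
      _ ≤ (11 + K) * ∑ j ∈ I, D * ENNReal.ofReal M ^ 2 * ∫⁻ x, ‖Pj j f x‖ₑ ^ 2 :=
          mul_le_mul_right (Finset.sum_le_sum fun j _ => hwb j) _
      _ ≤ (11 + K) * (D * ENNReal.ofReal M ^ 2 * (20 * ∫⁻ x, ‖f x‖ₑ ^ 2)) := by
          rw [← Finset.mul_sum]
          exact mul_le_mul_right (mul_le_mul_right (sum_lintegral_Pj_sq_le I f) _) _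
      _ = _ := by
          push_cast
          rw [ENNReal.ofReal]; ring
  refine lintegral_le_of_tendsto (F := fun k x =>
    ‖bet (((k : ℝ) + 1)⁻¹ • x) * ∑ j ∈ I, opS (fun q => S q * psi j q.2) f x‖ₑ ^ 2) ?_ ?_ ?_
  · intro k
    have : Continuous fun x => bet (((k : ℝ) + 1)⁻¹ • x) *
        ∑ j ∈ I, opS (fun q => S q * psi j q.2) f x :=
      (contDiff_bet_smul _).continuous.mul (continuous_finsetSum I fun j _ => hcT j)
    exact this.measurable.enorm.pow_const 2
  · intro x
    refine tendsto_const_nhds.congr' ?_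
    obtain ⟨k0, hk0⟩ := exists_nat_ge ‖x‖
    filter_upwards [Filter.eventually_ge_atTop k0] with k hk
    have hk' : (k0 : ℝ) ≤ k := by exact_mod_cast hk
    rw [bet_eq_one, one_mul]
    rw [norm_smul, norm_inv, Real.norm_of_nonneg (by positivity), inv_mul_le_iff₀ (by positivity)]
    linarith
  · intro k
    exact key _ (by positivity) (inv_le_one_of_one_le₀ (by
      have : (0 : ℝ) ≤ k := Nat.cast_nonneg k
      linarith))

end LTwo

section FarPieces

variable {n : ℕ}

/-- Averaging over balls of radius `l` dominates the integral. -/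
lemma lintegral_le_average_balls {g : (Fin n → ℝ) → ℝ≥0∞} (hg : Measurable g) {l : ℝ} (hl : 0 ≤ l)
    {A B : Set (Fin n → ℝ)} (hA : MeasurableSet A)
    (hAB : ∀ x ∈ A, Metric.closedBall x l ⊆ B) :
    ENNReal.ofReal ((2 * l) ^ n) * ∫⁻ x in A, g x ≤
      ∫⁻ c in B, ∫⁻ x in Metric.closedBall c l, g x := by
  have hm : Measurable fun p : (Fin n → ℝ) × (Fin n → ℝ) =>
      (Metric.closedBall p.1 l).indicator g p.2 := by
    have : (fun p : (Fin n → ℝ) × (Fin n → ℝ) => (Metric.closedBall p.1 l).indicator g p.2)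
        = {p : (Fin n → ℝ) × (Fin n → ℝ) | dist p.2 p.1 ≤ l}.indicator fun p => g p.2 := by
      ext p; simp [Set.indicator]
    rw [this]
    refine (hg.comp measurable_snd).indicator (measurableSet_le ?_ measurable_const)
    fun_prop
  have e1 : ∀ c, ∫⁻ x in Metric.closedBall c l, g x
      = ∫⁻ x, (Metric.closedBall c l).indicator g x := fun c =>
    (lintegral_indicator measurableSet_closedBall g).symm
  simp only [e1]
  rw [lintegral_lintegral_swap hm.aemeasurable, ← lintegral_const_mul _ hg,
    ← lintegral_indicator hA]
  refine lintegral_mono fun x => ?_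
  by_cases hx : x ∈ A
  · rw [Set.indicator_of_mem hx]
    have e2 : ∀ c, (Metric.closedBall c l).indicator g x
        = (Metric.closedBall x l).indicator (fun _ => g x) c := fun c => by
      simp [Set.indicator, dist_comm]
    simp only [e2]
    rw [lintegral_indicator_const measurableSet_closedBall,
      Measure.restrict_apply measurableSet_closedBall, Set.inter_eq_left.2 (hAB x hx),
      Real.volume_pi_closedBall _ hl, Fintype.card_fin, mul_comm]
  · rw [Set.indicator_of_notMem hx]; exact zero_le

lemma wt_far_le {t L : ℝ} (ht : 0 < t) (htL : t ≤ L) {y c c' : Fin n → ℝ}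
    (hc : ‖c' - c‖ ≤ t⁻¹ * 2) (hy : t⁻¹ * 4 ≤ ‖y - c‖) :
    wt (L • (y - c')) ≤ ENNReal.ofReal (4 ^ (2 * NN n) * (t / L) ^ (n + 1)) * wt (t • (y - c)) := by
  have hL : 0 < L := ht.trans_le htL
  unfold wt
  rw [← ENNReal.ofReal_mul (by positivity)]
  apply ENNReal.ofReal_le_ofReal
  have h1 : ‖y - c‖ / 2 ≤ ‖y - c'‖ := by
    have : ‖y - c‖ ≤ ‖y - c'‖ + ‖c' - c‖ := by
      have := norm_add_le (y - c') (c' - c)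
      rwa [sub_add_sub_cancel] at this
    linarith
  have h2 : 4 ≤ t * ‖y - c‖ := by
    rw [inv_mul_le_iff₀ ht] at hy; exact hy
  have h3 : (L / t / 4) * (1 + t * ‖y - c‖) ≤ 1 + L * ‖y - c'‖ := by
    have e1 : L / t * (t * ‖y - c‖ / 2) = L * (‖y - c‖ / 2) := by field_simp
    have e2 : L / t * ((1 + t * ‖y - c‖) / 4) ≤ L / t * (t * ‖y - c‖ / 2) := by
      exact mul_le_mul_of_nonneg_left (by linarith) (by positivity)
    have e3 : L * (‖y - c‖ / 2) ≤ L * ‖y - c'‖ := by gcongr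
    have e4 : (L / t / 4) * (1 + t * ‖y - c‖) = L / t * ((1 + t * ‖y - c‖) / 4) := by ring
    linarith
  have hN : n + 1 ≤ 2 * NN n := by unfold NN; omega
  unfold wR
  rw [norm_smul, norm_smul, Real.norm_of_nonneg ht.le, Real.norm_of_nonneg hL.le]
  have h4 : ((L / t / 4) * (1 + t * ‖y - c‖)) ^ (2 * NN n) ≤ (1 + L * ‖y - c'‖) ^ (2 * NN n) := by
    gcongr
  have h5 : 0 < ((L / t / 4) * (1 + t * ‖y - c‖)) ^ (2 * NN n) := by positivity
  refine (inv_anti₀ h5 h4).trans ?_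
  rw [mul_pow, mul_inv]
  refine mul_le_mul_of_nonneg_right ?_ (by positivity)
  have e : ((L / t / 4) ^ (2 * NN n))⁻¹ = 4 ^ (2 * NN n) * (t / L) ^ (2 * NN n) := by
    rw [← inv_pow, ← mul_pow]; congr 1; field_simp
  rw [e]
  refine mul_le_mul_of_nonneg_left ?_ (by positivity)
  exact pow_le_pow_of_le_one (by positivity) ((div_le_one hL).2 htL) hN

/-- Off-diagonal bound: `f` vanishes on the ball of radius `4/t`. -/
theorem far_bound (n : ℕ) [NeZero n] : ∃ C : NNReal,
    ∀ (s : (Fin n → ℝ) × (Fin n → ℝ) → ℂ) (M L B t : ℝ), ContDiff ℝ (⊤ : ℕ∞) s → 0 ≤ M → 0 < t →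
    t ≤ L → L ≤ B → (∀ q, SymAt L M s q) → (∀ x ξ, 2 * B < ‖ξ‖ → s (x, ξ) = 0) →
    ∀ (f : 𝓢(Fin n → ℝ, ℂ)) (c : Fin n → ℝ), (∀ y, ‖y - c‖ < t⁻¹ * 4 → f y = 0) →
    ∫⁻ x in Metric.closedBall c t⁻¹, ‖opS s f x‖ₑ ^ 2 ≤
      C * ENNReal.ofReal M ^ 2 * ENNReal.ofReal (t / L) * Vc t f c := by
  obtain ⟨C, hC⟩ := local_bounds n
  refine ⟨C * (4 ^ (2 * NN n) * 2 ^ n), ?_⟩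
  intro s M L B t hs hM ht htL hLB hsym hsupp f c hf
  have hL : 0 < L := ht.trans_le htL
  have hgm : Measurable fun x => ‖opS s f x‖ₑ ^ 2 :=
    (continuous_opS hs.continuous (fun q => (hsym q).norm_le) f).measurable.enorm.pow_const 2
  have hLt : L⁻¹ ≤ t⁻¹ := inv_anti₀ ht htL
  have h1 := lintegral_le_average_balls hgm (l := L⁻¹) (by positivity)
    (A := Metric.closedBall c t⁻¹) (B := Metric.closedBall c (t⁻¹ * 2)) measurableSet_closedBall
    (fun x hx => Metric.closedBall_subset_closedBall' (by
      rw [Metric.mem_closedBall] at hx; linarith))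
  have h2 : ∀ c' ∈ Metric.closedBall c (t⁻¹ * 2),
      ∫⁻ x in Metric.closedBall c' L⁻¹, ‖opS s f x‖ₑ ^ 2 ≤ C * ENNReal.ofReal M ^ 2 *
        (ENNReal.ofReal (4 ^ (2 * NN n) * (t / L) ^ (n + 1)) * Vc t f c) := by
    intro c' hc'
    have hsub : Metric.closedBall c' L⁻¹ ⊆ Metric.closedBall c' (L⁻¹ * 2) :=
      Metric.closedBall_subset_closedBall (by have : 0 < L⁻¹ := by positivity
                                              linarith)
    refine (lintegral_mono_set hsub).trans ((hC s M L B hs hM hL hLB hsym hsupp f c').1.trans ?_)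
    refine mul_le_mul_right ?_ _
    unfold Vc
    rw [← lintegral_const_mul' _ _ ENNReal.ofReal_ne_top]
    refine lintegral_mono fun y => ?_
    by_cases hy : ‖y - c‖ < t⁻¹ * 4
    · simp [hf y hy]
    · rw [mul_left_comm]
      refine mul_le_mul_right ?_ _
      exact wt_far_le ht htL (by rwa [Metric.mem_closedBall, dist_eq_norm] at hc') (not_lt.1 hy)
  have h3 := h1.trans (setLIntegral_mono measurable_const h2)
  rw [setLIntegral_const, Real.volume_pi_closedBall _ (by positivity), Fintype.card_fin] at h3
  have hp : ENNReal.ofReal ((2 * L⁻¹) ^ n) ≠ 0 := by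
    rw [Ne, ENNReal.ofReal_eq_zero, not_le]; positivity
  refine (ENNReal.mul_le_mul_iff_right hp ENNReal.ofReal_ne_top).1 (h3.trans_eq ?_)
  have e : ENNReal.ofReal (4 ^ (2 * NN n) * (t / L) ^ (n + 1)) * ENNReal.ofReal ((2 * (t⁻¹ * 2)) ^ n)
      = ENNReal.ofReal ((2 * L⁻¹) ^ n) * ((4 ^ (2 * NN n) * 2 ^ n : NNReal) * ENNReal.ofReal (t / L)) := by
    have e0 : (((4 ^ (2 * NN n) * 2 ^ n : NNReal)) : ℝ≥0∞) = ENNReal.ofReal (4 ^ (2 * NN n) * 2 ^ n) := by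
      rw [ENNReal.ofReal_mul (by positivity), ENNReal.ofReal_pow (by norm_num),
        ENNReal.ofReal_pow (by norm_num)]
      push_cast
      norm_num
    rw [e0, ← ENNReal.ofReal_mul (by positivity), ← ENNReal.ofReal_mul (by positivity),
      ← ENNReal.ofReal_mul (by positivity)]
    congr 1
    have e1 : (t / L) ^ (n + 1) = t ^ n * (L⁻¹) ^ n * (t / L) := by
      rw [pow_succ, ← mul_pow, div_eq_mul_inv]
    have e2 : t ^ n * (t⁻¹) ^ n = 1 := by rw [← mul_pow, mul_inv_cancel₀ ht.ne', one_pow]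
    rw [e1, mul_pow, mul_pow, mul_pow]
    linear_combination (4 ^ (2 * NN n) * (L⁻¹) ^ n * (t / L) * 2 ^ n * 2 ^ n) * e2
  rw [ENNReal.coe_mul]
  calc _ = C * ENNReal.ofReal M ^ 2 * Vc t f c * (ENNReal.ofReal (4 ^ (2 * NN n) * (t / L) ^ (n + 1)) * ENNReal.ofReal ((2 * (t⁻¹ * 2)) ^ n)) := by ring
    _ = _ := by rw [e]; ring

end FarPieces

section FarSums

variable {n : ℕ}

lemma ennreal_add_sq_le (a b : ℝ≥0∞) : (a + b) ^ 2 ≤ 4 * (a ^ 2 + b ^ 2) := by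
  rcases le_total a b with h | h
  · calc (a + b) ^ 2 ≤ (b + b) ^ 2 := pow_le_pow_left' (add_le_add_left h b) 2
      _ = 4 * b ^ 2 := by ring
      _ ≤ _ := mul_le_mul_right le_add_self _
  · calc (a + b) ^ 2 ≤ (a + a) ^ 2 := pow_le_pow_left' (add_le_add_right h a) 2
      _ = 4 * a ^ 2 := by ring
      _ ≤ _ := mul_le_mul_right le_self_add _

lemma opS_add {s : (Fin n → ℝ) × (Fin n → ℝ) → ℂ} {M : ℝ} (hs : Continuous s)
    (hM : ∀ q, ‖s q‖ ≤ M) (f g : 𝓢(Fin n → ℝ, ℂ)) (x : Fin n → ℝ) :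
    opS s (f + g : 𝓢(Fin n → ℝ, ℂ)) x = opS s f x + opS s g x := by
  have hi : ∀ f : 𝓢(Fin n → ℝ, ℂ), Integrable fun ξ => ph x (-ξ) * s (x, ξ) * FTg f ξ := fun f => by
    refine Integrable.bdd_mul (c := M) (integrable_FTg_schwartz f)
      (Continuous.aestronglyMeasurable (by fun_prop)) (Filter.Eventually.of_forall fun ξ => ?_)
    simpa [norm_ph] using hM (x, ξ)
  have e : ∀ ξ, FTg (f + g : 𝓢(Fin n → ℝ, ℂ)) ξ = FTg f ξ + FTg g ξ := fun ξ => by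
    unfold FTg
    rw [← integral_add (integrable_ph_mul f.integrable ξ) (integrable_ph_mul g.integrable ξ)]
    congr 1; ext y
    rw [← mul_add]; rfl
  unfold opS
  rw [← integral_add (hi f) (hi g)]
  congr 1; ext ξ
  rw [e, mul_add]

/-- Sums of pieces whose symbol scale is finer than `1/t` are bounded in `L²` on balls of radius
`1/t` by the weighted norm at scale `t`. -/
theorem far_sum_bound {m ρ δ C : ℝ} [NeZero n] (hC : 0 ≤ C) (hm : 0 ≤ m) (hδ0 : 0 ≤ δ) (hδ1 : δ < 1)
    (hδρ : δ ≤ ρ) (hρ1 : ρ ≤ 1) {S : (Fin n → ℝ) × (Fin n → ℝ) → ℂ}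
    (hS : ContDiff ℝ (⊤ : ℕ∞) S) (h : SClass m ρ δ C S) (K : NNReal)
    (hK : ∀ t : ℝ, 0 < t → ∀ I : Finset ℕ, (∀ j ∈ I, t ≤ 2 ^ ⌊ρ * j⌋₊) →
      ∑ j ∈ I, ENNReal.ofReal (2 ^ (-(j * m)) * √(t / 2 ^ ⌊ρ * j⌋₊)) ≤ K) :
    ∃ A : NNReal, ∀ t : ℝ, 0 < t → ∀ I : Finset ℕ, (∀ j ∈ I, t ≤ 2 ^ ⌊ρ * j⌋₊) →
      ∀ (f : 𝓢(Fin n → ℝ, ℂ)) (c : Fin n → ℝ), ∫⁻ x in Metric.closedBall c t⁻¹,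
        ‖∑ j ∈ I, opS (fun q => S q * psi j q.2) f x‖ₑ ^ 2 ≤ A * Vc t f c := by
  have hρ0 : 0 ≤ ρ := hδ0.trans hδρ
  obtain ⟨A, hA0, hA⟩ := exists_symAt_piece hC hm hδ0 hδ1.le hρ0 hρ1 hS h
  obtain ⟨D, hD⟩ := L2_finite_sums hC hδ0 hδ1 hS (h.mono hC hm hδρ)
  obtain ⟨F, hF⟩ := far_bound n
  refine ⟨4 * (D * 9 ^ (2 * NN n) + K * (F * A.toNNReal ^ 2 * K)), ?_⟩
  intro t ht I hI f c
  have hrj : ∀ j : ℕ, ⌊ρ * j⌋₊ ≤ j := fun j => Nat.floor_le_of_le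
    (mul_le_of_le_one_left (Nat.cast_nonneg j) hρ1)
  have hp : ∀ j : ℕ, ∀ q, SymAt ((2 : ℝ) ^ ⌊ρ * j⌋₊) (A * 2 ^ (-(j * m)))
      (fun q => S q * psi j q.2) q := fun j q =>
    hA j _ (Nat.floor_le (mul_nonneg hρ0 (Nat.cast_nonneg j)))
      ((mul_le_mul_of_nonneg_right hδρ (Nat.cast_nonneg j)).trans (Nat.lt_floor_add_one _).le) q
  have hsm : ∀ j, ContDiff ℝ (⊤ : ℕ∞) (fun q : (Fin n → ℝ) × (Fin n → ℝ) => S q * psi j q.2) :=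
    fun j => hS.mul ((contDiff_psi j).comp contDiff_snd)
  have hcT : ∀ j, ∀ g : 𝓢(Fin n → ℝ, ℂ), Continuous (opS (fun q => S q * psi j q.2) g) := fun j g =>
    continuous_opS (hsm j).continuous (fun q => (hp j q).norm_le) g
  obtain ⟨f1, hf1⟩ : ∃ f1 : 𝓢(Fin n → ℝ, ℂ), ∀ y, f1 y = bet ((t / 4) • (y - c)) * f y := by
    have h1 : ContDiff ℝ (⊤ : ℕ∞) fun y : Fin n → ℝ => bet ((t / 4) • (y - c)) :=
      (contDiff_bet_smul (t / 4)).comp (contDiff_id.sub contDiff_const)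
    have h2 : HasCompactSupport fun y : Fin n → ℝ => bet ((t / 4) • (y - c)) := by
      have := (hasCompactSupport_bet_smul (n := n) (c := t / 4) (by positivity)).comp_homeomorph
        (Homeomorph.subRight c)
      exact this
    have h3 : HasCompactSupport fun y : Fin n → ℝ => bet ((t / 4) • (y - c)) * f y := h2.mul_right
    exact ⟨h3.toSchwartzMap (h1.mul f.smooth'), fun y => rfl⟩
  obtain ⟨f2, hf2⟩ : ∃ f2 : 𝓢(Fin n → ℝ, ℂ), f2 = f - f1 := ⟨_, rfl⟩
  have hff : f = f1 + f2 := by rw [hf2]; abel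
  have hf2v : ∀ y, f2 y = (1 - bet ((t / 4) • (y - c))) * f y := fun y => by
    have : f2 y = f y - f1 y := by rw [hf2]; rfl
    rw [this, hf1]; ring
  have hnorm : ∀ y : Fin n → ℝ, ‖(t / 4) • (y - c)‖ = t * ‖y - c‖ / 4 := fun y => by
    rw [norm_smul, Real.norm_of_nonneg (by positivity)]; ring
  have hnear : ∫⁻ x, ‖f1 x‖ₑ ^ 2 ≤ 9 ^ (2 * NN n) * Vc t f c := by
    unfold Vc
    rw [← lintegral_const_mul' _ _ (by finiteness)]
    refine lintegral_mono fun y => ?_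
    by_cases hy : 2 ≤ ‖(t / 4) • (y - c)‖
    · rw [hf1, bet_eq_zero hy]; simp
    · rw [hf1, mul_left_comm, enorm_mul, mul_pow, mul_comm]
      refine mul_le_mul_right ?_ _
      have h1 : ‖bet ((t / 4) • (y - c))‖ₑ ^ 2 ≤ 1 := by
        have : ‖bet ((t / 4) • (y - c))‖ₑ ≤ 1 := by
          rw [← ofReal_norm, ENNReal.ofReal_le_one]; exact norm_bet_le _
        simpa using pow_le_pow_left' this 2
      refine h1.trans ?_
      rw [← wt_mul_wi (t • (y - c)), mul_comm]
      refine mul_le_mul_left ?_ _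
      have h9 : (9 : ℝ≥0∞) ^ (2 * NN n) = ENNReal.ofReal (9 ^ (2 * NN n)) := by
        rw [ENNReal.ofReal_pow (by norm_num)]; norm_num
      unfold wi wR
      rw [h9]
      refine ENNReal.ofReal_le_ofReal ?_
      have : ‖t • (y - c)‖ ≤ 8 := by
        rw [hnorm] at hy
        rw [norm_smul, Real.norm_of_nonneg ht.le]; linarith
      gcongr
      linarith
  obtain ⟨θ, hθ⟩ : ∃ θ : ℕ → ℝ, θ = fun j : ℕ => 2 ^ (-(j * m)) * √(t / 2 ^ ⌊ρ * j⌋₊) := ⟨_, rfl⟩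
  have hθ0 : ∀ j, 0 < θ j := fun j => by
    rw [hθ]
    have : 0 < √(t / 2 ^ ⌊ρ * j⌋₊) := Real.sqrt_pos.2 (by positivity)
    positivity
  have hfarj : ∀ j ∈ I, ∫⁻ x in Metric.closedBall c t⁻¹, ‖opS (fun q => S q * psi j q.2) f2 x‖ₑ ^ 2
      ≤ F * A.toNNReal ^ 2 * ENNReal.ofReal (θ j) ^ 2 * Vc t f c := by
    intro j hj
    refine (hF _ (A * 2 ^ (-(j * m))) (2 ^ ⌊ρ * j⌋₊) (2 ^ j) t (hsm j) (by positivity) ht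
      (hI j hj) (pow_le_pow_right₀ (by norm_num) (hrj j)) (hp j)
      (fun x ξ hξ => by simp only; rw [psi_eq_zero_of_ge hξ.le]; ring) f2 c (fun y hy => by
        rw [hf2v, bet_eq_one, sub_self, zero_mul]
        rw [hnorm]
        rw [← div_eq_inv_mul, lt_div_iff₀ ht] at hy
        linarith)).trans ?_
    have e1 : (F : ℝ≥0∞) * ENNReal.ofReal (A * 2 ^ (-(j * m))) ^ 2 * ENNReal.ofReal (t / 2 ^ ⌊ρ * j⌋₊)
        = F * A.toNNReal ^ 2 * ENNReal.ofReal (θ j) ^ 2 := by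
      rw [hθ]
      simp only
      rw [ENNReal.ofReal_mul hA0, ENNReal.ofReal_mul (by positivity), mul_pow, mul_pow,
        ← ENNReal.ofReal_pow (Real.sqrt_nonneg _), Real.sq_sqrt (by positivity)]
      simp only [ENNReal.ofReal]
      ring
    rw [e1]
    refine mul_le_mul_right ?_ _
    unfold Vc
    refine lintegral_mono fun y => ?_
    refine mul_le_mul_left (pow_le_pow_left' ?_ 2) _
    by_cases hy : 2 ≤ ‖(t / 4) • (y - c)‖
    · rw [hf2v, bet_eq_zero hy]; simp
    · rw [hf2v, enorm_mul]
      refine mul_le_of_le_one_left' ?_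
      rw [← ofReal_norm, ENNReal.ofReal_le_one]
      have e : (1 : ℂ) - bet ((t / 4) • (y - c)) = ((1 - betB n ((t / 4) • (y - c)) : ℝ) : ℂ) := by
        unfold bet; push_cast; ring
      rw [e, Complex.norm_real, Real.norm_of_nonneg (by linarith [(betB n).le_one (x := (t / 4) • (y - c))])]
      linarith [(betB n).nonneg (x := (t / 4) • (y - c))]
  have hfar : ∫⁻ x in Metric.closedBall c t⁻¹, ‖∑ j ∈ I, opS (fun q => S q * psi j q.2) f2 x‖ₑ ^ 2
      ≤ K * (F * A.toNNReal ^ 2 * K) * Vc t f c := by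
    have hmeas : ∀ j, Measurable fun x => (ENNReal.ofReal (θ j))⁻¹ *
        ‖opS (fun q => S q * psi j q.2) f2 x‖ₑ ^ 2 := fun j =>
      measurable_const.mul ((hcT j f2).measurable.enorm.pow_const 2)
    have hne : ∀ j, ENNReal.ofReal (θ j) ≠ 0 := fun j => by
      rw [Ne, ENNReal.ofReal_eq_zero, not_le]; exact hθ0 j
    have hKI : ∑ j ∈ I, ENNReal.ofReal (θ j) ≤ K := by rw [hθ]; exact hK t ht I hI
    calc _ ≤ ∫⁻ x in Metric.closedBall c t⁻¹, K * ∑ j ∈ I, (ENNReal.ofReal (θ j))⁻¹ *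
          ‖opS (fun q => S q * psi j q.2) f2 x‖ₑ ^ 2 := by
          refine lintegral_mono fun x => ?_
          refine (pow_le_pow_left' (enorm_sum_le I _) 2).trans ?_
          refine (sum_sq_le_weighted I _ (fun j => (ENNReal.ofReal (θ j))⁻¹)
            (fun j _ => ENNReal.inv_ne_zero.2 ENNReal.ofReal_ne_top)
            (fun j _ => ENNReal.inv_ne_top.2 (hne j))).trans ?_
          simp only [inv_inv]
          exact mul_le_mul_left hKI _
      _ = K * ∑ j ∈ I, (ENNReal.ofReal (θ j))⁻¹ * ∫⁻ x in Metric.closedBall c t⁻¹,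
          ‖opS (fun q => S q * psi j q.2) f2 x‖ₑ ^ 2 := by
          rw [lintegral_const_mul _ (Finset.measurable_sum I fun j _ => hmeas j),
            lintegral_finsetSum I fun j _ => hmeas j]
          congr 1
          refine Finset.sum_congr rfl fun j _ => ?_
          rw [lintegral_const_mul _ ((hcT j f2).measurable.enorm.pow_const 2)]
      _ ≤ K * ∑ j ∈ I, F * A.toNNReal ^ 2 * Vc t f c * ENNReal.ofReal (θ j) := by
          refine mul_le_mul_right (Finset.sum_le_sum fun j hj => ?_) _
          refine (mul_le_mul_right (hfarj j hj) _).trans_eq ?_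
          have : (ENNReal.ofReal (θ j))⁻¹ * ENNReal.ofReal (θ j) = 1 :=
            ENNReal.inv_mul_cancel (hne j) ENNReal.ofReal_ne_top
          calc _ = F * A.toNNReal ^ 2 * Vc t f c * ENNReal.ofReal (θ j) *
                ((ENNReal.ofReal (θ j))⁻¹ * ENNReal.ofReal (θ j)) := by ring
            _ = _ := by rw [this, mul_one]
      _ = K * (F * A.toNNReal ^ 2 * Vc t f c * ∑ j ∈ I, ENNReal.ofReal (θ j)) := by
          rw [← Finset.mul_sum]
      _ ≤ K * (F * A.toNNReal ^ 2 * Vc t f c * K) :=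
          mul_le_mul_right (mul_le_mul_right hKI _) _
      _ = _ := by ring
  have hsplit : ∀ x, ∑ j ∈ I, opS (fun q => S q * psi j q.2) f x
      = ∑ j ∈ I, opS (fun q => S q * psi j q.2) f1 x
        + ∑ j ∈ I, opS (fun q => S q * psi j q.2) f2 x := fun x => by
    rw [← Finset.sum_add_distrib]
    refine Finset.sum_congr rfl fun j _ => ?_
    conv_lhs => rw [hff]
    exact opS_add (hsm j).continuous (fun q => (hp j q).norm_le) f1 f2 x
  have hm1 : Measurable fun x => ‖∑ j ∈ I, opS (fun q => S q * psi j q.2) f1 x‖ₑ ^ 2 :=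
    (continuous_finsetSum I fun j _ => hcT j f1).measurable.enorm.pow_const 2
  have hm2 : Measurable fun x => ‖∑ j ∈ I, opS (fun q => S q * psi j q.2) f2 x‖ₑ ^ 2 :=
    (continuous_finsetSum I fun j _ => hcT j f2).measurable.enorm.pow_const 2
  calc _ ≤ ∫⁻ x in Metric.closedBall c t⁻¹, 4 *
        (‖∑ j ∈ I, opS (fun q => S q * psi j q.2) f1 x‖ₑ ^ 2
        + ‖∑ j ∈ I, opS (fun q => S q * psi j q.2) f2 x‖ₑ ^ 2) := by
        refine lintegral_mono fun x => ?_
        simp only [hsplit]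
        exact (pow_le_pow_left' (enorm_add_le _ _) 2).trans (ennreal_add_sq_le _ _)
    _ ≤ 4 * (D * (9 ^ (2 * NN n) * Vc t f c) + K * (F * A.toNNReal ^ 2 * K) * Vc t f c) := by
        rw [lintegral_const_mul' _ _ (by finiteness), lintegral_add_left hm1]
        refine mul_le_mul_right (add_le_add ?_ hfar) _
        exact (setLIntegral_le_lintegral _ _).trans ((hD I f1).trans (mul_le_mul_right hnear _))
    _ = _ := by push_cast; ring

/-- Summability of the gains for the fine pieces. -/
lemma exists_sum_fine {m ρ : ℝ} (hm : 0 ≤ m) (h : ρ = 1 ∨ 0 < m) : ∃ K : NNReal,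
    ∀ t : ℝ, 0 < t → ∀ I : Finset ℕ, (∀ j ∈ I, t ≤ 2 ^ ⌊ρ * j⌋₊) →
      ∑ j ∈ I, ENNReal.ofReal (2 ^ (-(j * m)) * √(t / 2 ^ ⌊ρ * j⌋₊)) ≤ K := by
  rcases h with rfl | hm0
  · set x : ℝ := √(1 / 2) with hx
    have hx0 : 0 < x := Real.sqrt_pos.2 (by norm_num)
    have hx1 : x < 1 := by rw [hx, Real.sqrt_lt' (by norm_num)]; norm_num
    have hs : Summable fun j : ℕ => x ^ j := summable_geometric_of_lt_one hx0.le hx1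
    refine ⟨(∑' j : ℕ, x ^ j).toNNReal, fun t ht I hI => ?_⟩
    simp only [one_mul, Nat.floor_natCast] at hI ⊢
    rcases I.eq_empty_or_nonempty with rfl | hne
    · simp
    obtain ⟨i, hi⟩ : ∃ i, i = I.min' hne := ⟨_, rfl⟩
    have hti : t ≤ 2 ^ i := hI i (hi ▸ I.min'_mem hne)
    have hle : ∀ j ∈ I, i ≤ j := fun j hj => hi ▸ I.min'_le j hj
    have h1 : ∀ j ∈ I, ENNReal.ofReal (2 ^ (-(j * m)) * √(t / 2 ^ j)) ≤ ENNReal.ofReal (x ^ (j - i)) := by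
      intro j hj
      refine ENNReal.ofReal_le_ofReal ?_
      have e1 : (2 : ℝ) ^ (-(j * m)) ≤ 1 := Real.rpow_le_one_of_one_le_of_nonpos (by norm_num) (by
        have : (0 : ℝ) ≤ j * m := by positivity
        linarith)
      have e2 : √(t / 2 ^ j) ≤ x ^ (j - i) := by
        refine Real.sqrt_le_iff.2 ⟨by positivity, ?_⟩
        rw [← pow_mul, mul_comm, pow_mul, hx, Real.sq_sqrt (by norm_num), div_pow, one_pow,
          div_le_div_iff₀ (by positivity) (by positivity), one_mul]
        calc t * 2 ^ (j - i) ≤ 2 ^ i * 2 ^ (j - i) := by gcongr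
          _ = 2 ^ j := by rw [← pow_add]; congr 1; have := hle j hj; omega
      calc _ ≤ 1 * √(t / 2 ^ j) := by gcongr
        _ ≤ _ := by rw [one_mul]; exact e2
    refine (Finset.sum_le_sum h1).trans ?_
    rw [← Finset.sum_image (s := I) (g := fun j => j - i) (f := fun k => ENNReal.ofReal (x ^ k))]
    · rw [← ENNReal.ofReal_sum_of_nonneg fun j _ => by positivity]
      exact ENNReal.ofReal_le_ofReal (hs.sum_le_tsum _ fun j _ => by positivity)
    · intro a ha b hb hab
      have := hle a ha
      have := hle b hb
      simp only at hab
      omega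
  · set x : ℝ := 2 ^ (-m) with hx
    have hx0 : 0 < x := by positivity
    have hx1 : x < 1 := Real.rpow_lt_one_of_one_lt_of_neg (by norm_num) (by linarith)
    have hs : Summable fun j : ℕ => x ^ j := summable_geometric_of_lt_one hx0.le hx1
    refine ⟨(∑' j : ℕ, x ^ j).toNNReal, fun t ht I hI => ?_⟩
    have h1 : ∀ j ∈ I, ENNReal.ofReal (2 ^ (-(j * m)) * √(t / 2 ^ ⌊ρ * j⌋₊)) ≤ ENNReal.ofReal (x ^ j) := by
      intro j hj
      refine ENNReal.ofReal_le_ofReal ?_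
      have e1 : (2 : ℝ) ^ (-(j * m)) = x ^ j := by
        rw [hx, ← Real.rpow_natCast, ← Real.rpow_mul (by norm_num)]; congr 1; ring
      have e2 : √(t / 2 ^ ⌊ρ * j⌋₊) ≤ 1 := by
        rw [Real.sqrt_le_one, div_le_one (by positivity)]
        exact hI j hj
      rw [e1]
      exact mul_le_of_le_one_right (by positivity) e2
    refine (Finset.sum_le_sum h1).trans ?_
    rw [← ENNReal.ofReal_sum_of_nonneg fun j _ => by positivity]
    exact ENNReal.ofReal_le_ofReal (hs.sum_le_tsum I fun j _ => by positivity)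

end FarSums

section HighPowers

variable {n : ℕ}

/-- Jensen's inequality for powers of integrals. -/
lemma lintegral_rpow_le {α : Type*} [MeasurableSpace α] (μ : Measure α) {a : α → ℝ≥0∞}
    (ha : Measurable a) {q : ℝ} (hq : 1 ≤ q) :
    (∫⁻ x, a x ∂μ) ^ q ≤ μ Set.univ ^ (q - 1) * ∫⁻ x, a x ^ q ∂μ := by
  have hq0 : 0 < q := by linarith
  have h := eLpNorm'_le_eLpNorm'_mul_rpow_measure_univ (μ := μ) (f := a) one_pos hq
    ha.aestronglyMeasurable
  simp only [eLpNorm'_eq_lintegral_enorm, enorm_eq_self, ENNReal.rpow_one, div_one] at h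
  calc _ ≤ ((∫⁻ x, a x ^ q ∂μ) ^ (1 / q) * μ Set.univ ^ (1 - 1 / q)) ^ q :=
        ENNReal.rpow_le_rpow h hq0.le
    _ = _ := by
        rw [ENNReal.mul_rpow_of_nonneg _ _ hq0.le, ← ENNReal.rpow_mul, ← ENNReal.rpow_mul,
          one_div_mul_cancel hq0.ne', ENNReal.rpow_one, mul_comm]
        congr 2
        field_simp

lemma lintegral_mul_rpow_le {α : Type*} [MeasurableSpace α] (μ : Measure α) {a w : α → ℝ≥0∞}
    (ha : Measurable a) (hw : Measurable w) {q : ℝ} (hq : 1 ≤ q) :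
    (∫⁻ x, a x * w x ∂μ) ^ q ≤ (∫⁻ x, w x ∂μ) ^ (q - 1) * ∫⁻ x, a x ^ q * w x ∂μ := by
  have h := lintegral_rpow_le (μ.withDensity w) ha hq
  rw [lintegral_withDensity_eq_lintegral_mul _ hw ha,
    lintegral_withDensity_eq_lintegral_mul _ hw (ha.pow_const q), withDensity_apply _ MeasurableSet.univ,
    Measure.restrict_univ] at h
  simpa only [Pi.mul_apply, mul_comm] using h

lemma lintegral_wt_smul_sub {l : ℝ} (hl : 0 < l) (x : Fin n → ℝ) :
    ∫⁻ c, wt (l • (x - c)) = ENNReal.ofReal (l⁻¹ ^ n) * wtI n := by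
  have h := lintegral_affine (inv_pos.2 hl) wt (-(l • x))
  rw [inv_inv] at h
  unfold wtI
  rw [← h]
  refine lintegral_congr fun c => ?_
  rw [← wt_neg]
  congr 1
  rw [smul_sub]; abel

lemma rpow_eq_rpow_sub_one_mul (a : ℝ≥0∞) {q : ℝ} (hq : 1 ≤ q) : a ^ q = a ^ (q - 1) * a := by
  conv_rhs => rw [← ENNReal.rpow_one a, ← ENNReal.rpow_mul, one_mul,
    ← ENNReal.rpow_add_of_nonneg _ _ (by linarith) zero_le_one, sub_add_cancel]

lemma lintegral_Vc_rpow_le {l : ℝ} (hl : 0 < l) {f : (Fin n → ℝ) → ℂ} (hf : Continuous f) {q : ℝ}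
    (hq : 1 ≤ q) : ∫⁻ c, Vc l f c ^ q ≤
      (ENNReal.ofReal (l⁻¹ ^ n) * wtI n) ^ q * ∫⁻ x, ‖f x‖ₑ ^ (2 * q) := by
  have hq0 : 0 < q := by linarith
  have hw : Measurable fun p : (Fin n → ℝ) × (Fin n → ℝ) => wt (l • (p.2 - p.1)) :=
    measurable_wt.comp (by fun_prop)
  have hF : Measurable fun p : (Fin n → ℝ) × (Fin n → ℝ) => ‖f p.2‖ₑ ^ (2 * q) * wt (l • (p.2 - p.1)) :=
    ((hf.measurable.comp measurable_snd).enorm.pow_const _).mul hw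
  calc _ ≤ ∫⁻ c, (ENNReal.ofReal (l⁻¹ ^ n) * wtI n) ^ (q - 1) *
        ∫⁻ x, ‖f x‖ₑ ^ (2 * q) * wt (l • (x - c)) := by
        refine lintegral_mono fun c => ?_
        have h := lintegral_mul_rpow_le volume (a := fun x => ‖f x‖ₑ ^ 2)
          (w := fun x => wt (l • (x - c))) (hf.measurable.enorm.pow_const 2)
          (measurable_wt.comp (by fun_prop)) hq
        have e1 : ∫⁻ x, wt (l • (x - c)) = ENNReal.ofReal (l⁻¹ ^ n) * wtI n := by
          rw [← lintegral_wt_smul_sub hl c]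
          refine lintegral_congr fun x => ?_
          rw [← wt_neg, ← smul_neg, neg_sub]
        have e2 : ∀ x, (‖f x‖ₑ ^ 2) ^ q = ‖f x‖ₑ ^ (2 * q) := fun x => by
          rw [ENNReal.rpow_mul]; norm_cast
        simp only [e1, e2] at h
        exact h
    _ = (ENNReal.ofReal (l⁻¹ ^ n) * wtI n) ^ (q - 1) *
        ∫⁻ x, ∫⁻ c, ‖f x‖ₑ ^ (2 * q) * wt (l • (x - c)) := by
        rw [lintegral_const_mul _ (Measurable.lintegral_prod_right' hF),
          lintegral_lintegral_swap hF.aemeasurable]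
    _ = (ENNReal.ofReal (l⁻¹ ^ n) * wtI n) ^ (q - 1) *
        ∫⁻ x, ‖f x‖ₑ ^ (2 * q) * (ENNReal.ofReal (l⁻¹ ^ n) * wtI n) := by
        congr 1
        refine lintegral_congr fun x => ?_
        have h1 : Measurable fun c : Fin n → ℝ => wt (l • (x - c)) := measurable_wt.comp (by fun_prop)
        rw [lintegral_const_mul _ h1, lintegral_wt_smul_sub hl x]
    _ = _ := by
        rw [lintegral_mul_const _ (hf.measurable.enorm.pow_const _)]
        obtain ⟨a, ha⟩ : ∃ a, a = ENNReal.ofReal (l⁻¹ ^ n) * wtI n := ⟨_, rfl⟩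
        have ha0 : a ^ q = a ^ (q - 1) * a := rpow_eq_rpow_sub_one_mul a hq
        rw [← ha, ha0]; ring

/-- A local `L²` bound together with a local uniform bound gives an `L^p` bound. -/
lemma lintegral_rpow_le_of_local {l : ℝ} (hl : 0 < l) {f : (Fin n → ℝ) → ℂ} (hf : Continuous f)
    {q : ℝ} (hq : 1 ≤ q) {F : (Fin n → ℝ) → ℝ≥0∞} (hF : Measurable F) {S Y : ℝ≥0∞}
    (h1 : ∀ c, ∀ x ∈ Metric.closedBall c l⁻¹, F x ≤ S * Y * Vc l f c)
    (h2 : ∀ c, ∫⁻ x in Metric.closedBall c l⁻¹, F x ≤ Y * Vc l f c) :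
    ∫⁻ x, F x ^ q ≤ (S * ENNReal.ofReal (l⁻¹ ^ n)) ^ (q - 1) * (Y * wtI n) ^ q *
      ∫⁻ x, ‖f x‖ₑ ^ (2 * q) := by
  have hq0 : 0 < q := by linarith
  have hpow : ∀ a : ℝ≥0∞, a ^ q = a ^ (q - 1) * a := fun a =>
    rpow_eq_rpow_sub_one_mul a hq
  have hav := lintegral_le_average_balls (n := n) (g := fun x => F x ^ q) (hF.pow_const q)
    (inv_pos.2 hl).le (A := Set.univ) (B := Set.univ) MeasurableSet.univ (fun _ _ => Set.subset_univ _)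
  simp only [Measure.restrict_univ] at hav
  have hb : ∀ c, ∫⁻ x in Metric.closedBall c l⁻¹, F x ^ q ≤ S ^ (q - 1) * Y ^ q * Vc l f c ^ q := by
    intro c
    calc _ ≤ ∫⁻ x in Metric.closedBall c l⁻¹, (S * Y * Vc l f c) ^ (q - 1) * F x := by
          refine setLIntegral_mono (measurable_const.mul hF) fun x hx => ?_
          rw [hpow]
          exact mul_le_mul_left (ENNReal.rpow_le_rpow (h1 c x hx) (by linarith)) _
      _ ≤ (S * Y * Vc l f c) ^ (q - 1) * (Y * Vc l f c) := by
          rw [lintegral_const_mul _ hF]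
          exact mul_le_mul_right (h2 c) _
      _ = _ := by
          rw [hpow Y, hpow (Vc l f c), ENNReal.mul_rpow_of_nonneg _ _ (by linarith),
            ENNReal.mul_rpow_of_nonneg _ _ (by linarith)]
          ring
  obtain ⟨a, ha⟩ : ∃ a, a = ENNReal.ofReal (l⁻¹ ^ n) := ⟨_, rfl⟩
  have ha0 : a ≠ 0 := by
    rw [ha, Ne, ENNReal.ofReal_eq_zero, not_le]; positivity
  have hat : a ≠ ⊤ := ha ▸ ENNReal.ofReal_ne_top
  have hal : a ≤ ENNReal.ofReal ((2 * l⁻¹) ^ n) := by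
    rw [ha]
    refine ENNReal.ofReal_le_ofReal (pow_le_pow_left₀ (by positivity) ?_ n)
    have : 0 < l⁻¹ := inv_pos.2 hl
    linarith
  refine (ENNReal.mul_le_mul_iff_right ha0 hat).1 ?_
  calc a * ∫⁻ x, F x ^ q ≤ ∫⁻ c, ∫⁻ x in Metric.closedBall c l⁻¹, F x ^ q :=
        (mul_le_mul_left hal _).trans hav
    _ ≤ ∫⁻ c, S ^ (q - 1) * Y ^ q * Vc l f c ^ q := lintegral_mono hb
    _ = S ^ (q - 1) * Y ^ q * ∫⁻ c, Vc l f c ^ q := by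
        refine lintegral_const_mul _ (Measurable.pow_const ?_ q)
        unfold Vc
        exact Measurable.lintegral_prod_right' (f := fun p : (Fin n → ℝ) × (Fin n → ℝ) =>
          ‖f p.2‖ₑ ^ 2 * wt (l • (p.2 - p.1)))
          (((hf.measurable.comp measurable_snd).enorm.pow_const _).mul (measurable_wt.comp (by fun_prop)))
    _ ≤ S ^ (q - 1) * Y ^ q * ((a * wtI n) ^ q * ∫⁻ x, ‖f x‖ₑ ^ (2 * q)) := by
        rw [ha]
        exact mul_le_mul_right (lintegral_Vc_rpow_le hl hf hq) _
    _ = _ := by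
        rw [← ha, ENNReal.mul_rpow_of_nonneg _ _ hq0.le, ENNReal.mul_rpow_of_nonneg _ _ hq0.le,
          ENNReal.mul_rpow_of_nonneg _ _ (show 0 ≤ q - 1 by linarith), hpow a]
        ring

lemma scale_gain {ρ m q : ℝ} (hq : 1 ≤ q) (hm : 2 * q * m = n * (1 - ρ) * (q - 1)) {j k r : ℕ}
    (hr : ρ * j ≤ r + 1) :
    (((2 : ℝ) ^ k) ^ n * ((2 ^ r)⁻¹) ^ n) ^ (q - 1) * ((2 ^ (-(j * m))) ^ 2) ^ q ≤
      2 ^ (n * (q - 1)) * 2 ^ (-(n * (q - 1) * (j - k))) := by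
  have e1 : (((2 : ℝ) ^ k) ^ n * ((2 ^ r)⁻¹) ^ n) ^ (q - 1) = 2 ^ ((k * n - r * n) * (q - 1)) := by
    have : ((2 : ℝ) ^ k) ^ n * ((2 ^ r)⁻¹) ^ n = 2 ^ ((k * n : ℝ) - r * n) := by
      rw [Real.rpow_sub (by norm_num), inv_pow, ← pow_mul, ← pow_mul, div_eq_mul_inv]
      norm_cast
    rw [this, ← Real.rpow_mul (by norm_num)]
  have e2 : (((2 : ℝ) ^ (-(j * m))) ^ 2) ^ q = 2 ^ (-(j * m) * 2 * q) := by
    rw [Real.rpow_mul (by norm_num), Real.rpow_mul (by norm_num)]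
    norm_cast
  rw [e1, e2, ← Real.rpow_add (by norm_num), ← Real.rpow_add (by norm_num)]
  refine Real.rpow_le_rpow_of_exponent_le (by norm_num) ?_
  have h1 : (j : ℝ) * (2 * q * m) = j * (n * (1 - ρ) * (q - 1)) := by rw [hm]
  have h2 : 0 ≤ (n : ℝ) * (q - 1) * (r + 1 - ρ * j) :=
    mul_nonneg (mul_nonneg (Nat.cast_nonneg n) (by linarith)) (by linarith)
  nlinarith

end HighPowers

section PieceBounds

variable {n : ℕ}

lemma measurable_setLIntegral_closedBall {g : (Fin n → ℝ) → ℝ≥0∞} (hg : Measurable g) (l : ℝ) :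
    Measurable fun x => ∫⁻ y in Metric.closedBall x l, g y := by
  have hm : Measurable fun p : (Fin n → ℝ) × (Fin n → ℝ) =>
      (Metric.closedBall p.1 l).indicator g p.2 := by
    have : (fun p : (Fin n → ℝ) × (Fin n → ℝ) => (Metric.closedBall p.1 l).indicator g p.2)
        = {p : (Fin n → ℝ) × (Fin n → ℝ) | dist p.2 p.1 ≤ l}.indicator fun p => g p.2 := by
      ext p; simp [Set.indicator]
    rw [this]
    refine (hg.comp measurable_snd).indicator (measurableSet_le ?_ measurable_const)
    fun_prop
  have e1 : ∀ c, ∫⁻ x in Metric.closedBall c l, g x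
      = ∫⁻ x, (Metric.closedBall c l).indicator g x := fun c =>
    (lintegral_indicator measurableSet_closedBall g).symm
  simp only [e1]
  exact Measurable.lintegral_prod_right' hm

/-- The integral of ball averages is dominated by the integral on an enlarged set. -/
lemma lintegral_average_balls_le {g : (Fin n → ℝ) → ℝ≥0∞} (hg : Measurable g) {l : ℝ} (hl : 0 ≤ l)
    {A B : Set (Fin n → ℝ)} (hB : MeasurableSet B)
    (hAB : ∀ x ∈ A, Metric.closedBall x l ⊆ B) :
    ∫⁻ c in A, ∫⁻ x in Metric.closedBall c l, g x ≤
      ENNReal.ofReal ((2 * l) ^ n) * ∫⁻ x in B, g x := by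
  have hm : Measurable fun p : (Fin n → ℝ) × (Fin n → ℝ) =>
      (Metric.closedBall p.1 l).indicator (B.indicator g) p.2 := by
    have : (fun p : (Fin n → ℝ) × (Fin n → ℝ) => (Metric.closedBall p.1 l).indicator (B.indicator g) p.2)
        = {p : (Fin n → ℝ) × (Fin n → ℝ) | dist p.2 p.1 ≤ l}.indicator fun p => B.indicator g p.2 := by
      ext p; simp [Set.indicator]
    rw [this]
    refine ((hg.indicator hB).comp measurable_snd).indicator (measurableSet_le ?_ measurable_const)
    fun_prop
  calc _ ≤ ∫⁻ c in A, ∫⁻ x, (Metric.closedBall c l).indicator (B.indicator g) x := by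
        refine setLIntegral_mono (Measurable.lintegral_prod_right' hm) fun c hc => ?_
        rw [← lintegral_indicator measurableSet_closedBall]
        refine lintegral_mono fun x => ?_
        by_cases hx : x ∈ Metric.closedBall c l
        · rw [Set.indicator_of_mem hx, Set.indicator_of_mem hx, Set.indicator_of_mem (hAB c hc hx)]
        · rw [Set.indicator_of_notMem hx]; exact zero_le
    _ ≤ ∫⁻ c, ∫⁻ x, (Metric.closedBall c l).indicator (B.indicator g) x := setLIntegral_le_lintegral _ _
    _ = ∫⁻ x, ∫⁻ c, (Metric.closedBall c l).indicator (B.indicator g) x :=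
        lintegral_lintegral_swap hm.aemeasurable
    _ = ∫⁻ x, ENNReal.ofReal ((2 * l) ^ n) * B.indicator g x := by
        refine lintegral_congr fun x => ?_
        have e2 : ∀ c, (Metric.closedBall c l).indicator (B.indicator g) x
            = (Metric.closedBall x l).indicator (fun _ => B.indicator g x) c := fun c => by
          simp [Set.indicator, dist_comm]
        simp only [e2]
        rw [lintegral_indicator_const measurableSet_closedBall,
          Real.volume_pi_closedBall _ hl, Fintype.card_fin, mul_comm]
    _ = _ := by rw [lintegral_const_mul _ (hg.indicator hB), lintegral_indicator hB]

/-- The `L^p` bounds for a single dyadic piece: averaged squares below its spatial scale, and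
differences below its frequency scale. -/
theorem piece_bounds {m ρ δ C q : ℝ} [NeZero n] (hC : 0 ≤ C) (hm : 0 ≤ m) (hδ0 : 0 ≤ δ) (hδ1 : δ < 1)
    (hδρ : δ ≤ ρ) (hρ1 : ρ ≤ 1) {S : (Fin n → ℝ) × (Fin n → ℝ) → ℂ}
    (hS : ContDiff ℝ (⊤ : ℕ∞) S) (h : SClass m ρ δ C S) (hq : 1 ≤ q)
    (hmq : 2 * q * m = n * (1 - ρ) * (q - 1)) :
    ∃ A : NNReal, ∀ (j : ℕ) (f : 𝓢(Fin n → ℝ, ℂ)),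
      (∀ k : ℕ, ⌊ρ * j⌋₊ ≤ k → ∫⁻ x, (ENNReal.ofReal ((2 ^ k) ^ n) *
        ∫⁻ y in Metric.closedBall x (2 ^ k)⁻¹, ‖opS (fun q => S q * psi j q.2) f y‖ₑ ^ 2) ^ q ≤
        A * ENNReal.ofReal (2 ^ (-(n * (q - 1) * (j - k)))) * ∫⁻ x, ‖f x‖ₑ ^ (2 * q)) ∧
      (∀ z : Fin n → ℝ, ‖z‖ ≤ (2 ^ j)⁻¹ → ∫⁻ x, ‖opS (fun q => S q * psi j q.2) f (x + z) -
          opS (fun q => S q * psi j q.2) f x‖ₑ ^ (2 * q) ≤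
        A * ENNReal.ofReal ((√(2 ^ j * ‖z‖)) ^ q) * ∫⁻ x, ‖f x‖ₑ ^ (2 * q)) := by
  have hρ0 : 0 ≤ ρ := hδ0.trans hδρ
  have hq0 : 0 < q := by linarith
  obtain ⟨A, hA0, hA⟩ := exists_symAt_piece hC hm hδ0 hδ1.le hρ0 hρ1 hS h
  obtain ⟨D, hD⟩ := local_bounds n
  have hwt : wtI n ≠ ⊤ := wtI_ne_top
  have hKt : ((2 ^ n * D) * ENNReal.ofReal A ^ 2 * wtI n) ^ q * ENNReal.ofReal (2 ^ (n * (q - 1))) ≠ ⊤ := by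
    have h1 := wtI_ne_top (n := n)
    have : ((2 ^ n * D) * ENNReal.ofReal A ^ 2 * wtI n) ≠ ⊤ := by finiteness
    exact ENNReal.mul_ne_top (ENNReal.rpow_ne_top_of_nonneg hq0.le this) ENNReal.ofReal_ne_top
  obtain ⟨W, hW⟩ : ∃ W : NNReal, (W : ℝ≥0∞) = ((2 ^ n * D) * ENNReal.ofReal A ^ 2 * wtI n) ^ q *
      ENNReal.ofReal (2 ^ (n * (q - 1))) := ⟨_, ENNReal.coe_toNNReal hKt⟩
  refine ⟨W, fun j f => ?_⟩
  rw [hW]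
  obtain ⟨r, hr⟩ : ∃ r, r = ⌊ρ * j⌋₊ := ⟨_, rfl⟩
  have hrj : r ≤ j := hr ▸ Nat.floor_le_of_le (mul_le_of_le_one_left (Nat.cast_nonneg j) hρ1)
  have hr1 : ρ * j ≤ r + 1 := hr ▸ (Nat.lt_floor_add_one _).le
  obtain ⟨M, hM⟩ : ∃ M : ℝ, M = A * 2 ^ (-(j * m)) := ⟨_, rfl⟩
  have hM0 : 0 ≤ M := hM ▸ by positivity
  obtain ⟨s, hs⟩ : ∃ s, s = fun q : (Fin n → ℝ) × (Fin n → ℝ) => S q * psi j q.2 := ⟨_, rfl⟩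
  have hp : ∀ q, SymAt ((2 : ℝ) ^ r) M s q := fun q => by
    rw [hM, hs]
    exact hA j _ (hr ▸ Nat.floor_le (mul_nonneg hρ0 (Nat.cast_nonneg j)))
      ((mul_le_mul_of_nonneg_right hδρ (Nat.cast_nonneg j)).trans hr1) q
  have hsm : ContDiff ℝ (⊤ : ℕ∞) s := hs ▸ hS.mul ((contDiff_psi j).comp contDiff_snd)
  have hcT : Continuous (opS s f) := continuous_opS hsm.continuous (fun q => (hp q).norm_le) f
  have hL := hD s M (2 ^ r) (2 ^ j) hsm hM0 (by positivity) (pow_le_pow_right₀ (by norm_num) hrj) hp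
    (fun x ξ hξ => by rw [hs]; simp only; rw [psi_eq_zero_of_ge hξ.le, mul_zero]) f
  rw [← hs, ← hr]
  have hgain : ∀ k : ℕ, ∀ Y : ℝ≥0∞, (ENNReal.ofReal ((2 ^ k) ^ n) * ENNReal.ofReal (((2 ^ r)⁻¹) ^ n)) ^ (q - 1) *
      ((2 ^ n * D) * ENNReal.ofReal M ^ 2 * Y * wtI n) ^ q ≤ ((2 ^ n * D) * ENNReal.ofReal A ^ 2 * wtI n) ^ q *
        ENNReal.ofReal (2 ^ (n * (q - 1))) * (ENNReal.ofReal (2 ^ (-(n * (q - 1) * (j - k)))) * Y ^ q) := by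
    intro k Y
    have e := ENNReal.ofReal_le_ofReal (scale_gain (n := n) hq hmq (k := k) hr1)
    rw [ENNReal.ofReal_mul (by positivity), ENNReal.ofReal_mul (by positivity),
      ← ENNReal.ofReal_rpow_of_nonneg (by positivity) (by linarith),
      ← ENNReal.ofReal_rpow_of_nonneg (x := (2 ^ (-(j * m))) ^ 2) (by positivity) (by linarith),
      ENNReal.ofReal_mul (by positivity), ENNReal.ofReal_pow (by positivity) 2] at e
    have e3 : ((2 ^ n * D) * ENNReal.ofReal M ^ 2 * Y * wtI n) ^ q
        = ((2 ^ n * D) * ENNReal.ofReal A ^ 2 * wtI n) ^ q * Y ^ q *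
          (ENNReal.ofReal (2 ^ (-(j * m))) ^ 2) ^ q := by
      rw [← ENNReal.mul_rpow_of_nonneg _ _ hq0.le, ← ENNReal.mul_rpow_of_nonneg _ _ hq0.le, hM,
        ENNReal.ofReal_mul hA0]
      congr 1; ring
    rw [e3]
    calc _ = ((2 ^ n * D) * ENNReal.ofReal A ^ 2 * wtI n) ^ q * Y ^ q *
          ((ENNReal.ofReal ((2 ^ k) ^ n) * ENNReal.ofReal (((2 ^ r)⁻¹) ^ n)) ^ (q - 1) *
            (ENNReal.ofReal (2 ^ (-(j * m))) ^ 2) ^ q) := by ring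
      _ ≤ _ := mul_le_mul_right e _
      _ = _ := by ring
  constructor
  · intro k hk
    have hkr : ((2 : ℝ) ^ k)⁻¹ ≤ (2 ^ r)⁻¹ :=
      inv_anti₀ (by positivity) (pow_le_pow_right₀ (by norm_num) hk)
    have hball : ∀ c, ∀ x ∈ Metric.closedBall c ((2 : ℝ) ^ r)⁻¹,
        Metric.closedBall x ((2 : ℝ) ^ k)⁻¹ ⊆ Metric.closedBall (c : Fin n → ℝ) ((2 ^ r)⁻¹ * 2) := by
      intro c x hx
      refine Metric.closedBall_subset_closedBall' ?_
      rw [Metric.mem_closedBall] at hx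
      linarith
    have hg : Measurable fun y => ‖opS s f y‖ₑ ^ 2 := hcT.measurable.enorm.pow_const 2
    have h2D : (D : ℝ≥0∞) ≤ 2 ^ n * D := le_mul_of_one_le_left' (one_le_pow₀ (by norm_num))
    have := lintegral_rpow_le_of_local (l := 2 ^ r) (by positivity) f.continuous hq
      (F := fun x => ENNReal.ofReal ((2 ^ k) ^ n) *
        ∫⁻ y in Metric.closedBall x (2 ^ k)⁻¹, ‖opS s f y‖ₑ ^ 2)
      (measurable_const.mul (measurable_setLIntegral_closedBall hg _))
      (S := ENNReal.ofReal ((2 ^ k) ^ n)) (Y := (2 ^ n * D) * ENNReal.ofReal M ^ 2 * 1)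
      (fun c x hx => by
        rw [mul_assoc]
        refine mul_le_mul_right ?_ _
        refine (lintegral_mono_set (hball c x hx)).trans ((hL c).1.trans ?_)
        rw [mul_one]
        exact mul_le_mul_left (mul_le_mul_left h2D _) _)
      (fun c => by
        rw [lintegral_const_mul _ (measurable_setLIntegral_closedBall hg _), mul_one]
        refine (mul_le_mul_right ((lintegral_average_balls_le hg (by positivity)
          measurableSet_closedBall (hball c)).trans
          (mul_le_mul_right (hL c).1 _)) _).trans_eq ?_
        rw [← mul_assoc, ← ENNReal.ofReal_mul (by positivity)]
        have : ((2 : ℝ) ^ k) ^ n * (2 * (2 ^ k)⁻¹) ^ n = 2 ^ n := by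
          rw [← mul_pow]; congr 1; field_simp
        rw [this, ENNReal.ofReal_pow (by norm_num), ENNReal.ofReal_ofNat]
        ring)
    refine this.trans (mul_le_mul_left ((hgain k 1).trans_eq ?_) _)
    rw [ENNReal.one_rpow, mul_one]
  · intro z hz
    have hzr : ‖z‖ ≤ ((2 : ℝ) ^ r)⁻¹ := hz.trans
      (inv_anti₀ (by positivity) (pow_le_pow_right₀ (by norm_num) hrj))
    have h2D : (D : ℝ≥0∞) ≤ 2 ^ n * D := le_mul_of_one_le_left' (one_le_pow₀ (by norm_num))
    have := lintegral_rpow_le_of_local (l := 2 ^ r) (by positivity) f.continuous hq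
      (F := fun x => ‖opS s f (x + z) - opS s f x‖ₑ ^ 2)
      (Measurable.pow_const (Continuous.measurable (by fun_prop)).enorm 2)
      (S := ENNReal.ofReal ((2 ^ j) ^ n))
      (Y := (2 ^ n * D) * ENNReal.ofReal M ^ 2 * ENNReal.ofReal √(2 ^ j * ‖z‖))
      (fun c x hx => by
        refine (((hL c).2 z hzr).2 x hx).trans ?_
        calc _ ≤ 2 ^ n * D * ENNReal.ofReal M ^ 2 * ENNReal.ofReal √(2 ^ j * ‖z‖) *
              ENNReal.ofReal ((2 ^ j) ^ n) * Vc (2 ^ r) f c := by gcongr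
          _ = _ := by ring)
      (fun c => by
        refine ((hL c).2 z hzr).1.trans ?_
        gcongr)
    have e2 : ∀ a : ℝ≥0∞, (a ^ 2) ^ q = a ^ (2 * q) := fun x => by
      rw [ENNReal.rpow_mul]; norm_cast
    simp only [e2] at this
    refine this.trans (mul_le_mul_left ((hgain j _).trans_eq ?_) _)
    rw [sub_self, mul_zero, neg_zero, Real.rpow_zero, ENNReal.ofReal_one, one_mul,
      ENNReal.ofReal_rpow_of_nonneg (by positivity) hq0.le]

end PieceBounds

section Interpolation

lemma rpow_layercake (x : ℝ≥0∞) {p : ℝ} (hp : 0 < p) :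
    x ^ p = ENNReal.ofReal p * ∫⁻ t in Set.Ioi (0 : ℝ),
      {t | ENNReal.ofReal t < x}.indicator (fun t => ENNReal.ofReal (t ^ (p - 1))) t := by
  have key : ∀ y : NNReal, (y : ℝ≥0∞) ^ p = ENNReal.ofReal p * ∫⁻ t in Set.Ioi (0 : ℝ),
      {t | ENNReal.ofReal t < y}.indicator (fun t => ENNReal.ofReal (t ^ (p - 1))) t := by
    intro y
    have h := lintegral_rpow_eq_lintegral_meas_lt_mul (Measure.dirac ()) (f := fun _ => (y : ℝ))
      (Filter.Eventually.of_forall fun _ => NNReal.coe_nonneg y) aemeasurable_const hp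
    rw [lintegral_dirac, ← ENNReal.ofReal_rpow_of_nonneg (NNReal.coe_nonneg y) hp.le, ENNReal.ofReal_coe_nnreal] at h
    rw [h]
    congr 1
    refine setLIntegral_congr_fun measurableSet_Ioi fun t ht => ?_
    by_cases hty : t < y
    · rw [Set.indicator_of_mem]
      · simp [hty]
      · rw [Set.mem_ofPred_eq, ENNReal.ofReal_lt_coe_iff ht.le]; exact hty
    · rw [Set.indicator_of_notMem]
      · simp [hty]
      · rw [Set.mem_ofPred_eq, ENNReal.ofReal_lt_coe_iff ht.le]; exact hty
  induction x with
  | coe y => exact key y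
  | top =>
    rw [ENNReal.top_rpow_of_pos hp]
    symm
    refine ENNReal.eq_top_of_forall_nnreal_le fun y => ?_
    have h1 : ((y ^ (1 / p) : NNReal) : ℝ≥0∞) ^ p = y := by
      rw [← ENNReal.coe_rpow_of_nonneg _ hp.le, ← NNReal.rpow_mul, one_div_mul_cancel hp.ne',
        NNReal.rpow_one]
    rw [← h1, key]
    refine mul_le_mul_right (lintegral_mono fun t => ?_) _
    refine Set.indicator_le_indicator_of_subset (fun t ht => ?_) (fun _ => zero_le) t
    exact lt_of_lt_of_le (b := ((y ^ (1 / p) : NNReal) : ℝ≥0∞)) ht le_top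

lemma lintegral_rpow_layercake {α : Type*} [MeasurableSpace α] (μ : Measure α) [SFinite μ]
    {F : α → ℝ≥0∞} (hF : Measurable F) (w : α → ℝ≥0∞) (hw : Measurable w) {p : ℝ} (hp : 0 < p) :
    ∫⁻ x, F x ^ p * w x ∂μ = ENNReal.ofReal p * ∫⁻ t in Set.Ioi (0 : ℝ),
      ENNReal.ofReal (t ^ (p - 1)) * ∫⁻ x in {x | ENNReal.ofReal t < F x}, w x ∂μ := by
  have hm : Measurable fun q : α × ℝ => {q : α × ℝ | ENNReal.ofReal q.2 < F q.1}.indicator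
      (fun q => ENNReal.ofReal (q.2 ^ (p - 1)) * w q.1) q := by
    refine Measurable.indicator ?_ (measurableSet_lt (by fun_prop) (by fun_prop))
    exact (Measurable.ennreal_ofReal (by fun_prop)).mul (by fun_prop)
  have hms : ∀ t, MeasurableSet {x | ENNReal.ofReal t < F x} := fun t => measurableSet_lt (by fun_prop) hF
  calc _ = ∫⁻ x, (ENNReal.ofReal p * ∫⁻ t in Set.Ioi (0 : ℝ),
        {q : α × ℝ | ENNReal.ofReal q.2 < F q.1}.indicator
          (fun q => ENNReal.ofReal (q.2 ^ (p - 1)) * w q.1) (x, t)) ∂μ := by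
        refine lintegral_congr fun x => ?_
        rw [rpow_layercake (F x) hp, mul_assoc, ← lintegral_mul_const]
        · congr 1
          refine lintegral_congr fun t => ?_
          by_cases h : ENNReal.ofReal t < F x
          · rw [Set.indicator_of_mem (by exact h), Set.indicator_of_mem (by exact h)]
          · rw [Set.indicator_of_notMem (by exact h), Set.indicator_of_notMem (by exact h), zero_mul]
        · exact Measurable.indicator (by fun_prop) (measurableSet_lt (by fun_prop) (by fun_prop))
    _ = ENNReal.ofReal p * ∫⁻ t in Set.Ioi (0 : ℝ), ∫⁻ x,
        ({q : α × ℝ | ENNReal.ofReal q.2 < F q.1}.indicator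
          (fun q => ENNReal.ofReal (q.2 ^ (p - 1)) * w q.1) (x, t)) ∂μ := by
        rw [lintegral_const_mul' _ _ ENNReal.ofReal_ne_top, lintegral_lintegral_swap hm.aemeasurable]
    _ = _ := by
        congr 1
        refine lintegral_congr fun t => ?_
        rw [← lintegral_const_mul _ hw, ← lintegral_indicator (hms t)]
        refine lintegral_congr fun x => ?_
        by_cases h : ENNReal.ofReal t < F x
        · rw [Set.indicator_of_mem (by exact h), Set.indicator_of_mem (by exact h)]
        · rw [Set.indicator_of_notMem (by exact h), Set.indicator_of_notMem (by exact h)]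

/-- Marcinkiewicz interpolation between a restricted weak type estimate and `L^∞`. -/
theorem marcinkiewicz {α β ι : Type*} [MeasurableSpace α] [MeasurableSpace β] (μ : Measure α)
    (ν : Measure β) [SFinite μ] [SFinite ν] (I : Finset ι) {F : ι → α → ℝ≥0∞}
    (hF : ∀ i, Measurable (F i)) {f : β → ℝ≥0∞} (hf : Measurable f) {p r : ℝ} (hr : 0 ≤ r) (hp : r < p)
    (A : NNReal)
    (h : ∀ t : ℝ, 0 < t → ENNReal.ofReal (t ^ r) * ∑ i ∈ I, μ {x | ENNReal.ofReal t < F i x} ≤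
      A * ∫⁻ x in {x | ENNReal.ofReal t < f x}, f x ^ r ∂ν) :
    ∑ i ∈ I, ∫⁻ x, F i x ^ p ∂μ ≤ A * ENNReal.ofReal (p / (p - r)) * ∫⁻ x, f x ^ p ∂ν := by
  have hp0 : 0 < p := hr.trans_lt hp
  have hpr : 0 < p - r := sub_pos.2 hp
  have e1 : ∀ i, ∫⁻ x, F i x ^ p ∂μ = ENNReal.ofReal p * ∫⁻ t in Set.Ioi (0 : ℝ),
      ENNReal.ofReal (t ^ (p - 1)) * μ {x | ENNReal.ofReal t < F i x} := fun i => by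
    have := lintegral_rpow_layercake μ (hF i) (fun _ => 1) measurable_const hp0
    simpa using this
  have e2 : ∫⁻ x, f x ^ p ∂ν = ENNReal.ofReal (p - r) * ∫⁻ t in Set.Ioi (0 : ℝ),
      ENNReal.ofReal (t ^ (p - r - 1)) * ∫⁻ x in {x | ENNReal.ofReal t < f x}, f x ^ r ∂ν := by
    rw [← lintegral_rpow_layercake ν hf (fun x => f x ^ r) (hf.pow_const r) hpr]
    refine lintegral_congr fun x => ?_
    rw [← ENNReal.rpow_add_of_nonneg _ _ hpr.le hr, sub_add_cancel]
  have hmeas : ∀ i, Measurable fun t : ℝ => ENNReal.ofReal (t ^ (p - 1)) *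
      μ {x | ENNReal.ofReal t < F i x} := fun i => by
    refine Measurable.mul (by fun_prop) (Antitone.measurable fun s t hst => measure_mono fun x hx => ?_)
    exact (ENNReal.ofReal_le_ofReal hst).trans_lt hx
  rw [e2]
  simp only [e1]
  rw [← Finset.mul_sum, ← lintegral_finsetSum I fun i _ => hmeas i]
  have e3 : ENNReal.ofReal p = ENNReal.ofReal (p / (p - r)) * ENNReal.ofReal (p - r) := by
    rw [← ENNReal.ofReal_mul (by positivity), div_mul_cancel₀ _ hpr.ne']
  calc _ ≤ ENNReal.ofReal p * ∫⁻ t in Set.Ioi (0 : ℝ), A * (ENNReal.ofReal (t ^ (p - r - 1)) *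
        ∫⁻ x in {x | ENNReal.ofReal t < f x}, f x ^ r ∂ν) := by
        refine mul_le_mul_right (setLIntegral_mono' measurableSet_Ioi fun t ht => ?_) _
        have ht0 : (0 : ℝ) < t := ht
        have : t ^ (p - 1) = t ^ (p - r - 1) * t ^ r := by
          rw [← Real.rpow_add ht0]; congr 1; ring
        rw [← Finset.mul_sum, this, ENNReal.ofReal_mul (by positivity), mul_assoc, mul_left_comm (A : ℝ≥0∞)]
        exact mul_le_mul_right (h t ht0) _
    _ = _ := by
        rw [lintegral_const_mul' _ _ ENNReal.coe_ne_top, e3]; ring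

end Interpolation

section Maximal

variable {n : ℕ}

/-- The average of `g` over the ball of radius `2 ^ (-k)` about `x`, up to normalisation. -/
def avB (k : ℤ) (g : (Fin n → ℝ) → ℝ≥0∞) (x : Fin n → ℝ) : ℝ≥0∞ :=
  ENNReal.ofReal (((2 : ℝ) ^ k) ^ n) * ∫⁻ y in Metric.closedBall x ((2 : ℝ) ^ k)⁻¹, g y

/-- The Hardy–Littlewood maximal function over balls with dyadic radii. -/
def hlM (g : (Fin n → ℝ) → ℝ≥0∞) (x : Fin n → ℝ) : ℝ≥0∞ := ⨆ k : ℤ, avB k g x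

lemma measurable_avB {g : (Fin n → ℝ) → ℝ≥0∞} (hg : Measurable g) (k : ℤ) : Measurable (avB k g) :=
  measurable_const.mul (measurable_setLIntegral_closedBall hg _)

lemma measurable_hlM {g : (Fin n → ℝ) → ℝ≥0∞} (hg : Measurable g) : Measurable (hlM g) :=
  Measurable.iSup fun k => measurable_avB hg k

lemma avB_le_hlM (k : ℤ) (g : (Fin n → ℝ) → ℝ≥0∞) (x : Fin n → ℝ) : avB k g x ≤ hlM g x :=
  le_iSup (fun k => avB k g x) k

lemma avB_const (k : ℤ) (a : ℝ≥0∞) (x : Fin n → ℝ) : avB k (fun _ => a) x = 2 ^ n * a := by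
  unfold avB
  rw [setLIntegral_const, Real.volume_pi_closedBall _ (by positivity), Fintype.card_fin, mul_left_comm,
    ← ENNReal.ofReal_mul (by positivity), ← mul_pow]
  have : (2 : ℝ) ^ k * (2 * (2 ^ k)⁻¹) = 2 := by
    have : (2 : ℝ) ^ k ≠ 0 := by positivity
    field_simp
  rw [this, mul_comm, ENNReal.ofReal_pow (by norm_num), ENNReal.ofReal_ofNat]

lemma hlM_le_add {g : (Fin n → ℝ) → ℝ≥0∞} (hg : Measurable g) (t : ℝ≥0∞) (x : Fin n → ℝ) :
    hlM g x ≤ hlM ({y | t < g y}.indicator g) x + 2 ^ n * t := by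
  have hms : MeasurableSet {y | t < g y} := measurableSet_lt measurable_const hg
  refine iSup_le fun k => ?_
  rw [← avB_const k t x]
  refine le_trans ?_ (add_le_add_left (avB_le_hlM k _ x) _)
  unfold avB
  rw [← mul_add, ← lintegral_add_right _ measurable_const]
  refine mul_le_mul_right (lintegral_mono fun y => ?_) _
  by_cases h : t < g y
  · rw [Set.indicator_of_mem (by exact h)]; exact le_self_add
  · rw [Set.indicator_of_notMem (by exact h), zero_add]; exact not_lt.1 h

/-- The weak type `(1,1)` bound for the maximal function. -/
theorem hlM_weak [NeZero n] (g : (Fin n → ℝ) → ℝ≥0∞) {t : ℝ} (ht : 0 < t) :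
    ENNReal.ofReal t * volume {x | ENNReal.ofReal t < hlM g x} ≤ 10 ^ n * ∫⁻ x, g x := by
  rcases eq_or_ne (∫⁻ x, g x) ⊤ with hg | hg
  · rw [hg, ENNReal.mul_top (by simp)]; exact le_top
  have hex : ∀ x : Fin n → ℝ, ∃ k : ℤ, x ∈ {x | ENNReal.ofReal t < hlM g x} →
      ENNReal.ofReal t < avB k g x := fun x => by
    by_cases hx : x ∈ {x | ENNReal.ofReal t < hlM g x}
    · obtain ⟨k, hk⟩ := lt_iSup_iff.1 (show ENNReal.ofReal t < ⨆ k : ℤ, avB k g x from hx)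
      exact ⟨k, fun _ => hk⟩
    · exact ⟨0, fun h => absurd h hx⟩
  choose k hk using hex
  obtain ⟨R, hR⟩ : ∃ R : ℝ, R = max 1 ((∫⁻ x, g x).toReal / t) := ⟨_, rfl⟩
  have hball : ∀ x ∈ {x | ENNReal.ofReal t < hlM g x},
      ENNReal.ofReal (t * (((2 : ℝ) ^ k x)⁻¹) ^ n) ≤
        ∫⁻ y in Metric.closedBall x ((2 : ℝ) ^ k x)⁻¹, g y := by
    intro x hx
    rw [ENNReal.ofReal_mul ht.le]
    refine (mul_le_mul_left (hk x hx).le _).trans_eq ?_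
    unfold avB
    rw [mul_right_comm, ← ENNReal.ofReal_mul (by positivity), ← mul_pow,
      mul_inv_cancel₀ (by positivity), one_pow, ENNReal.ofReal_one, one_mul]
  have hrad : ∀ x ∈ {x | ENNReal.ofReal t < hlM g x}, ((2 : ℝ) ^ k x)⁻¹ ≤ R := by
    intro x hx
    have h1 := (hball x hx).trans (setLIntegral_le_lintegral _ _)
    rw [ENNReal.ofReal_le_iff_le_toReal hg, mul_comm, ← le_div_iff₀ ht] at h1
    rcases le_total ((2 : ℝ) ^ k x)⁻¹ 1 with h2 | h2
    · exact h2.trans (hR ▸ le_max_left _ _)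
    · exact (le_self_pow₀ h2 (NeZero.ne n)).trans (h1.trans (hR ▸ le_max_right _ _))
  obtain ⟨u, hut, hud, huc⟩ := Vitali.exists_disjoint_subfamily_covering_enlargement_closedBall
    {x | ENNReal.ofReal t < hlM g x} id (fun x => ((2 : ℝ) ^ k x)⁻¹) R hrad 5 (by norm_num)
  have hcount : u.Countable := hud.countable_of_nonempty_interior fun x _ => by
    rw [interior_closedBall _ (by positivity)]
    exact ⟨x, Metric.mem_ball_self (by positivity)⟩
  have hsub : {x | ENNReal.ofReal t < hlM g x} ⊆ ⋃ x ∈ u, Metric.closedBall x (5 * ((2 : ℝ) ^ k x)⁻¹) := by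
    intro x hx
    obtain ⟨b, hb, hxb⟩ := huc x hx
    exact Set.mem_biUnion hb (hxb (Metric.mem_closedBall_self (by positivity)))
  have : Countable u := hcount.to_subtype
  calc _ ≤ ENNReal.ofReal t * ∑' x : u, volume (Metric.closedBall (x : Fin n → ℝ) (5 * ((2 : ℝ) ^ k x)⁻¹)) :=
        mul_le_mul_right ((measure_mono hsub).trans (measure_biUnion_le _ hcount _)) _
    _ ≤ ∑' x : u, 10 ^ n * ∫⁻ y in Metric.closedBall (x : Fin n → ℝ) ((2 : ℝ) ^ k x)⁻¹, g y := by
        rw [← ENNReal.tsum_mul_left]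
        refine ENNReal.tsum_le_tsum fun x => ?_
        rw [Real.volume_pi_closedBall _ (by positivity), Fintype.card_fin,
          ← ENNReal.ofReal_mul ht.le]
        have : t * (2 * (5 * ((2 : ℝ) ^ k x)⁻¹)) ^ n = 10 ^ n * (t * ((2 : ℝ) ^ k x)⁻¹ ^ n) := by
          rw [← mul_assoc, mul_pow]; norm_num; ring
        rw [this, ENNReal.ofReal_mul (by positivity), ENNReal.ofReal_pow (by norm_num), ENNReal.ofReal_ofNat]
        exact mul_le_mul_right (hball x (hut x.2)) _
    _ = 10 ^ n * ∫⁻ y in ⋃ x ∈ u, Metric.closedBall x ((2 : ℝ) ^ k x)⁻¹, g y := by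
        have hud' : u.PairwiseDisjoint fun a => Metric.closedBall a ((2 : ℝ) ^ k a)⁻¹ := hud
        rw [ENNReal.tsum_mul_left, lintegral_biUnion hcount (fun _ _ => measurableSet_closedBall) hud']
    _ ≤ _ := mul_le_mul_right (setLIntegral_le_lintegral _ _) _

/-- The maximal function is bounded on `L^p` for `1 < p`. -/
theorem hlM_strong (n : ℕ) [NeZero n] {p : ℝ} (hp : 1 < p) : ∃ A : NNReal, ∀ g : (Fin n → ℝ) → ℝ≥0∞,
    Measurable g → ∫⁻ x, hlM g x ^ p ≤ A * ∫⁻ x, g x ^ p := by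
  obtain ⟨c, hc⟩ : ∃ c : ℝ, c = 1 + 2 ^ n := ⟨_, rfl⟩
  have hc0 : 0 < c := hc ▸ by positivity
  have hcE : ENNReal.ofReal c = 1 + 2 ^ n := by
    rw [hc, ENNReal.ofReal_add (by norm_num) (by positivity), ENNReal.ofReal_pow (by norm_num)]; simp
  refine ⟨(c ^ p).toNNReal * (10 ^ n * (p / (p - 1)).toNNReal), fun g hg => ?_⟩
  have hM := measurable_hlM hg
  have key := marcinkiewicz (α := Fin n → ℝ) (β := Fin n → ℝ) volume volume {()}
    (F := fun (_ : Unit) x => (ENNReal.ofReal c)⁻¹ * hlM g x) (fun _ => measurable_const.mul hM) hg zero_le_one hp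
    (10 ^ n) (fun t ht => by
      simp only [Finset.sum_singleton, Real.rpow_one, ENNReal.rpow_one]
      have hms : MeasurableSet {y | ENNReal.ofReal t < g y} := measurableSet_lt measurable_const hg
      rw [← lintegral_indicator hms]
      refine le_trans (mul_le_mul_right (measure_mono fun x hx => ?_) _)
        ((hlM_weak ({y | ENNReal.ofReal t < g y}.indicator g) ht).trans_eq (by push_cast; rfl))
      by_contra hcon
      rw [Set.mem_ofPred_eq, not_lt] at hcon
      rw [Set.mem_ofPred_eq] at hx
      refine absurd hx (not_lt.2 ?_)
      have h1 : hlM g x ≤ ENNReal.ofReal c * ENNReal.ofReal t := by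
        refine (hlM_le_add hg (ENNReal.ofReal t) x).trans ?_
        rw [hcE, add_mul, one_mul]
        exact add_le_add_left hcon _
      calc _ ≤ (ENNReal.ofReal c)⁻¹ * (ENNReal.ofReal c * ENNReal.ofReal t) := mul_le_mul_right h1 _
        _ = _ := by
          rw [← mul_assoc, ENNReal.inv_mul_cancel (by simpa using hc0) ENNReal.ofReal_ne_top, one_mul])
  simp only [Finset.sum_singleton] at key
  have e1 : ∀ x, hlM g x ^ p = ENNReal.ofReal (c ^ p) * ((ENNReal.ofReal c)⁻¹ * hlM g x) ^ p := fun x => by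
    rw [← ENNReal.ofReal_rpow_of_nonneg hc0.le (by linarith), ← ENNReal.mul_rpow_of_nonneg _ _ (by linarith),
      ← mul_assoc, ENNReal.mul_inv_cancel (by simpa using hc0) ENNReal.ofReal_ne_top, one_mul]
  simp only [e1]
  rw [lintegral_const_mul' _ _ ENNReal.ofReal_ne_top]
  refine (mul_le_mul_right key _).trans_eq ?_
  push_cast
  simp only [ENNReal.ofReal]
  ring

end Maximal

section Sharp

variable {n : ℕ}

/-- The index of the dyadic cube of side `2 ^ (-k)` containing `x`. -/
def dyi (k : ℤ) (x : Fin n → ℝ) : Fin n → ℤ := fun i => ⌊(2 : ℝ) ^ k * x i⌋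

/-- The dyadic cube of side `2 ^ (-k)` containing `x`. -/
def dyQ (k : ℤ) (x : Fin n → ℝ) : Set (Fin n → ℝ) := {y | dyi k y = dyi k x}

lemma mem_dyQ {k : ℤ} {x y : Fin n → ℝ} : y ∈ dyQ k x ↔ dyi k y = dyi k x := Iff.rfl

lemma measurable_dyi (k : ℤ) : Measurable (dyi (n := n) k) :=
  measurable_pi_iff.2 fun i => Int.measurable_floor.comp (by fun_prop)

lemma measurableSet_dyQ (k : ℤ) (x : Fin n → ℝ) : MeasurableSet (dyQ k x) :=
  measurable_dyi k (measurableSet_singleton _)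

lemma dyQ_subset_closedBall (k : ℤ) (x : Fin n → ℝ) : dyQ k x ⊆ Metric.closedBall x ((2 : ℝ) ^ k)⁻¹ := by
  intro y hy
  have h2 : (0 : ℝ) < 2 ^ k := by positivity
  rw [Metric.mem_closedBall, dist_pi_le_iff (by positivity)]
  intro i
  have h := congrFun (mem_dyQ.1 hy) i
  have h1 := Int.abs_sub_lt_one_of_floor_eq_floor h
  rw [← mul_sub, abs_mul, abs_of_pos h2] at h1
  rw [Real.dist_eq, ← mul_le_mul_iff_right₀ h2, mul_inv_cancel₀ h2.ne']
  exact h1.le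

lemma volume_dyQ (k : ℤ) (x : Fin n → ℝ) : volume (dyQ k x) = ENNReal.ofReal ((((2 : ℝ) ^ k)⁻¹) ^ n) := by
  have h2 : (0 : ℝ) < 2 ^ k := by positivity
  have e : dyQ k x = Set.pi Set.univ fun i => Set.Ico ((dyi k x i : ℝ) / 2 ^ k) ((dyi k x i + 1) / 2 ^ k) := by
    ext y
    rw [mem_dyQ, Set.mem_univ_pi, funext_iff]
    refine forall_congr' fun i => ?_
    rw [Set.mem_Ico, div_le_iff₀ h2, lt_div_iff₀ h2, mul_comm]
    exact Int.floor_eq_iff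
  rw [e, Real.volume_pi_Ico]
  have : ∀ i, ENNReal.ofReal ((dyi k x i + 1) / 2 ^ k - (dyi k x i : ℝ) / 2 ^ k)
      = ENNReal.ofReal ((2 : ℝ) ^ k)⁻¹ := fun i => by
    congr 1; field_simp; ring
  simp only [this, Finset.prod_const, Finset.card_univ, Fintype.card_fin]
  rw [ENNReal.ofReal_pow (by positivity)]

lemma dyi_succ {k : ℤ} {x y : Fin n → ℝ} (h : dyi (k + 1) y = dyi (k + 1) x) : dyi k y = dyi k x := by
  funext i
  have h1 : ∀ z : Fin n → ℝ, dyi k z i = dyi (k + 1) z i / 2 := fun z => by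
    unfold dyi
    rw [zpow_add_one₀ (by norm_num), Int.floor_eq_iff]
    obtain ⟨a, ha⟩ : ∃ a : ℝ, a = (2 : ℝ) ^ k * z i := ⟨_, rfl⟩
    have e : (2 : ℝ) ^ k * 2 * z i = 2 * a := by rw [ha]; ring
    rw [e, ← ha]
    obtain ⟨m, hm⟩ : ∃ m : ℤ, m = ⌊2 * a⌋ := ⟨_, rfl⟩
    rw [← hm]
    have h3 : (m : ℝ) ≤ 2 * a := hm ▸ Int.floor_le _
    have h4 : 2 * a < m + 1 := hm ▸ Int.lt_floor_add_one _
    have h5 : 2 * (m / 2) ≤ m := by omega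
    have h6 : m + 1 ≤ 2 * (m / 2) + 2 := by omega
    have h5' : (2 : ℝ) * ((m / 2 : ℤ) : ℝ) ≤ m := by exact_mod_cast h5
    have h6' : (m : ℝ) + 1 ≤ 2 * ((m / 2 : ℤ) : ℝ) + 2 := by exact_mod_cast h6
    constructor <;> linarith
  rw [h1, h1, h]

lemma dyi_mono {k l : ℤ} (hkl : k ≤ l) {x y : Fin n → ℝ} (h : dyi l y = dyi l x) : dyi k y = dyi k x := by
  obtain ⟨d, rfl⟩ := Int.le.dest hkl
  induction d with
  | zero => simpa using h
  | succ d ih =>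
    refine ih (by omega) (dyi_succ ?_)
    rw [add_assoc]
    exact_mod_cast h

/-- The average of `g` over the dyadic cube of side `2 ^ (-k)` containing `x`. -/
def avD (k : ℤ) (g : (Fin n → ℝ) → ℝ≥0∞) (x : Fin n → ℝ) : ℝ≥0∞ :=
  ENNReal.ofReal (((2 : ℝ) ^ k) ^ n) * ∫⁻ y in dyQ k x, g y

lemma avD_congr {k : ℤ} (g : (Fin n → ℝ) → ℝ≥0∞) {x y : Fin n → ℝ} (h : dyi k y = dyi k x) :
    avD k g y = avD k g x := by
  unfold avD dyQ
  rw [h]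

lemma measurable_avD (k : ℤ) (g : (Fin n → ℝ) → ℝ≥0∞) : Measurable (avD k g) := by
  have : avD k g = (fun m : Fin n → ℤ => ENNReal.ofReal (((2 : ℝ) ^ k) ^ n) *
      ∫⁻ y in {y | dyi k y = m}, g y) ∘ dyi k := rfl
  rw [this]
  exact (measurable_of_countable _).comp (measurable_dyi k)

lemma avD_le_avB (k : ℤ) (g : (Fin n → ℝ) → ℝ≥0∞) (x : Fin n → ℝ) : avD k g x ≤ avB k g x :=
  mul_le_mul_right (lintegral_mono_set (dyQ_subset_closedBall k x)) _

lemma avD_const (k : ℤ) (a : ℝ≥0∞) (x : Fin n → ℝ) : avD k (fun _ => a) x = a := by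
  unfold avD
  rw [setLIntegral_const, volume_dyQ, mul_left_comm, ← ENNReal.ofReal_mul (by positivity), ← mul_pow,
    mul_inv_cancel₀ (by positivity), one_pow, ENNReal.ofReal_one, mul_one]

lemma avD_add_const (k : ℤ) (g : (Fin n → ℝ) → ℝ≥0∞) (a : ℝ≥0∞) (x : Fin n → ℝ) :
    avD k (fun y => g y + a) x = avD k g x + a := by
  conv_rhs => rw [← avD_const k a x]
  unfold avD
  rw [lintegral_add_right _ measurable_const, mul_add]

lemma avD_mono (k : ℤ) {g h : (Fin n → ℝ) → ℝ≥0∞} (hgh : ∀ x, g x ≤ h x) (x : Fin n → ℝ) :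
    avD k g x ≤ avD k h x := mul_le_mul_right (lintegral_mono hgh) _

/-- The dyadic maximal function. -/
def mdD (g : (Fin n → ℝ) → ℝ≥0∞) (x : Fin n → ℝ) : ℝ≥0∞ := ⨆ k : ℤ, avD k g x

lemma measurable_mdD (g : (Fin n → ℝ) → ℝ≥0∞) : Measurable (mdD g) := Measurable.iSup fun k => measurable_avD k g

lemma mdD_le_hlM (g : (Fin n → ℝ) → ℝ≥0∞) (x : Fin n → ℝ) : mdD g x ≤ hlM g x :=
  iSup_mono fun k => avD_le_avB k g x

lemma le_mdD {g : (Fin n → ℝ) → ℝ≥0∞} (hg : Continuous g) (x : Fin n → ℝ) : g x ≤ mdD g x := by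
  refine le_of_forall_lt fun a ha => ?_
  obtain ⟨b, hab, hb⟩ := exists_between ha
  obtain ⟨ε, hε, hball⟩ := Metric.isOpen_iff.1 (isOpen_lt continuous_const hg) x (show b < g x from hb)
  obtain ⟨N, hN⟩ := exists_pow_lt_of_lt_one hε (by norm_num : (1 / 2 : ℝ) < 1)
  refine hab.trans_le (le_trans ?_ (le_iSup (fun k : ℤ => avD k g x) (N : ℤ)))
  rw [← avD_const (N : ℤ) b x]
  unfold avD
  refine mul_le_mul_right (setLIntegral_mono hg.measurable fun y hy => ?_) _
  have h1 := dyQ_subset_closedBall _ _ hy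
  have h2 : y ∈ Metric.ball x ε := by
    rw [Metric.mem_closedBall] at h1
    rw [Metric.mem_ball]
    refine h1.trans_lt ?_
    rw [one_div, inv_pow] at hN
    exact_mod_cast hN
  exact (hball h2).le

/-- Dyadic averages at large scales are small. -/
lemma exists_avD_le {g : (Fin n → ℝ) → ℝ≥0∞} [NeZero n] (hg : Measurable g) {p : ℝ} (hp : 1 ≤ p)
    (hfin : ∫⁻ x, g x ^ p ≠ ⊤) {t : ℝ} (ht : 0 < t) :
    ∃ K : ℤ, ∀ k ≤ K, ∀ x, avD k g x ≤ ENNReal.ofReal t := by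
  have hp0 : 0 < p := by linarith
  obtain ⟨N, hN⟩ : ∃ N : ℕ, (∫⁻ x, g x ^ p).toReal / t ^ p < 2 ^ N := pow_unbounded_of_one_lt _ (by norm_num)
  refine ⟨-N, fun k hk x => ?_⟩
  rw [← ENNReal.rpow_le_rpow_iff hp0]
  have hX : ((2 : ℝ) ^ k) ^ n ≤ (2 ^ N)⁻¹ := by
    have h1 : (2 : ℝ) ^ k ≤ (2 ^ N)⁻¹ := by
      calc (2 : ℝ) ^ k ≤ 2 ^ (-(N : ℤ)) := zpow_le_zpow_right₀ (by norm_num) hk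
        _ = _ := by rw [zpow_neg, zpow_natCast]
    have h2 : (2 : ℝ) ^ k ≤ 1 := h1.trans (inv_le_one_of_one_le₀ (one_le_pow₀ (by norm_num)))
    exact (pow_le_of_le_one (by positivity) h2 (NeZero.ne n)).trans h1
  obtain ⟨X, hXd⟩ : ∃ X : ℝ, X = ((2 : ℝ) ^ k) ^ n := ⟨_, rfl⟩
  have hX0 : 0 < X := hXd ▸ by positivity
  have hXne : ENNReal.ofReal X ≠ 0 := by simpa using hX0
  calc avD k g x ^ p ≤ ENNReal.ofReal X * ∫⁻ x, g x ^ p := by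
        unfold avD
        rw [ENNReal.mul_rpow_of_nonneg _ _ hp0.le]
        refine (mul_le_mul_right (lintegral_rpow_le _ hg hp) _).trans ?_
        have e : ENNReal.ofReal X ^ (p - 1) * ENNReal.ofReal X⁻¹ ^ (p - 1) = 1 := by
          rw [← ENNReal.mul_rpow_of_nonneg _ _ (by linarith), ← ENNReal.ofReal_mul hX0.le,
            mul_inv_cancel₀ hX0.ne', ENNReal.ofReal_one, ENNReal.one_rpow]
        rw [Measure.restrict_apply_univ, volume_dyQ, ← mul_assoc, inv_pow, ← hXd,
          rpow_eq_rpow_sub_one_mul _ hp, mul_right_comm (ENNReal.ofReal X ^ (p - 1)), e, one_mul]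
        exact mul_le_mul_right (setLIntegral_le_lintegral _ _) _
    _ = ENNReal.ofReal (X * (∫⁻ x, g x ^ p).toReal) := by
        rw [ENNReal.ofReal_mul hX0.le, ENNReal.ofReal_toReal hfin]
    _ ≤ ENNReal.ofReal (t ^ p) := by
        refine ENNReal.ofReal_le_ofReal ?_
        rw [div_lt_iff₀ (by positivity)] at hN
        calc X * (∫⁻ x, g x ^ p).toReal ≤ (2 ^ N)⁻¹ * (2 ^ N * t ^ p) := by
              rw [hXd]; gcongr
          _ = t ^ p := by field_simp
    _ = _ := by rw [ENNReal.ofReal_rpow_of_nonneg ht.le hp0.le]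

end Sharp

section GoodLambda

variable {n : ℕ}

lemma avD_indicator {k l : ℤ} (hkl : l ≤ k) (g : (Fin n → ℝ) → ℝ≥0∞) {x x₀ : Fin n → ℝ}
    (hx : dyi l x = dyi l x₀) : avD k g x = avD k ((dyQ l x₀).indicator g) x := by
  unfold avD
  congr 1
  refine setLIntegral_congr_fun (measurableSet_dyQ k x) fun y hy => ?_
  rw [Set.indicator_of_mem]
  exact (dyi_mono hkl hy).trans hx

/-- The good-`λ` inequality on one cube of the stopping time decomposition. -/
lemma good_lambda_cube [NeZero n] {G : (Fin n → ℝ) → ℂ} (hG : Continuous G) {Sh : (Fin n → ℝ) → ℝ≥0∞}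
    (hSh : ∀ x (k : ℤ), ∃ c : ℂ, avD k (fun y => ‖G y - c‖ₑ) x ≤ Sh x) {t γ : ℝ} (ht : 0 < t)
    (hγ0 : 0 < γ) (hγ : γ ≤ 1) (k : ℤ) (x₁ : Fin n → ℝ)
    (hk : ∀ i < k, avD i (fun y => ‖G y‖ₑ) x₁ ≤ ENNReal.ofReal t) :
    volume ({x | 4 * ENNReal.ofReal t < mdD (fun y => ‖G y‖ₑ) x ∧ Sh x ≤ ENNReal.ofReal (γ * t)} ∩ dyQ k x₁)
      ≤ ENNReal.ofReal (20 ^ n * γ) * volume (dyQ k x₁) := by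
  rcases Set.eq_empty_or_nonempty ({x | 4 * ENNReal.ofReal t < mdD (fun y => ‖G y‖ₑ) x ∧
    Sh x ≤ ENNReal.ofReal (γ * t)} ∩ dyQ k x₁) with h | ⟨x₀, ⟨-, hx₀⟩, hx₀Q⟩
  · rw [h, measure_empty]; exact zero_le
  have hpar : ∀ x ∈ dyQ k x₁, ∀ i ≤ k, dyi i x = dyi i x₁ := fun x hx i hi => dyi_mono hi hx
  obtain ⟨c, hc⟩ := hSh x₀ (k - 1)
  have hT0 : ENNReal.ofReal t ≠ 0 := by simpa using ht
  have hγt : ENNReal.ofReal (γ * t) ≤ ENNReal.ofReal t :=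
    ENNReal.ofReal_le_ofReal (mul_le_of_le_one_left ht.le hγ)
  have hcn : ‖c‖ₑ ≤ 2 * ENNReal.ofReal t := by
    rw [← avD_const (k - 1) ‖c‖ₑ x₀]
    calc _ ≤ avD (k - 1) (fun y => ‖G y - c‖ₑ + ‖G y‖ₑ) x₀ := avD_mono _ (fun y => by
          calc ‖c‖ₑ = ‖-(G y - c) + G y‖ₑ := by congr 1; ring
            _ ≤ _ := (enorm_add_le _ _).trans_eq (by rw [enorm_neg])) _
      _ ≤ avD (k - 1) (fun y => ‖G y - c‖ₑ) x₀ + avD (k - 1) (fun y => ‖G y‖ₑ) x₀ := by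
          unfold avD
          rw [← mul_add, lintegral_add_right _ hG.measurable.enorm]
      _ ≤ ENNReal.ofReal t + ENNReal.ofReal t := by
          refine add_le_add ((hc.trans hx₀).trans hγt) ?_
          rw [avD_congr _ (hpar x₀ hx₀Q (k - 1) (by omega))]
          exact hk _ (by omega)
      _ = _ := by ring
  have hsub : {x | 4 * ENNReal.ofReal t < mdD (fun y => ‖G y‖ₑ) x ∧ Sh x ≤ ENNReal.ofReal (γ * t)} ∩ dyQ k x₁
      ⊆ {x | ENNReal.ofReal t < hlM ((dyQ (k - 1) x₀).indicator fun y => ‖G y - c‖ₑ) x} := by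
    rintro x ⟨⟨hx, -⟩, hxQ⟩
    obtain ⟨i, hi⟩ := lt_iSup_iff.1 (show _ < ⨆ k : ℤ, avD k (fun y => ‖G y‖ₑ) x from hx)
    have hik : k ≤ i := by
      by_contra hik
      push Not at hik
      rw [avD_congr _ (hpar x hxQ i hik.le)] at hi
      refine absurd (hi.trans_le (hk i hik)) (not_lt.2 ?_)
      exact le_mul_of_one_le_left' (by norm_num)
    have h1 : avD i (fun y => ‖G y‖ₑ) x ≤ avD i (fun y => ‖G y - c‖ₑ) x + ‖c‖ₑ := by
      rw [← avD_add_const]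
      refine avD_mono _ (fun y => ?_) _
      calc ‖G y‖ₑ = ‖(G y - c) + c‖ₑ := by congr 1; ring
        _ ≤ _ := enorm_add_le _ _
    have h2 : avD i (fun y => ‖G y - c‖ₑ) x ≤ hlM ((dyQ (k - 1) x₀).indicator fun y => ‖G y - c‖ₑ) x := by
      rw [avD_indicator (l := k - 1) (k := i) (by omega) (fun y => ‖G y - c‖ₑ) (x := x) (x₀ := x₀)
        ((hpar x hxQ _ (by omega)).trans (hpar x₀ hx₀Q _ (by omega)).symm)]
      exact (avD_le_avB _ _ _).trans (avB_le_hlM _ _ _)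
    refine lt_of_lt_of_le ?_ h2
    by_contra hcon
    push Not at hcon
    refine absurd hi (not_lt.2 (h1.trans ((add_le_add hcon hcn).trans ?_)))
    calc ENNReal.ofReal t + 2 * ENNReal.ofReal t = 3 * ENNReal.ofReal t := by ring
      _ ≤ _ := mul_le_mul_left (by norm_num) _
  refine (ENNReal.mul_le_mul_iff_right hT0 ENNReal.ofReal_ne_top).1 ?_
  refine (mul_le_mul_right (measure_mono hsub) _).trans ((hlM_weak _ ht).trans ?_)
  rw [lintegral_indicator (measurableSet_dyQ _ _)]
  have h3 : ∫⁻ y in dyQ (k - 1) x₀, ‖G y - c‖ₑ ≤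
      ENNReal.ofReal ((((2 : ℝ) ^ (k - 1))⁻¹) ^ n) * ENNReal.ofReal (γ * t) := by
    refine le_trans (le_of_eq ?_) (mul_le_mul_right (hc.trans hx₀) _)
    unfold avD
    rw [← mul_assoc, ← ENNReal.ofReal_mul (by positivity), ← mul_pow, inv_mul_cancel₀ (by positivity),
      one_pow, ENNReal.ofReal_one, one_mul]
  refine (mul_le_mul_right h3 _).trans_eq ?_
  rw [volume_dyQ, show (10 : ℝ≥0∞) ^ n = ENNReal.ofReal (10 ^ n) by
    rw [ENNReal.ofReal_pow (by norm_num)]; norm_num, ← ENNReal.ofReal_mul (by positivity),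
    ← ENNReal.ofReal_mul (by positivity), ← ENNReal.ofReal_mul (by positivity),
    ← ENNReal.ofReal_mul (by positivity)]
  congr 1
  rw [zpow_sub_one₀ (by norm_num), mul_inv, inv_inv, mul_pow, show (20 : ℝ) = 10 * 2 by norm_num, mul_pow]
  ring

/-- The good-`λ` inequality between the dyadic maximal function and the sharp function. -/
lemma good_lambda [NeZero n] {G : (Fin n → ℝ) → ℂ} (hG : Continuous G) {Sh : (Fin n → ℝ) → ℝ≥0∞}
    {p : ℝ} (hp : 1 ≤ p) (hfin : ∫⁻ x, ‖G x‖ₑ ^ p ≠ ⊤)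
    (hSh : ∀ x (k : ℤ), ∃ c : ℂ, avD k (fun y => ‖G y - c‖ₑ) x ≤ Sh x) {t γ : ℝ} (ht : 0 < t)
    (hγ0 : 0 < γ) (hγ : γ ≤ 1) :
    volume {x | 4 * ENNReal.ofReal t < mdD (fun y => ‖G y‖ₑ) x ∧ Sh x ≤ ENNReal.ofReal (γ * t)}
      ≤ ENNReal.ofReal (20 ^ n * γ) * volume {x | ENNReal.ofReal t < mdD (fun y => ‖G y‖ₑ) x} := by
  obtain ⟨g, hg⟩ : ∃ g : (Fin n → ℝ) → ℝ≥0∞, g = fun y => ‖G y‖ₑ := ⟨_, rfl⟩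
  obtain ⟨E, hE⟩ : ∃ E, E = {x | 4 * ENNReal.ofReal t < mdD (fun y => ‖G y‖ₑ) x ∧ Sh x ≤ ENNReal.ofReal (γ * t)} :=
    ⟨_, rfl⟩
  obtain ⟨K, hK⟩ := exists_avD_le (g := g) (hg ▸ hG.measurable.enorm) hp (hg ▸ hfin) ht
  obtain ⟨O, hO⟩ : ∃ O : ℤ × (Fin n → ℤ) → Set (Fin n → ℝ), O = fun q =>
      {x | (ENNReal.ofReal t < avD q.1 g x ∧ ∀ i < q.1, avD i g x ≤ ENNReal.ofReal t) ∧ dyi q.1 x = q.2} :=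
    ⟨_, rfl⟩
  have hOm : ∀ q, MeasurableSet (O q) := fun q => by
    rw [hO]
    refine MeasurableSet.inter (MeasurableSet.inter (measurableSet_lt measurable_const (measurable_avD _ _)) ?_)
      (measurable_dyi q.1 (measurableSet_singleton _))
    have : {x : Fin n → ℝ | ∀ i < q.1, avD i g x ≤ ENNReal.ofReal t}
        = ⋂ i : ℤ, ⋂ _ : i < q.1, {x | avD i g x ≤ ENNReal.ofReal t} := by ext x; simp
    rw [show (fun x : Fin n → ℝ => ∀ i < q.1, avD i g x ≤ ENNReal.ofReal t)
      = {x : Fin n → ℝ | ∀ i < q.1, avD i g x ≤ ENNReal.ofReal t} from rfl, this]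
    exact MeasurableSet.iInter fun i => MeasurableSet.iInter fun _ =>
      measurableSet_le (measurable_avD _ _) measurable_const
  have hOcover : ∀ x, ENNReal.ofReal t < mdD g x → ∃ q, x ∈ O q := by
    intro x hx
    have hex := lt_iSup_iff.1 (show _ < ⨆ k : ℤ, avD k g x from hx)
    obtain ⟨k, hk1, hk2⟩ := Int.exists_least_of_bdd (P := fun k => ENNReal.ofReal t < avD k g x)
      ⟨K, fun z hz => by
        by_contra hzK
        push Not at hzK
        exact absurd hz (not_lt.2 (hK z hzK.le x))⟩ hex
    refine ⟨(k, dyi k x), ?_⟩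
    rw [hO]
    refine ⟨⟨hk1, fun i hi => ?_⟩, rfl⟩
    by_contra hcon
    push Not at hcon
    exact absurd (hk2 i hcon) (by omega)
  have hOdisj : Pairwise (Function.onFun Disjoint O) := by
    intro q q' hqq'
    refine Set.disjoint_left.2 fun x hx hx' => hqq' ?_
    rw [hO] at hx hx'
    obtain ⟨⟨h1, h2⟩, h3⟩ := hx
    obtain ⟨⟨h1', h2'⟩, h3'⟩ := hx'
    have e : q.1 = q'.1 := by
      rcases lt_trichotomy q.1 q'.1 with h | h | h
      · exact absurd (h2' _ h) (not_le.2 h1)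
      · exact h
      · exact absurd (h2 _ h) (not_le.2 h1')
    refine Prod.ext e ?_
    rw [← h3, ← h3', e]
  have hcell : ∀ q, volume (E ∩ O q) ≤ ENNReal.ofReal (20 ^ n * γ) * volume (O q) := by
    intro q
    rcases (O q).eq_empty_or_nonempty with h | ⟨x₁, hx₁⟩
    · rw [h, Set.inter_empty, measure_empty]; exact zero_le
    have hx₁' := hx₁
    rw [hO] at hx₁'
    obtain ⟨⟨h1, h2⟩, h3⟩ := hx₁'
    have e : O q = dyQ q.1 x₁ := by
      ext y
      rw [mem_dyQ, h3]
      constructor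
      · intro hy
        rw [hO] at hy
        exact hy.2
      · intro hy
        have hy1 : dyi q.1 y = dyi q.1 x₁ := hy.trans h3.symm
        rw [hO]
        refine ⟨⟨?_, fun i hi => ?_⟩, hy⟩
        · rw [avD_congr g hy1]; exact h1
        · rw [avD_congr g (dyi_mono hi.le hy1)]; exact h2 i hi
    rw [e, hE]
    exact good_lambda_cube hG hSh ht hγ0 hγ q.1 x₁ (fun i hi => hg ▸ h2 i hi)
  rw [← hE, ← hg]
  have hEO : E ⊆ ⋃ q, E ∩ O q := by
    intro x hx
    have hx' := hx
    rw [hE, ← hg] at hx'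
    obtain ⟨q, hq⟩ := hOcover x (lt_of_le_of_lt (le_mul_of_one_le_left' (by norm_num)) hx'.1)
    exact Set.mem_iUnion.2 ⟨q, hx, hq⟩
  calc volume E ≤ ∑' q, volume (E ∩ O q) := (measure_mono hEO).trans (measure_iUnion_le _)
    _ ≤ ∑' q, ENNReal.ofReal (20 ^ n * γ) * volume (O q) := ENNReal.tsum_le_tsum hcell
    _ = ENNReal.ofReal (20 ^ n * γ) * volume (⋃ q, O q) := by
        rw [ENNReal.tsum_mul_left, measure_iUnion hOdisj hOm]
    _ ≤ _ := by
        refine mul_le_mul_right (measure_mono (Set.iUnion_subset fun q x hx => ?_)) _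
        rw [hO] at hx
        exact lt_of_lt_of_le hx.1.1 (le_iSup (fun k : ℤ => avD k g x) q.1)

/-- The sharp function controls the `L^p` norm. -/
theorem sharp_bound (n : ℕ) [NeZero n] {p : ℝ} (hp : 1 < p) : ∃ A : NNReal, ∀ (G : (Fin n → ℝ) → ℂ)
    (Sh : (Fin n → ℝ) → ℝ≥0∞), Continuous G → Measurable Sh → ∫⁻ x, ‖G x‖ₑ ^ p ≠ ⊤ →
    (∀ x (k : ℤ), ∃ c : ℂ, avB k (fun y => ‖G y - c‖ₑ) x ≤ Sh x) →
    ∫⁻ x, ‖G x‖ₑ ^ p ≤ A * ∫⁻ x, Sh x ^ p := by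
  have hp0 : 0 < p := by linarith
  obtain ⟨D, hD⟩ := hlM_strong n hp
  obtain ⟨γ, hγ⟩ : ∃ γ : ℝ, γ = (20 ^ n * (2 * 4 ^ p))⁻¹ := ⟨_, rfl⟩
  have hγ0 : 0 < γ := hγ ▸ by positivity
  have h4p : (1 : ℝ) ≤ 4 ^ p := Real.one_le_rpow (by norm_num) hp0.le
  have hγ1 : γ ≤ 1 := by
    rw [hγ]
    refine inv_le_one_of_one_le₀ ?_
    have : (1 : ℝ) ≤ 20 ^ n := one_le_pow₀ (by norm_num)
    nlinarith
  refine ⟨(2 * (4 * γ⁻¹) ^ p).toNNReal, fun G Sh hG hSm hfin hSh => ?_⟩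
  obtain ⟨F, hF⟩ : ∃ F, F = mdD (fun y => ‖G y‖ₑ) := ⟨_, rfl⟩
  have hFm : Measurable F := hF ▸ measurable_mdD _
  have hGF : ∫⁻ x, ‖G x‖ₑ ^ p ≤ ∫⁻ x, F x ^ p := lintegral_mono fun x =>
    ENNReal.rpow_le_rpow (hF ▸ le_mdD (g := fun y => ‖G y‖ₑ) (by fun_prop) x) hp0.le
  have hFfin : ∫⁻ x, F x ^ p ≠ ⊤ := by
    refine ne_top_of_le_ne_top (ENNReal.mul_ne_top ENNReal.coe_ne_top hfin) (le_trans ?_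
      (hD (fun y => ‖G y‖ₑ) hG.measurable.enorm))
    exact lintegral_mono fun x => ENNReal.rpow_le_rpow (hF ▸ mdD_le_hlM _ x) hp0.le
  have hlay : ∀ H : (Fin n → ℝ) → ℝ≥0∞, Measurable H → ∫⁻ x, H x ^ p = ENNReal.ofReal p *
      ∫⁻ t in Set.Ioi (0 : ℝ), ENNReal.ofReal (t ^ (p - 1)) * volume {x | ENNReal.ofReal t < H x} :=
    fun H hH => by
      have := lintegral_rpow_layercake volume hH (fun _ => 1) measurable_const hp0
      simpa using this
  have hmono : ∀ H : (Fin n → ℝ) → ℝ≥0∞, Measurable fun t : ℝ => ENNReal.ofReal (t ^ (p - 1)) *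
      volume {x | ENNReal.ofReal t < H x} := fun H => by
    refine Measurable.mul (by fun_prop) (Antitone.measurable fun s t hst => measure_mono fun x hx => ?_)
    exact lt_of_le_of_lt (ENNReal.ofReal_le_ofReal hst) hx
  have h4 : (4 : ℝ≥0∞) ≠ 0 := by norm_num
  have h4t : (4 : ℝ≥0∞) ≠ ⊤ := by norm_num
  have key : ∫⁻ x, (4⁻¹ * F x) ^ p ≤ (∫⁻ x, (ENNReal.ofReal γ⁻¹ * Sh x) ^ p) +
      ENNReal.ofReal (20 ^ n * γ) * ∫⁻ x, F x ^ p := by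
    rw [hlay (fun x => 4⁻¹ * F x) (measurable_const.mul hFm),
      hlay (fun x => ENNReal.ofReal γ⁻¹ * Sh x) (measurable_const.mul hSm), hlay F hFm, mul_left_comm,
      ← mul_add]
    refine mul_le_mul_right ?_ _
    rw [← lintegral_const_mul' _ _ ENNReal.ofReal_ne_top, ← lintegral_add_left (hmono _)]
    refine setLIntegral_mono' measurableSet_Ioi fun t ht => ?_
    have ht0 : (0 : ℝ) < t := ht
    rw [mul_left_comm, ← mul_add]
    refine mul_le_mul_right ?_ _
    have h1 := good_lambda hG hp.le hfin (fun x k => by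
      obtain ⟨c, hc⟩ := hSh x k
      exact ⟨c, (avD_le_avB _ _ _).trans hc⟩) ht0 hγ0 hγ1
    rw [← hF] at h1
    refine le_trans (measure_mono fun x hx => ?_) ((measure_union_le _ _).trans (add_le_add_right h1 _))
    have hx1 : 4 * ENNReal.ofReal t < F x := by
      have hx' : ENNReal.ofReal t < 4⁻¹ * F x := hx
      by_contra hcon
      push Not at hcon
      refine absurd hx' (not_lt.2 ((mul_le_mul_right hcon _).trans_eq ?_))
      rw [← mul_assoc, ENNReal.inv_mul_cancel h4 h4t, one_mul]
    by_cases hs : Sh x ≤ ENNReal.ofReal (γ * t)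
    · exact Or.inr ⟨hx1, hs⟩
    · left
      push Not at hs
      by_contra hcon
      have hcon' : ENNReal.ofReal γ⁻¹ * Sh x ≤ ENNReal.ofReal t := not_lt.1 hcon
      refine absurd hs (not_lt.2 ?_)
      have := mul_le_mul_right hcon' (ENNReal.ofReal γ)
      rwa [← mul_assoc, ← ENNReal.ofReal_mul hγ0.le, mul_inv_cancel₀ hγ0.ne', ENNReal.ofReal_one, one_mul,
        ← ENNReal.ofReal_mul hγ0.le] at this
  obtain ⟨a, ha⟩ : ∃ a, a = ∫⁻ x, F x ^ p := ⟨_, rfl⟩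
  obtain ⟨b, hb⟩ : ∃ b, b = ∫⁻ x, Sh x ^ p := ⟨_, rfl⟩
  have hc4 : (ENNReal.ofReal (4 ^ p)) = 4 ^ p := by
    rw [← ENNReal.ofReal_rpow_of_nonneg (by norm_num) hp0.le]; norm_num
  simp only [ENNReal.mul_rpow_of_nonneg _ _ hp0.le] at key
  rw [lintegral_const_mul' _ _ (by finiteness), lintegral_const_mul' _ _ (by finiteness), ← ha, ← hb] at key
  rw [← ha] at hGF hFfin
  rw [← hb]
  refine hGF.trans ?_
  have key2 : a ≤ ENNReal.ofReal ((4 * γ⁻¹) ^ p) * b + 2⁻¹ * a := by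
    have h44 : (4 : ℝ≥0∞) ^ p * 4⁻¹ ^ p = 1 := by
      rw [← ENNReal.mul_rpow_of_nonneg _ _ hp0.le, ENNReal.mul_inv_cancel h4 h4t, ENNReal.one_rpow]
    calc a = 4 ^ p * (4⁻¹ ^ p * a) := by rw [← mul_assoc, h44, one_mul]
      _ ≤ 4 ^ p * (ENNReal.ofReal γ⁻¹ ^ p * b + ENNReal.ofReal (20 ^ n * γ) * a) := mul_le_mul_right key _
      _ = _ := by
        rw [mul_add, ← mul_assoc, ← mul_assoc]
        congr 2
        · rw [ENNReal.ofReal_rpow_of_nonneg (by positivity) hp0.le, ← hc4, ← ENNReal.ofReal_mul (by positivity),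
            Real.mul_rpow (by norm_num) (by positivity)]
        · rw [← hc4, ← ENNReal.ofReal_mul (by positivity), hγ,
            show (4 : ℝ) ^ p * (20 ^ n * (20 ^ n * (2 * 4 ^ p))⁻¹) = 2⁻¹ by field_simp,
            ENNReal.ofReal_inv_of_pos (by norm_num), ENNReal.ofReal_ofNat]
  have e2 : a = 2⁻¹ * a + 2⁻¹ * a := by
    rw [← add_mul, ENNReal.inv_two_add_inv_two, one_mul]
  have hfin2 : 2⁻¹ * a ≠ ⊤ := by finiteness
  have key3 : 2⁻¹ * a ≤ ENNReal.ofReal ((4 * γ⁻¹) ^ p) * b := by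
    refine (ENNReal.add_le_add_iff_right hfin2).1 ?_
    rw [← e2]; exact key2
  calc a = 2 * (2⁻¹ * a) := by
        rw [← mul_assoc, ENNReal.mul_inv_cancel (by norm_num) (by norm_num), one_mul]
    _ ≤ 2 * (ENNReal.ofReal ((4 * γ⁻¹) ^ p) * b) := mul_le_mul_right key3 _
    _ = _ := by
        rw [← mul_assoc, ← ENNReal.ofReal_ofNat, ← ENNReal.ofReal_mul (by norm_num)]
        rfl

end GoodLambda

section LittlewoodPaley

variable {n : ℕ}

lemma Pa_eq_opS (a : ℕ) (f : 𝓢(Fin n → ℝ, ℂ)) (x : Fin n → ℝ) :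
    Pa a f x = opS (fun q => bet (((2 : ℝ) ^ a)⁻¹ • q.2)) f x := by
  rw [schwartz_inversion, FTg_Pa]
  simp only [opS, mul_assoc]

lemma Pa_add (a : ℕ) (f g : 𝓢(Fin n → ℝ, ℂ)) (x : Fin n → ℝ) :
    Pa a (f + g) x = Pa a f x + Pa a g x := by
  simp only [Pa_eq_opS]
  exact opS_add (M := 1) (contDiff_bet.continuous.comp (by fun_prop)) (fun q => norm_bet_le _) f g x

lemma Pj_add (j : ℕ) (f g : 𝓢(Fin n → ℝ, ℂ)) (x : Fin n → ℝ) :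
    Pj j (f + g) x = Pj j f x + Pj j g x := by
  unfold Pj
  split_ifs <;> simp only [sub_zero, sub_apply, Pa_add]
  ring

/-- The multiplication formula for the Fourier transform. -/
lemma integral_mul_FTg {f g : (Fin n → ℝ) → ℂ} (hf : Integrable f) (hg : Integrable g) :
    ∫ ξ, f ξ * FTg g ξ = ∫ y, FTg f y * g y := by
  unfold FTg
  have hi : Integrable (fun q : (Fin n → ℝ) × (Fin n → ℝ) => ph q.2 q.1 * (f q.1 * g q.2))
      (volume.prod volume) := by
    refine Integrable.bdd_mul (c := 1) (hf.mul_prod hg) (Continuous.aestronglyMeasurable (by fun_prop))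
      (Filter.Eventually.of_forall fun q => by rw [norm_ph])
  calc _ = ∫ ξ, ∫ y, ph y ξ * (f ξ * g y) := by
        congr 1; ext ξ; rw [← integral_const_mul]; congr 1; ext y; ring
    _ = ∫ y, ∫ ξ, ph y ξ * (f ξ * g y) := integral_integral_swap hi
    _ = _ := by
        congr 1; ext y; rw [← integral_mul_const]; congr 1; ext ξ; rw [ph_comm]; ring

lemma norm_Pa_le {f : 𝓢(Fin n → ℝ, ℂ)} {K : ℝ} (hK : ∀ x, ‖f x‖ ≤ K) (a : ℕ) (x : Fin n → ℝ) :
    ‖Pa a f x‖ ≤ (∫ y : Fin n → ℝ, ‖FTg bet y‖) * K := by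
  have hL : (0 : ℝ) < 2 ^ a := by positivity
  obtain ⟨g, hg⟩ := exists_schwartz_affine hL f x
  have hb : Integrable (bet (n := n)) := contDiff_bet.continuous.integrable_of_hasCompactSupport hasCompactSupport_bet
  have hFb : Integrable (FTg (bet (n := n))) :=
    integrable_FTg_schwartz (hasCompactSupport_bet.toSchwartzMap contDiff_bet)
  have e : Pa a f x = ∫ y, FTg bet y * g y := by
    have h1 := opS_affine hL (fun q => bet (((2 : ℝ) ^ a)⁻¹ • q.2)) f x 0
    rw [smul_zero, add_zero] at h1
    rw [Pa_eq_opS, h1, ← integral_mul_FTg hb g.integrable]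
    unfold opS
    congr 1; ext ξ
    have e2 : ((2 : ℝ) ^ a)⁻¹ • ((2 : ℝ) ^ a • ξ) = ξ := inv_smul_smul₀ hL.ne' ξ
    simp only [ph_zero_left, one_mul, e2, funext hg]
  rw [e, ← integral_mul_const]
  refine norm_integral_le_of_norm_le (hFb.norm.mul_const K) (Filter.Eventually.of_forall fun y => ?_)
  rw [norm_mul, hg]
  exact mul_le_mul_of_nonneg_left (hK _) (norm_nonneg _)

lemma norm_Pj_le {f : 𝓢(Fin n → ℝ, ℂ)} {K : ℝ} (hK : ∀ x, ‖f x‖ ≤ K) (j : ℕ) (x : Fin n → ℝ) :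
    ‖Pj j f x‖ ≤ 2 * (∫ y : Fin n → ℝ, ‖FTg bet y‖) * K := by
  have hK0 : 0 ≤ K := (norm_nonneg _).trans (hK x)
  have hB : 0 ≤ ∫ y : Fin n → ℝ, ‖FTg bet y‖ := integral_nonneg fun _ => norm_nonneg _
  have h1 := norm_Pa_le hK (j + 1) x
  have h2 := norm_Pa_le hK (j - 2) x
  unfold Pj
  split_ifs
  · rw [sub_zero]; nlinarith [mul_nonneg hB hK0]
  · rw [sub_apply]
    refine (norm_sub_le _ _).trans ?_
    linarith

/-- Smooth splitting of a Schwartz function at height `l`. -/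
lemma exists_truncation (f : 𝓢(Fin n → ℝ, ℂ)) {l : ℝ} (hl : 0 < l) : ∃ g b : 𝓢(Fin n → ℝ, ℂ), f = g + b ∧
    (∀ x, ‖g x‖ ≤ 2 * l) ∧ (∀ x, ‖b x‖ ≤ ‖f x‖) ∧ ∀ x, ‖f x‖ ≤ l → b x = 0 := by
  obtain ⟨θ, hθ⟩ : ∃ θ : (Fin n → ℝ) → ℝ, θ = fun x => Real.smoothTransition (‖f x‖ ^ 2 / l ^ 2 - 1) := ⟨_, rfl⟩
  have hθs : ContDiff ℝ (⊤ : ℕ∞) θ := by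
    rw [hθ]
    exact Real.smoothTransition.contDiff.comp (((f.smooth'.norm_sq ℝ).div_const _).sub contDiff_const)
  have hθ0 : ∀ x, ‖f x‖ ≤ l → θ x = 0 := fun x hx => by
    rw [hθ]
    refine Real.smoothTransition.zero_of_nonpos ?_
    rw [sub_nonpos, div_le_one (by positivity)]
    exact pow_le_pow_left₀ (norm_nonneg _) hx 2
  have hbs : ContDiff ℝ (⊤ : ℕ∞) fun x => (θ x : ℂ) * f x :=
    (Complex.ofRealCLM.contDiff.comp hθs).mul f.smooth'
  have hbc : HasCompactSupport fun x => (θ x : ℂ) * f x := by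
    have h1 := f.tendsto_cocompact
    have h2 := h1.eventually (Metric.ball_mem_nhds 0 hl)
    obtain ⟨K, hK, hKs⟩ := Filter.mem_cocompact.1 h2
    refine HasCompactSupport.intro hK fun x hx => ?_
    have : ‖f x‖ < l := by simpa using hKs hx
    rw [hθ0 x this.le]; simp
  have hθle : ∀ x, 0 ≤ θ x ∧ θ x ≤ 1 := fun x => by
    rw [hθ]; exact ⟨Real.smoothTransition.nonneg _, Real.smoothTransition.le_one _⟩
  refine ⟨f - hbc.toSchwartzMap hbs, hbc.toSchwartzMap hbs, by abel, fun x => ?_, fun x => ?_, fun x hx => ?_⟩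
  · have e : (f - hbc.toSchwartzMap hbs) x = ((1 - θ x : ℝ) : ℂ) * f x := by
      change f x - (θ x : ℂ) * f x = _
      push_cast; ring
    rw [e, norm_mul, Complex.norm_real, Real.norm_of_nonneg (by linarith [(hθle x).2])]
    by_cases hx : ‖f x‖ ≤ 2 * l
    · exact (mul_le_of_le_one_left (norm_nonneg _) (by linarith [(hθle x).1])).trans hx
    · have : θ x = 1 := by
        rw [hθ]
        refine Real.smoothTransition.one_of_one_le ?_
        rw [le_sub_iff_add_le, le_div_iff₀ (by positivity)]
        push Not at hx
        nlinarith
      rw [this]; simp; positivity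
  · change ‖(θ x : ℂ) * f x‖ ≤ _
    rw [norm_mul, Complex.norm_real, Real.norm_of_nonneg (hθle x).1]
    exact mul_le_of_le_one_left (norm_nonneg _) (hθle x).2
  · change (θ x : ℂ) * f x = 0
    rw [hθ0 x hx]; simp

/-- The easy half of Littlewood–Paley theory for `p > 2`. -/
theorem littlewood_paley (n : ℕ) {p : ℝ} (hp : 2 < p) : ∃ A : NNReal, ∀ (I : Finset ℕ) (f : 𝓢(Fin n → ℝ, ℂ)),
    ∑ j ∈ I, ∫⁻ x, ‖Pj j f x‖ₑ ^ p ≤ A * ∫⁻ x, ‖f x‖ₑ ^ p := by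
  obtain ⟨B, hB⟩ : ∃ B, B = 8 * ((∫ y : Fin n → ℝ, ‖FTg bet y‖) + 1) := ⟨_, rfl⟩
  have hB0 : 0 < B := by
    have : 0 ≤ ∫ y : Fin n → ℝ, ‖FTg bet y‖ := integral_nonneg fun _ => norm_nonneg _
    rw [hB]; positivity
  have hp0 : 0 < p := by linarith
  refine ⟨80 * (p / (p - 2)).toNNReal * (B ^ p).toNNReal, fun I f => ?_⟩
  have key := marcinkiewicz (volume : Measure (Fin n → ℝ)) (volume : Measure (Fin n → ℝ)) I
    (F := fun j x => ‖Pj j f x‖ₑ) (fun j => (Pj j f).continuous.measurable.enorm)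
    (f := fun x => ENNReal.ofReal B * ‖f x‖ₑ) (measurable_const.mul f.continuous.measurable.enorm)
    (r := 2) (by norm_num) hp 80 ?_
  · refine key.trans_eq ?_
    simp only [ENNReal.mul_rpow_of_nonneg _ _ hp0.le]
    rw [lintegral_const_mul' _ _ (by finiteness), ENNReal.ofReal_rpow_of_nonneg hB0.le hp0.le, ← mul_assoc]
    rfl
  intro t ht
  obtain ⟨g, b, hfgb, hg, hb, hb0⟩ := exists_truncation f (l := t / B) (by positivity)
  have h1 : ∀ j x, ENNReal.ofReal t < ‖Pj j f x‖ₑ → ENNReal.ofReal (t / 2) ≤ ‖Pj j b x‖ₑ := by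
    intro j x hx
    have h2 := norm_Pj_le hg j x
    rw [← ofReal_norm, ENNReal.ofReal_lt_ofReal_iff_of_nonneg ht.le] at hx
    rw [← ofReal_norm]
    refine ENNReal.ofReal_le_ofReal ?_
    have h3 : ‖Pj j f x‖ ≤ ‖Pj j g x‖ + ‖Pj j b x‖ := by
      conv_lhs => rw [hfgb, Pj_add]
      exact norm_add_le _ _
    have h4 : 2 * (∫ y : Fin n → ℝ, ‖FTg bet y‖) * (2 * (t / B)) ≤ t / 2 := by
      have : ∫ y : Fin n → ℝ, ‖FTg bet y‖ = B / 8 - 1 := by rw [hB]; ring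
      rw [this, show 2 * (B / 8 - 1) * (2 * (t / B)) = t / 2 - 4 * (t / B) by field_simp; ring]
      have : 0 < t / B := by positivity
      linarith
    linarith
  have h2 : ∀ j, ENNReal.ofReal (t ^ (2 : ℝ)) * volume {x | ENNReal.ofReal t < ‖Pj j f x‖ₑ} ≤
      4 * ∫⁻ x, ‖Pj j b x‖ₑ ^ 2 := by
    intro j
    have h3 := mul_meas_ge_le_lintegral (μ := volume) (f := fun x => ‖Pj j b x‖ₑ ^ 2)
      ((Pj j b).continuous.measurable.enorm.pow_const 2) (ENNReal.ofReal (t / 2) ^ 2)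
    refine le_trans ?_ (mul_le_mul_right h3 4)
    rw [← mul_assoc]
    have e : (4 : ℝ≥0∞) * ENNReal.ofReal (t / 2) ^ 2 = ENNReal.ofReal (t ^ (2 : ℝ)) := by
      rw [← ENNReal.ofReal_pow (by positivity), ← ENNReal.ofReal_ofNat, ← ENNReal.ofReal_mul (by norm_num)]
      congr 1; norm_cast; ring
    rw [e]
    exact mul_le_mul_right (measure_mono fun x hx => pow_le_pow_left' (h1 j x hx) 2) _
  rw [Finset.mul_sum]
  refine (Finset.sum_le_sum fun j _ => h2 j).trans ?_
  rw [← Finset.mul_sum]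
  refine (mul_le_mul_right (sum_lintegral_Pj_sq_le I b) 4).trans ?_
  rw [← mul_assoc, show (4 : ℝ≥0∞) * 20 = ((80 : NNReal) : ℝ≥0∞) by norm_num]
  refine mul_le_mul_right ?_ _
  have hB1 : 1 ≤ B := by
    have : 0 ≤ ∫ y : Fin n → ℝ, ‖FTg bet y‖ := integral_nonneg fun _ => norm_nonneg _
    rw [hB]; linarith
  have hms : MeasurableSet {x | ENNReal.ofReal t < ENNReal.ofReal B * ‖f x‖ₑ} :=
    measurableSet_lt measurable_const (measurable_const.mul f.continuous.measurable.enorm)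
  rw [← lintegral_indicator hms]
  refine lintegral_mono fun x => ?_
  by_cases hx : ENNReal.ofReal t < ENNReal.ofReal B * ‖f x‖ₑ
  · rw [Set.indicator_of_mem (show x ∈ {x | ENNReal.ofReal t < ENNReal.ofReal B * ‖f x‖ₑ} from hx), ENNReal.rpow_ofNat]
    refine pow_le_pow_left' (le_trans ?_ (le_mul_of_one_le_left' (ENNReal.one_le_ofReal.2 hB1))) 2
    exact enorm_le_iff_norm_le.2 (hb x)
  · rw [hb0 x]
    · simp
    · rw [← ofReal_norm, ← ENNReal.ofReal_mul hB0.le, ENNReal.ofReal_lt_ofReal_iff_of_nonneg ht.le] at hx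
      push Not at hx
      rwa [le_div_iff₀' hB0]

end LittlewoodPaley

section MaximalControl

variable {n : ℕ}

lemma wt_le_of_annulus (y : Fin n → ℝ) : ∃ i : ℕ, ‖y‖ ≤ 2 ^ i ∧
    wt y ≤ ENNReal.ofReal (2 ^ (n + 1) * ((2 ^ i) ^ (n + 1))⁻¹) := by
  classical
  have hex : ∃ i : ℕ, ‖y‖ ≤ 2 ^ i := (pow_unbounded_of_one_lt ‖y‖ one_lt_two).imp fun _ h => h.le
  refine ⟨Nat.find hex, Nat.find_spec hex, ENNReal.ofReal_le_ofReal ?_⟩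
  rcases h : Nat.find hex with _ | i
  · refine (inv_le_one_of_one_le₀ (one_le_wR y)).trans ?_
    simpa using one_le_pow₀ (M₀ := ℝ) (n := n + 1) one_le_two
  · have hi : (2 : ℝ) ^ i < ‖y‖ := by
      have := Nat.find_min hex (m := i) (by omega)
      exact not_le.1 this
    have e : (2 : ℝ) ^ (n + 1) * ((2 ^ (i + 1)) ^ (n + 1))⁻¹ = ((2 ^ i) ^ (n + 1))⁻¹ := by
      rw [pow_succ 2 i, mul_pow, mul_inv]; field_simp
    rw [e]
    refine inv_anti₀ (by positivity) ?_
    have h1 : (1 : ℝ) ≤ 2 ^ i := one_le_pow₀ one_le_two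
    calc ((2 : ℝ) ^ i) ^ (n + 1) ≤ (2 ^ i) ^ (2 * NN n) := pow_le_pow_right₀ h1 (by unfold NN; omega)
      _ ≤ _ := pow_le_pow_left₀ (by positivity) (by linarith) _

/-- Weighted averages are controlled by the maximal function. -/
lemma lintegral_mul_wt_le_hlM {g : (Fin n → ℝ) → ℝ≥0∞} (hg : Measurable g) (k : ℤ) (x : Fin n → ℝ) :
    ENNReal.ofReal (((2 : ℝ) ^ k) ^ n) * ∫⁻ y, g y * wt ((2 : ℝ) ^ k • (y - x)) ≤ 2 ^ (n + 2) * hlM g x := by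
  have hk : (0 : ℝ) < 2 ^ k := by positivity
  obtain ⟨a, ha⟩ : ∃ a : ℕ → ℝ≥0∞, a = fun i => ENNReal.ofReal (2 ^ (n + 1) * ((2 ^ i) ^ (n + 1))⁻¹) := ⟨_, rfl⟩
  have h1 : ∀ y, g y * wt ((2 : ℝ) ^ k • (y - x)) ≤
      ∑' i : ℕ, a i * (Metric.closedBall x ((2 : ℝ) ^ (k - i))⁻¹).indicator g y := by
    intro y
    obtain ⟨i, hi1, hi2⟩ := wt_le_of_annulus ((2 : ℝ) ^ k • (y - x))
    refine le_trans ?_ (ENNReal.le_tsum i)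
    rw [Set.indicator_of_mem, mul_comm]
    · rw [ha]; exact mul_le_mul_left hi2 _
    · rw [mem_closedBall_iff_norm, zpow_sub₀ two_ne_zero, inv_div, zpow_natCast, le_div_iff₀ hk]
      rwa [norm_smul, Real.norm_of_nonneg hk.le, mul_comm] at hi1
  calc _ ≤ ENNReal.ofReal (((2 : ℝ) ^ k) ^ n) *
        ∫⁻ y, ∑' i : ℕ, a i * (Metric.closedBall x ((2 : ℝ) ^ (k - i))⁻¹).indicator g y :=
        mul_le_mul_right (lintegral_mono h1) _
    _ = ∑' i : ℕ, ENNReal.ofReal (((2 : ℝ) ^ k) ^ n) * (a i *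
          ∫⁻ y in Metric.closedBall x ((2 : ℝ) ^ (k - i))⁻¹, g y) := by
        rw [lintegral_tsum fun i => ((hg.indicator measurableSet_closedBall).const_mul (a i)).aemeasurable,
          ← ENNReal.tsum_mul_left]
        refine tsum_congr fun i => ?_
        rw [lintegral_const_mul _ (hg.indicator measurableSet_closedBall),
          lintegral_indicator measurableSet_closedBall]
    _ ≤ ∑' i : ℕ, 2 ^ (n + 1) * 2⁻¹ ^ i * hlM g x := by
        refine ENNReal.tsum_le_tsum fun i => ?_
        refine le_trans (le_of_eq ?_) (mul_le_mul_right (avB_le_hlM (k - i) g x) _)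
        unfold avB
        rw [← mul_assoc, ← mul_assoc, ha]
        congr 1
        have e : (2 : ℝ≥0∞) ^ (n + 1) * 2⁻¹ ^ i = ENNReal.ofReal (2 ^ (n + 1) * 2⁻¹ ^ i) := by
          rw [ENNReal.ofReal_mul (by positivity), ENNReal.ofReal_pow (by norm_num), ENNReal.ofReal_pow (by norm_num),
            ENNReal.ofReal_inv_of_pos (by norm_num), ENNReal.ofReal_ofNat]
        rw [e]
        simp only
        rw [← ENNReal.ofReal_mul (by positivity), ← ENNReal.ofReal_mul (by positivity), zpow_sub₀ two_ne_zero, zpow_natCast]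
        congr 1
        rw [div_pow, pow_succ ((2 : ℝ) ^ i), inv_pow]
        field_simp
    _ = _ := by
        rw [ENNReal.tsum_mul_right, ENNReal.tsum_mul_left, ENNReal.tsum_geometric, ENNReal.one_sub_inv_two, inv_inv,
          pow_succ _ (n + 1)]

/-- Cauchy–Schwarz for averages. -/
lemma avB_sq_le {g : (Fin n → ℝ) → ℝ≥0∞} (hg : Measurable g) (k : ℤ) (x : Fin n → ℝ) :
    avB k g x ^ 2 ≤ 2 ^ n * avB k (fun y => g y ^ 2) x := by
  have h := lintegral_rpow_le (volume.restrict (Metric.closedBall x ((2 : ℝ) ^ k)⁻¹)) hg (q := 2) (by norm_num)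
  have h1 := avB_const k 1 x
  simp only [ENNReal.rpow_ofNat] at h
  rw [show (2 : ℝ) - 1 = 1 by norm_num, ENNReal.rpow_one] at h
  unfold avB at *
  rw [lintegral_one, mul_one] at h1
  rw [mul_pow, ← h1]
  refine (mul_le_mul_right h _).trans_eq ?_
  ring

end MaximalControl

section SchurSum

lemma tsum_pow_dist_le (Z : ℝ≥0∞) (k : ℕ) : ∑' j : ℕ, Z ^ Nat.dist k j ≤ 2 * (1 - Z)⁻¹ := by
  calc ∑' j : ℕ, Z ^ Nat.dist k j ≤ ∑' j : ℕ, ∑' i : ℕ, if i = Nat.dist k j then Z ^ i else 0 := by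
        refine ENNReal.tsum_le_tsum fun j => ?_
        rw [tsum_ite_eq]
    _ = ∑' i : ℕ, ∑' j : ℕ, if i = Nat.dist k j then Z ^ i else 0 := ENNReal.tsum_comm
    _ ≤ ∑' i : ℕ, ∑' j : ℕ, ((if j = k + i then Z ^ i else 0) + if j = k - i then Z ^ i else 0) := by
        refine ENNReal.tsum_le_tsum fun i => ENNReal.tsum_le_tsum fun j => ?_
        by_cases h : i = Nat.dist k j
        · rw [if_pos h]
          rcases le_total k j with hkj | hkj
          · rw [if_pos (show j = k + i by rw [h, Nat.dist_eq_sub_of_le hkj]; omega)]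
            exact le_self_add
          · rw [if_pos (show j = k - i by rw [h, Nat.dist_eq_sub_of_le_right hkj]; omega)]
            exact le_add_self
        · rw [if_neg h]; exact zero_le
    _ = ∑' i : ℕ, 2 * Z ^ i := by
        refine tsum_congr fun i => ?_
        rw [ENNReal.tsum_add, tsum_ite_eq, tsum_ite_eq, two_mul]
    _ = _ := by rw [ENNReal.tsum_mul_left, ENNReal.tsum_geometric]

lemma sum_rpow_le {ι : Type*} (I : Finset ι) (a w : ι → ℝ≥0∞) {p : ℝ} (hp : 1 ≤ p) :
    (∑ j ∈ I, a j * w j) ^ p ≤ (∑ j ∈ I, w j) ^ (p - 1) * ∑ j ∈ I, a j ^ p * w j := by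
  let _ : MeasurableSpace ι := ⊤
  have e : ∀ g : ι → ℝ≥0∞, ∑ j ∈ I, g j = ∫⁻ j, g j ∂(Measure.sum fun i : I => Measure.dirac (i : ι)) := by
    intro g
    rw [lintegral_sum_measure, tsum_fintype]
    simp only [lintegral_dirac]
    exact (Finset.sum_coe_sort I g).symm
  rw [e, e, e]
  exact lintegral_mul_rpow_le _ measurable_from_top measurable_from_top hp

/-- Summation of pieces with exponential off-diagonal decay. -/
lemma lintegral_tsum_rpow_le {α : Type*} [MeasurableSpace α] (μ : Measure α) {O : ℕ → ℕ → α → ℝ≥0∞}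
    (hO : ∀ k j, Measurable (O k j)) {b : ℕ → ℝ≥0∞} {Z : ℝ≥0∞} (hZ0 : Z ≠ 0) (hZ1 : Z < 1) {p : ℝ}
    (hp : 1 ≤ p) (h : ∀ k j, ∫⁻ x, O k j x ^ p ∂μ ≤ (Z ^ Nat.dist k j) ^ p * b j) (I : Finset ℕ) :
    ∫⁻ x, ∑' k, (∑ j ∈ I, O k j x) ^ p ∂μ ≤ (2 * (1 - Z)⁻¹) ^ p * ∑ j ∈ I, b j := by
  have hp0 : 0 ≤ p := by linarith
  have hp1 : 0 ≤ p - 1 := by linarith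
  have hZt : Z ≠ ⊤ := (hZ1.trans ENNReal.one_lt_top).ne
  obtain ⟨W, hW⟩ : ∃ W, W = 2 * (1 - Z)⁻¹ := ⟨_, rfl⟩
  obtain ⟨w, hw⟩ : ∃ w : ℕ → ℕ → ℝ≥0∞, w = fun k j => Z ^ Nat.dist k j := ⟨_, rfl⟩
  have hw0 : ∀ k j, w k j ≠ 0 := fun k j => by rw [hw]; exact pow_ne_zero _ hZ0
  have hwt : ∀ k j, w k j ≠ ⊤ := fun k j => by rw [hw]; exact ENNReal.pow_ne_top hZt
  have h1 : ∀ k x, (∑ j ∈ I, O k j x) ^ p ≤ W ^ (p - 1) * ∑ j ∈ I, O k j x ^ p * ((w k j)⁻¹ ^ p * w k j) := by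
    intro k x
    have := sum_rpow_le I (fun j => O k j x * (w k j)⁻¹) (w k) hp
    simp only [mul_assoc, ENNReal.inv_mul_cancel (hw0 _ _) (hwt _ _), mul_one,
      ENNReal.mul_rpow_of_nonneg _ _ hp0] at this
    refine this.trans (mul_le_mul_left (ENNReal.rpow_le_rpow ?_ hp1) _)
    rw [hw, hW]
    exact (ENNReal.sum_le_tsum I).trans (tsum_pow_dist_le Z k)
  have h2 : ∀ k j, ∫⁻ x, O k j x ^ p * ((w k j)⁻¹ ^ p * w k j) ∂μ ≤ w k j * b j := by
    intro k j
    rw [lintegral_mul_const _ ((hO k j).pow_const p)]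
    refine (mul_le_mul_left (h k j) _).trans_eq ?_
    have : w k j ^ p * (w k j)⁻¹ ^ p = 1 := by
      rw [← ENNReal.mul_rpow_of_nonneg _ _ hp0, ENNReal.mul_inv_cancel (hw0 _ _) (hwt _ _), ENNReal.one_rpow]
    rw [show Z ^ Nat.dist k j = w k j by rw [hw]]
    calc _ = (w k j ^ p * (w k j)⁻¹ ^ p) * (w k j * b j) := by ring
      _ = _ := by rw [this, one_mul]
  have hm : ∀ k j, Measurable fun x => O k j x ^ p * ((w k j)⁻¹ ^ p * w k j) := fun k j =>
    ((hO k j).pow_const p).mul_const _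
  calc ∫⁻ x, ∑' k, (∑ j ∈ I, O k j x) ^ p ∂μ
      ≤ ∫⁻ x, ∑' k, W ^ (p - 1) * ∑ j ∈ I, O k j x ^ p * ((w k j)⁻¹ ^ p * w k j) ∂μ :=
        lintegral_mono fun x => ENNReal.tsum_le_tsum fun k => h1 k x
    _ = ∑' k, W ^ (p - 1) * ∑ j ∈ I, ∫⁻ x, O k j x ^ p * ((w k j)⁻¹ ^ p * w k j) ∂μ := by
        rw [lintegral_tsum fun k => (Measurable.const_mul (Finset.measurable_fun_sum I fun j _ => hm k j) _).aemeasurable]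
        refine tsum_congr fun k => ?_
        rw [lintegral_const_mul _ (Finset.measurable_fun_sum I fun j _ => hm k j), lintegral_finsetSum I fun j _ => hm k j]
    _ ≤ ∑' k, W ^ (p - 1) * ∑ j ∈ I, w k j * b j := ENNReal.tsum_le_tsum fun k =>
        mul_le_mul_right (Finset.sum_le_sum fun j _ => h2 k j) _
    _ = W ^ (p - 1) * ∑ j ∈ I, (∑' k, w k j) * b j := by
        rw [ENNReal.tsum_mul_left, Summable.tsum_finsetSum fun _ _ => ENNReal.summable]
        simp only [ENNReal.tsum_mul_right]
    _ ≤ W ^ (p - 1) * ∑ j ∈ I, W * b j := by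
        refine mul_le_mul_right (Finset.sum_le_sum fun j _ => mul_le_mul_left ?_ _) _
        rw [hw, hW]
        simp only [Nat.dist_comm _ j]
        exact tsum_pow_dist_le Z j
    _ = _ := by rw [← Finset.mul_sum, ← mul_assoc, ← rpow_eq_rpow_sub_one_mul _ hp, hW]

end SchurSum

section Oscillation

variable {n : ℕ}

/-- Mean oscillation around the central value. -/
def oscB (k : ℤ) (G : (Fin n → ℝ) → ℂ) (x : Fin n → ℝ) : ℝ≥0∞ :=
  ENNReal.ofReal (((2 : ℝ) ^ k) ^ n) * ∫⁻ z in Metric.closedBall 0 ((2 : ℝ) ^ k)⁻¹, ‖G (x + z) - G x‖ₑ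

lemma avB_sub_self (k : ℤ) (G : (Fin n → ℝ) → ℂ) (x : Fin n → ℝ) :
    avB k (fun y => ‖G y - G x‖ₑ) x = oscB k G x := by
  unfold avB oscB
  congr 1
  rw [← lintegral_indicator measurableSet_closedBall, ← lintegral_indicator measurableSet_closedBall,
    ← lintegral_add_left_eq_self _ x]
  congr 1; ext z
  simp only [Set.indicator, mem_closedBall_iff_norm, add_sub_cancel_left, sub_zero]

lemma measurable_oscB {G : (Fin n → ℝ) → ℂ} (hG : Continuous G) (k : ℤ) : Measurable (oscB k G) := by
  have h : Measurable fun q : (Fin n → ℝ) × (Fin n → ℝ) => ‖G (q.1 + q.2) - G q.1‖ₑ :=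
    (Continuous.measurable (by fun_prop)).enorm
  exact measurable_const.mul h.lintegral_prod_right'

lemma lintegral_oscB_rpow_le {G : (Fin n → ℝ) → ℂ} (hG : Continuous G) (k : ℤ) {p : ℝ} (hp : 1 ≤ p) {B : ℝ≥0∞}
    (h : ∀ z : Fin n → ℝ, ‖z‖ ≤ ((2 : ℝ) ^ k)⁻¹ → ∫⁻ x, ‖G (x + z) - G x‖ₑ ^ p ≤ B) :
    ∫⁻ x, oscB k G x ^ p ≤ (2 ^ n) ^ p * B := by
  have hm : Measurable fun q : (Fin n → ℝ) × (Fin n → ℝ) => ‖G (q.1 + q.2) - G q.1‖ₑ :=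
    (Continuous.measurable (by fun_prop)).enorm
  obtain ⟨c, hc⟩ : ∃ c, c = ENNReal.ofReal (((2 : ℝ) ^ k) ^ n) := ⟨_, rfl⟩
  obtain ⟨v, hv⟩ : ∃ v, v = volume (Metric.closedBall (0 : Fin n → ℝ) ((2 : ℝ) ^ k)⁻¹) := ⟨_, rfl⟩
  have hcv : c * v = 2 ^ n := by
    have := avB_const (n := n) k 1 0
    unfold avB at this
    rwa [lintegral_one, mul_one, Measure.restrict_apply_univ, ← hc, ← hv] at this
  have hct : c ≠ ⊤ := hc ▸ ENNReal.ofReal_ne_top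
  have h1 : ∀ x, oscB k G x ^ p ≤ c ^ p * (v ^ (p - 1) *
      ∫⁻ z in Metric.closedBall 0 ((2 : ℝ) ^ k)⁻¹, ‖G (x + z) - G x‖ₑ ^ p) := by
    intro x
    unfold oscB
    rw [ENNReal.mul_rpow_of_nonneg _ _ (by linarith), ← hc]
    have := lintegral_rpow_le (volume.restrict (Metric.closedBall (0 : Fin n → ℝ) ((2 : ℝ) ^ k)⁻¹))
      (a := fun z => ‖G (x + z) - G x‖ₑ) (Continuous.measurable (by fun_prop)).enorm hp
    rw [Measure.restrict_apply_univ, ← hv] at this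
    exact mul_le_mul_right this _
  refine (lintegral_mono h1).trans ?_
  have hm2 : Measurable fun x => ∫⁻ z in Metric.closedBall 0 ((2 : ℝ) ^ k)⁻¹, ‖G (x + z) - G x‖ₑ ^ p :=
    (hm.pow_const p).lintegral_prod_right'
  rw [lintegral_const_mul _ (hm2.const_mul _), lintegral_const_mul _ hm2,
    lintegral_lintegral_swap (hm.pow_const p).aemeasurable]
  calc _ ≤ c ^ p * (v ^ (p - 1) * ∫⁻ _ in Metric.closedBall (0 : Fin n → ℝ) ((2 : ℝ) ^ k)⁻¹, B) := by
        refine mul_le_mul_right (mul_le_mul_right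
          (setLIntegral_mono' measurableSet_closedBall fun z hz => h z ?_) _) _
        simpa using hz
    _ = _ := by
        rw [setLIntegral_const, ← hv, ← hcv, ENNReal.mul_rpow_of_nonneg _ _ (by linarith),
          rpow_eq_rpow_sub_one_mul v hp]
        ring

/-- The oscillation of the `j`th piece at scale `2^{-k}`. -/
def oscP (ρ : ℝ) (T : ℕ → (Fin n → ℝ) → ℂ) (k j : ℕ) (x : Fin n → ℝ) : ℝ≥0∞ :=
  if j ≤ k then oscB k (T j) x else if ⌊ρ * j⌋₊ ≤ k then avB k (fun y => ‖T j y‖ₑ) x else 0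

lemma measurable_oscP (ρ : ℝ) {T : ℕ → (Fin n → ℝ) → ℂ} (hT : ∀ j, Continuous (T j)) (k j : ℕ) :
    Measurable (oscP ρ T k j) := by
  unfold oscP
  split_ifs
  · exact measurable_oscB (hT j) k
  · exact measurable_avB (hT j).measurable.enorm k
  · exact measurable_const

lemma lintegral_oscP_rpow_le [NeZero n] {ρ q : ℝ} (hq : 1 < q) {T : ℕ → (Fin n → ℝ) → ℂ} (hT : ∀ j, Continuous (T j))
    {A : ℝ≥0∞} {b : ℕ → ℝ≥0∞}
    (h1 : ∀ j k : ℕ, ⌊ρ * j⌋₊ ≤ k → ∫⁻ x, (ENNReal.ofReal (((2 : ℝ) ^ k) ^ n) *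
      ∫⁻ y in Metric.closedBall x ((2 : ℝ) ^ k)⁻¹, ‖T j y‖ₑ ^ 2) ^ q ≤
      A * ENNReal.ofReal (2 ^ (-(n * (q - 1) * (j - k)))) * b j)
    (h2 : ∀ (j : ℕ) (z : Fin n → ℝ), ‖z‖ ≤ ((2 : ℝ) ^ j)⁻¹ → ∫⁻ x, ‖T j (x + z) - T j x‖ₑ ^ (2 * q) ≤
      A * ENNReal.ofReal (√(2 ^ j * ‖z‖) ^ q) * b j) (k j : ℕ) :
    ∫⁻ x, oscP ρ T k j x ^ (2 * q) ≤
      (ENNReal.ofReal (2 ^ (-min (1 / 4) ((q - 1) / (2 * q)))) ^ Nat.dist k j) ^ (2 * q) *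
        ((2 ^ n) ^ (2 * q) * A * b j) := by
  have hq0 : 0 < q := by linarith
  obtain ⟨μ, hμ⟩ : ∃ μ : ℝ, μ = min (1 / 4) ((q - 1) / (2 * q)) := ⟨_, rfl⟩
  have hμ1 : μ ≤ 1 / 4 := hμ ▸ min_le_left _ _
  have hμ2 : μ * (2 * q) ≤ q - 1 := by
    have : μ ≤ (q - 1) / (2 * q) := hμ ▸ min_le_right _ _
    rwa [le_div_iff₀ (by positivity)] at this
  rw [← hμ]
  have eZ : ∀ d : ℕ, (ENNReal.ofReal (2 ^ (-μ)) ^ d) ^ (2 * q) = ENNReal.ofReal (2 ^ (-(μ * (2 * q)) * d)) := by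
    intro d
    rw [← ENNReal.ofReal_pow (by positivity), ENNReal.ofReal_rpow_of_nonneg (by positivity) (by positivity),
      ← Real.rpow_natCast, ← Real.rpow_mul (by positivity), ← Real.rpow_mul (by norm_num)]
    congr 2; ring
  rw [eZ]
  unfold oscP
  split_ifs with hjk hr
  · rw [Nat.dist_eq_sub_of_le_right hjk]
    refine (lintegral_oscB_rpow_le (hT j) k (by linarith)
      (B := A * ENNReal.ofReal (2 ^ (-(μ * (2 * q)) * (k - j : ℕ))) * b j) fun z hz => ?_).trans_eq (by ring)
    have hk : (0 : ℝ) < 2 ^ k := by positivity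
    have hj : (0 : ℝ) < 2 ^ j := by positivity
    rw [zpow_natCast] at hz
    refine (h2 j z (hz.trans (inv_anti₀ hj (pow_le_pow_right₀ one_le_two hjk)))).trans ?_
    refine mul_le_mul_left (mul_le_mul_right (ENNReal.ofReal_le_ofReal ?_) _) _
    have e : (2 : ℝ) ^ j * (2 ^ k)⁻¹ = 2 ^ (-((k - j : ℕ) : ℝ)) := by
      rw [Nat.cast_sub hjk, neg_sub, Real.rpow_sub (by norm_num), Real.rpow_natCast, Real.rpow_natCast]; rfl
    calc √(2 ^ j * ‖z‖) ^ q ≤ √(2 ^ (-((k - j : ℕ) : ℝ))) ^ q := by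
          refine Real.rpow_le_rpow (Real.sqrt_nonneg _) (Real.sqrt_le_sqrt ?_) hq0.le
          rw [← e]; gcongr
      _ = 2 ^ (-((k - j : ℕ) : ℝ) * (1 / 2) * q) := by
          rw [Real.sqrt_eq_rpow, ← Real.rpow_mul (by norm_num), ← Real.rpow_mul (by norm_num), mul_assoc]
      _ ≤ _ := by
          refine Real.rpow_le_rpow_of_exponent_le (by norm_num) ?_
          have : (0 : ℝ) ≤ (k - j : ℕ) := Nat.cast_nonneg _
          have h3 : μ * (2 * q) ≤ q / 2 := by nlinarith
          nlinarith
  · push Not at hjk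
    rw [Nat.dist_eq_sub_of_le hjk.le]
    have h3 : ∀ x, avB k (fun y => ‖T j y‖ₑ) x ^ (2 * q) ≤ (2 ^ n) ^ q * avB k (fun y => ‖T j y‖ₑ ^ 2) x ^ q := by
      intro x
      rw [ENNReal.rpow_mul, ← ENNReal.mul_rpow_of_nonneg _ _ hq0.le]
      refine ENNReal.rpow_le_rpow ?_ hq0.le
      rw [ENNReal.rpow_ofNat]
      exact avB_sq_le (hT j).measurable.enorm k x
    refine (lintegral_mono h3).trans ?_
    rw [lintegral_const_mul' _ _ (by finiteness)]
    have h4 := h1 j k hr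
    have h5 : ∫⁻ x, avB k (fun y => ‖T j y‖ₑ ^ 2) x ^ q ≤ A * ENNReal.ofReal (2 ^ (-(n * (q - 1) * (j - k)))) * b j := by
      unfold avB
      simpa only [zpow_natCast] using h4
    calc _ ≤ (2 ^ n) ^ (2 * q) * (A * ENNReal.ofReal (2 ^ (-(μ * (2 * q)) * (j - k : ℕ))) * b j) := by
          refine mul_le_mul' (ENNReal.rpow_le_rpow_of_exponent_le (one_le_pow₀ (by norm_num)) (by linarith)) ?_
          refine h5.trans (mul_le_mul_left (mul_le_mul_right (ENNReal.ofReal_le_ofReal ?_) _) _)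
          refine Real.rpow_le_rpow_of_exponent_le (by norm_num) ?_
          have h6 : (0 : ℝ) ≤ (j - k : ℕ) := Nat.cast_nonneg _
          have hn : (1 : ℝ) ≤ n := by exact_mod_cast NeZero.one_le
          have h7 : μ * (2 * q) ≤ n * (q - 1) := hμ2.trans (le_mul_of_one_le_left (by linarith) hn)
          rw [← Nat.cast_sub hjk.le]
          nlinarith
      _ = _ := by ring
  · rw [ENNReal.zero_rpow_of_pos (by positivity), lintegral_zero]
    exact zero_le

end Oscillation

section SharpPointwise

variable {n : ℕ}

lemma avB_mono {k : ℤ} {f g : (Fin n → ℝ) → ℝ≥0∞} (h : ∀ y, f y ≤ g y) (x : Fin n → ℝ) : avB k f x ≤ avB k g x :=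
  mul_le_mul_right (lintegral_mono h) _

lemma avB_sum_add (k : ℤ) (I : Finset ℕ) {f : ℕ → (Fin n → ℝ) → ℝ≥0∞} (hf : ∀ j, Measurable (f j))
    (g : (Fin n → ℝ) → ℝ≥0∞) (x : Fin n → ℝ) :
    avB k (fun y => ∑ j ∈ I, f j y + g y) x = ∑ j ∈ I, avB k (f j) x + avB k g x := by
  unfold avB
  rw [lintegral_add_left (Finset.measurable_fun_sum I fun j _ => hf j), lintegral_finsetSum I fun j _ => hf j,
    mul_add, Finset.mul_sum]

lemma avB_far_le {f : (Fin n → ℝ) → ℂ} (hf : Measurable f) {F : (Fin n → ℝ) → ℂ} (hF : Measurable F) {A : ℝ≥0∞}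
    (k : ℤ) (x : Fin n → ℝ)
    (h : ∫⁻ y in Metric.closedBall x ((2 : ℝ) ^ k)⁻¹, ‖F y‖ₑ ^ 2 ≤ A * Vc ((2 : ℝ) ^ k) f x) :
    avB k (fun y => ‖F y‖ₑ) x ≤ (2 ^ n * A * 2 ^ (n + 2) * hlM (fun y => ‖f y‖ₑ ^ 2) x) ^ (1 / 2 : ℝ) := by
  rw [one_div, ENNReal.le_rpow_inv_iff (by norm_num), ENNReal.rpow_ofNat]
  calc _ ≤ 2 ^ n * avB k (fun y => ‖F y‖ₑ ^ 2) x := avB_sq_le hF.enorm k x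
    _ ≤ 2 ^ n * (ENNReal.ofReal (((2 : ℝ) ^ k) ^ n) * (A * Vc ((2 : ℝ) ^ k) f x)) :=
        mul_le_mul_right (mul_le_mul_right h _) _
    _ = 2 ^ n * A * (ENNReal.ofReal (((2 : ℝ) ^ k) ^ n) * Vc ((2 : ℝ) ^ k) f x) := by ring
    _ ≤ 2 ^ n * A * (2 ^ (n + 2) * hlM (fun y => ‖f y‖ₑ ^ 2) x) :=
        mul_le_mul_right (lintegral_mul_wt_le_hlM (hf.enorm.pow_const 2) k x) _
    _ = _ := by ring

lemma exists_center_avB_le {f : (Fin n → ℝ) → ℂ} (hf : Measurable f) {T : ℕ → (Fin n → ℝ) → ℂ}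
    (hT : ∀ j, Continuous (T j)) {A : ℝ≥0∞} {ρ p : ℝ} (hp : 0 < p)
    (h : ∀ t : ℝ, 0 < t → ∀ I : Finset ℕ, (∀ j ∈ I, t ≤ 2 ^ ⌊ρ * j⌋₊) → ∀ c : Fin n → ℝ,
      ∫⁻ x in Metric.closedBall c t⁻¹, ‖∑ j ∈ I, T j x‖ₑ ^ 2 ≤ A * Vc t f c)
    (I : Finset ℕ) (x : Fin n → ℝ) (k : ℤ) :
    ∃ c : ℂ, avB k (fun y => ‖∑ j ∈ I, T j y - c‖ₑ) x ≤ (∑' k : ℕ, (∑ j ∈ I, oscP ρ T k j x) ^ p) ^ (1 / p) +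
      (2 ^ n * A * 2 ^ (n + 2) * hlM (fun y => ‖f y‖ₑ ^ 2) x) ^ (1 / 2 : ℝ) := by
  have hm : ∀ I : Finset ℕ, Measurable fun y => ∑ j ∈ I, T j y := fun I =>
    (continuous_finsetSum I fun j _ => hT j).measurable
  rcases lt_or_ge k 0 with hk | hk
  · refine ⟨0, le_add_left ?_⟩
    simp only [sub_zero]
    refine avB_far_le hf (hm I) k x (h _ (by positivity) I (fun j _ => ?_) x)
    exact (zpow_le_one_of_nonpos₀ one_le_two hk.le).trans (one_le_pow₀ one_le_two)
  · obtain ⟨k, rfl⟩ := Int.eq_ofNat_of_zero_le hk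
    classical
    obtain ⟨e, he⟩ : ∃ e : ℕ → (Fin n → ℝ) → ℂ, e = fun j y => if j ≤ k then T j y - T j x else T j y := ⟨_, rfl⟩
    have hem : ∀ j, Measurable (e j) := by
      intro j
      rw [he]; dsimp only
      split_ifs
      · exact (hT j).measurable.sub_const _
      · exact (hT j).measurable
    have hsum : ∀ y, ∑ j ∈ I, T j y - ∑ j ∈ I, (if j ≤ k then T j x else 0) = ∑ j ∈ I, e j y := by
      intro y
      rw [← Finset.sum_sub_distrib]
      refine Finset.sum_congr rfl fun j _ => ?_
      rw [he]; dsimp only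
      split_ifs
      · rfl
      · rw [sub_zero]
    refine ⟨∑ j ∈ I, (if j ≤ k then T j x else 0), ?_⟩
    obtain ⟨P, hP⟩ : ∃ P : ℕ → Prop, P = fun j : ℕ => j ≤ k ∨ ⌊ρ * j⌋₊ ≤ k := ⟨_, rfl⟩
    have h1 : ∀ y, ‖∑ j ∈ I, T j y - ∑ j ∈ I, (if j ≤ k then T j x else 0)‖ₑ ≤
        ∑ j ∈ I with P j, ‖e j y‖ₑ + ‖∑ j ∈ I with ¬P j, T j y‖ₑ := by
      intro y
      rw [hsum, ← Finset.sum_filter_add_sum_filter_not I P]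
      refine (enorm_add_le _ _).trans (add_le_add (enorm_sum_le _ _) (le_of_eq ?_))
      congr 1
      refine Finset.sum_congr rfl fun j hj => ?_
      have := (Finset.mem_filter.1 hj).2
      rw [hP] at this; push Not at this
      rw [he]; dsimp only
      rw [if_neg (not_le.2 this.1)]
    refine (avB_mono h1 x).trans ?_
    rw [avB_sum_add _ _ (fun j => (hem j).enorm)]
    refine add_le_add ?_ ?_
    · have h2 : ∑ j ∈ I with P j, avB (k : ℤ) (fun y => ‖e j y‖ₑ) x ≤ ∑ j ∈ I, oscP ρ T k j x := by
        rw [Finset.sum_filter]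
        refine Finset.sum_le_sum fun j _ => ?_
        split_ifs with hj
        · rw [hP] at hj
          rw [he]; unfold oscP; dsimp only
          split_ifs with h3 h4
          · rw [avB_sub_self]
          · exact le_rfl
          · exact absurd hj (by simp [h3, h4])
        · exact zero_le
      refine h2.trans ?_
      rw [one_div, ENNReal.le_rpow_inv_iff hp]
      exact ENNReal.le_tsum (f := fun k : ℕ => (∑ j ∈ I, oscP ρ T k j x) ^ p) k
    · refine avB_far_le hf (hm _) k x (h _ (by positivity) _ (fun j hj => ?_) x)
      have := (Finset.mem_filter.1 hj).2
      rw [hP] at this; push Not at this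
      rw [zpow_natCast]
      exact pow_le_pow_right₀ one_le_two this.2.le

end SharpPointwise

section LpSums

variable {n : ℕ}

lemma lintegral_rpow_ne_top_of_bdd {G : (Fin n → ℝ) → ℂ} {M p : ℝ} (hp : 2 ≤ p) (hM : ∀ x, ‖G x‖ ≤ M)
    (h2 : ∫⁻ x, ‖G x‖ₑ ^ 2 ≠ ⊤) : ∫⁻ x, ‖G x‖ₑ ^ p ≠ ⊤ := by
  refine ne_top_of_le_ne_top (b := ENNReal.ofReal M ^ (p - 2) * ∫⁻ x, ‖G x‖ₑ ^ 2) (by finiteness [sub_nonneg.2 hp]) ?_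
  rw [← lintegral_const_mul' _ _ (by finiteness [sub_nonneg.2 hp])]
  refine lintegral_mono fun x => ?_
  calc ‖G x‖ₑ ^ p = ‖G x‖ₑ ^ (p - 2) * ‖G x‖ₑ ^ 2 := by
        rw [← ENNReal.rpow_ofNat, ← ENNReal.rpow_add_of_nonneg _ _ (by linarith) (by norm_num), sub_add_cancel]
    _ ≤ _ := by
        refine mul_le_mul_left (ENNReal.rpow_le_rpow ?_ (by linarith)) _
        rw [← ofReal_norm]
        exact ENNReal.ofReal_le_ofReal (hM x)

theorem Lp_finite_sums {m ρ δ C q : ℝ} [NeZero n] (hC : 0 ≤ C) (hm : 0 ≤ m) (hδ0 : 0 ≤ δ) (hδ1 : δ < 1)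
    (hδρ : δ ≤ ρ) (hρ1 : ρ ≤ 1) {S : (Fin n → ℝ) × (Fin n → ℝ) → ℂ}
    (hS : ContDiff ℝ (⊤ : ℕ∞) S) (h : SClass m ρ δ C S) (hq : 1 < q)
    (hmq : 2 * q * m = n * (1 - ρ) * (q - 1)) :
    ∃ A : NNReal, ∀ (I : Finset ℕ) (f : 𝓢(Fin n → ℝ, ℂ)),
      ∫⁻ x, ‖∑ j ∈ I, opS (fun q => S q * psi j q.2) f x‖ₑ ^ (2 * q) ≤ A * ∫⁻ x, ‖f x‖ₑ ^ (2 * q) := by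
  have hρ0 : 0 ≤ ρ := hδ0.trans hδρ
  have hn : (0 : ℝ) < n := by exact_mod_cast Nat.pos_of_neZero n
  have hq0 : 0 < q := by linarith
  have hm' : ρ = 1 ∨ 0 < m := by
    rcases hρ1.eq_or_lt with h1 | h1
    · exact Or.inl h1
    · right
      have : 0 < n * (1 - ρ) * (q - 1) := mul_pos (mul_pos hn (by linarith)) (by linarith)
      rw [← hmq] at this
      exact pos_of_mul_pos_right this (by positivity)
  obtain ⟨A0, hA00, hA0⟩ := exists_symAt_piece hC hm hδ0 hδ1.le hρ0 hρ1 hS h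
  obtain ⟨K, hK⟩ := exists_sum_fine hm hm'
  obtain ⟨A1, hA1⟩ := far_sum_bound hC hm hδ0 hδ1 hδρ hρ1 hS h K hK
  obtain ⟨A2, hA2⟩ := piece_bounds hC hm hδ0 hδ1 hδρ hρ1 hS h hq.le hmq
  obtain ⟨A3, hA3⟩ := littlewood_paley n (p := 2 * q) (by linarith)
  obtain ⟨A4, hA4⟩ := hlM_strong n hq
  obtain ⟨A5, hA5⟩ := sharp_bound n (p := 2 * q) (by linarith)
  obtain ⟨A6, hA6⟩ := L2_finite_sums hC hδ0 hδ1 hS (h.mono hC hm hδρ)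
  obtain ⟨Z, hZ⟩ : ∃ Z, Z = ENNReal.ofReal (2 ^ (-min (1 / 4) ((q - 1) / (2 * q)))) := ⟨_, rfl⟩
  have hZ0 : Z ≠ 0 := by rw [hZ]; exact (ENNReal.ofReal_pos.2 (by positivity)).ne'
  have hZ1 : Z < 1 := by
    rw [hZ, ENNReal.ofReal_lt_one]
    refine Real.rpow_lt_one_of_one_lt_of_neg (by norm_num) (neg_neg_of_pos (lt_min (by norm_num) ?_))
    exact div_pos (by linarith) (by linarith)
  have hZ2 : (1 - Z)⁻¹ ≠ ⊤ := ENNReal.inv_ne_top.2 (tsub_pos_of_lt hZ1).ne'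
  obtain ⟨D, hD⟩ : ∃ D : ℝ≥0∞, D = 2 ^ n * A1 * 2 ^ (n + 2) := ⟨_, rfl⟩
  have hDt : D ≠ ⊤ := by rw [hD]; finiteness
  obtain ⟨W, hW⟩ : ∃ W : NNReal, (W : ℝ≥0∞) = A5 * (2 ^ (2 * q - 1) *
      ((2 * (1 - Z)⁻¹) ^ (2 * q) * ((2 ^ n) ^ (2 * q) * A2 * A3) + D ^ q * A4)) :=
    ⟨_, ENNReal.coe_toNNReal (by
      have : 0 ≤ 2 * q - 1 := by linarith
      finiteness)⟩
  refine ⟨W, fun I f => ?_⟩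
  obtain ⟨T, hT⟩ : ∃ T : ℕ → (Fin n → ℝ) → ℂ, T = fun j => opS (fun q => S q * psi j q.2) f := ⟨_, rfl⟩
  have hsb : ∀ j : ℕ, ∀ q, ‖S q * psi j q.2‖ ≤ A0 * 2 ^ (-(j * m)) := fun j q =>
    (hA0 j ⌊ρ * j⌋₊ (Nat.floor_le (by positivity)) (by
      have := Nat.lt_floor_add_one (ρ * j)
      have h2 : δ * j ≤ ρ * j := mul_le_mul_of_nonneg_right hδρ (Nat.cast_nonneg j)
      linarith) q).norm_le
  have hTc : ∀ j, Continuous (T j) := fun j => by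
    rw [hT]
    exact continuous_opS (hS.mul ((contDiff_psi j).comp contDiff_snd)).continuous (hsb j) f
  have hTb : ∀ j x, ‖T j x‖ ≤ A0 * 2 ^ (-(j * m)) * ∫ ξ, ‖FTg f ξ‖ := fun j x => by
    rw [hT]
    exact norm_opS_le (hsb j) f x
  have e : ∀ x, ∑ j ∈ I, opS (fun q => S q * psi j q.2) f x = ∑ j ∈ I, T j x := fun x => by rw [hT]
  simp only [e]
  have hfar : ∀ t : ℝ, 0 < t → ∀ I : Finset ℕ, (∀ j ∈ I, t ≤ 2 ^ ⌊ρ * j⌋₊) → ∀ c : Fin n → ℝ,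
      ∫⁻ x in Metric.closedBall c t⁻¹, ‖∑ j ∈ I, T j x‖ₑ ^ 2 ≤ A1 * Vc t f c := by
    intro t ht I hI c
    rw [hT]
    exact hA1 t ht I hI f c
  have hfin : ∫⁻ x, ‖∑ j ∈ I, T j x‖ₑ ^ (2 * q) ≠ ⊤ := by
    refine lintegral_rpow_ne_top_of_bdd (M := ∑ j ∈ I, A0 * 2 ^ (-(j * m)) * ∫ ξ, ‖FTg f ξ‖) (by linarith)
      (fun x => (norm_sum_le _ _).trans (Finset.sum_le_sum fun j _ => hTb j x)) ?_
    have h6 : ∫⁻ x, ‖∑ j ∈ I, T j x‖ₑ ^ 2 ≤ A6 * ∫⁻ x, ‖f x‖ₑ ^ 2 := by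
      rw [hT]
      exact hA6 I f
    exact ne_top_of_le_ne_top (ENNReal.mul_ne_top ENNReal.coe_ne_top (lintegral_schwartz_sq_lt_top f).ne) h6
  obtain ⟨U, hU⟩ : ∃ U : (Fin n → ℝ) → ℝ≥0∞, U = fun x => ∑' k : ℕ, (∑ j ∈ I, oscP ρ T k j x) ^ (2 * q) := ⟨_, rfl⟩
  have hUm : Measurable U := by
    rw [hU]
    exact Measurable.tsum fun k =>
      (Finset.measurable_fun_sum I fun j _ => measurable_oscP ρ hTc k j).pow_const _
  have hf2 : Measurable fun y => ‖f y‖ₑ ^ 2 := f.continuous.measurable.enorm.pow_const 2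
  obtain ⟨H, hH⟩ : ∃ H : (Fin n → ℝ) → ℝ≥0∞, H = hlM (fun y => ‖f y‖ₑ ^ 2) := ⟨_, rfl⟩
  have hHm : Measurable H := hH ▸ measurable_hlM hf2
  have key := hA5 (fun x => ∑ j ∈ I, T j x) (fun x => U x ^ (1 / (2 * q)) + (D * H x) ^ (1 / 2 : ℝ))
    (continuous_finsetSum I fun j _ => hTc j)
    ((hUm.pow_const _).add ((hHm.const_mul D).pow_const _)) hfin (fun x k => by
      rw [hU, hH, hD]
      exact exists_center_avB_le f.continuous.measurable hTc (by positivity) hfar I x k)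
  obtain ⟨N, hN⟩ : ∃ N, N = ∫⁻ x, ‖f x‖ₑ ^ (2 * q) := ⟨_, rfl⟩
  rw [← hN]
  have hUi : ∫⁻ x, U x ≤ (2 * (1 - Z)⁻¹) ^ (2 * q) * ((2 ^ n) ^ (2 * q) * A2 * A3) * N := by
    have h1 := lintegral_tsum_rpow_le volume (O := oscP ρ T) (measurable_oscP ρ hTc) hZ0 hZ1 (p := 2 * q)
      (by linarith) (b := fun j => (2 ^ n) ^ (2 * q) * A2 * ∫⁻ x, ‖Pj j f x‖ₑ ^ (2 * q)) (fun k j => by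
        rw [hZ]
        refine lintegral_oscP_rpow_le hq hTc (b := fun j => ∫⁻ x, ‖Pj j f x‖ₑ ^ (2 * q)) (fun j k hk => ?_)
          (fun j z hz => ?_) k j
        · rw [hT]
          have := (hA2 j (Pj j f)).1 k hk
          rwa [opS_Pj] at this
        · rw [hT]
          have := (hA2 j (Pj j f)).2 z hz
          rwa [opS_Pj] at this) I
    rw [hU]
    refine h1.trans ?_
    rw [← Finset.mul_sum, hN]
    refine (mul_le_mul_right (mul_le_mul_right (hA3 I f) _) _).trans_eq ?_
    ring
  have hHi : ∫⁻ x, H x ^ q ≤ A4 * N := by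
    rw [hH, hN]
    refine (hA4 _ hf2).trans_eq ?_
    congr 2; ext x
    rw [ENNReal.rpow_mul, ENNReal.rpow_ofNat]
  refine key.trans ?_
  rw [hW, mul_assoc (A5 : ℝ≥0∞)]
  refine mul_le_mul_right ?_ _
  calc ∫⁻ x, (U x ^ (1 / (2 * q)) + (D * H x) ^ (1 / 2 : ℝ)) ^ (2 * q)
      ≤ ∫⁻ x, 2 ^ (2 * q - 1) * (U x + D ^ q * H x ^ q) := by
        refine lintegral_mono fun x => (ENNReal.rpow_add_le_mul_rpow_add_rpow _ _ (by linarith)).trans_eq ?_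
        rw [← ENNReal.rpow_mul, ← ENNReal.rpow_mul, one_div_mul_cancel (by positivity), ENNReal.rpow_one,
          ← mul_assoc, show (1 / 2 : ℝ) * 2 * q = q by ring, ENNReal.mul_rpow_of_nonneg _ _ hq0.le]
    _ = 2 ^ (2 * q - 1) * ((∫⁻ x, U x) + D ^ q * ∫⁻ x, H x ^ q) := by
        rw [lintegral_const_mul' _ _ (by finiteness [show 0 ≤ 2 * q - 1 by linarith]), lintegral_add_left hUm,
          lintegral_const_mul _ (hHm.pow_const q)]
    _ ≤ 2 ^ (2 * q - 1) * ((2 * (1 - Z)⁻¹) ^ (2 * q) * ((2 ^ n) ^ (2 * q) * A2 * A3) * N + D ^ q * (A4 * N)) := by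
        gcongr
    _ = _ := by ring

end LpSums

section Conclusion

variable {n : ℕ}

lemma tendsto_sum_opS {S : (Fin n → ℝ) × (Fin n → ℝ) → ℂ} (hS : Continuous S) {M : ℝ} (hM : ∀ q, ‖S q‖ ≤ M)
    {B : ℕ → ℝ} (hB : ∀ (j : ℕ) q, ‖S q * psi j q.2‖ ≤ B j) (f : 𝓢(Fin n → ℝ, ℂ)) (x : Fin n → ℝ) :
    Filter.Tendsto (fun J : ℕ => ∑ j ∈ Finset.range (J + 1), opS (fun q => S q * psi j q.2) f x) Filter.atTop
      (nhds (opS S f x)) := by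
  have hFc : Continuous (FTg f) := continuous_FTg f.integrable
  have hM0 : 0 ≤ M := (norm_nonneg _).trans (hM 0)
  have hpsi : ∀ j, Continuous (psi (n := n) j) := fun j => (contDiff_psi j).continuous
  have hbet : Continuous (bet (n := n)) := contDiff_bet.continuous
  have e : ∀ J : ℕ, ∑ j ∈ Finset.range (J + 1), opS (fun q => S q * psi j q.2) f x =
      ∫ ξ, ph x (-ξ) * (S (x, ξ) * bet (((2 : ℝ) ^ J)⁻¹ • ξ)) * FTg f ξ := by
    intro J
    unfold opS
    rw [← integral_finsetSum]
    · congr 1; ext ξ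
      rw [← sum_psi, Finset.mul_sum, Finset.mul_sum, Finset.sum_mul]
    · intro j _
      refine Integrable.bdd_mul (c := B j) (integrable_FTg_schwartz f)
        (Continuous.aestronglyMeasurable (by fun_prop)) (Filter.Eventually.of_forall fun ξ => ?_)
      rw [norm_mul, norm_ph, one_mul]
      exact hB j (x, ξ)
  simp only [e]
  unfold opS
  refine tendsto_integral_of_dominated_convergence (fun ξ => M * ‖FTg f ξ‖) (fun J => ?_)
    ((integrable_FTg_schwartz f).norm.const_mul M) (fun J => Filter.Eventually.of_forall fun ξ => ?_)
    (Filter.Eventually.of_forall fun ξ => ?_)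
  · exact Continuous.aestronglyMeasurable (by fun_prop)
  · rw [norm_mul, norm_mul, norm_ph, one_mul, norm_mul]
    exact mul_le_mul_of_nonneg_right
      ((mul_le_mul (hM _) (norm_bet_le _) (norm_nonneg _) hM0).trans_eq (mul_one M)) (norm_nonneg _)
  · refine tendsto_const_nhds.congr' ?_
    obtain ⟨J, hJ⟩ := pow_unbounded_of_one_lt ‖ξ‖ (one_lt_two (α := ℝ))
    filter_upwards [Filter.eventually_ge_atTop J] with i hi
    rw [bet_eq_one, mul_one]
    rw [norm_inv_pow_smul, div_le_one (by positivity)]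
    exact hJ.le.trans (pow_le_pow_right₀ one_le_two hi)

lemma lintegral_opS_rpow_le [NeZero n] {m ρ δ C p : ℝ} (hC : 0 ≤ C) (hm : 0 ≤ m) (hδ0 : 0 ≤ δ) (hδ1 : δ < 1)
    (hδρ : δ ≤ ρ) (hρ1 : ρ ≤ 1) {S : (Fin n → ℝ) × (Fin n → ℝ) → ℂ}
    (hS : ContDiff ℝ (⊤ : ℕ∞) S) (h : SClass m ρ δ C S) (hM : ∀ q, ‖S q‖ ≤ C) (f : 𝓢(Fin n → ℝ, ℂ)) {K : ℝ≥0∞}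
    (hK : ∀ I : Finset ℕ, ∫⁻ x, ‖∑ j ∈ I, opS (fun q => S q * psi j q.2) f x‖ₑ ^ p ≤ K) :
    ∫⁻ x, ‖opS S f x‖ₑ ^ p ≤ K := by
  have hρ0 : 0 ≤ ρ := hδ0.trans hδρ
  obtain ⟨A0, hA00, hA0⟩ := exists_symAt_piece hC hm hδ0 hδ1.le hρ0 hρ1 hS h
  have hsb : ∀ j : ℕ, ∀ q, ‖S q * psi j q.2‖ ≤ A0 * 2 ^ (-(j * m)) := fun j q =>
    (hA0 j ⌊ρ * j⌋₊ (Nat.floor_le (by positivity)) (by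
      have := Nat.lt_floor_add_one (ρ * j)
      have h2 : δ * j ≤ ρ * j := mul_le_mul_of_nonneg_right hδρ (Nat.cast_nonneg j)
      linarith) q).norm_le
  refine lintegral_le_of_tendsto
    (F := fun J x => ‖∑ j ∈ Finset.range (J + 1), opS (fun q => S q * psi j q.2) f x‖ₑ ^ p) (fun J => ?_)
    (fun x => ?_) (fun J => hK _)
  · refine Measurable.pow_const (Measurable.enorm (Continuous.measurable (continuous_finsetSum _ fun j _ => ?_))) _
    exact continuous_opS (hS.mul ((contDiff_psi j).comp contDiff_snd)).continuous (hsb j) f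
  · exact ((ENNReal.continuous_rpow_const.tendsto _).comp
      ((continuous_enorm.tendsto _).comp (tendsto_sum_opS hS.continuous hM hsb f x)))

theorem Lp_opS [NeZero n] {ρ δ C p : ℝ} (hC : 0 ≤ C) (hδ0 : 0 ≤ δ) (hδ1 : δ < 1)
    (hδρ : δ ≤ ρ) (hρ1 : ρ ≤ 1) (hp : 2 ≤ p) {S : (Fin n → ℝ) × (Fin n → ℝ) → ℂ}
    (hS : ContDiff ℝ (⊤ : ℕ∞) S) (h : SClass (n * (1 - ρ) * |1 / p - 1 / 2|) ρ δ C S) (hM : ∀ q, ‖S q‖ ≤ C) :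
    ∃ A : NNReal, ∀ f : 𝓢(Fin n → ℝ, ℂ), ∫⁻ x, ‖opS S f x‖ₑ ^ p ≤ A * ∫⁻ x, ‖f x‖ₑ ^ p := by
  have hm : 0 ≤ n * (1 - ρ) * |1 / p - 1 / 2| :=
    mul_nonneg (mul_nonneg (Nat.cast_nonneg n) (by linarith)) (abs_nonneg _)
  rcases hp.eq_or_lt with rfl | hp
  · obtain ⟨A, hA⟩ := L2_finite_sums hC hδ0 hδ1 hS (h.mono hC hm hδρ)
    refine ⟨A, fun f => lintegral_opS_rpow_le hC hm hδ0 hδ1 hδρ hρ1 hS h hM f fun I => ?_⟩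
    simp only [ENNReal.rpow_ofNat]
    exact hA I f
  · have hp0 : 0 < p := by linarith
    obtain ⟨A, hA⟩ := Lp_finite_sums (q := p / 2) hC hm hδ0 hδ1 hδρ hρ1 hS h (by linarith) (by
      rw [abs_sub_comm, abs_of_nonneg (sub_nonneg.2 (one_div_le_one_div_of_le two_pos hp.le))]
      field_simp)
    rw [show 2 * (p / 2) = p by ring] at hA
    exact ⟨A, fun f => lintegral_opS_rpow_le hC hm hδ0 hδ1 hδρ hρ1 hS h hM f fun I => hA I f⟩

lemma integral_norm_rpow_eq {g : (Fin n → ℝ) → ℂ} (hg : Continuous g) {p : ℝ} (hp : 0 ≤ p) :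
    ∫ x, ‖g x‖ ^ p = (∫⁻ x, ‖g x‖ₑ ^ p).toReal := by
  rw [integral_eq_lintegral_of_nonneg_ae (Filter.Eventually.of_forall fun x => by positivity)
    (hg.norm.rpow_const fun _ => Or.inr hp).aestronglyMeasurable]
  congr 2; ext x
  rw [← ENNReal.ofReal_rpow_of_nonneg (norm_nonneg _) hp, ofReal_norm]

lemma lpR_le_of_lintegral_le {f g : (Fin n → ℝ) → ℂ} (hf : Continuous f) (hg : Continuous g) {p : ℝ} (hp : 0 < p)
    {A : NNReal} (hft : ∫⁻ x, ‖f x‖ₑ ^ p ≠ ⊤) (h : ∫⁻ x, ‖g x‖ₑ ^ p ≤ A * ∫⁻ x, ‖f x‖ₑ ^ p) :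
    lpR n p g ≤ (A : ℝ) ^ (1 / p) * lpR n p f := by
  unfold lpR
  rw [integral_norm_rpow_eq hf hp.le, integral_norm_rpow_eq hg hp.le,
    ← Real.mul_rpow A.coe_nonneg ENNReal.toReal_nonneg]
  refine Real.rpow_le_rpow ENNReal.toReal_nonneg ?_ (by positivity)
  rw [← ENNReal.coe_toReal, ← ENNReal.toReal_mul]
  exact ENNReal.toReal_mono (ENNReal.mul_ne_top ENNReal.coe_ne_top hft) h

end Conclusion

end PseudoDifferential

/-- **Fefferman's theorem for limited-smoothness symbols.** Let `2 ≤ p < ∞`,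
`0 ≤ δ ≤ ρ ≤ 1`, `δ < 1` and `m_p = n(1-ρ)|1/p - 1/2|`.  If a symbol `σ : ℝⁿ × ℝⁿ → ℂ`
satisfies `|∂_x^β ∂_ξ^α σ(x,ξ)| ≤ C ⟨ξ⟩^{-m_p - ρ|α| + δ|β|}` for `|α|, |β| ≤ [n/2]+1`,
then `T_σ : L^p(ℝⁿ) → L^p(ℝⁿ)` is bounded. -/
theorem pseudodiff_Rn_fefferman_Lp_bounded
    (n : ℕ) (hn : 1 ≤ n) (δ ρ p : ℝ)
    (hδ0 : 0 ≤ δ) (hδρ : δ ≤ ρ) (hρ1 : ρ ≤ 1) (hδ1 : δ < 1) (hp2 : 2 ≤ p)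
    (σ : (Fin n → ℝ) → (Fin n → ℝ) → ℂ)
    (hσ_smooth : ContDiff ℝ (⊤ : ℕ∞) fun q : (Fin n → ℝ) × (Fin n → ℝ) => σ q.1 q.2)
    (C : ℝ) (hC : 0 < C)
    (hσ : ∀ α β : Fin n → ℕ, (∑ j, α j) ≤ n / 2 + 1 → (∑ j, β j) ≤ n / 2 + 1 →
      ∀ x ξ : Fin n → ℝ,
        ‖symbDxDξ β α σ x ξ‖ ≤
          C * jbR ξ ^ (-((n : ℝ) * (1 - ρ) * |1 / p - 1 / 2|) - ρ * (∑ j, (α j : ℝ)) +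
            δ * ∑ j, (β j : ℝ))) :
    ∃ C' : ℝ, 0 < C' ∧ ∀ u : SchwartzMap (Fin n → ℝ) ℂ,
      lpR n p (OpR σ u) ≤ C' * lpR n p (⇑u) := by
  have : NeZero n := ⟨by omega⟩
  have hp0 : 0 < p := by linarith
  have hcl := SClass.of_symbDxDξ hσ_smooth hσ
  have hm : 0 ≤ n * (1 - ρ) * |1 / p - 1 / 2| :=
    mul_nonneg (mul_nonneg (Nat.cast_nonneg n) (by linarith)) (abs_nonneg _)
  have hM : ∀ q : (Fin n → ℝ) × (Fin n → ℝ), ‖σ q.1 q.2‖ ≤ C := fun q => by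
    refine ((hcl.mono hC.le hm hδρ) 0 0 0 (Nat.zero_le _) 0 (Nat.zero_le _) q.1 q.2).trans_eq ?_
    simp
  obtain ⟨A, hA⟩ := Lp_opS hC.le hδ0 hδ1 hδρ hρ1 hp2 hσ_smooth hcl hM
  refine ⟨(A : ℝ) ^ (1 / p) + 1, by positivity, fun u => ?_⟩
  have e : OpR σ u = opS (fun q => σ q.1 q.2) u := funext fun x => OpR_eq σ u x
  rw [e]
  have hu : ∀ x, ‖u x‖ ≤ SchwartzMap.seminorm ℝ 0 0 u := fun x => u.norm_le_seminorm ℝ x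
  refine (lpR_le_of_lintegral_le u.continuous (continuous_opS hσ_smooth.continuous hM u) hp0
    (lintegral_rpow_ne_top_of_bdd hp2 hu (lintegral_schwartz_sq_lt_top u).ne) (hA u)).trans ?_
  refine mul_le_mul_of_nonneg_right (by linarith) (Real.rpow_nonneg (integral_nonneg fun x => ?_) _)
  positivity
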